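/- Let G be a finite nonabelian simple group which is isomorphic to a subgroup of the projective general linear group PGL(3, ℂ) (i.e. there is an injective group homomorphism G → PGL(3, ℂ)). Then G is isomorphic to the alternating group A_5, to the alternating group A_6, or to PSL(2, 𝔽_7). -/

import Mathlib

/-- The projective general linear group `PGL(n, F)`: the quotient of `GL(n, F)` by its center. -/
abbrev PGL (n : ℕ) (F : Type) [Field F] :=
  Matrix.GeneralLinearGroup (Fin n) F ⧸ Subgroup.center (Matrix.GeneralLinearGroup (Fin n) F)

/-- The projective special linear group `PSL(n, F)`: the quotient of `SL(n, F)` by its center. -/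
abbrev PSL (n : ℕ) (F : Type) [Field F] :=
  Matrix.SpecialLinearGroup (Fin n) F ⧸ Subgroup.center (Matrix.SpecialLinearGroup (Fin n) F)

instance : Fact (Nat.Prime 7) := ⟨by norm_num⟩

section SimpleGroups

variable {G : Type*} [Group G]

theorem MonoidHom.injective_of_isSimpleGroup [IsSimpleGroup G] {H : Type*} [Group H]
    (f : G →* H) (hf : ∃ g, f g ≠ 1) : Function.Injective f := by
  rw [← MonoidHom.ker_eq_bot_iff]
  refine (f.normal_ker.eq_bot_or_eq_top).resolve_right fun h => ?_
  obtain ⟨g, hg⟩ := hf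
  exact hg (MonoidHom.mem_ker.1 (h ▸ Subgroup.mem_top g))

theorem MonoidHom.eq_one_of_isSimpleGroup [IsSimpleGroup G]
    (hna : ∃ a b : G, a * b ≠ b * a) {H : Type*} [CommGroup H] (f : G →* H) (g : G) :
    f g = 1 := by
  by_contra hg
  have hinj := f.injective_of_isSimpleGroup ⟨g, hg⟩
  obtain ⟨a, b, hab⟩ := hna
  exact hab (hinj (by rw [map_mul, map_mul, mul_comm]))

theorem MonoidHom.exists_mem_ker_eq_of_isSimpleGroup {Γ : Type*} [Group Γ] [IsSimpleGroup G]
    (hna : ∃ a b : G, a * b ≠ b * a) (p : Γ →* G) (hp : Function.Surjective p)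
    {H : Type*} [CommGroup H] (κ : Γ →* H) (x : Γ) : ∃ z ∈ p.ker, κ x = κ z := by
  have hn : (κ.ker.map p).Normal := κ.normal_ker.map p hp
  have htop : κ.ker.map p = ⊤ := by
    refine hn.eq_bot_or_eq_top.resolve_left fun hbot => ?_
    obtain ⟨a, b, hab⟩ := hna
    obtain ⟨x, rfl⟩ := hp a
    obtain ⟨y, rfl⟩ := hp b
    have hk : x * y * x⁻¹ * y⁻¹ ∈ κ.ker := by
      rw [MonoidHom.mem_ker]
      simp
    have : p (x * y * x⁻¹ * y⁻¹) ∈ κ.ker.map p := Subgroup.mem_map_of_mem p hk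
    rw [hbot, Subgroup.mem_bot] at this
    simp only [map_mul, map_inv] at this
    apply hab
    rw [mul_inv_eq_one] at this
    rwa [mul_inv_eq_iff_eq_mul] at this
  obtain ⟨k, hk, hkx⟩ : p x ∈ κ.ker.map p := htop ▸ Subgroup.mem_top _
  refine ⟨x * k⁻¹, ?_, ?_⟩
  · rw [MonoidHom.mem_ker, map_mul, map_inv, hkx, mul_inv_cancel]
  · rw [map_mul, map_inv, MonoidHom.mem_ker.1 hk, inv_one, mul_one]

theorem sign_eq_one_of_isSimpleGroup [IsSimpleGroup G] (hna : ∃ a b : G, a * b ≠ b * a)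
    {α : Type*} [Fintype α] [DecidableEq α] (f : G →* Equiv.Perm α) (g : G) :
    Equiv.Perm.sign (f g) = 1 :=
  MonoidHom.eq_one_of_isSimpleGroup hna (Equiv.Perm.sign.comp f) g

theorem nonempty_mulEquiv_alternatingGroup_of_card [Finite G] [IsSimpleGroup G]
    (hna : ∃ a b : G, a * b ≠ b * a) {n : ℕ} (hn : 2 ≤ n) (f : G →* Equiv.Perm (Fin n))
    (hf : Function.Injective f) (hcard : 2 * Nat.card G = n.factorial) :
    Nonempty (G ≃* alternatingGroup (Fin n)) := by
  have : Nontrivial (Fin n) := Fin.nontrivial_iff_two_le.2 hn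
  let F : G →* alternatingGroup (Fin n) :=
    f.codRestrict _ fun g => Equiv.Perm.mem_alternatingGroup.2
        (sign_eq_one_of_isSimpleGroup hna f g)
  have hF : Function.Injective F := fun a b h => hf (congrArg Subtype.val h)
  refine ⟨MulEquiv.ofBijective F ((Nat.bijective_iff_injective_and_card _).2 ⟨hF, ?_⟩)⟩
  have h2 : 2 * Nat.card (alternatingGroup (Fin n)) = n.factorial := by
    rw [two_mul_nat_card_alternatingGroup, Nat.card_perm, Nat.card_fin]
  omega

theorem nonempty_mulEquiv_alternatingGroup_of_card_perm [Finite G] [IsSimpleGroup G]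
    (hna : ∃ a b : G, a * b ≠ b * a) {n : ℕ} (hn : 2 ≤ n) {α : Type*} [Finite α]
    (hα : Nat.card α = n) (f : G →* Equiv.Perm α)
    (hf : Function.Injective f) (hcard : 2 * Nat.card G = n.factorial) :
    Nonempty (G ≃* alternatingGroup (Fin n)) := by
  let e : α ≃ Fin n := Finite.equivFinOfCardEq hα
  exact nonempty_mulEquiv_alternatingGroup_of_card hna hn (e.permCongrHom.toMonoidHom.comp f)
    (e.permCongrHom.injective.comp hf) hcard

theorem toPermHom_quotient_injective [IsSimpleGroup G] (H : Subgroup G) (hH : H ≠ ⊤) :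
    Function.Injective (MulAction.toPermHom G (G ⧸ H)) := by
  apply MonoidHom.injective_of_isSimpleGroup
  obtain ⟨g, hg⟩ : ∃ g, g ∉ H := by
    by_contra! h
    exact hH ((Subgroup.eq_top_iff' H).2 h)
  refine ⟨g, fun h => hg ?_⟩
  have h1 : g • ((1 : G) : G ⧸ H) = ((1 : G) : G ⧸ H) := by
    have := congrArg (fun σ : Equiv.Perm (G ⧸ H) => σ ((1 : G) : G ⧸ H)) h
    simpa using this
  rw [MulAction.Quotient.smul_coe, QuotientGroup.eq] at h1
  simpa using h1

theorem nonempty_mulEquiv_alternatingGroup_of_index [Finite G] [IsSimpleGroup G]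
    (hna : ∃ a b : G, a * b ≠ b * a) {n : ℕ} (hn : 2 ≤ n) (H : Subgroup G)
    (hH : H.index = n) (hcard : 2 * Nat.card G = n.factorial) :
    Nonempty (G ≃* alternatingGroup (Fin n)) := by
  have hH' : H ≠ ⊤ := by
    rintro rfl
    rw [Subgroup.index_top] at hH
    omega
  exact nonempty_mulEquiv_alternatingGroup_of_card_perm hna hn (α := G ⧸ H) hH _
    (toPermHom_quotient_injective H hH') hcard

theorem card_dvd_factorial_of_index [Finite G] [IsSimpleGroup G] (H : Subgroup G) (hH : H ≠ ⊤) :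
    Nat.card G ∣ H.index.factorial := by
  have := Subgroup.card_dvd_of_injective _ (toPermHom_quotient_injective H hH)
  rwa [Nat.card_perm] at this

theorem normalizer_sylow_ne_top [Finite G] [IsSimpleGroup G] (hna : ∃ a b : G, a * b ≠ b * a)
    {p : ℕ} [Fact p.Prime] (hp : p ∣ Nat.card G) (P : Sylow p G) :
    Subgroup.normalizer (P : Set G) ≠ ⊤ := by
  intro h
  have hP : (P : Subgroup G).Normal := Subgroup.normalizer_eq_top_iff.1 h
  have hPne : (P : Subgroup G) ≠ ⊥ := P.ne_bot_of_dvd_card hp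
  have hPtop := hP.eq_bot_or_eq_top.resolve_left hPne
  have hpG : IsPGroup p G := by
    have := P.isPGroup'
    rw [hPtop] at this
    exact this.of_equiv Subgroup.topEquiv
  have hnt : Nontrivial G := inferInstance
  have hc : Nontrivial (Subgroup.center G) := hpG.center_nontrivial
  have hctop := (inferInstance : (Subgroup.center G).Normal).eq_bot_or_eq_top.resolve_left
    ((Subgroup.nontrivial_iff_ne_bot _).1 hc)
  obtain ⟨a, b, hab⟩ := hna
  exact hab (Subgroup.mem_center_iff.1 (hctop ▸ Subgroup.mem_top b : b ∈ Subgroup.center G) a)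

theorem card_sylow_props [Finite G] [IsSimpleGroup G] (hna : ∃ a b : G, a * b ≠ b * a)
    {p : ℕ} [Fact p.Prime] (hp : p ∣ Nat.card G) :
    Nat.card (Sylow p G) ≠ 1 ∧ Nat.card (Sylow p G) % p = 1 ∧
      Nat.card G ∣ (Nat.card (Sylow p G)).factorial := by
  obtain ⟨P⟩ : Nonempty (Sylow p G) := inferInstance
  have h := normalizer_sylow_ne_top hna hp P
  refine ⟨fun h1 => h ?_, ?_, ?_⟩
  · rw [P.card_eq_index_normalizer] at h1
    exact Subgroup.index_eq_one.1 h1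
  · have h2 := card_sylow_modEq_one p G
    have : 1 % p = 1 := Nat.mod_eq_of_lt (Fact.out : p.Prime).one_lt
    rwa [Nat.ModEq, this] at h2
  · rw [P.card_eq_index_normalizer]
    exact card_dvd_factorial_of_index _ h

theorem card_sylow_subgroup [Finite G] {p k m : ℕ} [hp : Fact p.Prime]
    (hG : Nat.card G = p ^ k * m) (hm : ¬ p ∣ m) (P : Sylow p G) : Nat.card P = p ^ k := by
  have := P.card_eq_multiplicity
  rw [hG, Nat.factorization_mul (pow_ne_zero _ hp.out.ne_zero) (by rintro rfl; simp at hm),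
    Nat.factorization_pow] at this
  simpa [hp.out.factorization_self, Nat.factorization_eq_zero_of_not_dvd hm] using this

theorem card_sylow_dvd [Finite G] {p k m : ℕ} [hp : Fact p.Prime]
    (hG : Nat.card G = p ^ k * m) (hm : ¬ p ∣ m) : Nat.card (Sylow p G) ∣ m := by
  obtain ⟨P⟩ : Nonempty (Sylow p G) := inferInstance
  have h := P.card_dvd_index
  have hc := card_sylow_subgroup hG hm P
  have hi := (P : Subgroup G).card_mul_index
  rw [hc, hG] at hi
  rwa [Nat.eq_of_mul_eq_mul_left (pow_pos hp.out.pos k) hi] at h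

theorem card_sylow_mem_divisors [Finite G] [IsSimpleGroup G] (hna : ∃ a b : G, a * b ≠ b * a)
    {p k m : ℕ} [hp : Fact p.Prime] (hG : Nat.card G = p ^ (k + 1) * m) (hm : ¬ p ∣ m) :
    Nat.card (Sylow p G) ∈ m.divisors ∧
      Nat.card (Sylow p G) ≠ 1 ∧ Nat.card (Sylow p G) % p = 1 ∧
      Nat.card G ∣ (Nat.card (Sylow p G)).factorial := by
  refine ⟨?_, card_sylow_props hna ?_⟩
  · rw [Nat.mem_divisors]
    exact ⟨card_sylow_dvd hG hm, by rintro rfl; simp at hm⟩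
  · rw [hG, pow_succ]
    exact Dvd.intro_left (p ^ k * m) (by ring)

theorem card_ne_of_isSimpleGroup [Finite G] [IsSimpleGroup G] (hna : ∃ a b : G, a * b ≠ b * a) :
    Nat.card G ≠ 12 ∧ Nat.card G ≠ 24 ∧ Nat.card G ≠ 72 := by
  refine ⟨fun h => ?_, fun h => ?_, fun h => ?_⟩
  · have key := card_sylow_mem_divisors hna (p := 2) (k := 1) (m := 3) h (by decide)
    rw [h] at key
    generalize Nat.card (Sylow 2 G) = n at key
    revert key
    rintro ⟨h1, h2⟩
    revert h2
    have : n = 1 ∨ n = 3 := by simpa [show Nat.divisors 3 = {1, 3} by decide] using h1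
    rcases this with rfl | rfl <;> decide
  · have key := card_sylow_mem_divisors hna (p := 2) (k := 2) (m := 3) h (by decide)
    rw [h] at key
    generalize Nat.card (Sylow 2 G) = n at key
    obtain ⟨h1, h2⟩ := key
    revert h2
    have : n = 1 ∨ n = 3 := by simpa [show Nat.divisors 3 = {1, 3} by decide] using h1
    rcases this with rfl | rfl <;> decide
  · have key := card_sylow_mem_divisors hna (p := 3) (k := 1) (m := 8) h (by decide)
    rw [h] at key
    generalize Nat.card (Sylow 3 G) = n at key
    obtain ⟨h1, h2⟩ := key
    revert h2
    have : n = 1 ∨ n = 2 ∨ n = 4 ∨ n = 8 := by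
      simpa [show Nat.divisors 8 = {1, 2, 4, 8} by decide] using h1
    rcases this with rfl | rfl | rfl | rfl <;> decide

theorem exists_hom_perm_of_fixed {α : Type*} (f : G →* Equiv.Perm α)
    (hf : Function.Injective f) (a : α) (ha : ∀ g, f g a = a) :
    ∃ ψ : G →* Equiv.Perm {x // x ≠ a}, Function.Injective ψ := by
  have hne : ∀ g x, f g x ≠ a ↔ x ≠ a := fun g x => by
    conv_lhs => rw [← ha g]
    rw [(f g).injective.ne_iff]
  refine ⟨{ toFun := fun g => (f g).subtypePerm (hne g)
            map_one' := by ext; simp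
            map_mul' := fun x y => by
              ext b
              change f (x * y) b.1 = f x (f y b.1)
              rw [map_mul, Equiv.Perm.mul_apply] }, fun x y h => hf ?_⟩
  ext b
  by_cases hb : b = a
  · rw [hb, ha, ha]
  · exact congrArg (fun σ : Equiv.Perm _ => (σ ⟨b, hb⟩).1) h

theorem nonempty_mulEquiv_alternatingGroup_five [Finite G] [IsSimpleGroup G]
    (hna : ∃ a b : G, a * b ≠ b * a) (hG : Nat.card G = 60) :
    Nonempty (G ≃* alternatingGroup (Fin 5)) := by
  have : Fact (Nat.Prime 5) := ⟨by norm_num⟩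
  obtain ⟨P⟩ : Nonempty (Sylow 5 G) := inferInstance
  have hn : Nat.card (Sylow 5 G) = 6 := by
    have key := card_sylow_mem_divisors hna (p := 5) (k := 0) (m := 12) hG (by decide)
    generalize Nat.card (Sylow 5 G) = n at key
    obtain ⟨h1, h2, h3, -⟩ := key
    have : n = 1 ∨ n = 2 ∨ n = 3 ∨ n = 4 ∨ n = 6 ∨ n = 12 := by
      simpa [show Nat.divisors 12 = {1, 2, 3, 4, 6, 12} by decide] using h1
    omega
  rw [P.card_eq_index_normalizer] at hn
  set H := Subgroup.normalizer (P : Set G) with hH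
  have hHtop : H ≠ ⊤ := normalizer_sylow_ne_top hna (hG ▸ by norm_num) P
  let e : (G ⧸ H) ≃ Fin 6 := Finite.equivFinOfCardEq hn
  let f : G →* Equiv.Perm (Fin 6) := e.permCongrHom.toMonoidHom.comp (MulAction.toPermHom G (G ⧸ H))
  have hf : Function.Injective f :=
    e.permCongrHom.injective.comp (toPermHom_quotient_injective H hHtop)
  let F : G →* alternatingGroup (Fin 6) :=
    f.codRestrict _ fun g => Equiv.Perm.mem_alternatingGroup.2
        (sign_eq_one_of_isSimpleGroup hna f g)
  have hF : Function.Injective F := fun a b h => hf (congrArg Subtype.val h)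
  have hcA : Nat.card (alternatingGroup (Fin 6)) = 360 := by
    rw [nat_card_alternatingGroup, Nat.card_fin]
    rfl
  have : IsSimpleGroup (alternatingGroup (Fin 6)) := alternatingGroup.isSimpleGroup (by simp)
  set K : Subgroup (alternatingGroup (Fin 6)) := F.range with hK
  have hcK : Nat.card K = 60 := by rw [← hG]; exact (Nat.card_congr (F.ofInjective hF).toEquiv).symm
  have hiK : K.index = 6 := by
    have := K.card_mul_index
    rw [hcK, hcA] at this
    omega
  have hKtop : K ≠ ⊤ := by
    intro h
    rw [h, Subgroup.index_top] at hiK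
    omega
  let a : alternatingGroup (Fin 6) ⧸ K := ((1 : alternatingGroup (Fin 6)) : _ ⧸ K)
  have hS : MulAction.stabilizer (alternatingGroup (Fin 6)) a = K := MulAction.stabilizer_quotient K
  have hFS : ∀ g, F g • a = a := fun g =>
    MulAction.mem_stabilizer_iff.1 (hS.symm ▸ (⟨g, rfl⟩ : F g ∈ K))
  obtain ⟨ψ, hψ⟩ := exists_hom_perm_of_fixed
    ((MulAction.toPermHom (alternatingGroup (Fin 6)) (alternatingGroup (Fin 6) ⧸ K)).comp F)
    ((toPermHom_quotient_injective K hKtop).comp hF) a hFS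
  refine nonempty_mulEquiv_alternatingGroup_of_card_perm hna (by norm_num) ?_ ψ hψ
    (by rw [hG]; rfl)
  have h6 : Nat.card (alternatingGroup (Fin 6) ⧸ K) = 6 := hiK
  have := Set.ncard_add_ncard_compl {a}
  rw [h6, Set.ncard_singleton] at this
  have h7 : Nat.card {x // x ≠ a} = ({a}ᶜ : Set _).ncard := rfl
  omega

end SimpleGroups

section PSLSeven

open OnePoint

/-- The map `x ↦ c x²` on nonzero squares of `𝔽₇` and `x ↦ d x²` elsewhere. -/
def twistedSquare (c d x : ZMod 7) : ZMod 7 :=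
  if x = 1 ∨ x = 2 ∨ x = 4 then c * x ^ 2 else d * x ^ 2

theorem twistedSquare_classification : ∀ c d : ZMod 7, c ≠ 0 → d ≠ 0 →
    (∀ x : ZMod 7, x ≠ 0 → twistedSquare c d (twistedSquare c d x) = x) →
    (∀ a : ZMod 7, a ≠ 0 → ∃ k : ZMod 7, (k = 1 ∨ k = 2 ∨ k = 4) ∧ ∀ x : ZMod 7, x ≠ 0 →
      twistedSquare c d x + a ≠ 0 →
      twistedSquare c d (twistedSquare c d (twistedSquare c d x + a) - twistedSquare c d a) =
      k * x + twistedSquare c d (-twistedSquare c d a)) →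
    d = -c ∧ (c = 3 ∨ c = 5 ∨ c = 6) := by
  unfold twistedSquare
  decide

/-- Every element of the permutation group `R` fixing `∞` is an affine map with square slope. -/
def AffineAtInfty (R : Subgroup (Equiv.Perm (OnePoint (ZMod 7)))) : Prop :=
  ∀ r ∈ R, r ∞ = ∞ → ∃ k : ZMod 7, (k = 1 ∨ k = 2 ∨ k = 4) ∧
    ∃ b : ZMod 7, ∀ x : ZMod 7, r x = ((k * x + b : ZMod 7) : OnePoint (ZMod 7))

theorem pow_apply_of_translation {s : Equiv.Perm (OnePoint (ZMod 7))} (hs0 : s ∞ = ∞)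
    (hs : ∀ x : ZMod 7, s x = ((x + 1 : ZMod 7) : OnePoint (ZMod 7))) (n : ℕ) :
    (s ^ n) ∞ = ∞ ∧
      ∀ x : ZMod 7, (s ^ n) x = ((x + n : ZMod 7) : OnePoint (ZMod 7)) := by
  induction n with
  | zero => simp
  | succ n ih =>
    refine ⟨by rw [pow_succ', Equiv.Perm.mul_apply, ih.1, hs0], fun x => ?_⟩
    rw [pow_succ', Equiv.Perm.mul_apply, ih.2, hs]
    push_cast
    rw [add_assoc]

theorem le_of_affineAtInfty {R R' : Subgroup (Equiv.Perm (OnePoint (ZMod 7)))}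
    (hR : AffineAtInfty R) {s y τ : Equiv.Perm (OnePoint (ZMod 7))}
    (hsR : s ∈ R) (hτR : τ ∈ R)
    (hsR' : s ∈ R') (hyR' : y ∈ R') (hτR' : τ ∈ R')
    (hs0 : s ∞ = ∞) (hs : ∀ x : ZMod 7, s x = ((x + 1 : ZMod 7) : OnePoint (ZMod 7)))
    (hy0 : y ∞ = ∞) (hy : ∀ x : ZMod 7, y x = ((2 * x : ZMod 7) : OnePoint (ZMod 7)))
    (hτ : τ (0 : ZMod 7) = ∞) : R ≤ R' := by
  have haff : ∀ r ∈ R, r ∞ = ∞ → r ∈ R' := by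
    intro r hr hr0
    obtain ⟨k, hk, b, hb⟩ := hR r hr hr0
    obtain ⟨n, hn⟩ : ∃ n : ℕ, n < 3 ∧ ∀ x : ZMod 7, k * x = 2 ^ n * x := by
      rcases hk with rfl | rfl | rfl
      · exact ⟨0, by decide, by decide⟩
      · exact ⟨1, by decide, by decide⟩
      · exact ⟨2, by decide, by decide⟩
    have hyn : ∀ n : ℕ, (y ^ n) ∞ = ∞ ∧
        ∀ x : ZMod 7, (y ^ n) x = ((2 ^ n * x : ZMod 7) : OnePoint (ZMod 7)) := by
      intro n
      induction n with
      | zero => simp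
      | succ n ih =>
        refine ⟨by rw [pow_succ', Equiv.Perm.mul_apply, ih.1, hy0], fun x => ?_⟩
        rw [pow_succ', Equiv.Perm.mul_apply, ih.2, hy, pow_succ']
        rw [mul_assoc]
    have : r = s ^ b.val * y ^ n := by
      ext x
      rw [Equiv.Perm.mul_apply]
      induction x using OnePoint.rec with
      | infty => rw [hr0, (hyn n).1, (pow_apply_of_translation hs0 hs _).1]
      | coe x =>
        rw [hb, (hyn n).2, (pow_apply_of_translation hs0 hs _).2, hn.2, ZMod.natCast_val,
          ZMod.cast_id]
    rw [this]
    exact R'.mul_mem (R'.pow_mem hsR' _) (R'.pow_mem hyR' _)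
  intro r hr
  by_cases hr0 : r ∞ = ∞
  · exact haff r hr hr0
  · obtain ⟨a, ha⟩ := OnePoint.ne_infty_iff_exists.1 hr0
    have h1 : (τ * s ^ (-a).val * r) ∞ = ∞ := by
      rw [Equiv.Perm.mul_apply, Equiv.Perm.mul_apply, ← ha,
        (pow_apply_of_translation hs0 hs _).2, ZMod.natCast_val, ZMod.cast_id, add_neg_cancel, hτ]
    have h2 := haff _ (R.mul_mem (R.mul_mem hτR (R.pow_mem hsR _)) hr) h1
    exact (R'.mul_mem_cancel_left (R'.mul_mem hτR' (R'.pow_mem hsR' _))).1 h2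

/-- The action of `SL(2, 𝔽₇)` on the projective line. -/
noncomputable def slSevenPerm :
    Matrix.SpecialLinearGroup (Fin 2) (ZMod 7) →* Equiv.Perm (OnePoint (ZMod 7)) :=
  (MulAction.toPermHom (GL (Fin 2) (ZMod 7)) (OnePoint (ZMod 7))).comp
    Matrix.SpecialLinearGroup.toGL

theorem slSevenPerm_infty (M : Matrix.SpecialLinearGroup (Fin 2) (ZMod 7)) :
    slSevenPerm M ∞ = if M 1 0 = 0 then ∞ else ((M 0 0 / M 1 0 : ZMod 7) : OnePoint (ZMod 7)) :=
  OnePoint.smul_infty_eq_ite (M : GL (Fin 2) (ZMod 7))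

theorem slSevenPerm_coe (M : Matrix.SpecialLinearGroup (Fin 2) (ZMod 7)) (x : ZMod 7) :
    slSevenPerm M x = if M 1 0 * x + M 1 1 = 0 then ∞ else
      (((M 0 0 * x + M 0 1) / (M 1 0 * x + M 1 1) : ZMod 7) : OnePoint (ZMod 7)) :=
  OnePoint.smul_some_eq_ite (g := (M : GL (Fin 2) (ZMod 7)))

theorem ker_slSevenPerm :
    slSevenPerm.ker = Subgroup.center (Matrix.SpecialLinearGroup (Fin 2) (ZMod 7)) := by
  ext M
  rw [MonoidHom.mem_ker, Matrix.SpecialLinearGroup.mem_center_iff]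
  have hdet := M.det_coe
  rw [Matrix.det_fin_two] at hdet
  constructor
  · intro h
    have h1 := slSevenPerm_infty M
    have h2 := slSevenPerm_coe M 0
    have h3 := slSevenPerm_coe M 1
    rw [h, Equiv.Perm.one_apply] at h1 h2 h3
    have h10 : M 1 0 = 0 := by
      by_contra hne
      rw [if_neg hne] at h1
      exact OnePoint.infty_ne_coe _ h1
    have h11 : M 1 1 ≠ 0 := by
      intro h0
      rw [h10, h0] at hdet
      simp at hdet
    rw [h10, zero_mul, zero_add, if_neg h11, OnePoint.coe_eq_coe] at h2
    rw [h10, zero_mul, zero_add, if_neg h11, OnePoint.coe_eq_coe] at h3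
    have h01 : M 0 1 = 0 := by
      field_simp at h2
      simpa using h2.symm
    have h00 : M 0 0 = M 1 1 := by
      rw [h01] at h3
      field_simp at h3
      simpa using h3.symm
    refine ⟨M 1 1, ?_, ?_⟩
    · rw [h10, h00] at hdet
      simp only [Fintype.card_fin]
      linear_combination hdet
    · ext i j
      fin_cases i <;> fin_cases j <;> simp [h01, h00, h10]
  · rintro ⟨r, hr, hM⟩
    have e : ∀ i j, M i j = Matrix.scalar (Fin 2) r i j := fun i j => by rw [hM]
    have hr0 : r ≠ 0 := by
      rintro rfl
      simp at hr
    ext x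
    rw [Equiv.Perm.one_apply]
    induction x using OnePoint.rec with
    | infty => rw [slSevenPerm_infty, e]; simp
    | coe x =>
      rw [slSevenPerm_coe, e, e, e, e]
      simp [hr0]

theorem affineAtInfty_range_slSevenPerm : AffineAtInfty slSevenPerm.range := by
  rintro _ ⟨M, rfl⟩ h
  have hdet := M.det_coe
  rw [Matrix.det_fin_two] at hdet
  rw [slSevenPerm_infty] at h
  have h10 : M 1 0 = 0 := by
    by_contra hne
    rw [if_neg hne] at h
    exact OnePoint.coe_ne_infty _ h
  have h11 : M 1 1 ≠ 0 := by
    intro h0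
    rw [h10, h0] at hdet
    simp at hdet
  have hsq : ∀ a : ZMod 7, a ≠ 0 → (a ^ 2 = 1 ∨ a ^ 2 = 2 ∨ a ^ 2 = 4) := by decide
  have h00 : M 0 0 ≠ 0 := by
    intro h0
    rw [h10, h0] at hdet
    simp at hdet
  rw [h10, mul_zero, sub_zero] at hdet
  refine ⟨M 0 0 ^ 2, hsq _ h00, M 0 0 * M 0 1, fun x => ?_⟩
  rw [slSevenPerm_coe, h10, zero_mul, zero_add, if_neg h11, OnePoint.coe_eq_coe]
  rw [div_eq_iff h11]
  linear_combination (-M 0 0 * x - M 0 1) * hdet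

theorem mem_range_slSevenPerm {s : Equiv.Perm (OnePoint (ZMod 7))} (a b c d : ZMod 7)
    (hdet : a * d - b * c = 1)
    (hs0 : s ∞ = if c = 0 then ∞ else ((a / c : ZMod 7) : OnePoint (ZMod 7)))
    (hs : ∀ x : ZMod 7, s x = if c * x + d = 0 then ∞ else
      (((a * x + b) / (c * x + d) : ZMod 7) : OnePoint (ZMod 7))) : s ∈ slSevenPerm.range := by
  let M : Matrix.SpecialLinearGroup (Fin 2) (ZMod 7) :=
    ⟨!![a, b; c, d], by rw [Matrix.det_fin_two_of]; exact hdet⟩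
  refine ⟨M, ?_⟩
  ext x
  induction x using OnePoint.rec with
  | infty =>
    rw [slSevenPerm_infty, hs0]
    rfl
  | coe x =>
    rw [slSevenPerm_coe, hs]
    rfl

end PSLSeven

section PSLSevenIso

open OnePoint

theorem mem_range_slSevenPerm_translation {s : Equiv.Perm (OnePoint (ZMod 7))} (hs0 : s ∞ = ∞)
    (hs : ∀ x : ZMod 7, s x = ((x + 1 : ZMod 7) : OnePoint (ZMod 7))) :
    s ∈ slSevenPerm.range :=
  mem_range_slSevenPerm 1 1 0 1 (by ring) (by simpa using hs0) (by simpa using hs)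

theorem mem_range_slSevenPerm_double {y : Equiv.Perm (OnePoint (ZMod 7))} (hy0 : y ∞ = ∞)
    (hy : ∀ x : ZMod 7, y x = ((2 * x : ZMod 7) : OnePoint (ZMod 7))) :
    y ∈ slSevenPerm.range := by
  refine mem_range_slSevenPerm 3 0 0 5 (by decide) (by simpa using hy0) fun x => ?_
  rw [hy, zero_mul, zero_add, if_neg (by decide)]
  congr 1
  rw [eq_div_iff (by decide)]
  revert x
  decide

theorem mem_range_slSevenPerm_inversion {τ : Equiv.Perm (OnePoint (ZMod 7))} {c : ZMod 7}
    (hc : c = 3 ∨ c = 5 ∨ c = 6) (hτ0 : τ ∞ = (0 : ZMod 7)) (hτ1 : τ (0 : ZMod 7) = ∞)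
    (hτ : ∀ x : ZMod 7, x ≠ 0 → τ x = ((c / x : ZMod 7) : OnePoint (ZMod 7))) :
    τ ∈ slSevenPerm.range := by
  obtain ⟨u, hu0, hu⟩ : ∃ u : ZMod 7, u ≠ 0 ∧ -c * u ^ 2 = 1 := by
    rcases hc with rfl | rfl | rfl
    · exact ⟨3, by decide, by decide⟩
    · exact ⟨2, by decide, by decide⟩
    · exact ⟨1, by decide, by decide⟩
  refine mem_range_slSevenPerm 0 (c * u) u 0 (by linear_combination hu) ?_ fun x => ?_
  · rw [hτ0, if_neg hu0, zero_div]
  · by_cases hx : x = 0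
    · subst hx
      simp [hτ1]
    · have : u * x + 0 ≠ 0 := by simp [hu0, hx]
      rw [hτ x hx, if_neg this]
      congr 1
      field_simp
      ring

/-- A permutation group of the projective line over `𝔽₇` containing the translation, the doubling
map and a swap of `0` and `∞` inverting the doubling map, whose elements fixing `∞` are affine,
contains an element of the range of `slSevenPerm` of the same kind. -/
theorem mem_range_slSevenPerm_of_swap {R : Subgroup (Equiv.Perm (OnePoint (ZMod 7)))}
    (hR : AffineAtInfty R) {s y τ : Equiv.Perm (OnePoint (ZMod 7))}
    (hsR : s ∈ R) (hτR : τ ∈ R)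
    (hs0 : s ∞ = ∞) (hs : ∀ x : ZMod 7, s x = ((x + 1 : ZMod 7) : OnePoint (ZMod 7)))
    (hy : ∀ x : ZMod 7, y x = ((2 * x : ZMod 7) : OnePoint (ZMod 7)))
    (hτ0 : τ ∞ = (0 : ZMod 7)) (hτ1 : τ (0 : ZMod 7) = ∞)
    (hττ : τ * τ = 1) (hτy : τ * y = y * y * τ) : τ ∈ slSevenPerm.range := by
  have hτx : ∀ x : ZMod 7, x ≠ 0 → ∃ u : ZMod 7, u ≠ 0 ∧ τ x = u := by
    intro x hx
    have h1 : τ x ≠ ∞ := by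
      rw [← hτ1]
      exact fun h => hx (OnePoint.coe_eq_coe.1 (τ.injective h))
    obtain ⟨u, hu⟩ := OnePoint.ne_infty_iff_exists.1 h1
    refine ⟨u, ?_, hu.symm⟩
    rintro rfl
    rw [← hτ0] at hu
    exact OnePoint.infty_ne_coe _ (τ.injective hu)
  obtain ⟨c, hc0, hc⟩ := hτx 1 (by decide)
  obtain ⟨d, hd0, hd⟩ := hτx 6 (by decide)
  have hdouble : ∀ x u : ZMod 7, τ x = u → τ ((2 * x : ZMod 7) : OnePoint (ZMod 7)) =
      ((2 * (2 * u) : ZMod 7) : OnePoint (ZMod 7)) := by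
    intro x u h
    have := congrArg (fun σ : Equiv.Perm _ => σ (x : OnePoint (ZMod 7))) hτy
    simp only [Equiv.Perm.mul_apply, hy, h] at this
    exact this
  have hT : ∀ x : ZMod 7, x ≠ 0 → τ x = (twistedSquare c d x : ZMod 7) := by
    have h2 := hdouble _ _ hc
    have h4 := hdouble _ _ h2
    have h5 := hdouble _ _ hd
    have h3 := hdouble _ _ h5
    intro x hx
    have : x = 1 ∨ x = 2 * 1 ∨ x = 2 * (2 * 1) ∨ x = 6 ∨ x = 2 * 6 ∨ x = 2 * (2 * 6) := by
      revert hx x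
      decide
    rcases this with rfl | rfl | rfl | rfl | rfl | rfl
    · rw [hc]
      congr 1
      generalize c = c, d = d
      revert c d
      decide
    · rw [h2]
      congr 1
      generalize c = c, d = d
      revert c d
      decide
    · rw [h4]
      congr 1
      generalize c = c, d = d
      revert c d
      decide
    · rw [hd]
      congr 1
      generalize c = c, d = d
      revert c d
      decide
    · rw [h5]
      congr 1
      generalize c = c, d = d
      revert c d
      decide
    · rw [h3]
      congr 1
      generalize c = c, d = d
      revert c d
      decide
  have hTne : ∀ x : ZMod 7, x ≠ 0 → twistedSquare c d x ≠ 0 := by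
    intro x hx h0
    have := hT x hx
    rw [h0, ← hτ0] at this
    exact OnePoint.coe_ne_infty _ (τ.injective this)
  have hTT : ∀ x : ZMod 7, x ≠ 0 → twistedSquare c d (twistedSquare c d x) = x := by
    intro x hx
    have := congrArg (fun σ : Equiv.Perm _ => σ (x : OnePoint (ZMod 7))) hττ
    simp only [Equiv.Perm.mul_apply, Equiv.Perm.one_apply] at this
    rw [hT x hx, hT _ (hTne x hx)] at this
    exact OnePoint.coe_eq_coe.1 this
  have hsn := pow_apply_of_translation hs0 hs
  have hsn' : ∀ a x : ZMod 7, (s ^ a.val) x = ((x + a : ZMod 7) : OnePoint (ZMod 7)) := by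
    intro a x
    rw [(hsn _).2, ZMod.natCast_val, ZMod.cast_id]
  obtain ⟨rfl, hc'⟩ := twistedSquare_classification c d hc0 hd0 hTT (by
    intro a ha
    obtain ⟨k, hk, b, hb⟩ := hR (τ * s ^ (-twistedSquare c d a).val * τ * s ^ a.val * τ)
      (R.mul_mem (R.mul_mem (R.mul_mem (R.mul_mem hτR (R.pow_mem hsR _)) hτR)
        (R.pow_mem hsR _)) hτR) (by
      simp only [Equiv.Perm.mul_apply]
      rw [hτ0, hsn', zero_add, hT a ha, hsn', add_neg_cancel, hτ1])
    refine ⟨k, hk, fun x hx hxa => ?_⟩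
    have hb0 := hb 0
    simp only [Equiv.Perm.mul_apply] at hb0
    rw [hτ1, (hsn _).1, hτ0, hsn', zero_add, hT _ (neg_ne_zero.2 (hTne a ha)),
      OnePoint.coe_eq_coe, mul_zero, zero_add] at hb0
    have hbx := hb x
    simp only [Equiv.Perm.mul_apply] at hbx
    rw [hT x hx, hsn', hT _ hxa, hsn', hT, OnePoint.coe_eq_coe] at hbx
    · rw [hb0, ← hbx, sub_eq_add_neg]
    · rw [← sub_eq_add_neg, sub_ne_zero]
      intro h
      have h1 := hTT _ hxa
      rw [h, hTT a ha] at h1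
      exact hTne x hx (by linear_combination -h1))
  refine mem_range_slSevenPerm_inversion hc' hτ0 hτ1 fun x hx => ?_
  rw [hT x hx]
  congr 1
  rw [eq_div_iff hx]
  rcases hc' with rfl | rfl | rfl <;> revert hx x <;> decide

end PSLSevenIso

section PSLSevenIso

open OnePoint

/-- The translation `x ↦ x + 1` of the projective line over `𝔽₇`. -/
def translationSeven : Equiv.Perm (OnePoint (ZMod 7)) :=
  Equiv.optionCongr (Equiv.addRight (1 : ZMod 7))

theorem translationSeven_infty : translationSeven ∞ = ∞ := rfl

theorem translationSeven_coe (x : ZMod 7) :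
    translationSeven x = ((x + 1 : ZMod 7) : OnePoint (ZMod 7)) := rfl

theorem cycleType_of_orderOf_eq_seven {α : Type*} [Fintype α] [DecidableEq α]
    (hα : Fintype.card α = 8) {σ : Equiv.Perm α} (hσ : orderOf σ = 7) : σ.cycleType = {7} := by
  have h := Equiv.Perm.isCycle_of_prime_order' (σ := σ) (by rw [hσ]; norm_num)
      (by rw [hσ, hα]; norm_num)
  rw [h.cycleType, ← h.orderOf, hσ]

theorem orderOf_translationSeven : orderOf translationSeven = 7 := by
  refine orderOf_eq_prime ?_ ?_
  · ext x
    have h := pow_apply_of_translation translationSeven_infty translationSeven_coe 7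
    rw [Equiv.Perm.one_apply]
    induction x using OnePoint.rec with
    | infty => exact h.1
    | coe x =>
      rw [h.2]
      congr 1
      revert x
      decide
  · intro h
    have := translationSeven_coe 0
    rw [h, Equiv.Perm.one_apply, OnePoint.coe_eq_coe] at this
    revert this
    decide

theorem translationSeven_eq_self {x : OnePoint (ZMod 7)} (h : translationSeven x = x) : x = ∞ := by
  induction x using OnePoint.rec with
  | infty => rfl
  | coe x =>
    rw [translationSeven_coe, OnePoint.coe_eq_coe] at h
    simp at h

theorem exists_equiv_onePoint {α : Type*} [Finite α] (hα : Nat.card α = 8) {σ : Equiv.Perm α}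
    (hσ : orderOf σ = 7) : ∃ e : α ≃ OnePoint (ZMod 7), ∀ x, e (σ x) = translationSeven (e x) := by
  classical
  have : Fintype α := Fintype.ofFinite α
  have h8 : Nat.card (OnePoint (ZMod 7)) = 8 := by
    change Nat.card (Option (ZMod 7)) = 8
    rw [Finite.card_option, Nat.card_zmod]
  have : Fintype (OnePoint (ZMod 7)) := Fintype.ofFinite _
  rw [Nat.card_eq_fintype_card] at h8 hα
  let e0 : α ≃ OnePoint (ZMod 7) := Fintype.equivOfCardEq (hα.trans h8.symm)
  have hc : IsConj (e0.permCongr σ) translationSeven := by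
    rw [Equiv.Perm.isConj_iff_cycleType_eq]
    rw [cycleType_of_orderOf_eq_seven h8 orderOf_translationSeven]
    refine cycleType_of_orderOf_eq_seven h8 ?_
    exact (orderOf_injective e0.permCongrHom.toMonoidHom e0.permCongrHom.injective σ).trans hσ
  obtain ⟨c, hc⟩ := isConj_iff.1 hc
  refine ⟨e0.trans c, fun x => ?_⟩
  rw [← hc]
  simp

theorem normalizer_of_affine {G : Type*} [Group G] (f : G →* Equiv.Perm (OnePoint (ZMod 7)))
    {s : G} (hs : f s = translationSeven) {r : G} {n : ℕ}
    (hr : r * s * r⁻¹ = s ^ n) (hr21 : r ^ 21 = 1) (hr0 : f r ∞ = ∞) :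
    ∃ k : ZMod 7, (k = 1 ∨ k = 2 ∨ k = 4) ∧
    ∃ b : ZMod 7, ∀ x : ZMod 7, f r x = ((k * x + b : ZMod 7) : OnePoint (ZMod 7)) := by
  have hsn := pow_apply_of_translation translationSeven_infty translationSeven_coe
  have h0 : f r (0 : ZMod 7) ≠ ∞ := by
    intro h
    rw [← hr0] at h
    exact OnePoint.coe_ne_infty _ ((f r).injective h)
  obtain ⟨b, hb⟩ := OnePoint.ne_infty_iff_exists.1 h0
  have hrs : f r * translationSeven = translationSeven ^ n * f r := by
    rw [← hs, ← map_pow, ← map_mul, ← map_mul, ← hr, inv_mul_cancel_right]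
  have hn : ∀ m : ℕ, f r ((m : ZMod 7) : OnePoint (ZMod 7)) =
      ((n * m + b : ZMod 7) : OnePoint (ZMod 7)) := by
    intro m
    induction m with
    | zero => simp [hb]
    | succ m ih =>
      have := congrArg (fun σ : Equiv.Perm _ => σ ((m : ZMod 7) : OnePoint (ZMod 7))) hrs
      simp only [Equiv.Perm.mul_apply, translationSeven_coe] at this
      rw [ih, (hsn n).2] at this
      push_cast
      rw [this]
      congr 1
      ring
  have hnx : ∀ x : ZMod 7, f r x = ((n * x + b : ZMod 7) : OnePoint (ZMod 7)) := by
    intro x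
    have := hn x.val
    rwa [ZMod.natCast_val, ZMod.cast_id] at this
  refine ⟨n, ?_, b, hnx⟩
  have hpow : ∀ m : ℕ, ∃ c : ZMod 7, ∀ x : ZMod 7, f (r ^ m) x =
      (((n : ZMod 7) ^ m * x + c : ZMod 7) : OnePoint (ZMod 7)) := by
    intro m
    induction m with
    | zero => exact ⟨0, by simp⟩
    | succ m ih =>
      obtain ⟨c, hc⟩ := ih
      refine ⟨n * c + b, fun x => ?_⟩
      rw [pow_succ', map_mul, Equiv.Perm.mul_apply, hc, hnx]
      congr 1
      ring
  obtain ⟨c, hc⟩ := hpow 21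
  rw [hr21, map_one] at hc
  have h1 := hc 0
  have h2 := hc 1
  simp only [Equiv.Perm.one_apply, OnePoint.coe_eq_coe] at h1 h2
  have h3 : (n : ZMod 7) ^ 21 = 1 := by linear_combination h1 - h2
  revert h3
  generalize (n : ZMod 7) = k
  revert k
  decide

/-- The configuration of a translation, its normalizer and a transitive action. -/
theorem exists_hom_perm_onePoint {G : Type*} [Group G] [Finite G] [IsSimpleGroup G]
    (hna : ∃ a b : G, a * b ≠ b * a) (hG : Nat.card G = 168) :
    ∃ (f : G →* Equiv.Perm (OnePoint (ZMod 7))) (s q : G), Function.Injective f ∧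
      f s = translationSeven ∧ AffineAtInfty f.range ∧ f q ∞ = ∞ ∧ orderOf q = 3 ∧
      ∃ r : G, f r ∞ = (0 : ZMod 7) := by
  obtain ⟨P⟩ : Nonempty (Sylow 7 G) := inferInstance
  have hn : Nat.card (Sylow 7 G) = 8 := by
    have key := card_sylow_mem_divisors hna (p := 7) (k := 0) (m := 24) hG (by decide)
    generalize Nat.card (Sylow 7 G) = n at key
    obtain ⟨h1, h2, h3, -⟩ := key
    have : n = 1 ∨ n = 2 ∨ n = 3 ∨ n = 4 ∨ n = 6 ∨ n = 8 ∨ n = 12 ∨ n = 24 := by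
      simpa [show Nat.divisors 24 = {1, 2, 3, 4, 6, 8, 12, 24} by decide] using h1
    omega
  have hcP : Nat.card P = 7 :=
    card_sylow_subgroup (k := 1) (m := 24) hG (by decide) P
  have hnorm : Subgroup.normalizer (P : Set G) ≠ ⊤ :=
    normalizer_sylow_ne_top hna (hG ▸ by norm_num) P
  have hcN : Nat.card (Subgroup.normalizer (P : Set G)) = 21 := by
    have h1 := P.card_eq_index_normalizer
    have h2 := Subgroup.card_mul_index (Subgroup.normalizer (P : Set G))
    rw [← h1, hn, hG] at h2
    omega
  let f0 : G →* Equiv.Perm (Sylow 7 G) := MulAction.toPermHom G (Sylow 7 G)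
  have hf0 : Function.Injective f0 := by
    apply MonoidHom.injective_of_isSimpleGroup
    by_contra! h
    apply hnorm
    rw [← Sylow.stabilizer_eq_normalizer, eq_top_iff]
    intro g _
    rw [MulAction.mem_stabilizer_iff]
    exact congrArg (fun σ : Equiv.Perm _ => σ P) (h g)
  obtain ⟨⟨s, hsP⟩, hs⟩ := exists_prime_orderOf_dvd_card' (G := P) 7 (by rw [hcP])
  rw [Subgroup.orderOf_mk] at hs
  have hPs : (P : Subgroup G) = Subgroup.zpowers s := by
    symm
    apply Subgroup.eq_of_le_of_card_ge
    · rw [Subgroup.zpowers_le]; exact hsP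
    · rw [Nat.card_zpowers, hs]; exact hcP.le
  obtain ⟨e, he⟩ := exists_equiv_onePoint hn (σ := f0 s) (by rw [orderOf_injective f0 hf0, hs])
  have heP : e P = ∞ := by
    apply translationSeven_eq_self
    rw [← he]
    congr 1
    exact Sylow.smul_eq_iff_mem_normalizer.2 (Subgroup.le_normalizer hsP)
  let f : G →* Equiv.Perm (OnePoint (ZMod 7)) := e.permCongrHom.toMonoidHom.comp f0
  have hfe : ∀ g Q, f g (e Q) = e (g • Q) := by
    intro g Q
    change e (f0 g (e.symm (e Q))) = _
    rw [e.symm_apply_apply]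
    rfl
  have hf : Function.Injective f := e.permCongrHom.injective.comp hf0
  have hfs : f s = translationSeven := by
    ext x
    obtain ⟨Q, rfl⟩ := e.surjective x
    rw [hfe, ← he]
    rfl
  have hmem : ∀ g, f g ∞ = ∞ ↔ g ∈ Subgroup.normalizer (P : Set G) := by
    intro g
    rw [← heP, hfe, e.injective.eq_iff, ← Sylow.stabilizer_eq_normalizer,
      MulAction.mem_stabilizer_iff]
  obtain ⟨⟨q, hqN⟩, hq⟩ := exists_prime_orderOf_dvd_card'
    (G := Subgroup.normalizer (P : Set G)) 3 (by rw [hcN]; norm_num)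
  rw [Subgroup.orderOf_mk] at hq
  refine ⟨f, s, q, hf, hfs, ?_, (hmem q).2 hqN, hq, ?_⟩
  · rintro _ ⟨r, rfl⟩ hr0
    have hrN := (hmem r).1 hr0
    have h1 : r * s * r⁻¹ ∈ (P : Subgroup G) := (Subgroup.mem_normalizer_iff.1 hrN s).1 hsP
    rw [hPs, ← mem_powers_iff_mem_zpowers] at h1
    obtain ⟨n, hn⟩ := h1
    refine normalizer_of_affine f hfs hn.symm ?_ hr0
    have := pow_card_eq_one' (x := (⟨r, hrN⟩ : Subgroup.normalizer (P : Set G)))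
    rw [hcN] at this
    exact congrArg Subtype.val this
  · obtain ⟨Q, hQ⟩ := e.surjective ((0 : ZMod 7) : OnePoint (ZMod 7))
    obtain ⟨r, hr⟩ := MulAction.exists_smul_eq G P Q
    exact ⟨r, by rw [← heP, hfe, hr, hQ]⟩

end PSLSevenIso

section PSLSevenIso

open OnePoint

theorem exists_double_of_orderOf_three {G : Type*} [Group G] [Finite G]
    (f : G →* Equiv.Perm (OnePoint (ZMod 7))) (hf : Function.Injective f) {s q : G}
    (hs : f s = translationSeven) (hR : AffineAtInfty f.range) (hq0 : f q ∞ = ∞)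
    (hq : orderOf q = 3) : ∃ y : G, orderOf y = 3 ∧ f y ∞ = ∞ ∧
      ∀ x : ZMod 7, f y x = ((2 * x : ZMod 7) : OnePoint (ZMod 7)) := by
  have hsn := pow_apply_of_translation translationSeven_infty translationSeven_coe
  have key : ∀ q : G, orderOf q = 3 → f q ∞ = ∞ → ∀ b : ZMod 7,
      (∀ x : ZMod 7, f q x = ((2 * x + b : ZMod 7) : OnePoint (ZMod 7))) →
      ∃ y : G, orderOf y = 3 ∧ f y ∞ = ∞ ∧
      ∀ x : ZMod 7, f y x = ((2 * x : ZMod 7) : OnePoint (ZMod 7)) := by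
    intro q hq hq0 b hb
    have hinv : ∀ x : ZMod 7, (translationSeven ^ b.val)⁻¹ (x : OnePoint (ZMod 7)) =
        ((x - b : ZMod 7) : OnePoint (ZMod 7)) := by
      intro x
      rw [Equiv.Perm.inv_eq_iff_eq, (hsn _).2, ZMod.natCast_val, ZMod.cast_id, sub_add_cancel]
    refine ⟨s ^ b.val * q * (s ^ b.val)⁻¹, ?_, ?_, fun x => ?_⟩
    · rw [← hq]
      exact orderOf_injective (MulAut.conj (s ^ b.val)).toMonoidHom
        (MulAut.conj (s ^ b.val)).injective q
    · simp only [map_mul, map_inv, map_pow, hs, Equiv.Perm.mul_apply]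
      rw [Equiv.Perm.inv_eq_iff_eq.2 (hsn _).1.symm, hq0, (hsn _).1]
    · simp only [map_mul, map_inv, map_pow, hs, Equiv.Perm.mul_apply]
      rw [hinv, hb, (hsn _).2, ZMod.natCast_val, ZMod.cast_id]
      congr 1
      ring
  obtain ⟨k, hk, b, hb⟩ := hR _ ⟨q, rfl⟩ hq0
  rcases hk with rfl | rfl | rfl
  · exfalso
    have hpow : ∀ n : ℕ, f (q ^ n) ∞ = ∞ ∧ ∀ x : ZMod 7,
        f (q ^ n) x = ((x + n * b : ZMod 7) : OnePoint (ZMod 7)) := by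
      intro n
      induction n with
      | zero => simp
      | succ n ih =>
        refine ⟨by rw [pow_succ', map_mul, Equiv.Perm.mul_apply, ih.1, hq0], fun x => ?_⟩
        rw [pow_succ', map_mul, Equiv.Perm.mul_apply, ih.2, hb]
        congr 1
        push_cast
        ring
    have h7 : q ^ 7 = 1 := by
      apply hf
      rw [map_one]
      ext x
      rw [Equiv.Perm.one_apply]
      induction x using OnePoint.rec with
      | infty => exact (hpow 7).1
      | coe x =>
        rw [(hpow 7).2]
        congr 1
        clear hpow hb
        revert x b
        decide
    have := orderOf_dvd_of_pow_eq_one h7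
    rw [hq] at this
    revert this
    decide
  · exact key q hq hq0 b hb
  · refine key (q ^ 2) ?_ ?_ (5 * b) fun x => ?_
    · rw [orderOf_pow, hq]
      rfl
    · rw [pow_two, map_mul, Equiv.Perm.mul_apply, hq0, hq0]
    · rw [pow_two, map_mul, Equiv.Perm.mul_apply, hb, hb]
      congr 1
      clear hb
      revert x b
      decide

theorem nonempty_mulEquiv_PSL_seven {G : Type*} [Group G] [Finite G] [IsSimpleGroup G]
    (hna : ∃ a b : G, a * b ≠ b * a) (hG : Nat.card G = 168) :
    Nonempty (G ≃* PSL 2 (ZMod 7)) := by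
  obtain ⟨f, s, q, hf, hs, hR, hq0, hq, r, hr⟩ := exists_hom_perm_onePoint hna hG
  obtain ⟨y, hy3, hy0, hy⟩ := exists_double_of_orderOf_three f hf hs hR hq0 hq
  have hsn := pow_apply_of_translation translationSeven_infty translationSeven_coe
  have hy00 : f y (0 : ZMod 7) = (0 : ZMod 7) := by rw [hy, mul_zero]
  -- elements fixing `0` and `∞` are powers of `y`
  have hstab : ∀ g, f g ∞ = ∞ → f g (0 : ZMod 7) = (0 : ZMod 7) → g = 1 ∨ g = y ∨ g = y * y := by
    intro g hg0 hg1
    obtain ⟨k, hk, b, hb⟩ := hR _ ⟨g, rfl⟩ hg0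
    have hb0 : b = 0 := by
      have := hb 0
      rw [hg1, OnePoint.coe_eq_coe] at this
      simpa using this.symm
    subst hb0
    rcases hk with rfl | rfl | rfl
    · left
      apply hf
      ext x
      induction x using OnePoint.rec with
      | infty => simp [hg0]
      | coe x => simp [hb]
    · right; left
      apply hf
      ext x
      induction x using OnePoint.rec with
      | infty => simp [hg0, hy0]
      | coe x => simp [hb, hy]
    · right; right
      apply hf
      ext x
      induction x using OnePoint.rec with
      | infty => simp [hg0, hy0]
      | coe x =>
        rw [hb, map_mul, Equiv.Perm.mul_apply, hy, hy]
        congr 1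
        ring
  have hyyy : y * y * y = 1 := by
    have := pow_orderOf_eq_one y
    rwa [hy3, pow_succ, pow_two] at this
  -- a swap of `0` and `∞`
  obtain ⟨t, ht0, ht1⟩ : ∃ t, f t ∞ = (0 : ZMod 7) ∧ f t (0 : ZMod 7) = ∞ := by
    have : (f r)⁻¹ ∞ ≠ ∞ := by
      intro h
      rw [Equiv.Perm.inv_eq_iff_eq, hr] at h
      exact OnePoint.infty_ne_coe _ h
    obtain ⟨u, hu⟩ := OnePoint.ne_infty_iff_exists.1 this
    refine ⟨r * s ^ u.val, ?_, ?_⟩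
    · rw [map_mul, map_pow, hs, Equiv.Perm.mul_apply, (hsn _).1, hr]
    · rw [map_mul, map_pow, hs, Equiv.Perm.mul_apply, (hsn _).2, ZMod.natCast_val, ZMod.cast_id,
        zero_add, hu]
      exact (f r).apply_symm_apply ∞
  have ht2 : t * t * (t * t) * (t * t) = 1 := by
    rcases hstab (t * t) (by simp [ht0, ht1]) (by simp [ht0, ht1]) with h | h | h
    · simp [h]
    · rw [h, hyyy]
    · rw [h]
      calc y * y * (y * y) * (y * y) = (y * y * y) * (y * y * y) := by group
        _ = 1 := by rw [hyyy, one_mul]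
  obtain ⟨τ, hτdef⟩ : ∃ τ, τ = t * t * t := ⟨_, rfl⟩
  have hτ0 : f τ ∞ = (0 : ZMod 7) := by simp [hτdef, ht0, ht1]
  have hτ1 : f τ (0 : ZMod 7) = ∞ := by simp [hτdef, ht0, ht1]
  have hττ : τ * τ = 1 := by
    rw [← ht2, hτdef]
    group
  have hτinv : τ⁻¹ = τ := inv_eq_of_mul_eq_one_left hττ
  have hτy : τ * y * τ = y ∨ τ * y * τ = y * y := by
    rcases hstab (τ * y * τ) (by simp [hτ0, hτ1, hy00]) (by simp [hτ0, hτ1, hy0]) with h | h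
    · exfalso
      have : y = 1 := by
        calc y = (τ * τ) * y * (τ * τ) := by rw [hττ]; group
          _ = τ * (τ * y * τ) * τ := by group
          _ = 1 := by rw [h, mul_one, hττ]
      rw [this, orderOf_one] at hy3
      omega
    · exact h
  rcases hτy with hτy | hτy
  · exfalso
    have hcomm : τ * y = y * τ := by
      rw [← mul_inv_eq_iff_eq_mul, hτinv, hτy]
    have : Fact (Nat.Prime 3) := ⟨by norm_num⟩
    let P : Sylow 3 G := Sylow.ofCard (Subgroup.zpowers y) (by
      rw [Nat.card_zpowers, hy3, hG, show (168 : ℕ) = 3 * 56 by norm_num,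
        Nat.factorization_mul (by norm_num) (by norm_num)]
      simp [(by norm_num : Nat.Prime 3).factorization_self,
        Nat.factorization_eq_zero_of_not_dvd (show ¬ 3 ∣ 56 by norm_num)])
    have hPy : (P : Subgroup G) = Subgroup.zpowers y := rfl
    have hfix : ∀ x : OnePoint (ZMod 7), f y x = x → x = ∞ ∨ x = (0 : ZMod 7) := by
      intro x hx
      induction x using OnePoint.rec with
      | infty => exact Or.inl rfl
      | coe x =>
        right
        rw [hy, OnePoint.coe_eq_coe] at hx
        rw [OnePoint.coe_eq_coe]
        linear_combination hx
    have hcen : ∀ g, f g ∞ = ∞ → f g (0 : ZMod 7) = (0 : ZMod 7) → g * y = y * g := by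
      intro g h0 h1
      rcases hstab g h0 h1 with rfl | rfl | rfl <;> group
    have hNC : Subgroup.normalizer (P : Set G) ≤ Subgroup.centralizer (P : Set G) := by
      intro n hn
      have hfixn : ∀ x, f y x = x → f y (f n x) = f n x := by
        intro x hx
        have h1 : n⁻¹ * y * n ∈ (P : Subgroup G) := by
          have := (Subgroup.mem_normalizer_iff.1 (Subgroup.inv_mem _ hn) y).1
            (Subgroup.mem_zpowers y)
          simpa using this
        rw [hPy, Subgroup.mem_zpowers_iff] at h1
        obtain ⟨k, hk⟩ := h1
        have h2 : y * n = n * y ^ k := by rw [hk]; group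
        have h3 := congrArg (fun g => f g x) h2
        simp only [map_mul, map_zpow, Equiv.Perm.mul_apply] at h3
        rw [h3, Equiv.Perm.zpow_apply_eq_self_of_apply_eq_self hx]
      have h1 := hfix _ (hfixn _ hy0)
      have h2 := hfix _ (hfixn _ hy00)
      have hne : f n ∞ ≠ f n (0 : ZMod 7) := fun h =>
        OnePoint.infty_ne_coe _ ((f n).injective h)
      have hny : n * y = y * n := by
        rcases h1 with h1 | h1
        · rcases h2 with h2 | h2
          · exact absurd (h1.trans h2.symm) hne
          · exact hcen n h1 h2
        · rcases h2 with h2 | h2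
          · have h3 := hcen (τ * n) (by simp [h1, hτ1]) (by simp [h2, hτ0])
            have h4 : τ * (n * y) = τ * (y * n) := by
              rw [← mul_assoc, h3, ← mul_assoc, ← mul_assoc, ← hcomm]
            exact mul_left_cancel h4
          · exact absurd (h1.trans h2.symm) hne
      rw [Subgroup.mem_centralizer_iff]
      intro h hh
      have hh' : h ∈ Subgroup.zpowers y := hh
      obtain ⟨k, rfl⟩ := Subgroup.mem_zpowers_iff.1 hh'
      exact (Commute.zpow_right hny k).symm
    have hcompl := MonoidHom.ker_transferSylow_isComplement' P hNC
    have hker : (MonoidHom.transferSylow P hNC).ker = ⊤ := by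
      rw [eq_top_iff]
      intro g _
      let : CommGroup P := { (inferInstance : Group P) with
        mul_comm := fun a b => Subtype.ext
          (Subgroup.mem_centralizer_iff.1 (hNC (Subgroup.le_normalizer b.2)) a a.2) }
      exact MonoidHom.eq_one_of_isSimpleGroup hna (MonoidHom.transferSylow P hNC) g
    have hyk : y ∈ (MonoidHom.transferSylow P hNC).ker ⊓ (P : Subgroup G) :=
      ⟨hker ▸ Subgroup.mem_top y, Subgroup.mem_zpowers y⟩
    rw [hcompl.disjoint.eq_bot, Subgroup.mem_bot] at hyk
    rw [hyk, orderOf_one] at hy3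
    omega
  · have hτy' : f τ * f y = f y * f y * f τ := by
      rw [← map_mul, ← map_mul, ← map_mul]
      congr 1
      rw [← hτy, mul_assoc (τ * y), hττ, mul_one]
    have hsR : f s ∈ f.range := ⟨s, rfl⟩
    have hyR : f y ∈ f.range := ⟨y, rfl⟩
    have hτR : f τ ∈ f.range := ⟨τ, rfl⟩
    have hs0 : f s ∞ = ∞ := by rw [hs, translationSeven_infty]
    have hs1 : ∀ x : ZMod 7, f s x = ((x + 1 : ZMod 7) : OnePoint (ZMod 7)) := by
      intro x
      rw [hs, translationSeven_coe]
    have hsS := mem_range_slSevenPerm_translation hs0 hs1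
    have hyS := mem_range_slSevenPerm_double hy0 hy
    have hτS := mem_range_slSevenPerm_of_swap hR hsR hτR hs0 hs1 hy hτ0 hτ1
      (by rw [← map_mul, hττ, map_one]) hτy'
    have hle := le_of_affineAtInfty hR hsR hτR hsS hyS hτS hs0 hs1 hy0 hy hτ1
    have hge := le_of_affineAtInfty affineAtInfty_range_slSevenPerm hsS hτS hsR hyR hτR
      hs0 hs1 hy0 hy hτ1
    have e1 : G ≃* f.range := f.ofInjective hf
    have e2 : f.range ≃* slSevenPerm.range := MulEquiv.subgroupCongr (le_antisymm hle hge)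
    have e3 : (Matrix.SpecialLinearGroup (Fin 2) (ZMod 7) ⧸ slSevenPerm.ker) ≃*
      slSevenPerm.range := QuotientGroup.quotientKerEquivRange _
    have e4 : (Matrix.SpecialLinearGroup (Fin 2) (ZMod 7) ⧸ slSevenPerm.ker) ≃* PSL 2 (ZMod 7) :=
      QuotientGroup.quotientMulEquivOfEq ker_slSevenPerm
    exact ⟨e1.trans (e2.trans (e3.symm.trans e4))⟩

end PSLSevenIso

section SchurOrthogonality

open Matrix
open scoped Kronecker

variable {Γ : Type*} [Group Γ] [Fintype Γ] {ι : Type*} [Fintype ι] [DecidableEq ι]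

/-- A matrix representation with scalar commutant. -/
def HasScalarCommutant (ρ : Γ →* Matrix ι ι ℂ) : Prop :=
  ∀ X : Matrix ι ι ℂ, (∀ g, ρ g * X = X * ρ g) → ∃ c : ℂ, X = c • 1

lemma mul_sum_conj (ρ : Γ →* Matrix ι ι ℂ) (X : Matrix ι ι ℂ) (h : Γ) :
    ρ h * (∑ g, ρ g * X * ρ g⁻¹) = (∑ g, ρ g * X * ρ g⁻¹) * ρ h := by
  rw [Finset.mul_sum, Finset.sum_mul]
  refine Fintype.sum_equiv (Equiv.mulLeft h) _ _ fun g => ?_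
  simp only [Equiv.coe_mulLeft, _root_.mul_inv_rev, map_mul, mul_assoc]
  rw [← map_mul ρ h⁻¹ h, inv_mul_cancel, map_one, mul_one]

lemma trace_sum_conj (ρ : Γ →* Matrix ι ι ℂ) (X : Matrix ι ι ℂ) :
    (∑ g, ρ g * X * ρ g⁻¹).trace = Fintype.card Γ * X.trace := by
  rw [trace_sum]
  have : ∀ g ∈ Finset.univ, (ρ g * X * ρ g⁻¹).trace = X.trace := fun g _ => by
    rw [trace_mul_cycle, ← map_mul, inv_mul_cancel, map_one, one_mul]
  rw [Finset.sum_congr rfl this]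
  simp

lemma mul_single_one_mul_apply (A B : Matrix ι ι ℂ) (i j k l : ι) :
    (A * Matrix.single i j (1 : ℂ) * B : Matrix ι ι ℂ) k l = A k i * B j l := by
  rw [Matrix.mul_apply, Finset.sum_eq_single j]
  · rw [Matrix.mul_single_apply_same, mul_one]
  · intro b _ hb
    rw [Matrix.mul_single_apply_of_ne _ _ _ _ _ hb, zero_mul]
  · simp

lemma HasScalarCommutant.sum_conj [Nonempty ι] {ρ : Γ →* Matrix ι ι ℂ}
    (hρ : HasScalarCommutant ρ) (X : Matrix ι ι ℂ) :
    ∑ g, ρ g * X * ρ g⁻¹ = ((Fintype.card Γ : ℂ) * X.trace / Fintype.card ι) • 1 := by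
  obtain ⟨c, hc⟩ := hρ _ (mul_sum_conj ρ X)
  have h := trace_sum_conj ρ X
  rw [hc] at h ⊢
  rw [trace_smul, trace_one, smul_eq_mul] at h
  rw [← h, mul_div_cancel_right₀]
  exact_mod_cast Fintype.card_ne_zero

lemma HasScalarCommutant.sum_trace_mul_trace_inv [Nonempty ι] {ρ : Γ →* Matrix ι ι ℂ}
    (hρ : HasScalarCommutant ρ) :
    ∑ g, (ρ g).trace * (ρ g⁻¹).trace = Fintype.card Γ := by
  have h : ∀ i j, ∑ g, ρ g i i * ρ g⁻¹ j j =
      if i = j then (Fintype.card Γ : ℂ) / Fintype.card ι else 0 := by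
    intro i j
    have := congrFun₂ (hρ.sum_conj (Matrix.single i j 1)) i j
    simp only [Matrix.sum_apply, mul_single_one_mul_apply] at this
    rw [this]
    split_ifs with hij
    · subst hij
      simp
    · simp [hij]
  simp only [Matrix.trace, Matrix.diag_apply, Finset.sum_mul_sum]
  rw [Finset.sum_comm]
  simp_rw [Finset.sum_comm (s := (Finset.univ : Finset Γ)), h]
  have : (Fintype.card ι : ℂ) ≠ 0 := by exact_mod_cast Fintype.card_ne_zero
  simp [mul_div_cancel₀ _ this]

lemma HasScalarCommutant.sum_trace_eq_zero {ρ : Γ →* Matrix ι ι ℂ}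
    (hρ : HasScalarCommutant ρ) (hne : ∃ g, ρ g ≠ 1) : ∑ g, (ρ g).trace = 0 := by
  have h : ∀ h, ρ h * ∑ g, ρ g = ∑ g, ρ g := fun h => by
    rw [Finset.mul_sum]
    exact Fintype.sum_equiv (Equiv.mulLeft h) _ _ fun g => by simp
  have h' : ∀ h, (∑ g, ρ g) * ρ h = ∑ g, ρ g := fun h => by
    rw [Finset.sum_mul]
    exact Fintype.sum_equiv (Equiv.mulRight h) _ _ fun g => by simp
  obtain ⟨c, hc⟩ := hρ (∑ g, ρ g) fun g => by rw [h, h']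
  obtain ⟨g, hg⟩ := hne
  have h1 := h g
  rw [← trace_sum, hc]
  rw [hc, mul_smul_comm, mul_one] at h1
  by_cases hc0 : c = 0
  · simp [hc0]
  · exact absurd (smul_right_injective _ hc0 h1) hg

/-- The matrix of the flip of `V ⊗ V`. -/
def flipMatrix : Matrix (Fin 3 × Fin 3) (Fin 3 × Fin 3) ℂ :=
  Matrix.of fun p q => if p.1 = q.2 ∧ p.2 = q.1 then 1 else 0

lemma trace_kronecker_mul_flipMatrix (A B : Matrix (Fin 3) (Fin 3) ℂ) :
    ((A ⊗ₖ B) * flipMatrix).trace = (A * B).trace := by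
  simp [Matrix.trace, Matrix.mul_apply, flipMatrix, Fintype.sum_prod_type, Fin.sum_univ_three]

lemma flipMatrix_mul_kronecker (A B : Matrix (Fin 3) (Fin 3) ℂ) :
    flipMatrix * (A ⊗ₖ B) = (B ⊗ₖ A) * flipMatrix := by
  ext ⟨a, b⟩ ⟨c, d⟩
  simp [Matrix.mul_apply, flipMatrix, Fintype.sum_prod_type, ite_and, mul_comm]

lemma trace_flipMatrix : flipMatrix.trace = 3 := by
  have := trace_kronecker_mul_flipMatrix 1 1
  simpa using this

lemma flipMatrix_mul_self : flipMatrix * flipMatrix = 1 := by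
  ext ⟨a, b⟩ ⟨c, d⟩
  simp [Matrix.mul_apply, flipMatrix, Fintype.sum_prod_type, ite_and, Matrix.one_apply]

/-- The tensor square of a matrix representation. -/
def tensorSquare (ρ : Γ →* Matrix (Fin 3) (Fin 3) ℂ) :
    Γ →* Matrix (Fin 3 × Fin 3) (Fin 3 × Fin 3) ℂ where
  toFun g := ρ g ⊗ₖ ρ g
  map_one' := by simp
  map_mul' g h := by rw [map_mul, mul_kronecker_mul]

/-- The commutant of the tensor square is spanned by the identity and the flip. -/
def HasFlipCommutant (ρ : Γ →* Matrix (Fin 3) (Fin 3) ℂ) : Prop :=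
  ∀ T, (∀ g, tensorSquare ρ g * T = T * tensorSquare ρ g) →
    ∃ a b : ℂ, T = a • 1 + b • flipMatrix

lemma HasFlipCommutant.sum_conj {ρ : Γ →* Matrix (Fin 3) (Fin 3) ℂ} (hρ : HasFlipCommutant ρ)
    (X : Matrix (Fin 3 × Fin 3) (Fin 3 × Fin 3) ℂ) :
    ∑ g, tensorSquare ρ g * X * tensorSquare ρ g⁻¹ =
      ((Fintype.card Γ : ℂ) * (3 * X.trace - (X * flipMatrix).trace) / 24) • 1 +
      ((Fintype.card Γ : ℂ) * (3 * (X * flipMatrix).trace - X.trace) / 24) • flipMatrix := by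
  obtain ⟨a, b, hc⟩ := hρ _ (mul_sum_conj (tensorSquare ρ) X)
  have h := trace_sum_conj (tensorSquare ρ) X
  have h2 := trace_sum_conj (tensorSquare ρ) (X * flipMatrix)
  have h3 : ∑ g, tensorSquare ρ g * (X * flipMatrix) * tensorSquare ρ g⁻¹ =
      (∑ g, tensorSquare ρ g * X * tensorSquare ρ g⁻¹) * flipMatrix := by
    rw [Finset.sum_mul]
    refine Finset.sum_congr rfl fun g _ => ?_
    have : flipMatrix * tensorSquare ρ g⁻¹ = tensorSquare ρ g⁻¹ * flipMatrix :=
      flipMatrix_mul_kronecker _ _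
    simp only [mul_assoc, this]
  rw [h3] at h2
  rw [hc] at h h2 ⊢
  rw [add_mul, smul_mul_assoc, smul_mul_assoc, flipMatrix_mul_self, one_mul] at h2
  simp only [trace_add, trace_smul, trace_one, trace_flipMatrix, smul_eq_mul, Fintype.card_prod,
    Fintype.card_fin, Nat.cast_mul, Nat.cast_ofNat] at h h2
  congr 2
  · linear_combination (1 / 8 : ℂ) * h - (1 / 24 : ℂ) * h2
  · linear_combination (1 / 8 : ℂ) * h2 - (1 / 24 : ℂ) * h

omit [Fintype Γ] in
lemma HasFlipCommutant.hasScalarCommutant {ρ : Γ →* Matrix (Fin 3) (Fin 3) ℂ}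
    (hρ : HasFlipCommutant ρ) : HasScalarCommutant ρ := by
  intro X hX
  obtain ⟨a, b, h⟩ := hρ (X ⊗ₖ 1) fun g => by
    simp only [tensorSquare, MonoidHom.coe_mk, OneHom.coe_mk, ← mul_kronecker_mul, hX, mul_one,
      one_mul]
  have h' : ∀ i j k l, X i j * (1 : Matrix (Fin 3) (Fin 3) ℂ) k l =
      a * (1 : Matrix (Fin 3 × Fin 3) (Fin 3 × Fin 3) ℂ) (i, k) (j, l) +
        b * flipMatrix (i, k) (j, l) := fun i j k l => by
    simpa using congrFun₂ h (i, k) (j, l)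
  refine ⟨a, ?_⟩
  ext i j
  obtain ⟨k, hk⟩ : ∃ k : Fin 3, ¬ (i = k ∧ k = j) ∧ k ≠ i := by
    revert i j; decide
  have := h' i j k k
  simpa [flipMatrix, hk.1, Matrix.one_apply, hk.2.symm] using this

lemma HasFlipCommutant.sum_trace_mul_trace_inv_sq {ρ : Γ →* Matrix (Fin 3) (Fin 3) ℂ}
    (hρ : HasFlipCommutant ρ) :
    ∑ g, ((ρ g).trace * (ρ g⁻¹).trace) ^ 2 = 2 * Fintype.card Γ := by
  have h : ∀ p q, ∑ g, tensorSquare ρ g p p * tensorSquare ρ g⁻¹ q q =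
      (Fintype.card Γ : ℂ) / 24 *
      ((3 * (if p = q then 1 else 0) - (if p.1 = q.2 ∧ p.2 = q.1 then 1 else 0)) *
        (if p = q then 1 else 0) +
        (3 * (if p.1 = q.2 ∧ p.2 = q.1 then 1 else 0) - (if p = q then 1 else 0)) *
        (if p.1 = q.2 ∧ p.2 = q.1 then 1 else 0)) := by
    intro p q
    have := congrFun₂ (hρ.sum_conj (Matrix.single p q 1)) p q
    simp only [Matrix.sum_apply, mul_single_one_mul_apply] at this
    have e1 : (Matrix.single p q (1 : ℂ)).trace = if p = q then 1 else 0 := by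
      split_ifs with hpq
      · subst hpq; simp [Matrix.trace, Matrix.single]
      · exact Matrix.trace_single_eq_of_ne _ _ _ hpq
    have e2 : (Matrix.single p q (1 : ℂ) * flipMatrix).trace =
        if p.1 = q.2 ∧ p.2 = q.1 then 1 else 0 := by
      rw [Matrix.trace_mul_comm, Matrix.trace_mul_single]
      simp [flipMatrix, eq_comm, and_comm]
    rw [e1, e2] at this
    simp only [Matrix.of_apply, Matrix.smul_apply, Matrix.one_apply, Matrix.add_apply, flipMatrix,
      smul_eq_mul] at this
    rw [this]
    simp only [ite_and]
    split_ifs <;> ring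
  have h0 : ∀ g, ((ρ g).trace * (ρ g⁻¹).trace) ^ 2 =
      ∑ p, ∑ q, tensorSquare ρ g p p * tensorSquare ρ g⁻¹ q q := by
    intro g
    rw [← Finset.sum_mul_sum]
    have : ∀ g, ∑ p, tensorSquare ρ g p p = (ρ g).trace ^ 2 := fun g => by
      rw [sq, ← trace_kronecker]; rfl
    rw [this, this]; ring
  simp_rw [h0]
  rw [Finset.sum_comm]
  simp_rw [Finset.sum_comm (s := (Finset.univ : Finset Γ)), h, ← Finset.mul_sum]
  simp only [Fintype.sum_prod_type, Fin.sum_univ_three]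
  simp [Prod.ext_iff]
  ring

lemma HasScalarCommutant.sum_trace_conj {ρ : Γ →* Matrix (Fin 3) (Fin 3) ℂ}
    (hρ : HasScalarCommutant ρ) {P : Matrix (Fin 3) (Fin 3) ℂ} (hP : P.trace = 1) :
    ∑ g, (P * (ρ g * P * ρ g⁻¹)).trace = Fintype.card Γ / 3 := by
  rw [← trace_sum, ← Finset.mul_sum, hρ.sum_conj, hP, mul_smul_comm, Matrix.mul_one, trace_smul, hP]
  simp

lemma HasFlipCommutant.sum_trace_conj_sq {ρ : Γ →* Matrix (Fin 3) (Fin 3) ℂ}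
    (hρ : HasFlipCommutant ρ) {P : Matrix (Fin 3) (Fin 3) ℂ} (hP : P.trace = 1)
    (hP2 : P * P = P) :
    ∑ g, (P * (ρ g * P * ρ g⁻¹)).trace ^ 2 = Fintype.card Γ / 6 := by
  have h : ∀ g, (P * (ρ g * P * ρ g⁻¹)).trace ^ 2 =
      ((P ⊗ₖ P) * (tensorSquare ρ g * (P ⊗ₖ P) * tensorSquare ρ g⁻¹)).trace := fun g => by
    simp only [tensorSquare, MonoidHom.coe_mk, OneHom.coe_mk, ← mul_kronecker_mul,
      trace_kronecker, sq]
  simp_rw [h]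
  rw [← trace_sum, ← Finset.mul_sum, hρ.sum_conj, trace_kronecker_mul_flipMatrix, hP2,
    trace_kronecker, hP, mul_add, mul_smul_comm, mul_smul_comm, Matrix.mul_one, trace_add,
        trace_smul,
    trace_smul, trace_kronecker_mul_flipMatrix, hP2, trace_kronecker, hP]
  simp only [smul_eq_mul]
  ring

end SchurOrthogonality

section CentralizerClasses

open scoped Classical in
/-- The sum of `f` over the elements of `R` in the centralizer of `x`. -/
noncomputable def centralizerSum {Γ : Type*} [Group Γ] [Fintype Γ] (R : Γ → Prop) (f : Γ → ℝ)
    (x : Γ) : ℝ :=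
  ∑ y with R y ∧ y ∈ Subgroup.centralizer {x}, f y

open scoped Classical in
/-- The elements of `R` whose centralizer is conjugate to that of `x`. -/
noncomputable def centralizerClass {Γ : Type*} [Group Γ] [Fintype Γ] (R : Γ → Prop) (x : Γ) :
    Finset Γ :=
  {y | R y ∧ ∃ g, Subgroup.centralizer {y} = Subgroup.centralizer {g * x * g⁻¹}}

variable {Γ : Type*} [Group Γ] {R : Γ → Prop} {f : Γ → ℝ}

lemma mem_centralizer_conj {x y g : Γ} :
    y ∈ Subgroup.centralizer {g * x * g⁻¹} ↔ g⁻¹ * y * g ∈ Subgroup.centralizer {x} := by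
  simp only [Subgroup.mem_centralizer_singleton_iff]
  constructor
  · intro h
    calc g⁻¹ * y * g * x = g⁻¹ * (y * (g * x * g⁻¹)) * g := by group
      _ = x * (g⁻¹ * y * g) := by rw [h]; group
  · intro h
    calc y * (g * x * g⁻¹) = g * (g⁻¹ * y * g * x) * g⁻¹ := by group
      _ = g * x * g⁻¹ * y := by rw [h]; group

lemma centralizer_conj_congr {x y : Γ}
    (h : Subgroup.centralizer {x} = Subgroup.centralizer {y}) (g : Γ) :
    Subgroup.centralizer {g * x * g⁻¹} = Subgroup.centralizer {g * y * g⁻¹} := by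
  ext z
  rw [mem_centralizer_conj, mem_centralizer_conj, h]

lemma mem_normalizer_centralizer_iff {x n : Γ} :
    n ∈ Subgroup.normalizer (Subgroup.centralizer {x} : Set Γ) ↔
      Subgroup.centralizer {n * x * n⁻¹} = Subgroup.centralizer {x} := by
  rw [Subgroup.mem_normalizer_iff]
  constructor
  · intro h
    ext y
    rw [mem_centralizer_conj]
    have := h (n⁻¹ * y * n)
    rw [this]
    simp [mul_assoc]
  · intro h y
    have := mem_centralizer_conj (x := x) (y := n * y * n⁻¹) (g := n)
    rw [h] at this
    rw [this]
    simp [mul_assoc]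

variable [Fintype Γ]

open scoped Classical in
lemma mem_centralizerClass {x y : Γ} : y ∈ centralizerClass R x ↔
    R y ∧ ∃ g, Subgroup.centralizer {y} = Subgroup.centralizer {g * x * g⁻¹} := by
  simp [centralizerClass]

lemma self_mem_centralizerClass {x : Γ} (hx : R x) : x ∈ centralizerClass R x :=
  mem_centralizerClass.2 ⟨hx, 1, by simp⟩

lemma centralizerClass_eq {x y : Γ} (h : y ∈ centralizerClass R x) :
    centralizerClass R y = centralizerClass R x := by
  obtain ⟨hy, g, hg⟩ := mem_centralizerClass.1 h
  ext z
  rw [mem_centralizerClass, mem_centralizerClass]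
  refine and_congr_right fun _ => ⟨?_, ?_⟩
  · rintro ⟨k, hk⟩
    refine ⟨k * g, hk.trans ?_⟩
    rw [centralizer_conj_congr hg k]
    simp [mul_assoc]
  · rintro ⟨k, hk⟩
    refine ⟨k * g⁻¹, hk.trans ?_⟩
    rw [centralizer_conj_congr hg (k * g⁻¹)]
    simp [mul_assoc]

open scoped Classical in
lemma card_normalizer_mul_sum_centralizerClass
    (hconj : ∀ x g, R x → R (g * x * g⁻¹))
    (hcen : ∀ x y, R x → R y → y ∈ Subgroup.centralizer {x} →
      Subgroup.centralizer {y} = Subgroup.centralizer {x})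
    (hf : ∀ x g, f (g * x * g⁻¹) = f x) {x : Γ} (hx : R x) :
    (Nat.card (Subgroup.normalizer (Subgroup.centralizer {x} : Set Γ)) : ℝ) *
      ∑ y ∈ centralizerClass R x, f y = Fintype.card Γ * centralizerSum R f x := by
  have h1 : ∑ p : Γ × Γ with R p.2 ∧ p.2 ∈ Subgroup.centralizer {x},
      f (p.1 * p.2 * p.1⁻¹) = Fintype.card Γ * centralizerSum R f x := by
    simp only [hf]
    have : (Finset.univ.filter fun p : Γ × Γ => R p.2 ∧ p.2 ∈ Subgroup.centralizer {x}) =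
        Finset.univ ×ˢ (Finset.univ.filter fun y => R y ∧ y ∈ Subgroup.centralizer {x}) := by
      ext p; simp
    rw [this, Finset.sum_product]
    simp [centralizerSum]
  rw [← h1, ← Finset.sum_fiberwise_of_maps_to (t := centralizerClass R x)
    (g := fun p : Γ × Γ => p.1 * p.2 * p.1⁻¹), Finset.mul_sum]
  · refine Finset.sum_congr rfl fun y hy => ?_
    rw [Finset.sum_congr rfl (g := fun _ => f y) (fun p hp => by rw [(Finset.mem_filter.1 hp).2]),
      Finset.sum_const, nsmul_eq_mul]
    congr 2
    obtain ⟨hy, g, hg⟩ := mem_centralizerClass.1 hy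
    rw [Nat.card_eq_fintype_card, Fintype.card_subtype]
    refine Finset.card_bij (fun n _ => (g * n, (g * n)⁻¹ * y * (g * n))) ?_ ?_ ?_
    · intro n hn
      have hn := (Finset.mem_filter.1 hn).2
      rw [mem_normalizer_centralizer_iff] at hn
      have hyc : (g * n)⁻¹ * y * (g * n) ∈ Subgroup.centralizer {x} := by
        rw [← mem_centralizer_conj]
        have := centralizer_conj_congr hn g
        have e : g * (n * x * n⁻¹) * g⁻¹ = g * n * x * (g * n)⁻¹ := by group
        rw [e] at this
        rw [this, ← hg]
        exact Subgroup.mem_centralizer_singleton_iff.2 rfl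
      simp only [Finset.mem_filter, Finset.mem_univ, true_and]
      refine ⟨⟨?_, hyc⟩, by group⟩
      have := hconj y (g * n)⁻¹ hy
      rwa [inv_inv] at this
    · intro a _ b _ hab
      exact mul_left_cancel (Prod.ext_iff.1 hab).1
    · rintro ⟨k, z⟩ hp
      simp only [Finset.mem_filter, Finset.mem_univ, true_and] at hp
      obtain ⟨⟨hz, hzx⟩, hkz⟩ := hp
      refine ⟨g⁻¹ * k, ?_, ?_⟩
      · simp only [Finset.mem_filter, Finset.mem_univ, true_and]
        rw [mem_normalizer_centralizer_iff]
        have h2 := centralizer_conj_congr (hcen x z hx hz hzx) k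
        rw [hkz, hg] at h2
        have h3 := centralizer_conj_congr h2 g⁻¹
        have e1 : g⁻¹ * (g * x * g⁻¹) * g⁻¹⁻¹ = x := by group
        have e2 : g⁻¹ * (k * x * k⁻¹) * g⁻¹⁻¹ = g⁻¹ * k * x * (g⁻¹ * k)⁻¹ := by group
        rw [e1, e2] at h3
        exact h3.symm
      · simp only [mul_inv_cancel_left, Prod.mk.injEq, true_and]
        rw [← hkz]; group
  · rintro ⟨k, z⟩ hp
    simp only [Finset.mem_filter, Finset.mem_univ, true_and] at hp
    exact mem_centralizerClass.2 ⟨hconj _ _ hp.1,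
      k, centralizer_conj_congr (hcen x z hx hp.1 hp.2) k⟩

open scoped Classical in
lemma sum_eq_sum_centralizerClass :
    ∑ y with R y, f y = ∑ c ∈ (Finset.univ.filter R).image (centralizerClass R), ∑ y ∈ c, f y := by
  rw [← Finset.sum_fiberwise_of_maps_to (g := centralizerClass R)
    (fun y hy => Finset.mem_image_of_mem _ hy)]
  refine Finset.sum_congr rfl fun c hc => Finset.sum_congr ?_ fun _ _ => rfl
  obtain ⟨x, hx, rfl⟩ := Finset.mem_image.1 hc
  ext y
  simp only [Finset.mem_filter, Finset.mem_univ, true_and]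
  constructor
  · rintro ⟨hy, h⟩
    rw [← h]
    exact self_mem_centralizerClass hy
  · intro h
    exact ⟨(mem_centralizerClass.1 h).1, centralizerClass_eq h⟩

open scoped Classical in
lemma card_mul_centralizerSum_le
    (hconj : ∀ x g, R x → R (g * x * g⁻¹))
    (hcen : ∀ x y, R x → R y → y ∈ Subgroup.centralizer {x} →
      Subgroup.centralizer {y} = Subgroup.centralizer {x})
    (hf : ∀ x g, f (g * x * g⁻¹) = f x)
    (hS : ∀ x, R x → 0 ≤ centralizerSum R f x) {x : Γ} (hx : R x) :
    Fintype.card Γ * centralizerSum R f x ≤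
      (Nat.card (Subgroup.normalizer (Subgroup.centralizer {x} : Set Γ)) : ℝ) *
        ∑ y with R y, f y := by
  rw [← card_normalizer_mul_sum_centralizerClass hconj hcen hf hx]
  refine mul_le_mul_of_nonneg_left ?_ (Nat.cast_nonneg _)
  rw [sum_eq_sum_centralizerClass]
  refine Finset.single_le_sum (f := fun c => ∑ y ∈ c, f y) ?_
    (Finset.mem_image_of_mem _ (by simpa using hx))
  intro c hc
  obtain ⟨y, hy, rfl⟩ := Finset.mem_image.1 hc
  have hy : R y := by simpa using hy
  have h1 := card_normalizer_mul_sum_centralizerClass hconj hcen hf hy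
  have h2 : (0 : ℝ) < Nat.card (Subgroup.normalizer (Subgroup.centralizer {y} : Set Γ)) := by
    exact_mod_cast Nat.card_pos
  refine nonneg_of_mul_nonneg_right (a := _) ?_ h2
  rw [h1]
  exact mul_nonneg (Nat.cast_nonneg _) (hS y hy)

open scoped Classical in
lemma exists_card_mul_centralizerSum_eq
    (hconj : ∀ x g, R x → R (g * x * g⁻¹))
    (hcen : ∀ x y, R x → R y → y ∈ Subgroup.centralizer {x} →
      Subgroup.centralizer {y} = Subgroup.centralizer {x})
    (hf : ∀ x g, f (g * x * g⁻¹) = f x)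
    (hS : ∀ x, R x → centralizerSum R f x = 0 ∨
      (Nat.card (Subgroup.normalizer (Subgroup.centralizer {x} : Set Γ)) : ℝ) ≤
        2 * centralizerSum R f x)
    (hsum : ∑ y with R y, f y < Fintype.card Γ) :
    ∑ y with R y, f y = 0 ∨ ∃ x, R x ∧ 0 < centralizerSum R f x ∧
      Fintype.card Γ * centralizerSum R f x =
        (Nat.card (Subgroup.normalizer (Subgroup.centralizer {x} : Set Γ)) : ℝ) *
        ∑ y with R y, f y := by
  have hN : ∀ y : Γ, (0 : ℝ) < Nat.card (Subgroup.normalizer (Subgroup.centralizer {y} : Set Γ)) :=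
    fun y => by exact_mod_cast Nat.card_pos
  have hdich : ∀ c ∈ (Finset.univ.filter R).image (centralizerClass R),
      ∑ y ∈ c, f y = 0 ∨ (Fintype.card Γ : ℝ) ≤ 2 * ∑ y ∈ c, f y := by
    intro c hc
    obtain ⟨y, hy, rfl⟩ := Finset.mem_image.1 hc
    have hy : R y := by simpa using hy
    have h1 := card_normalizer_mul_sum_centralizerClass hconj hcen hf hy
    rcases hS y hy with h | h
    · rw [h, mul_zero] at h1
      exact Or.inl ((mul_eq_zero.1 h1).resolve_left (hN y).ne')
    · right
      refine le_of_mul_le_mul_left ?_ (hN y)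
      have : (0 : ℝ) ≤ Fintype.card Γ := Nat.cast_nonneg _
      nlinarith
  have hnn : ∀ c ∈ (Finset.univ.filter R).image (centralizerClass R), 0 ≤ ∑ y ∈ c, f y := by
    intro c hc
    have : (0 : ℝ) ≤ Fintype.card Γ := Nat.cast_nonneg _
    rcases hdich c hc with h | h <;> linarith
  by_cases hall : ∀ c ∈ (Finset.univ.filter R).image (centralizerClass R), ∑ y ∈ c, f y = 0
  · left
    rw [sum_eq_sum_centralizerClass]
    exact Finset.sum_eq_zero hall
  · right
    push Not at hall
    obtain ⟨c, hc, hc0⟩ := hall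
    have hc1 := (hdich c hc).resolve_left hc0
    have hsum2 : ∑ y with R y, f y = ∑ y ∈ c, f y := by
      rw [sum_eq_sum_centralizerClass]
      refine Finset.sum_eq_single_of_mem (f := fun c => ∑ y ∈ c, f y) c hc fun b hb hbc => ?_
      by_contra hb0
      have hb1 := (hdich b hb).resolve_left hb0
      have h3 : ∑ y ∈ c, f y + ∑ y ∈ b, f y ≤ ∑ y with R y, f y := by
        rw [sum_eq_sum_centralizerClass, ← Finset.sum_pair (f := fun c => ∑ y ∈ c, f y) hbc.symm]
        refine Finset.sum_le_sum_of_subset_of_nonneg ?_ fun d hd _ => hnn d hd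
        intro d hd
        rcases Finset.mem_insert.1 hd with rfl | hd
        · exact hc
        · rw [Finset.mem_singleton.1 hd]; exact hb
      linarith
    obtain ⟨x, hx, rfl⟩ := Finset.mem_image.1 hc
    have hx : R x := by simpa using hx
    have h1 := card_normalizer_mul_sum_centralizerClass hconj hcen hf hx
    refine ⟨x, hx, ?_, ?_⟩
    · have h4 : (0 : ℝ) < Fintype.card Γ := by exact_mod_cast Fintype.card_pos
      have h5 : 0 < ∑ y ∈ centralizerClass R x, f y := lt_of_le_of_ne (hnn _ hc) (Ne.symm hc0)
      refine pos_of_mul_pos_right (a := (Fintype.card Γ : ℝ)) ?_ h4.le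
      rw [← h1]
      exact mul_pos (hN x) h5
    · rw [← h1, hsum2]

end CentralizerClasses

section FiniteOrderMatrices

open Matrix

lemma exists_diagonal_of_pow_eq_one {n : ℕ} {M : Matrix (Fin n) (Fin n) ℂ} {k : ℕ} (hk : k ≠ 0)
    (hM : M ^ k = 1) : ∃ (S T : Matrix (Fin n) (Fin n) ℂ) (d : Fin n → ℂ),
      S * T = 1 ∧ T * S = 1 ∧ M = S * diagonal d * T := by
  classical
  set f : Module.End ℂ (Fin n → ℂ) := Matrix.toLin' M with hf
  have hfk : f ^ k = 1 := by rw [hf, ← Matrix.toLin'_pow, hM, Matrix.toLin'_one]; rfl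
  have hss : f.IsSemisimple := by
    refine Module.End.isSemisimple_of_squarefree_aeval_eq_zero (p := Polynomial.X ^ k - 1) ?_ ?_
    · have := (Polynomial.separable_X_pow_sub_C (1 : ℂ) (n := k) (by exact_mod_cast hk)
        one_ne_zero).squarefree
      simpa using this
    · simp [hfk]
  have htop := hss.iSup_eigenspace_eq_top
  let s : Set (Fin n → ℂ) := {v | ∃ μ : ℂ, v ∈ f.eigenspace μ}
  have hs : ⊤ ≤ Submodule.span ℂ s := by
    rw [← htop]
    exact iSup_le fun μ v hv => Submodule.subset_span ⟨μ, hv⟩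
  let b := Module.Basis.ofSpan hs
  have : Finite ((linearIndepOn_empty ℂ id).extend (Set.empty_subset s)) :=
    Module.Finite.finite_basis b
  let e : ((linearIndepOn_empty ℂ id).extend (Set.empty_subset s)) ≃ Fin n :=
    Finite.equivFinOfCardEq (by
      rw [← Module.finrank_eq_nat_card_basis b, Module.finrank_fin_fun])
  let c := b.reindex e
  have hc : ∀ i, ∃ μ : ℂ, M *ᵥ (c i) = μ • (c i) := by
    intro i
    have : b (e.symm i) ∈ s := Module.Basis.ofSpan_subset hs ⟨_, rfl⟩
    obtain ⟨μ, hμ⟩ := this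
    refine ⟨μ, ?_⟩
    rw [Module.End.mem_eigenspace_iff] at hμ
    simpa [c, hf] using hμ
  choose d hd using hc
  let S : Matrix (Fin n) (Fin n) ℂ := (Pi.basisFun ℂ (Fin n)).toMatrix c
  let T : Matrix (Fin n) (Fin n) ℂ := c.toMatrix (Pi.basisFun ℂ (Fin n))
  have hST : S * T = 1 := Module.Basis.toMatrix_mul_toMatrix_flip _ _
  have hTS : T * S = 1 := Module.Basis.toMatrix_mul_toMatrix_flip _ _
  have hMS : M * S = S * diagonal d := by
    ext i j
    have := congrFun (hd j) i
    rw [Matrix.mul_diagonal, mul_comm]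
    simpa [S, Matrix.mul_apply, Module.Basis.toMatrix_apply, Matrix.mulVec, dotProduct] using this
  exact ⟨S, T, d, hST, hTS, by rw [← hMS, mul_assoc, hST, mul_one]⟩

/-- Conjugation by `S` with inverse `T` brings `M` to the diagonal matrix with entries `d`. -/
structure IsDiagonalization {n : ℕ} (M S T : Matrix (Fin n) (Fin n) ℂ) (d : Fin n → ℂ) :
    Prop where
  mul_inv : S * T = 1
  inv_mul : T * S = 1
  eq : M = S * diagonal d * T

variable {n : ℕ} {M N S T : Matrix (Fin n) (Fin n) ℂ} {d e : Fin n → ℂ}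

lemma IsDiagonalization.conj_eq (h : IsDiagonalization M S T d) : T * M * S = diagonal d := by
  rw [h.eq, ← mul_assoc, ← mul_assoc, h.inv_mul, one_mul, mul_assoc, h.inv_mul, mul_one]

lemma IsDiagonalization.trace (h : IsDiagonalization M S T d) : M.trace = ∑ i, d i := by
  rw [h.eq, trace_mul_cycle, h.inv_mul, one_mul, trace_diagonal]

lemma IsDiagonalization.det (h : IsDiagonalization M S T d) : M.det = ∏ i, d i := by
  have h1 := congrArg Matrix.det h.inv_mul
  rw [det_mul, det_one] at h1
  rw [h.eq, det_mul, det_mul, det_diagonal]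
  linear_combination (∏ i, d i) * h1

lemma IsDiagonalization.mul (h : IsDiagonalization M S T d) (h' : IsDiagonalization N S T e) :
    IsDiagonalization (M * N) S T (d * e) := by
  refine ⟨h.mul_inv, h.inv_mul, ?_⟩
  rw [h.eq, h'.eq]
  calc S * diagonal d * T * (S * diagonal e * T) = S * diagonal d * (T * S) * diagonal e * T := by
        simp only [mul_assoc]
    _ = S * (diagonal d * diagonal e) * T := by rw [h.inv_mul]; simp only [mul_assoc, one_mul]
    _ = _ := by rw [diagonal_mul_diagonal]; rfl

lemma IsDiagonalization.eq_of_eq (h : IsDiagonalization M S T d)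
    (h' : IsDiagonalization M S T e) : d = e := by
  have := h.conj_eq.symm.trans h'.conj_eq
  exact diagonal_injective this

lemma IsDiagonalization.one (h1 : S * T = 1) (h2 : T * S = 1) : IsDiagonalization 1 S T 1 :=
  ⟨h1, h2, by rw [show diagonal (1 : Fin n → ℂ) = 1 from diagonal_one, mul_one, h1]⟩

lemma IsDiagonalization.pow (h : IsDiagonalization M S T d) (k : ℕ) :
    IsDiagonalization (M ^ k) S T (d ^ k) := by
  induction k with
  | zero => simpa using IsDiagonalization.one h.mul_inv h.inv_mul
  | succ k ih => rw [pow_succ, pow_succ]; exact ih.mul h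

lemma IsDiagonalization.smul (h : IsDiagonalization M S T d) (c : ℂ) :
    IsDiagonalization (c • M) S T (c • d) := by
  refine ⟨h.mul_inv, h.inv_mul, ?_⟩
  rw [h.eq, diagonal_smul, mul_smul_comm, smul_mul_assoc]

lemma IsDiagonalization.scalar (h1 : S * T = 1) (h2 : T * S = 1) (c : ℂ) :
    IsDiagonalization (c • 1) S T (fun _ => c) := by
  have := (IsDiagonalization.one h1 h2).smul c
  convert this using 1
  ext; simp

lemma IsDiagonalization.of_commute (h : IsDiagonalization M S T d) (hd : Function.Injective d)
    (hMN : M * N = N * M) : ∃ e, IsDiagonalization N S T e := by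
  have h1 : diagonal d * (T * N * S) = T * N * S * diagonal d := by
    rw [← h.conj_eq]
    calc T * M * S * (T * N * S) = T * M * (S * T) * N * S := by simp only [mul_assoc]
      _ = T * (M * N) * S := by rw [h.mul_inv]; simp only [mul_assoc, one_mul]
      _ = T * N * (S * T) * M * S := by rw [hMN, h.mul_inv]; simp only [mul_assoc, one_mul]
      _ = _ := by simp only [mul_assoc]
  refine ⟨fun i => (T * N * S) i i, h.mul_inv, h.inv_mul, ?_⟩
  have h2 : diagonal (fun i => (T * N * S) i i) = T * N * S := by
    ext i j
    by_cases hij : i = j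
    · subst hij; simp
    · rw [diagonal_apply_ne _ hij]
      have := congrFun₂ h1 i j
      rw [diagonal_mul, mul_diagonal] at this
      have h3 : (d i - d j) * (T * N * S) i j = 0 := by linear_combination this
      exact ((mul_eq_zero.1 h3).resolve_left (sub_ne_zero.2 fun h => hij (hd h))).symm
  rw [h2]
  calc N = (S * T) * N * (S * T) := by rw [h.mul_inv, one_mul, mul_one]
    _ = _ := by simp only [mul_assoc]

lemma IsDiagonalization.commute (h : IsDiagonalization M S T d)
    (h' : IsDiagonalization N S T e) : M * N = N * M := by
  have h1 := h.mul h'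
  have h2 := h'.mul h
  rw [h1.eq, h2.eq, mul_comm d e]

lemma exists_perm_forall_apply_ne_zero {K L : Matrix (Fin n) (Fin n) ℂ} (hKL : K * L = 1) :
    ∃ σ : Equiv.Perm (Fin n), ∀ j, K (σ j) j ≠ 0 := by
  have h1 : K.det ≠ 0 := by
    intro h
    have := congrArg Matrix.det hKL
    rw [det_mul, h, zero_mul, det_one] at this
    exact zero_ne_one this
  rw [det_apply] at h1
  obtain ⟨σ, -, hσ⟩ := Finset.exists_ne_zero_of_sum_ne_zero h1
  refine ⟨σ, fun j hj => hσ ?_⟩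
  rw [Finset.prod_eq_zero (f := fun i => K (σ i) i) (Finset.mem_univ j) hj, smul_zero]

end FiniteOrderMatrices

section Tori

open Matrix

/-- A faithful unitary representation of determinant one and degree three. -/
structure IsSpecialUnitaryRep {Γ : Type*} [Group Γ] (ρ : Γ →* Matrix (Fin 3) (Fin 3) ℂ) : Prop where
  injective : Function.Injective ρ
  det_eq_one : ∀ g, (ρ g).det = 1
  map_inv : ∀ g, ρ g⁻¹ = (ρ g)ᴴ

variable {Γ : Type*} [Group Γ] {ρ : Γ →* Matrix (Fin 3) (Fin 3) ℂ}

/-- The elements with three distinct eigenvalues. -/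
def IsRegularElt (ρ : Γ →* Matrix (Fin 3) (Fin 3) ℂ) (x : Γ) : Prop :=
  ∃ S T d, IsDiagonalization (ρ x) S T d ∧ Function.Injective d

/-- The subgroup of elements acting as scalars. -/
def scalarSubgroup (ρ : Γ →* Matrix (Fin 3) (Fin 3) ℂ) : Subgroup Γ where
  carrier := {z | ∃ c : ℂ, ρ z = c • 1}
  one_mem' := ⟨1, by simp⟩
  mul_mem' := by
    rintro a b ⟨c, hc⟩ ⟨d, hd⟩
    exact ⟨c * d, by rw [map_mul, hc, hd, smul_mul_smul_comm, one_mul]⟩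
  inv_mem' := by
    rintro a ⟨c, hc⟩
    have h : ρ a * ρ a⁻¹ = 1 := by rw [← map_mul, mul_inv_cancel, map_one]
    rw [hc, smul_mul_assoc, one_mul] at h
    have hc0 : c ≠ 0 := by
      rintro rfl
      rw [zero_smul] at h
      exact zero_ne_one h
    exact ⟨c⁻¹, by rw [← h, smul_smul, inv_mul_cancel₀ hc0, one_smul]⟩

lemma mem_scalarSubgroup {z : Γ} : z ∈ scalarSubgroup ρ ↔ ∃ c : ℂ, ρ z = c • 1 := Iff.rfl

lemma isRegularElt_conj {x : Γ} (g : Γ) (hx : IsRegularElt ρ x) :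
    IsRegularElt ρ (g * x * g⁻¹) := by
  obtain ⟨S, T, d, h, hd⟩ := hx
  have h1 : ρ g * ρ g⁻¹ = 1 := by rw [← map_mul, mul_inv_cancel, map_one]
  have h2 : ρ g⁻¹ * ρ g = 1 := by rw [← map_mul, inv_mul_cancel, map_one]
  refine ⟨ρ g * S, T * ρ g⁻¹, d, ⟨?_, ?_, ?_⟩, hd⟩
  · calc ρ g * S * (T * ρ g⁻¹) = ρ g * (S * T) * ρ g⁻¹ := by simp only [mul_assoc]
      _ = 1 := by rw [h.mul_inv, mul_one, h1]
  · calc T * ρ g⁻¹ * (ρ g * S) = T * (ρ g⁻¹ * ρ g) * S := by simp only [mul_assoc]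
      _ = 1 := by rw [h2, mul_one, h.inv_mul]
  · rw [map_mul, map_mul, h.eq]
    simp only [mul_assoc]

lemma IsSpecialUnitaryRep.commute_scalar (hρ : IsSpecialUnitaryRep ρ) {z : Γ}
    (hz : z ∈ scalarSubgroup ρ) (g : Γ) : g * z = z * g := by
  obtain ⟨c, hc⟩ := hz
  apply hρ.injective
  rw [map_mul, map_mul, hc]
  simp

lemma IsDiagonalization.injective_of_injective {n : ℕ} {M S T S' T' : Matrix (Fin n) (Fin n) ℂ}
    {d e : Fin n → ℂ} (h : IsDiagonalization M S T d) (h' : IsDiagonalization M S' T' e)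
    (hd : Function.Injective d) : Function.Injective e := by
  have h1 : diagonal d * (T * S') = T * S' * diagonal e := by
    have e1 : M * S' = S' * diagonal e := by
      rw [h'.eq, mul_assoc, h'.inv_mul, mul_one]
    have e2 : T * M = diagonal d * T := by
      rw [h.eq, ← mul_assoc, ← mul_assoc, h.inv_mul, one_mul]
    rw [← mul_assoc, ← e2, mul_assoc, e1, mul_assoc]
  have h2 : (T * S') * (T' * S) = 1 := by
    calc (T * S') * (T' * S) = T * (S' * T') * S := by simp only [mul_assoc]
      _ = 1 := by rw [h'.mul_inv, mul_one, h.inv_mul]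
  obtain ⟨σ, hσ⟩ := exists_perm_forall_apply_ne_zero h2
  have h3 : ∀ j, d (σ j) = e j := fun j => by
    have := congrFun₂ h1 (σ j) j
    rw [diagonal_mul, mul_diagonal, mul_comm] at this
    exact mul_left_cancel₀ (hσ j) this
  intro i j hij
  rw [← h3, ← h3] at hij
  exact σ.injective (hd hij)

lemma IsSpecialUnitaryRep.centralizer_eq (hρ : IsSpecialUnitaryRep ρ) (x y : Γ)
    (hx : IsRegularElt ρ x) (hy : IsRegularElt ρ y) (hxy : y ∈ Subgroup.centralizer {x}) :
    Subgroup.centralizer {y} = Subgroup.centralizer {x} := by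
  have key : ∀ {u v : Γ}, IsRegularElt ρ u → u * v = v * u → ∀ g,
      g * u = u * g → g * v = v * g := by
    rintro u v ⟨S, T, d, h, hd⟩ huv g hg
    obtain ⟨e, he⟩ := h.of_commute (N := ρ v) hd (by rw [← map_mul, huv, map_mul])
    obtain ⟨e', he'⟩ := h.of_commute (N := ρ g) hd (by rw [← map_mul, ← hg, map_mul])
    apply hρ.injective
    rw [map_mul, map_mul, he'.commute he]
  rw [Subgroup.mem_centralizer_singleton_iff] at hxy
  ext g
  rw [Subgroup.mem_centralizer_singleton_iff, Subgroup.mem_centralizer_singleton_iff]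
  exact ⟨key hy hxy g, key hx hxy.symm g⟩

lemma not_isRegularElt_of_mem_scalarSubgroup {z : Γ} (hz : z ∈ scalarSubgroup ρ) :
    ¬ IsRegularElt ρ z := by
  rintro ⟨S, T, d, h, hd⟩
  obtain ⟨c, hc⟩ := hz
  rw [hc] at h
  have := h.eq_of_eq (IsDiagonalization.scalar h.mul_inv h.inv_mul c)
  have h01 : d 0 = d 1 := by rw [this]
  exact absurd (hd h01) (by decide)

/-- A simultaneous diagonalization of the centralizer of an element. -/
structure CentralizerDiagonalization (ρ : Γ →* Matrix (Fin 3) (Fin 3) ℂ) (x : Γ) where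
  /-- The change of basis. -/
  S : Matrix (Fin 3) (Fin 3) ℂ
  /-- The inverse change of basis. -/
  T : Matrix (Fin 3) (Fin 3) ℂ
  /-- The diagonal entries. -/
  δ : Fin 3 → Subgroup.centralizer {x} →* ℂ
  diag : ∀ y : Subgroup.centralizer {x}, IsDiagonalization (ρ y) S T (fun i => δ i y)
  injective : Function.Injective fun i => δ i ⟨x, Subgroup.mem_centralizer_singleton_iff.2 rfl⟩

lemma IsRegularElt.nonempty_centralizerDiagonalization {x : Γ} (hx : IsRegularElt ρ x) :
    Nonempty (CentralizerDiagonalization ρ x) := by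
  obtain ⟨S, T, d, h, hd⟩ := hx
  have h1 : ∀ y : Subgroup.centralizer {x}, ∃ e, IsDiagonalization (ρ y) S T e := fun y => by
    refine h.of_commute hd ?_
    have := Subgroup.mem_centralizer_singleton_iff.1 y.2
    rw [← map_mul, ← this, map_mul]
  choose e he using h1
  have hmul : ∀ y z, e (y * z) = e y * e z := fun y z => by
    refine (he (y * z)).eq_of_eq ?_
    rw [Subgroup.coe_mul, map_mul]
    exact (he y).mul (he z)
  have hone : e 1 = 1 := by
    refine (he 1).eq_of_eq ?_
    rw [Subgroup.coe_one, map_one]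
    exact IsDiagonalization.one h.mul_inv h.inv_mul
  refine ⟨⟨S, T, fun i => ⟨⟨fun y => e y i, by rw [hone]; rfl⟩, fun y z => by
    simp only [hmul]; rfl⟩, he, ?_⟩⟩
  have h2 := h.eq_of_eq (he ⟨x, Subgroup.mem_centralizer_singleton_iff.2 rfl⟩)
  simpa [← h2] using hd

namespace CentralizerDiagonalization

variable {x : Γ} (t : CentralizerDiagonalization ρ x)

lemma trace (y : Subgroup.centralizer {x}) : (ρ y).trace = t.δ 0 y + t.δ 1 y + t.δ 2 y := by
  rw [(t.diag y).trace, Fin.sum_univ_three]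

lemma prod (hρ : IsSpecialUnitaryRep ρ) (y : Subgroup.centralizer {x}) :
    t.δ 0 y * t.δ 1 y * t.δ 2 y = 1 := by
  have := (t.diag y).det
  rwa [hρ.det_eq_one, Fin.prod_univ_three, eq_comm] at this

lemma ext (hρ : IsSpecialUnitaryRep ρ) {y z : Subgroup.centralizer {x}}
    (h : ∀ i, t.δ i y = t.δ i z) : y = z := by
  apply Subtype.ext
  apply hρ.injective
  rw [(t.diag y).eq, (t.diag z).eq]
  simp only [h]

lemma mem_scalarSubgroup_iff {y : Subgroup.centralizer {x}} :
    (y : Γ) ∈ scalarSubgroup ρ ↔ t.δ 0 y = t.δ 1 y ∧ t.δ 0 y = t.δ 2 y := by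
  constructor
  · rintro ⟨c, hc⟩
    have h := t.diag y
    rw [hc] at h
    have := h.eq_of_eq (IsDiagonalization.scalar h.mul_inv h.inv_mul c)
    have h' : ∀ i, t.δ i y = c := fun i => congrFun this i
    simp [h']
  · rintro ⟨h1, h2⟩
    refine ⟨t.δ 0 y, ?_⟩
    have h := t.diag y
    rw [h.eq, (IsDiagonalization.scalar h.mul_inv h.inv_mul (t.δ 0 y)).eq]
    congr 3
    ext i
    fin_cases i
    · rfl
    · exact h1.symm
    · exact h2.symm

lemma isRegularElt_of_injective {y : Subgroup.centralizer {x}}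
    (h : Function.Injective fun i => t.δ i y) : IsRegularElt ρ y :=
  ⟨_, _, _, t.diag y, h⟩

lemma ne_zero (i : Fin 3) (y : Subgroup.centralizer {x}) : t.δ i y ≠ 0 := by
  intro h
  have := map_mul (t.δ i) y y⁻¹
  rw [mul_inv_cancel, map_one, h, zero_mul] at this
  exact one_ne_zero this

lemma map_inv (i : Fin 3) (y : Subgroup.centralizer {x}) : t.δ i y⁻¹ = (t.δ i y)⁻¹ := by
  refine eq_inv_of_mul_eq_one_left ?_
  rw [← map_mul, inv_mul_cancel, map_one]

lemma exists_hom_perm (hρ : IsSpecialUnitaryRep ρ) :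
    ∃ f : Subgroup.normalizer (Subgroup.centralizer {x} : Set Γ) →* Equiv.Perm (Fin 3),
      (∀ n : Subgroup.normalizer (Subgroup.centralizer {x} : Set Γ),
        ∀ y z : Subgroup.centralizer {x}, (z : Γ) = n * y * (n : Γ)⁻¹ →
        ∀ j, t.δ (f n j) z = t.δ j y) ∧
      ∀ n, f n = 1 ↔ (n : Γ) ∈ Subgroup.centralizer {x} := by
  set x' : Subgroup.centralizer {x} := ⟨x, Subgroup.mem_centralizer_singleton_iff.2 rfl⟩ with hx'
  have hex : ∀ n : Subgroup.normalizer (Subgroup.centralizer {x} : Set Γ),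
      ∃ σ : Equiv.Perm (Fin 3), ∀ y z : Subgroup.centralizer {x},
        (z : Γ) = n * y * (n : Γ)⁻¹ → ∀ j, t.δ (σ j) z = t.δ j y := by
    intro n
    have h1 := (t.diag x').mul_inv
    have h2 : (t.T * ρ n * t.S) * (t.T * ρ (n : Γ)⁻¹ * t.S) = 1 := by
      calc _ = t.T * (ρ n * (t.S * t.T) * ρ (n : Γ)⁻¹) * t.S := by simp only [mul_assoc]
        _ = 1 := by
          rw [h1, mul_one, ← map_mul, mul_inv_cancel, map_one, mul_one, (t.diag x').inv_mul]
    obtain ⟨σ, hσ⟩ := exists_perm_forall_apply_ne_zero h2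
    refine ⟨σ, fun y z hz j => ?_⟩
    have h3 : diagonal (fun i => t.δ i z) * (t.T * ρ n * t.S) =
        (t.T * ρ n * t.S) * diagonal (fun i => t.δ i y) := by
      rw [← (t.diag z).conj_eq, ← (t.diag y).conj_eq]
      calc _ = t.T * (ρ z * (t.S * t.T) * ρ n) * t.S := by simp only [mul_assoc]
        _ = t.T * (ρ n * (t.S * t.T) * ρ y) * t.S := by
          rw [h1, mul_one, mul_one, ← map_mul, ← map_mul, hz]; simp
        _ = _ := by simp only [mul_assoc]
    have := congrFun₂ h3 (σ j) j
    rw [diagonal_mul, mul_diagonal, mul_comm] at this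
    exact mul_left_cancel₀ (hσ j) this
  have hmem : ∀ (n : Subgroup.normalizer (Subgroup.centralizer {x} : Set Γ))
      (y : Subgroup.centralizer {x}), (n : Γ) * y * (n : Γ)⁻¹ ∈ Subgroup.centralizer {x} :=
    fun n y => (Subgroup.mem_normalizer_iff.1 n.2 y).1 y.2
  choose s hs using hex
  have hinj : ∀ n : Subgroup.normalizer (Subgroup.centralizer {x} : Set Γ),
      Function.Injective fun i => t.δ i ⟨_, hmem n x'⟩ := by
    intro n
    have h1 : (fun i => t.δ i ⟨_, hmem n x'⟩) ∘ s n = fun i => t.δ i x' :=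
      funext fun j => hs n x' ⟨_, hmem n x'⟩ rfl j
    have h2 : Function.Injective ((fun i => t.δ i ⟨_, hmem n x'⟩) ∘ s n) := by
      rw [h1]; exact t.injective
    exact (Function.Injective.of_comp_iff' _ (s n).bijective).1 h2
  have huniq : ∀ (n : Subgroup.normalizer (Subgroup.centralizer {x} : Set Γ))
      (σ : Equiv.Perm (Fin 3)), (∀ y z : Subgroup.centralizer {x},
        (z : Γ) = n * y * (n : Γ)⁻¹ → ∀ j, t.δ (σ j) z = t.δ j y) → s n = σ := by
    intro n σ hσ
    ext1 j
    apply hinj n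
    simp only
    rw [hs n x' _ rfl, hσ x' _ rfl]
  refine ⟨MonoidHom.mk' s fun n m => ?_, hs, fun n => ⟨fun h => ?_, fun h => ?_⟩⟩
  · refine huniq _ _ fun y z hz j => ?_
    rw [Equiv.Perm.mul_apply, hs n ⟨_, hmem m y⟩ z (by simp [hz, mul_assoc]), hs m y _ rfl]
  · have h1 : (⟨_, hmem n x'⟩ : Subgroup.centralizer {x}) = x' := by
      refine t.ext hρ fun i => ?_
      have := hs n x' ⟨_, hmem n x'⟩ rfl i
      rwa [show s n = 1 from h] at this
    rw [Subgroup.mem_centralizer_singleton_iff]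
    have h2 := congrArg Subtype.val h1
    simp only [hx'] at h2
    rw [mul_inv_eq_iff_eq_mul] at h2
    exact h2
  · refine huniq _ _ fun y z hz j => ?_
    have hyz : z = y := by
      have : z = ⟨(n : Γ), h⟩ * y * ⟨(n : Γ), h⟩⁻¹ := Subtype.ext (by simp [hz])
      rw [this]
      refine t.ext hρ fun i => ?_
      rw [_root_.map_mul, _root_.map_mul, mul_right_comm, ← _root_.map_mul, mul_inv_cancel,
        map_one, one_mul]
    rw [hyz]; rfl

end CentralizerDiagonalization

end Tori

section SquaredCharacter

open Matrix

variable {Γ : Type*} [Group Γ] {ρ : Γ →* Matrix (Fin 3) (Fin 3) ℂ}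

/-- The squared modulus of the character. -/
noncomputable def sqChar (ρ : Γ →* Matrix (Fin 3) (Fin 3) ℂ) (g : Γ) : ℝ :=
  Complex.normSq (ρ g).trace

lemma IsSpecialUnitaryRep.trace_inv (hρ : IsSpecialUnitaryRep ρ) (g : Γ) :
    (ρ g⁻¹).trace = starRingEnd ℂ (ρ g).trace := by
  rw [hρ.map_inv, trace_conjTranspose]; rfl

lemma IsSpecialUnitaryRep.ofReal_sqChar (hρ : IsSpecialUnitaryRep ρ) (g : Γ) :
    (sqChar ρ g : ℂ) = (ρ g).trace * (ρ g⁻¹).trace := by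
  rw [hρ.trace_inv, sqChar, Complex.mul_conj]

lemma trace_rep_conj (ρ : Γ →* Matrix (Fin 3) (Fin 3) ℂ) (x g : Γ) :
    (ρ (g * x * g⁻¹)).trace = (ρ x).trace := by
  rw [map_mul, map_mul, trace_mul_cycle, ← map_mul, inv_mul_cancel, map_one, one_mul]

lemma sqChar_conj (ρ : Γ →* Matrix (Fin 3) (Fin 3) ℂ) (x g : Γ) :
    sqChar ρ (g * x * g⁻¹) = sqChar ρ x := by
  rw [sqChar, trace_rep_conj, sqChar]

lemma IsSpecialUnitaryRep.scalar_pow_three (hρ : IsSpecialUnitaryRep ρ) {z : Γ} {c : ℂ}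
    (hz : ρ z = c • 1) : c ^ 3 = 1 := by
  have := hρ.det_eq_one z
  rwa [hz, det_smul, det_one, mul_one, Fintype.card_fin] at this

lemma IsSpecialUnitaryRep.sqChar_mul_scalar (hρ : IsSpecialUnitaryRep ρ) (x : Γ) {z : Γ}
    (hz : z ∈ scalarSubgroup ρ) : sqChar ρ (x * z) = sqChar ρ x := by
  obtain ⟨c, hc⟩ := hz
  have h1 := Complex.norm_eq_one_of_pow_eq_one (hρ.scalar_pow_three hc) (by norm_num)
  rw [sqChar, map_mul, hc, mul_smul_comm, mul_one, trace_smul, smul_eq_mul, Complex.normSq_mul,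
    Complex.normSq_eq_norm_sq c, h1, sqChar]
  ring

lemma sqChar_one : sqChar ρ 1 = 9 := by
  rw [sqChar, map_one, trace_one]
  norm_num

lemma IsSpecialUnitaryRep.sqChar_scalar (hρ : IsSpecialUnitaryRep ρ) {z : Γ}
    (hz : z ∈ scalarSubgroup ρ) : sqChar ρ z = 9 := by
  have := hρ.sqChar_mul_scalar 1 hz
  rwa [one_mul, sqChar_one] at this

lemma IsSpecialUnitaryRep.pow_three_eq_one [Finite Γ] (hρ : IsSpecialUnitaryRep ρ) {x : Γ}
    (hx : (ρ x).trace = 0) : x ^ 3 = 1 := by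
  obtain ⟨S, T, d, hST, hTS, heq⟩ := exists_diagonal_of_pow_eq_one (M := ρ x)
    (k := Nat.card Γ) Nat.card_pos.ne' (by rw [← map_pow, pow_card_eq_one', map_one])
  have h : IsDiagonalization (ρ x) S T d := ⟨hST, hTS, heq⟩
  have h1 : d 0 + d 1 + d 2 = 0 := by rw [← Fin.sum_univ_three, ← h.trace, hx]
  have h2 : d 0 * d 1 * d 2 = 1 := by rw [← Fin.prod_univ_three, ← h.det, hρ.det_eq_one]
  have hn : ∀ i, d i ^ Nat.card Γ = 1 := fun i => by
    have h3 := h.pow (Nat.card Γ)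
    rw [← map_pow, pow_card_eq_one', map_one] at h3
    exact congrFun (h3.eq_of_eq (IsDiagonalization.one hST hTS)) i
  have hc : ∀ i, d i * starRingEnd ℂ (d i) = 1 := fun i => by
    rw [Complex.mul_conj, Complex.normSq_eq_norm_sq,
      Complex.norm_eq_one_of_pow_eq_one (hn i) Nat.card_pos.ne']
    simp
  have h4 : starRingEnd ℂ (d 0) + starRingEnd ℂ (d 1) + starRingEnd ℂ (d 2) = 0 := by
    rw [← map_add, ← map_add, h1, map_zero]
  have h5 : d 1 * d 2 + d 0 * d 2 + d 0 * d 1 = 0 := by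
    linear_combination h4 * (d 0 * d 1 * d 2) - d 1 * d 2 * hc 0 - d 0 * d 2 * hc 1
      - d 0 * d 1 * hc 2
  have h6 : d ^ 3 = 1 := by
    ext i
    fin_cases i
    · simp only [Pi.pow_apply, Pi.one_apply, Fin.zero_eta]
      linear_combination d 0 ^ 2 * h1 - d 0 * h5 + h2
    · simp only [Pi.pow_apply, Pi.one_apply, Fin.mk_one]
      linear_combination d 1 ^ 2 * h1 - d 1 * h5 + h2
    · simp only [Pi.pow_apply, Pi.one_apply, Fin.reduceFinMk]
      linear_combination d 2 ^ 2 * h1 - d 2 * h5 + h2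
  apply hρ.injective
  have h7 := h.pow 3
  rw [h6] at h7
  rw [map_pow, map_one, h7.eq, (IsDiagonalization.one hST hTS).eq]

lemma IsSpecialUnitaryRep.trace_eq_zero_of_conj (hρ : IsSpecialUnitaryRep ρ) {x n z : Γ}
    (hz : z ∈ scalarSubgroup ρ) (h : n * x * n⁻¹ = x * z)
    (hn : n ∉ Subgroup.centralizer {x}) : (ρ x).trace = 0 := by
  have h1 := trace_rep_conj ρ x n
  obtain ⟨c, hc⟩ := hz
  rw [h, map_mul, hc, mul_smul_comm, mul_one, trace_smul, smul_eq_mul] at h1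
  have h2 : (c - 1) * (ρ x).trace = 0 := by linear_combination h1
  refine (mul_eq_zero.1 h2).resolve_left fun h3 => hn ?_
  have h4 : z = 1 := hρ.injective (by rw [hc, sub_eq_zero.1 h3, one_smul, map_one])
  rw [h4, mul_one, mul_inv_eq_iff_eq_mul] at h
  exact Subgroup.mem_centralizer_singleton_iff.2 h

namespace CentralizerDiagonalization

variable {x : Γ} (t : CentralizerDiagonalization ρ x)

/-- The quotient of characters `δ i * δ k / (δ j * δ l)`. -/
noncomputable def ratio (i k j l : Fin 3) : Subgroup.centralizer {x} →* ℂ :=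
  t.δ i * t.δ k * (invMonoidWithZeroHom : ℂ →*₀ ℂ).toMonoidHom.comp (t.δ j * t.δ l)

lemma ratio_apply (i k j l : Fin 3) (y : Subgroup.centralizer {x}) :
    t.ratio i k j l y = t.δ i y * t.δ k y * (t.δ j y * t.δ l y)⁻¹ := rfl

lemma ratio_eq_one_iff (i k j l : Fin 3) :
    t.ratio i k j l = 1 ↔ ∀ y, t.δ i y * t.δ k y = t.δ j y * t.δ l y := by
  rw [MonoidHom.ext_iff]
  refine forall_congr' fun y => ?_
  rw [ratio_apply, MonoidHom.one_apply, mul_inv_eq_one₀]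
  exact mul_ne_zero (t.ne_zero _ _) (t.ne_zero _ _)

variable [Fintype Γ]

open scoped Classical in
lemma sum_ratio (i k j l : Fin 3) : ∑ y, t.ratio i k j l y =
    if t.ratio i k j l = 1 then (Nat.card (Subgroup.centralizer {x}) : ℂ) else 0 := by
  split_ifs with h
  · rw [h]
    simp
  · exact sum_hom_units_eq_zero _ h

omit [Fintype Γ] in
lemma sqChar_eq [Finite Γ] (hρ : IsSpecialUnitaryRep ρ) (y : Subgroup.centralizer {x}) :
    (sqChar ρ y : ℂ) = ∑ i, ∑ j, t.ratio i 0 j 0 y := by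
  rw [hρ.ofReal_sqChar]
  have h1 := t.trace y
  have h2 := t.trace y⁻¹
  rw [Subgroup.coe_inv] at h2
  rw [h1, h2]
  have h0 : t.δ 0 y ≠ 0 := t.ne_zero 0 y
  have h1 : t.δ 1 y ≠ 0 := t.ne_zero 1 y
  have h2 : t.δ 2 y ≠ 0 := t.ne_zero 2 y
  simp only [Fin.sum_univ_three, ratio_apply, map_inv]
  field_simp

omit [Fintype Γ] in
lemma sqChar_sq_eq [Finite Γ] (hρ : IsSpecialUnitaryRep ρ) (y : Subgroup.centralizer {x}) :
    ((sqChar ρ y ^ 2 : ℝ) : ℂ) =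
      ∑ p : Fin 3 × Fin 3 × Fin 3 × Fin 3, t.ratio p.1 p.2.1 p.2.2.1 p.2.2.2 y := by
  rw [Complex.ofReal_pow, t.sqChar_eq hρ]
  have h0 : t.δ 0 y ≠ 0 := t.ne_zero 0 y
  have h : ∀ i j, t.ratio i 0 j 0 y = t.δ i y * (t.δ j y)⁻¹ := fun i j => by
    rw [ratio_apply, mul_inv, mul_mul_mul_comm, mul_inv_cancel₀ h0, mul_one]
  simp only [h, ← Finset.sum_mul_sum, sq, Fintype.sum_prod_type, ratio_apply]
  have h' : ∀ i k j l, t.δ i y * t.δ k y * (t.δ j y * t.δ l y)⁻¹ =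
    t.δ i y * (t.δ k y * ((t.δ j y)⁻¹ * (t.δ l y)⁻¹)) := fun i k j l => by
      rw [mul_inv, mul_assoc]
  simp only [h', ← Finset.mul_sum, ← Finset.sum_mul]
  ring

include t in
open scoped Classical in
lemma sum_sqChar (hρ : IsSpecialUnitaryRep ρ) :
    ∑ y : Subgroup.centralizer {x}, sqChar ρ y = 3 * Nat.card (Subgroup.centralizer {x}) := by
  have h : ((∑ y : Subgroup.centralizer {x}, sqChar ρ y : ℝ) : ℂ) =
      ((3 * Nat.card (Subgroup.centralizer {x}) : ℝ) : ℂ) := by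
    push_cast
    simp_rw [t.sqChar_eq hρ]
    rw [Finset.sum_comm]
    simp_rw [Finset.sum_comm (s := (Finset.univ : Finset (Subgroup.centralizer {x}))),
      t.sum_ratio]
    have h1 : ∀ i j, t.ratio i 0 j 0 = 1 ↔ i = j := by
      intro i j
      rw [ratio_eq_one_iff]
      constructor
      · intro h
        exact t.injective (mul_right_cancel₀ (t.ne_zero 0 _) (h _))
      · rintro rfl y; rfl
    simp_rw [h1]
    simp
  exact_mod_cast h

include t in
open scoped Classical in
/-- A lower bound for the sum of squares from a list of coincidences among the characters. -/
lemma card_mul_le_sum_sqChar_sq (hρ : IsSpecialUnitaryRep ρ)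
    (s : Finset (Fin 3 × Fin 3 × Fin 3 × Fin 3))
    (hs : ∀ p ∈ s, ∀ y, t.δ p.1 y * t.δ p.2.1 y = t.δ p.2.2.1 y * t.δ p.2.2.2 y) :
    (s.card : ℝ) * Nat.card (Subgroup.centralizer {x}) ≤
      ∑ y : Subgroup.centralizer {x}, sqChar ρ y ^ 2 := by
  have h : ((∑ y : Subgroup.centralizer {x}, sqChar ρ y ^ 2 : ℝ) : ℂ) =
      ((∑ p : Fin 3 × Fin 3 × Fin 3 × Fin 3, if t.ratio p.1 p.2.1 p.2.2.1 p.2.2.2 = 1 then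
        (Nat.card (Subgroup.centralizer {x}) : ℝ) else 0 : ℝ) : ℂ) := by
    rw [Complex.ofReal_sum]
    simp_rw [t.sqChar_sq_eq hρ]
    rw [Finset.sum_comm]
    simp_rw [t.sum_ratio]
    push_cast
    exact Finset.sum_congr rfl fun p _ => by split_ifs <;> simp
  rw [Complex.ofReal_injective h, ← nsmul_eq_mul, ← Finset.sum_const]
  refine le_trans (Finset.sum_le_sum fun p hp => ?_)
    (Finset.sum_le_sum_of_subset_of_nonneg (Finset.subset_univ s) fun p _ _ => ?_)
  · rw [if_pos ((t.ratio_eq_one_iff _ _ _ _).2 (hs p hp))]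
  · split_ifs
    · exact Nat.cast_nonneg _
    · exact le_rfl

include t in
open scoped Classical in
lemma fifteen_mul_le_sum_sqChar_sq (hρ : IsSpecialUnitaryRep ρ) :
    (15 : ℝ) * Nat.card (Subgroup.centralizer {x}) ≤
      ∑ y : Subgroup.centralizer {x}, sqChar ρ y ^ 2 := by
  have := t.card_mul_le_sum_sqChar_sq hρ
    {p | (p.1 = p.2.2.1 ∧ p.2.1 = p.2.2.2) ∨ (p.1 = p.2.2.2 ∧ p.2.1 = p.2.2.1)} (by
      rintro ⟨i, k, j, l⟩ hp y
      simp only [Finset.mem_filter, Finset.mem_univ, true_and] at hp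
      rcases hp with ⟨rfl, rfl⟩ | ⟨rfl, rfl⟩
      · rfl
      · exact mul_comm _ _)
  have hcard : Finset.card {p : Fin 3 × Fin 3 × Fin 3 × Fin 3 |
      (p.1 = p.2.2.1 ∧ p.2.1 = p.2.2.2) ∨ (p.1 = p.2.2.2 ∧ p.2.1 = p.2.2.1)} = 15 := by
    decide
  rw [hcard] at this
  exact_mod_cast this

/-- One of the characters squares to the product of the other two. -/
def IsRealType : Prop :=
  ∃ a b c : Fin 3, a ≠ b ∧ a ≠ c ∧ b ≠ c ∧ ∀ y, t.δ a y * t.δ a y = t.δ b y * t.δ c y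

open scoped Classical in
lemma IsRealType.nineteen_mul_le_sum_sqChar_sq {t : CentralizerDiagonalization ρ x}
    (ht : t.IsRealType) (hρ : IsSpecialUnitaryRep ρ) :
    (19 : ℝ) * Nat.card (Subgroup.centralizer {x}) ≤
      ∑ y : Subgroup.centralizer {x}, sqChar ρ y ^ 2 := by
  obtain ⟨a, b, c, hab, hac, hbc, h⟩ := ht
  have := t.card_mul_le_sum_sqChar_sq hρ
    {p | (p.1 = p.2.2.1 ∧ p.2.1 = p.2.2.2) ∨ (p.1 = p.2.2.2 ∧ p.2.1 = p.2.2.1) ∨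
      p = (a, a, b, c) ∨ p = (a, a, c, b) ∨ p = (b, c, a, a) ∨ p = (c, b, a, a)} (by
      rintro ⟨i, k, j, l⟩ hp y
      simp only [Finset.mem_filter, Finset.mem_univ, true_and, Prod.mk.injEq] at hp
      rcases hp with ⟨rfl, rfl⟩ | ⟨rfl, rfl⟩ | ⟨rfl, rfl, rfl, rfl⟩ | ⟨rfl, rfl, rfl, rfl⟩ |
        ⟨rfl, rfl, rfl, rfl⟩ | ⟨rfl, rfl, rfl, rfl⟩
      · rfl
      · exact mul_comm _ _
      · exact h y
      · simp only [h y, mul_comm]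
      · exact (h y).symm
      · simp only [h y, mul_comm])
  have hcard : ∀ a b c : Fin 3, a ≠ b → a ≠ c → b ≠ c →
    Finset.card {p : Fin 3 × Fin 3 × Fin 3 × Fin 3 |
      (p.1 = p.2.2.1 ∧ p.2.1 = p.2.2.2) ∨ (p.1 = p.2.2.2 ∧ p.2.1 = p.2.2.1) ∨
      p = (a, a, b, c) ∨ p = (a, a, c, b) ∨ p = (b, c, a, a) ∨ p = (c, b, a, a)} = 19 := by
    decide
  rw [hcard a b c hab hac hbc] at this
  exact_mod_cast this

end CentralizerDiagonalization

end SquaredCharacter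

section NormalizersOfTori

open Matrix

variable {Γ : Type*} [Group Γ] {ρ : Γ →* Matrix (Fin 3) (Fin 3) ℂ}

open scoped Classical in
lemma sum_eq_sum_isRegularElt_add [Fintype Γ] {f : Γ → ℝ}
    (hz : ∀ z ∈ scalarSubgroup ρ, f z = f 1)
    (hf : ∀ y, ¬ IsRegularElt ρ y → y ∉ scalarSubgroup ρ → f y = 0) (H : Subgroup Γ)
    (hH : scalarSubgroup ρ ≤ H) :
    ∑ y : H, f y = ∑ y with IsRegularElt ρ y ∧ y ∈ H, f y + Nat.card (scalarSubgroup ρ) * f 1 := by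
  have h1 : ∑ y : H, f y = ∑ y with y ∈ H, f y :=
    (Finset.sum_subtype _ (by simp) _).symm
  have h2 : ∑ y with y ∈ scalarSubgroup ρ, f y = Nat.card (scalarSubgroup ρ) * f 1 := by
    rw [Finset.sum_congr rfl (g := fun _ => f 1) (fun z hzz => hz z (Finset.mem_filter.1 hzz).2),
      Finset.sum_const, nsmul_eq_mul, Nat.card_eq_fintype_card, Fintype.card_subtype]
  rw [h1, ← h2, ← Finset.sum_filter_add_sum_filter_not _ (IsRegularElt ρ), Finset.filter_filter,
    Finset.filter_filter]
  congr 1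
  · exact Finset.sum_congr (Finset.filter_congr fun _ _ => and_comm) fun _ _ => rfl
  · symm
    refine Finset.sum_subset ?_ ?_
    · intro z hzz
      have hzz := (Finset.mem_filter.1 hzz).2
      simp only [Finset.mem_filter, Finset.mem_univ, true_and]
      exact ⟨hH hzz, not_isRegularElt_of_mem_scalarSubgroup hzz⟩
    · intro y hy hyz
      simp only [Finset.mem_filter, Finset.mem_univ, true_and] at hy hyz
      exact hf y hy.2 hyz

lemma IsSpecialUnitaryRep.scalarSubgroup_le_centralizer (hρ : IsSpecialUnitaryRep ρ) (x : Γ) :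
    scalarSubgroup ρ ≤ Subgroup.centralizer {x} := fun _ hz =>
  Subgroup.mem_centralizer_singleton_iff.2 (hρ.commute_scalar hz x).symm

open scoped Classical in
lemma IsSpecialUnitaryRep.centralizerSum_eq [Fintype Γ] (hρ : IsSpecialUnitaryRep ρ) {f : Γ → ℝ}
    (hz : ∀ z ∈ scalarSubgroup ρ, f z = f 1)
    (hf : ∀ y, ¬ IsRegularElt ρ y → y ∉ scalarSubgroup ρ → f y = 0) (x : Γ) :
    centralizerSum (IsRegularElt ρ) f x =
      ∑ y : Subgroup.centralizer {x}, f y - Nat.card (scalarSubgroup ρ) * f 1 := by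
  rw [sum_eq_sum_isRegularElt_add hz hf _ (hρ.scalarSubgroup_le_centralizer x), centralizerSum]
  ring

open scoped Classical in
lemma sum_isRegularElt_eq [Fintype Γ] {f : Γ → ℝ}
    (hz : ∀ z ∈ scalarSubgroup ρ, f z = f 1)
    (hf : ∀ y, ¬ IsRegularElt ρ y → y ∉ scalarSubgroup ρ → f y = 0) :
    ∑ y with IsRegularElt ρ y, f y = ∑ y, f y - Nat.card (scalarSubgroup ρ) * f 1 := by
  have h := sum_eq_sum_isRegularElt_add hz hf ⊤ le_top
  have h1 : ∑ y : (⊤ : Subgroup Γ), f y = ∑ y, f y :=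
    Fintype.sum_equiv Subgroup.topEquiv.toEquiv _ _ fun _ => rfl
  rw [h1] at h
  simp only [Subgroup.mem_top, and_true] at h
  rw [h]
  ring

lemma centralizer_le_normalizer (x : Γ) : Subgroup.centralizer {x} ≤
    Subgroup.normalizer (Subgroup.centralizer {x} : Set Γ) := Subgroup.le_normalizer

lemma IsSpecialUnitaryRep.exists_card_normalizer [Finite Γ] (hρ : IsSpecialUnitaryRep ρ) {x : Γ}
    (hx : IsRegularElt ρ x) :
    ∃ w, Nat.card (Subgroup.normalizer (Subgroup.centralizer {x} : Set Γ)) =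
        w * Nat.card (Subgroup.centralizer {x}) ∧ (w = 1 ∨ w = 2 ∨ w = 3 ∨ w = 6) ∧
      (w = 6 → ∃ n₁ ∈ Subgroup.normalizer (Subgroup.centralizer {x} : Set Γ),
        ∃ n₂ ∈ Subgroup.normalizer (Subgroup.centralizer {x} : Set Γ),
        (n₂ * n₁)⁻¹ * (n₁ * n₂) ∉ Subgroup.centralizer {x}) ∧
      (w.Prime → ∃ n ∈ Subgroup.normalizer (Subgroup.centralizer {x} : Set Γ),
        n ∉ Subgroup.centralizer {x} ∧ n ^ w ∈ Subgroup.centralizer {x}) := by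
  obtain ⟨t⟩ := hx.nonempty_centralizerDiagonalization
  obtain ⟨f, -, hf⟩ := t.exists_hom_perm hρ
  have hker : f.ker = (Subgroup.centralizer {x}).subgroupOf _ := by
    ext n
    rw [MonoidHom.mem_ker, hf, Subgroup.mem_subgroupOf]
  have hcard : Nat.card (Subgroup.normalizer (Subgroup.centralizer {x} : Set Γ)) =
      Nat.card f.range * Nat.card (Subgroup.centralizer {x}) := by
    rw [← Subgroup.index_ker, hker, mul_comm, ← Nat.card_congr
      (Subgroup.subgroupOfEquivOfLe (centralizer_le_normalizer x)).toEquiv]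
    exact (Subgroup.card_mul_index _).symm
  refine ⟨Nat.card f.range, hcard, ?_, ?_, ?_⟩
  · have h1 : Nat.card f.range ∣ 6 := by
      have := Subgroup.card_subgroup_dvd_card f.range
      rwa [Nat.card_perm, Nat.card_eq_fintype_card (α := Fin 3), Fintype.card_fin,
        show Nat.factorial 3 = 6 from rfl] at this
    have h2 : Nat.card f.range ≤ 6 := Nat.le_of_dvd (by norm_num) h1
    interval_cases h : Nat.card f.range <;> simp_all
  · intro h
    have htop : f.range = ⊤ := by
      apply Subgroup.eq_top_of_card_eq
      rw [h, Nat.card_perm, Nat.card_eq_fintype_card (α := Fin 3), Fintype.card_fin]; rfl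
    rw [MonoidHom.range_eq_top] at htop
    obtain ⟨n₁, h1⟩ := htop (Equiv.swap 0 1)
    obtain ⟨n₂, h2⟩ := htop (Equiv.swap 1 2)
    refine ⟨n₁, n₁.2, n₂, n₂.2, fun h3 => ?_⟩
    have h4 := (hf ((n₂ * n₁)⁻¹ * (n₁ * n₂))).2 (by simpa using h3)
    rw [map_mul, _root_.map_inv, map_mul, map_mul, h1, h2] at h4
    exact absurd h4 (by decide)
  · intro hp
    have hfact : Fact (Nat.card f.range).Prime := ⟨hp⟩
    obtain ⟨g, hg⟩ := exists_prime_orderOf_dvd_card' (G := f.range) (Nat.card f.range) dvd_rfl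
    obtain ⟨n, hn⟩ := g.2
    have hord : orderOf (f n) = Nat.card f.range := by rw [hn, Subgroup.orderOf_coe, hg]
    refine ⟨n, n.2, fun h => ?_, ?_⟩
    · rw [(hf n).2 h, orderOf_one] at hord
      exact hp.one_lt.ne hord
    · have h1 := (hf (n ^ Nat.card f.range)).1 (by
        rw [map_pow]
        exact orderOf_dvd_iff_pow_eq_one.1 hord.dvd)
      simpa using h1

variable {G : Type*} [Group G] {π : Γ →* G}

lemma card_centralizer_eq [Finite Γ] (hρ : IsSpecialUnitaryRep ρ)
    (hπ : ∀ g, π g = 1 ↔ g ∈ scalarSubgroup ρ) (x : Γ) :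
    Nat.card (Subgroup.centralizer {x}) =
      Nat.card (scalarSubgroup ρ) * Nat.card ((Subgroup.centralizer {x}).map π) := by
  have h1 : (π.comp (Subgroup.centralizer {x}).subtype).ker =
      (scalarSubgroup ρ).subgroupOf (Subgroup.centralizer {x}) := by
    ext y
    rw [MonoidHom.mem_ker, Subgroup.mem_subgroupOf]
    exact hπ y
  have h2 : (π.comp (Subgroup.centralizer {x}).subtype).range =
      (Subgroup.centralizer {x}).map π := by
    rw [MonoidHom.range_comp, Subgroup.range_subtype]
  rw [← h2, ← Subgroup.index_ker, h1, ← Nat.card_congr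
      (Subgroup.subgroupOfEquivOfLe (hρ.scalarSubgroup_le_centralizer x)).toEquiv]
  exact (Subgroup.card_mul_index _).symm

lemma orderOf_dvd_card_map_centralizer (x : Γ) :
    orderOf (π x) ∣ Nat.card ((Subgroup.centralizer {x}).map π) := by
  have h : π x ∈ (Subgroup.centralizer {x}).map π :=
    ⟨x, Subgroup.mem_centralizer_singleton_iff.2 rfl, rfl⟩
  rw [← Subgroup.orderOf_mk _ h]
  exact orderOf_dvd_natCard _

lemma conj_pow_eq {g s : G} {k : ℕ} (h : g * s * g⁻¹ = s ^ k) (l : ℕ) :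
    g * s ^ l * g⁻¹ = s ^ (k * l) := by
  rw [← conj_pow, h, pow_mul]

lemma pow_conj_eq {g s : G} {k : ℕ} (h : g * s * g⁻¹ = s ^ k) (j : ℕ) :
    g ^ j * s * (g ^ j)⁻¹ = s ^ (k ^ j) := by
  induction j with
  | zero => simp
  | succ j ih =>
    rw [pow_succ' g, show g * g ^ j * s * (g * g ^ j)⁻¹ = g * (g ^ j * s * (g ^ j)⁻¹) * g⁻¹ by
        group,
      ih, conj_pow_eq h, pow_succ']

/-- If the order of `x` modulo scalars is coprime to its index in the centralizer of `x`
modulo scalars, then the normalizer of that centralizer normalizes the cyclic group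
generated by `x` modulo scalars. -/
lemma exists_conj_eq_pow [Finite Γ]
    (hρ : IsSpecialUnitaryRep ρ) {x : Γ} (hx : IsRegularElt ρ x) {j : ℕ}
    (hj : Nat.card ((Subgroup.centralizer {x}).map π) = orderOf (π x) * j)
    (hcop : (orderOf (π x)).Coprime j) {n : Γ}
    (hn : n ∈ Subgroup.normalizer (Subgroup.centralizer {x} : Set Γ)) :
    ∃ k : ℕ, π n * π x * (π n)⁻¹ = π x ^ k := by
  obtain ⟨t⟩ := hx.nonempty_centralizerDiagonalization
  have hcomm : ∀ y z : Subgroup.centralizer {x}, y * z = z * y := fun y z =>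
    t.ext hρ fun i => by rw [map_mul, map_mul, mul_comm]
  have hxC : x ∈ Subgroup.centralizer {x} := Subgroup.mem_centralizer_singleton_iff.2 rfl
  set A := (Subgroup.centralizer {x}).map π with hA
  have hAcomm : ∀ y z : A, y * z = z * y := by
    rintro ⟨_, y, hy, rfl⟩ ⟨_, z, hz, rfl⟩
    apply Subtype.ext
    have := congrArg (fun u : Subgroup.centralizer {x} => π u) (hcomm ⟨y, hy⟩ ⟨z, hz⟩)
    simpa using this
  have hnx : π (n * x * n⁻¹) ∈ A := ⟨_, (Subgroup.mem_normalizer_iff.1 hn x).1 hxC, rfl⟩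
  let s : A := ⟨π x, x, hxC, rfl⟩
  let y : A := ⟨_, hnx⟩
  have hs : orderOf s = orderOf (π x) := Subgroup.orderOf_mk _ _
  have hnorm : (Subgroup.zpowers s).Normal :=
      ⟨fun a _ g => by rwa [hAcomm g a, mul_inv_cancel_right]⟩
  have hAfin : Finite A := Set.Finite.to_subtype
      (Set.toFinite (Subgroup.centralizer {x} : Set Γ) |>.image π)
  have hidx : (Subgroup.zpowers s).index = j := by
    have h1 := Subgroup.card_mul_index (Subgroup.zpowers s)
    rw [Nat.card_zpowers, hs, hj] at h1
    refine Nat.eq_of_mul_eq_mul_left ?_ h1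
    rw [← hs]
    exact orderOf_pos s
  have h1 : y ^ j ∈ Subgroup.zpowers s := by
    rw [← hidx]
    exact Subgroup.pow_index_mem _ _
  have h2 : y ^ orderOf (π x) = 1 := by
    apply Subtype.ext
    simp only [y, SubmonoidClass.mk_pow, Subgroup.coe_one]
    rw [map_mul, map_mul, map_inv, conj_pow, pow_orderOf_eq_one]
    simp
  have h3 : y ∈ Subgroup.zpowers s := by
    have h4 : (orderOf y).Coprime j :=
      Nat.Coprime.coprime_dvd_left (orderOf_dvd_of_pow_eq_one h2) hcop
    obtain ⟨l, hl⟩ := exists_pow_eq_self_of_coprime h4.symm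
    rw [← hl]
    exact Subgroup.pow_mem _ h1 l
  rw [← mem_powers_iff_mem_zpowers] at h3
  obtain ⟨k, hk⟩ := h3
  refine ⟨k, ?_⟩
  have : π x ^ k = π (n * x * n⁻¹) := congrArg Subtype.val hk
  rw [this, map_mul, map_mul, _root_.map_inv]

lemma IsSpecialUnitaryRep.trace_eq_zero_of_map_conj (hρ : IsSpecialUnitaryRep ρ)
    (hπ : ∀ g, π g = 1 ↔ g ∈ scalarSubgroup ρ) {x n : Γ}
    (h : π n * π x * (π n)⁻¹ = π x) (hn : n ∉ Subgroup.centralizer {x}) : (ρ x).trace = 0 := by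
  refine hρ.trace_eq_zero_of_conj (n := n) (z := x⁻¹ * (n * x * n⁻¹)) ?_ (by group) hn
  rw [← hπ]
  simp [h]

lemma IsSpecialUnitaryRep.trace_eq_zero_of_noncommuting (hρ : IsSpecialUnitaryRep ρ)
    (hπ : ∀ g, π g = 1 ↔ g ∈ scalarSubgroup ρ) {x n₁ n₂ : Γ} {k₁ k₂ : ℕ}
    (h₁ : π n₁ * π x * (π n₁)⁻¹ = π x ^ k₁) (h₂ : π n₂ * π x * (π n₂)⁻¹ = π x ^ k₂)
    (hn : (n₂ * n₁)⁻¹ * (n₁ * n₂) ∉ Subgroup.centralizer {x}) : (ρ x).trace = 0 := by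
  refine hρ.trace_eq_zero_of_map_conj hπ ?_ hn
  simp only [map_mul, _root_.map_inv]
  have h3 : π n₁ * π n₂ * π x * (π n₁ * π n₂)⁻¹ = π x ^ (k₁ * k₂) := by
    rw [← conj_pow_eq h₁, ← h₂]; group
  have h4 : π n₂ * π n₁ * π x * (π n₂ * π n₁)⁻¹ = π x ^ (k₁ * k₂) := by
    rw [mul_comm k₁, ← conj_pow_eq h₂, ← h₁]; group
  calc (π n₂ * π n₁)⁻¹ * (π n₁ * π n₂) * π x * ((π n₂ * π n₁)⁻¹ * (π n₁ * π n₂))⁻¹ =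
      (π n₂ * π n₁)⁻¹ * (π n₁ * π n₂ * π x * (π n₁ * π n₂)⁻¹) * (π n₂ * π n₁) := by group
    _ = π x := by rw [h3, ← h4]; group

/-- A normalizing element of order `p` modulo the centralizer acts on the cyclic group generated
by `x` modulo scalars through an exponent whose `p`-th power is one. -/
lemma pow_modEq_one_of_pow_mem_centralizer {x n : Γ} {k p : ℕ}
    (h : π n * π x * (π n)⁻¹ = π x ^ k) (hn : n ^ p ∈ Subgroup.centralizer {x}) :
    k ^ p ≡ 1 [MOD orderOf (π x)] := by
  rw [← pow_eq_pow_iff_modEq, ← pow_conj_eq h, ← map_pow, ← map_mul,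
    Subgroup.mem_centralizer_singleton_iff.1 hn, map_mul, mul_inv_cancel_right, pow_one]

end NormalizersOfTori

section OddOrder

variable {Γ : Type*} [Group Γ] {ρ : Γ →* Matrix (Fin 3) (Fin 3) ℂ} {G : Type*} [Group G]
  {π : Γ →* G}

lemma IsRegularElt.map_ne_one (hπ : ∀ g, π g = 1 ↔ g ∈ scalarSubgroup ρ) {x : Γ}
    (hx : IsRegularElt ρ x) : π x ≠ 1 := fun h =>
  not_isRegularElt_of_mem_scalarSubgroup ((hπ x).1 h) hx

lemma IsSpecialUnitaryRep.orderOf_map_dvd_three [Finite Γ] (hρ : IsSpecialUnitaryRep ρ) {x : Γ}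
    (hx : (ρ x).trace = 0) : orderOf (π x) ∣ 3 :=
  orderOf_dvd_of_pow_eq_one (by rw [← map_pow, hρ.pow_three_eq_one hx, map_one])

lemma IsSpecialUnitaryRep.centralizer_comm (hρ : IsSpecialUnitaryRep ρ) {x y z : Γ}
    (hx : IsRegularElt ρ x) (hy : y ∈ Subgroup.centralizer {x})
    (hz : z ∈ Subgroup.centralizer {x}) : y * z = z * y := by
  obtain ⟨t⟩ := hx.nonempty_centralizerDiagonalization
  have : (⟨y, hy⟩ : Subgroup.centralizer {x}) * ⟨z, hz⟩ = ⟨z, hz⟩ * ⟨y, hy⟩ :=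
    t.ext hρ fun i => by rw [map_mul, map_mul, mul_comm]
  exact congrArg Subtype.val this

lemma IsSpecialUnitaryRep.normalizer_centralizer_ne_top [IsSimpleGroup G]
    (hna : ∃ a b : G, a * b ≠ b * a) (hρ : IsSpecialUnitaryRep ρ)
    (hsurj : Function.Surjective π) (hπ : ∀ g, π g = 1 ↔ g ∈ scalarSubgroup ρ) {x : Γ}
    (hx : IsRegularElt ρ x) :
    Subgroup.normalizer (Subgroup.centralizer {x} : Set Γ) ≠ ⊤ := by
  intro h
  have hn : (Subgroup.centralizer {x}).Normal := Subgroup.normalizer_eq_top_iff.1 h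
  have hn' : ((Subgroup.centralizer {x}).map π).Normal := hn.map π hsurj
  have hxC : x ∈ Subgroup.centralizer {x} := Subgroup.mem_centralizer_singleton_iff.2 rfl
  rcases hn'.eq_bot_or_eq_top with h1 | h1
  · refine hx.map_ne_one hπ ?_
    have : π x ∈ (Subgroup.centralizer {x}).map π := ⟨x, hxC, rfl⟩
    rwa [h1, Subgroup.mem_bot] at this
  · obtain ⟨a, b, hab⟩ := hna
    obtain ⟨a', ha', rfl⟩ : a ∈ (Subgroup.centralizer {x}).map π := h1 ▸ Subgroup.mem_top a
    obtain ⟨b', hb', rfl⟩ : b ∈ (Subgroup.centralizer {x}).map π := h1 ▸ Subgroup.mem_top b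
    exact hab (by rw [← map_mul, hρ.centralizer_comm hx ha' hb', map_mul])

lemma one_lt_card_map_centralizer [Finite Γ] (hπ : ∀ g, π g = 1 ↔ g ∈ scalarSubgroup ρ) {x : Γ}
    (hx : IsRegularElt ρ x) : 1 < Nat.card ((Subgroup.centralizer {x}).map π) := by
  have hfin : Finite ((Subgroup.centralizer {x}).map π) :=
    Set.Finite.to_subtype ((Set.toFinite (Subgroup.centralizer {x} : Set Γ)).image π)
  have h : π x ∈ (Subgroup.centralizer {x}).map π :=
    ⟨x, Subgroup.mem_centralizer_singleton_iff.2 rfl, rfl⟩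
  rw [Finite.one_lt_card_iff_nontrivial]
  exact ⟨⟨⟨_, h⟩, 1, fun h1 => hx.map_ne_one hπ (congrArg Subtype.val h1)⟩⟩

/-- A cyclic centralizer quotient of order five is not normalized by an element of order three. -/
lemma IsSpecialUnitaryRep.false_of_five_of_three [Finite Γ] (hρ : IsSpecialUnitaryRep ρ)
    (hπ : ∀ g, π g = 1 ↔ g ∈ scalarSubgroup ρ) {x : Γ} (hx : IsRegularElt ρ x)
    (ha : Nat.card ((Subgroup.centralizer {x}).map π) = 5) {n : Γ}
    (hn : n ∈ Subgroup.normalizer (Subgroup.centralizer {x} : Set Γ))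
    (hnC : n ∉ Subgroup.centralizer {x}) (hn3 : n ^ 3 ∈ Subgroup.centralizer {x}) : False := by
  have hm : orderOf (π x) = 5 := by
    have h1 := orderOf_dvd_card_map_centralizer (π := π) x
    rw [ha] at h1
    exact ((Nat.dvd_prime (by norm_num)).1 h1).resolve_left
      (fun h => hx.map_ne_one hπ (orderOf_eq_one_iff.1 h))
  obtain ⟨k, hk⟩ := exists_conj_eq_pow (π := π) (j := 1) hρ hx (by rw [ha, hm])
    (Nat.coprime_one_right _) hn
  have h1 := pow_modEq_one_of_pow_mem_centralizer hk hn3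
  rw [hm] at h1
  have h2 : k ≡ 1 [MOD 5] := by
    have h3 : k % 5 < 5 := Nat.mod_lt _ (by norm_num)
    have h4 : (k % 5) ^ 3 ≡ 1 [MOD 5] := ((Nat.mod_modEq k 5).pow 3).trans h1
    have h5 : k % 5 = 1 := by
      generalize k % 5 = r at h3 h4
      interval_cases r <;> revert h4 <;> decide
    exact h5
  have h3 : π x ^ k = π x := by
    conv_rhs => rw [← pow_one (π x)]
    rw [pow_eq_pow_iff_modEq, hm]
    exact h2
  have h4 := hρ.orderOf_map_dvd_three (π := π)
    (hρ.trace_eq_zero_of_map_conj hπ (hk.trans h3) hnC)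
  rw [hm] at h4
  exact absurd h4 (by norm_num)

open scoped Classical in
/-- The class function counting alternative, in terms of sums over the whole group. -/
lemma IsSpecialUnitaryRep.sum_eq_or_exists [Fintype Γ] (hρ : IsSpecialUnitaryRep ρ) {f : Γ → ℝ}
    (hz : ∀ z ∈ scalarSubgroup ρ, f z = f 1)
    (hf : ∀ y, ¬ IsRegularElt ρ y → y ∉ scalarSubgroup ρ → f y = 0)
    (hconj : ∀ x g, f (g * x * g⁻¹) = f x)
    (hS : ∀ x, IsRegularElt ρ x → centralizerSum (IsRegularElt ρ) f x = 0 ∨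
      (Nat.card (Subgroup.normalizer (Subgroup.centralizer {x} : Set Γ)) : ℝ) ≤
        2 * centralizerSum (IsRegularElt ρ) f x)
    (hlt : ∑ y, f y - Nat.card (scalarSubgroup ρ) * f 1 < Nat.card Γ) :
    ∑ y, f y = Nat.card (scalarSubgroup ρ) * f 1 ∨ ∃ x, IsRegularElt ρ x ∧
      0 < centralizerSum (IsRegularElt ρ) f x ∧
      (Nat.card Γ : ℝ) * centralizerSum (IsRegularElt ρ) f x =
        Nat.card (Subgroup.normalizer (Subgroup.centralizer {x} : Set Γ)) *
        (∑ y, f y - Nat.card (scalarSubgroup ρ) * f 1) := by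
  have h := exists_card_mul_centralizerSum_eq (R := IsRegularElt ρ) (f := f)
    (fun x g hx => isRegularElt_conj g hx) hρ.centralizer_eq hconj hS
    (by rwa [sum_isRegularElt_eq hz hf, ← Nat.card_eq_fintype_card])
  rw [sum_isRegularElt_eq hz hf, ← Nat.card_eq_fintype_card] at h
  rcases h with h | h
  · left; linarith
  · right; exact h

lemma card_eq_card_scalarSubgroup_mul [Finite Γ] (hsurj : Function.Surjective π)
    (hπ : ∀ g, π g = 1 ↔ g ∈ scalarSubgroup ρ) :
    Nat.card Γ = Nat.card (scalarSubgroup ρ) * Nat.card G := by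
  have h : scalarSubgroup ρ = π.ker := by ext; rw [MonoidHom.mem_ker, hπ]
  have h1 := Subgroup.card_mul_index π.ker
  rwa [Subgroup.index_ker, MonoidHom.range_eq_top.2 hsurj, Subgroup.card_top, ← h, eq_comm] at h1

open scoped Classical in
/-- If all nonscalar elements of a finite group of odd order are regular, then its quotient by
the scalars is not a nonabelian simple group. -/
lemma IsSpecialUnitaryRep.false_of_odd [Fintype Γ] [Finite G] [IsSimpleGroup G]
    (hna : ∃ a b : G, a * b ≠ b * a) (hρ : IsSpecialUnitaryRep ρ) (hc : HasScalarCommutant ρ)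
    (hsurj : Function.Surjective π) (hπ : ∀ g, π g = 1 ↔ g ∈ scalarSubgroup ρ)
    (hodd : Odd (Nat.card Γ)) (hreg : ∀ y, ¬ IsRegularElt ρ y → y ∈ scalarSubgroup ρ) :
    False := by
  have hz : ∀ z ∈ scalarSubgroup ρ, sqChar ρ z = sqChar ρ 1 := fun z h => by
    rw [hρ.sqChar_scalar h, sqChar_one]
  have hf : ∀ y, ¬ IsRegularElt ρ y → y ∉ scalarSubgroup ρ → sqChar ρ y = 0 := fun y h h' =>
    absurd (hreg y h) h'
  have hsum : ∑ y, sqChar ρ y = Nat.card Γ := by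
    have h := hc.sum_trace_mul_trace_inv
    simp only [← hρ.ofReal_sqChar] at h
    rw [Nat.card_eq_fintype_card]
    exact_mod_cast h
  have hZ : 0 < Nat.card (scalarSubgroup ρ) := Nat.card_pos
  have hZ' : (0 : ℝ) < Nat.card (scalarSubgroup ρ) := by exact_mod_cast hZ
  have key : ∀ x, IsRegularElt ρ x → ∃ w a : ℕ,
      Nat.card (Subgroup.normalizer (Subgroup.centralizer {x} : Set Γ)) =
        w * (Nat.card (scalarSubgroup ρ) * a) ∧ centralizerSum (IsRegularElt ρ) (sqChar ρ) x =
        Nat.card (scalarSubgroup ρ) * (3 * a - 9) ∧ (a = 3 ∨ a = 5 ∧ w = 1 ∨ 7 ≤ a) ∧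
        (w = 1 ∨ w = 3) := by
    intro x hx
    obtain ⟨w, hw, hw', -, hwp⟩ := hρ.exists_card_normalizer hx
    obtain ⟨t⟩ := hx.nonempty_centralizerDiagonalization
    have hC := card_centralizer_eq hρ hπ x
    have hS := hρ.centralizerSum_eq hz hf x
    have h1 := one_lt_card_map_centralizer hπ hx
    have h5 := hρ.false_of_five_of_three hπ hx
    have hNodd : Odd (Nat.card (Subgroup.normalizer (Subgroup.centralizer {x} : Set Γ))) :=
      Odd.of_dvd_nat hodd (Subgroup.card_subgroup_dvd_card _)
    rw [t.sum_sqChar hρ, hC, sqChar_one] at hS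
    rw [hC] at hw
    generalize Nat.card ((Subgroup.centralizer {x}).map π) = a at *
    rw [hw, Nat.odd_mul, Nat.odd_mul] at hNodd
    refine ⟨w, a, hw, by rw [hS]; push_cast; ring, ?_, ?_⟩
    · rcases hw' with rfl | rfl | rfl | rfl
      · have := hNodd.2.2; grind
      · exact absurd hNodd.1 (by decide)
      · have h6 : a ≠ 5 := fun h => by
          obtain ⟨n, hn, hnC, hn3⟩ := hwp (by norm_num)
          exact h5 h hn hnC hn3
        have := hNodd.2.2; grind
      · exact absurd hNodd.1 (by decide)
    · rcases hw' with rfl | rfl | rfl | rfl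
      · simp
      · exact absurd hNodd.1 (by decide)
      · simp
      · exact absurd hNodd.1 (by decide)
  have hcard := card_eq_card_scalarSubgroup_mul hsurj hπ
  have hn9 : Nat.card G ≠ 9 := fun h9 => by
    have hp : Fact (Nat.Prime 3) := ⟨Nat.prime_three⟩
    have h1 := card_sylow_mem_divisors hna (p := 3) (k := 1) (m := 1) h9 (by norm_num)
    rw [Nat.divisors_one, Finset.mem_singleton] at h1
    exact h1.2.1 h1.1
  have hS : ∀ x, IsRegularElt ρ x → centralizerSum (IsRegularElt ρ) (sqChar ρ) x = 0 ∨
      (Nat.card (Subgroup.normalizer (Subgroup.centralizer {x} : Set Γ)) : ℝ) ≤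
        2 * centralizerSum (IsRegularElt ρ) (sqChar ρ) x := fun x hx => by
    obtain ⟨w, a, hN, hS, ha, hw⟩ := key x hx
    rw [hN, hS]
    rcases ha with rfl | ⟨rfl, rfl⟩ | ha
    · left; norm_num
    · right; push_cast; linarith
    · right
      have ha' : (7 : ℝ) ≤ a := by exact_mod_cast ha
      rcases hw with rfl | rfl <;> push_cast <;> nlinarith
  rcases hρ.sum_eq_or_exists hz hf (fun x g => sqChar_conj ρ x g) hS
    (by rw [hsum, sqChar_one]; linarith) with h | h
  · rw [hsum, sqChar_one, hcard] at h
    have h9 : Nat.card G = 9 := by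
      have : (Nat.card G : ℝ) = 9 := by
        push_cast at h
        exact mul_left_cancel₀ hZ'.ne' h
      exact_mod_cast this
    exact hn9 h9
  · obtain ⟨x, hx, hpos', h⟩ := h
    obtain ⟨w, a, hN, hS, ha, hw⟩ := key x hx
    have hlt : Nat.card (Subgroup.normalizer (Subgroup.centralizer {x} : Set Γ)) ≠ Nat.card Γ :=
      fun h1 => hρ.normalizer_centralizer_ne_top hna hsurj hπ hx (Subgroup.eq_top_of_card_eq _ h1)
    rw [hS] at hpos'
    rw [hS, hsum, sqChar_one, hN] at h
    have hpos : (0 : ℝ) < Nat.card Γ := by exact_mod_cast Nat.card_pos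
    have ha3 : (3 : ℝ) ≤ a := by exact_mod_cast (show 3 ≤ a by omega)
    rcases hw with rfl | rfl
    · push_cast at h
      rcases ha with rfl | ⟨rfl, -⟩ | ha
      · norm_num at hpos'
      · push_cast at h; nlinarith [mul_pos hZ' hpos, mul_pos hZ' hZ']
      · have ha' : (7 : ℝ) ≤ a := by exact_mod_cast ha
        have : (Nat.card Γ : ℝ) * (3 * a - 9) = a * (Nat.card Γ - Nat.card (scalarSubgroup ρ) * 9) :=
            by
          apply mul_left_cancel₀ hZ'.ne'
          linarith
        nlinarith
    · apply hlt
      rw [hN]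
      push_cast at h
      have : (Nat.card Γ : ℝ) = 3 * (Nat.card (scalarSubgroup ρ) * a) := by
        have h2 : (Nat.card (scalarSubgroup ρ) : ℝ) *
            (Nat.card Γ - 3 * (Nat.card (scalarSubgroup ρ) * a)) = 0 := by
          linarith
        rcases mul_eq_zero.1 h2 with h2 | h2 <;> linarith
      exact_mod_cast this.symm

end OddOrder

section InvariantForm

open Matrix

variable {Γ : Type*} [Group Γ] {ρ : Γ →* Matrix (Fin 3) (Fin 3) ℂ}

lemma IsDiagonalization.exists_perm_mul_eq_one {M S T X : Matrix (Fin 3) (Fin 3) ℂ}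
    {d : Fin 3 → ℂ} (h : IsDiagonalization M S T d) (hM : M * X * Mᵀ = X) {i j : Fin 3}
    (hij : (T * X * Tᵀ) i j ≠ 0) : d i * d j = 1 := by
  have h1 : diagonal d * (T * X * Tᵀ) * diagonal d = T * X * Tᵀ := by
    have e1 : T * M = diagonal d * T := by
      rw [h.eq, ← mul_assoc, ← mul_assoc, h.inv_mul, one_mul]
    have e2 : Mᵀ * Tᵀ = Tᵀ * diagonal d := by
      rw [← transpose_mul, e1, transpose_mul, diagonal_transpose]
    calc diagonal d * (T * X * Tᵀ) * diagonal d = (diagonal d * T) * X * (Tᵀ * diagonal d) := by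
          simp only [mul_assoc]
      _ = T * (M * X * Mᵀ) * Tᵀ := by rw [← e1, ← e2]; simp only [mul_assoc]
      _ = T * X * Tᵀ := by rw [hM]
  have h2 := congrFun₂ h1 i j
  rw [mul_diagonal, diagonal_mul] at h2
  refine mul_right_cancel₀ hij ?_
  linear_combination h2

lemma IsDiagonalization.exists_perm_of_form {M S T X X' : Matrix (Fin 3) (Fin 3) ℂ}
    {d : Fin 3 → ℂ} (h : IsDiagonalization M S T d) (hX : X * X' = 1) :
    ∃ σ : Equiv.Perm (Fin 3), ∀ j, (T * X * Tᵀ) (σ j) j ≠ 0 := by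
  refine exists_perm_forall_apply_ne_zero (L := Sᵀ * X' * S) ?_
  calc T * X * Tᵀ * (Sᵀ * X' * S) = T * X * (Tᵀ * Sᵀ) * X' * S := by simp only [mul_assoc]
    _ = 1 := by
      rw [← transpose_mul, h.mul_inv, transpose_one, mul_one, mul_assoc T, hX, mul_one, h.inv_mul]

lemma perm_fin_three_cases (σ : Equiv.Perm (Fin 3)) :
    (∀ i, σ i = i) ∨ (∃ a b c : Fin 3, a ≠ b ∧ a ≠ c ∧ b ≠ c ∧ σ a = a ∧ σ b = c ∧ σ c = b) ∨
      (∃ a b c : Fin 3, a ≠ b ∧ a ≠ c ∧ b ≠ c ∧ σ a = b ∧ σ b = c ∧ σ c = a) := by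
  revert σ; decide

lemma prod_eq_of_ne {d : Fin 3 → ℂ} {a b c : Fin 3} (hab : a ≠ b) (hac : a ≠ c) (hbc : b ≠ c) :
    d a * d b * d c = d 0 * d 1 * d 2 := by
  fin_cases a <;> fin_cases b <;> fin_cases c <;>
    first
    | exact (hab rfl).elim
    | exact (hac rfl).elim
    | exact (hbc rfl).elim
    | (simp only [Fin.zero_eta, Fin.isValue, Fin.mk_one, Fin.reduceFinMk]; try ring)

lemma sum_eq_of_ne {d : Fin 3 → ℂ} {a b c : Fin 3} (hab : a ≠ b) (hac : a ≠ c) (hbc : b ≠ c) :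
    d a + d b + d c = d 0 + d 1 + d 2 := by
  fin_cases a <;> fin_cases b <;> fin_cases c <;>
    first
    | exact (hab rfl).elim
    | exact (hac rfl).elim
    | exact (hbc rfl).elim
    | (simp only [Fin.zero_eta, Fin.isValue, Fin.mk_one, Fin.reduceFinMk]; try ring)

lemma eq_or_of_ne {a b c : Fin 3} (hab : a ≠ b) (hac : a ≠ c) (hbc : b ≠ c) (i : Fin 3) :
    i = a ∨ i = b ∨ i = c := by
  revert a b c i; decide

lemma trace_eq_of_perm {d : Fin 3 → ℂ} {σ : Equiv.Perm (Fin 3)} (hσ : ∀ j, d (σ j) * d j = 1)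
    (hprod : d 0 * d 1 * d 2 = 1) (hinj : ¬ Function.Injective d) :
    (∀ i, d i = 1) ∨ d 0 + d 1 + d 2 = -1 := by
  rcases perm_fin_three_cases σ with h | ⟨a, b, c, hab, hac, hbc, ha, hb, hc⟩ |
    ⟨a, b, c, hab, hac, hbc, ha, hb, hc⟩
  · have h1 : ∀ i, d i = 1 ∨ d i = -1 := fun i => by
      have := hσ i
      rw [h i] at this
      exact mul_self_eq_one_iff.1 this
    rcases h1 0 with h0 | h0 <;> rcases h1 1 with h1 | h1 <;> rw [h0, h1] at hprod <;>
      norm_num at hprod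
    · left; intro i; fin_cases i <;> assumption
    · right; rw [h0, h1]; linear_combination -hprod
    · right; rw [h0, h1]; linear_combination -hprod
    · right; rw [h0, h1, hprod]; norm_num
  · have h1 := hσ c
    rw [hc] at h1
    have h2 : d a = 1 := by
      rw [← prod_eq_of_ne hab hac hbc, mul_assoc, h1, mul_one] at hprod
      exact hprod
    rw [← sum_eq_of_ne hab hac hbc]
    have h3 : d a = d b ∨ d a = d c ∨ d b = d c := by
      by_contra! h4
      refine hinj fun i j hij => ?_
      rcases eq_or_of_ne hab hac hbc i with rfl | rfl | rfl <;>
        rcases eq_or_of_ne hab hac hbc j with rfl | rfl | rfl <;> grind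
    have h4 : d b = 1 ∧ d c = 1 ∨ d b = -1 ∧ d c = -1 := by
      rcases h3 with h3 | h3 | h3
      · rw [← h3, h2, one_mul] at h1; left; exact ⟨h3 ▸ h2, h1⟩
      · rw [← h3, h2, mul_one] at h1; left; exact ⟨h1, h3 ▸ h2⟩
      · rw [← h3] at h1 ⊢
        rcases mul_self_eq_one_iff.1 h1 with h | h <;> simp [h]
    rcases h4 with ⟨h4, h5⟩ | ⟨h4, h5⟩
    · left
      intro i
      rcases eq_or_of_ne hab hac hbc i with rfl | rfl | rfl <;> assumption
    · right; rw [h2, h4, h5]; norm_num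
  · left
    have h1 := hσ a
    have h2 := hσ b
    have h3 := hσ c
    rw [ha] at h1; rw [hb] at h2; rw [hc] at h3
    have hp := prod_eq_of_ne (d := d) hab hac hbc
    rw [hprod] at hp
    have e1 : d a = 1 := by linear_combination hp - d a * h2
    have e2 : d b = 1 := by linear_combination hp - d b * h3
    have e3 : d c = 1 := by linear_combination hp - d c * h1
    intro i
    rcases eq_or_of_ne hab hac hbc i with rfl | rfl | rfl <;> assumption

/-- The centralizer of a regular element preserving a nondegenerate form fixes an eigenvector. -/
lemma CentralizerDiagonalization.exists_eq_one {x : Γ} (t : CentralizerDiagonalization ρ x)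
    (hρ : IsSpecialUnitaryRep ρ) {X X' : Matrix (Fin 3) (Fin 3) ℂ} (hX : X * X' = 1)
    (hinv : ∀ n, ρ n * X * (ρ n)ᵀ = X) :
    ∃ a b c : Fin 3, a ≠ b ∧ a ≠ c ∧ b ≠ c ∧ (∀ y, t.δ a y = 1) ∧
      ∀ y, t.δ b y * t.δ c y = 1 := by
  obtain ⟨σ, hσ⟩ := (t.diag 1).exists_perm_of_form hX
  have h1 : ∀ y j, t.δ (σ j) y * t.δ j y = 1 := fun y j =>
    (t.diag y).exists_perm_mul_eq_one (hinv y) (hσ j)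
  have hinj := t.injective
  have hx0 := fun j => h1 ⟨x, Subgroup.mem_centralizer_singleton_iff.2 rfl⟩ j
  rcases perm_fin_three_cases σ with h | ⟨a, b, c, hab, hac, hbc, ha, hb, hc⟩ |
    ⟨a, b, c, hab, hac, hbc, ha, hb, hc⟩
  · exfalso
    simp only [h] at hx0
    have h2 := fun i => mul_self_eq_one_iff.1 (hx0 i)
    have h01 := hinj.ne (show (0 : Fin 3) ≠ 1 by decide)
    have h02 := hinj.ne (show (0 : Fin 3) ≠ 2 by decide)
    have h12 := hinj.ne (show (1 : Fin 3) ≠ 2 by decide)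
    have e0 := h2 0
    have e1 := h2 1
    have e2 := h2 2
    grind
  · refine ⟨a, b, c, hab, hac, hbc, fun y => ?_, fun y => ?_⟩
    · have h2 := h1 y c
      rw [hc] at h2
      have h3 := t.prod hρ y
      rwa [← prod_eq_of_ne (d := fun i => t.δ i y) hab hac hbc, mul_assoc, h2, mul_one] at h3
    · have h2 := h1 y c
      rwa [hc] at h2
  · exfalso
    have e1 := hx0 a
    have e2 := hx0 b
    rw [ha] at e1; rw [hb] at e2
    refine hac (hinj ?_)
    have hb0 := t.ne_zero b ⟨x, Subgroup.mem_centralizer_singleton_iff.2 rfl⟩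
    refine mul_left_cancel₀ hb0 ?_
    rw [e1, mul_comm, e2]

open scoped Classical in
lemma CentralizerDiagonalization.sum_sqChar_add_trace [Fintype Γ] {x : Γ}
    (t : CentralizerDiagonalization ρ x)
    (hρ : IsSpecialUnitaryRep ρ) {X X' : Matrix (Fin 3) (Fin 3) ℂ} (hX : X * X' = 1)
    (hinv : ∀ n, ρ n * X * (ρ n)ᵀ = X) :
    ∑ y : Subgroup.centralizer {x}, (sqChar ρ y + (ρ y).trace.re) =
      4 * Nat.card (Subgroup.centralizer {x}) := by
  obtain ⟨a, b, c, hab, hac, hbc, ha, -⟩ := t.exists_eq_one hρ hX hinv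
  have hinj := t.injective
  have h0 : ∀ i, i ≠ a → ∑ y, t.δ i y = 0 := fun i hi => by
    refine sum_hom_units_eq_zero _ fun h => hi (hinj ?_)
    simp only [ha, h, MonoidHom.one_apply]
  have h1 : ∑ y : Subgroup.centralizer {x}, (ρ y).trace = Nat.card (Subgroup.centralizer {x}) := by
    rw [Finset.sum_congr rfl fun y _ => (t.trace y).trans
      (sum_eq_of_ne (d := fun i => t.δ i y) hab hac hbc).symm]
    rw [Finset.sum_add_distrib, Finset.sum_add_distrib, h0 b hab.symm, h0 c hac.symm]
    simp [ha]
  rw [Finset.sum_add_distrib, t.sum_sqChar hρ, ← Complex.re_sum, h1, Complex.natCast_re]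
  ring

lemma CentralizerDiagonalization.conj_eq_or_of_form {x : Γ}
    (t : CentralizerDiagonalization ρ x)
    (hρ : IsSpecialUnitaryRep ρ) {X X' : Matrix (Fin 3) (Fin 3) ℂ} (hX : X * X' = 1)
    (hinv : ∀ n, ρ n * X * (ρ n)ᵀ = X) {n : Γ}
    (hn : n ∈ Subgroup.normalizer (Subgroup.centralizer {x} : Set Γ)) :
    n * x * n⁻¹ = x ∨ n * x * n⁻¹ = x⁻¹ := by
  obtain ⟨a, b, c, hab, hac, hbc, ha, hbc1⟩ := t.exists_eq_one hρ hX hinv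
  have hx : x ∈ Subgroup.centralizer {x} := Subgroup.mem_centralizer_singleton_iff.2 rfl
  have hy : n * x * n⁻¹ ∈ Subgroup.centralizer {x} := (Subgroup.mem_normalizer_iff.1 hn x).1 hx
  have htr := trace_rep_conj ρ x n
  have e1 := t.trace ⟨_, hy⟩
  have e2 := t.trace ⟨x, hx⟩
  rw [← sum_eq_of_ne (d := fun i => t.δ i _) hab hac hbc] at e1 e2
  simp only [ha] at e1 e2
  rw [htr, e2] at e1
  have p1 := hbc1 ⟨_, hy⟩
  have p2 := hbc1 ⟨x, hx⟩
  have key : (t.δ b ⟨_, hy⟩ - t.δ b ⟨x, hx⟩) * (t.δ b ⟨_, hy⟩ - t.δ c ⟨x, hx⟩) = 0 := by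
    linear_combination p2 - p1 - t.δ b ⟨_, hy⟩ * e1
  rcases mul_eq_zero.1 key with h | h
  · left
    refine congrArg Subtype.val (t.ext hρ (y := ⟨_, hy⟩) (z := ⟨x, hx⟩) fun i => ?_)
    rcases eq_or_of_ne hab hac hbc i with rfl | rfl | rfl
    · rw [ha, ha]
    · linear_combination h
    · linear_combination -e1 - h
  · right
    refine congrArg Subtype.val (t.ext hρ (y := ⟨_, hy⟩) (z := ⟨x, hx⟩⁻¹) fun i => ?_)
    rw [t.map_inv]
    rcases eq_or_of_ne hab hac hbc i with rfl | rfl | rfl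
    · rw [ha, ha, inv_one]
    · refine eq_inv_of_mul_eq_one_left ?_
      linear_combination p2 + t.δ i ⟨x, hx⟩ * h
    · refine eq_inv_of_mul_eq_one_left ?_
      linear_combination p2 - t.δ i ⟨x, hx⟩ * (e1 + h)

open scoped Classical in
/-- The order of an irreducible finite subgroup of `SL(3, ℂ)` preserving a nondegenerate
bilinear form. -/
theorem IsSpecialUnitaryRep.card_of_form [Fintype Γ] (hρ : IsSpecialUnitaryRep ρ)
    (hc : HasScalarCommutant ρ) {X X' : Matrix (Fin 3) (Fin 3) ℂ} (hX : X * X' = 1)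
    (hinv : ∀ n, ρ n * X * (ρ n)ᵀ = X) :
    Nat.card Γ = 12 ∨ Nat.card Γ = 24 ∨ Nat.card Γ = 60 := by
  have hX0 : X ≠ 0 := by
    rintro rfl
    rw [zero_mul] at hX
    exact zero_ne_one hX
  have hZ1 : ∀ z ∈ scalarSubgroup ρ, z = 1 := by
    rintro z ⟨c, hcz⟩
    have h3 := hρ.scalar_pow_three hcz
    have h1 := hinv z
    rw [hcz, transpose_smul, transpose_one, mul_smul_comm, smul_mul_assoc, smul_mul_assoc, one_mul,
      mul_one, smul_smul] at h1
    have h2 : (c * c - 1) • X = 0 := by rw [sub_smul, h1, one_smul, sub_self]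
    have h4 := (smul_eq_zero.1 h2).resolve_right hX0
    have h5 : c = 1 := by linear_combination h3 - c * h4
    apply hρ.injective
    rw [hcz, h5, one_smul, map_one]
  have hZ : Nat.card (scalarSubgroup ρ) = 1 := by
    rw [Subgroup.card_eq_one, eq_bot_iff]
    exact fun z hz => hZ1 z hz
  have hne : ∃ g, ρ g ≠ 1 := by
    by_contra! h
    obtain ⟨c, hc⟩ := hc (Matrix.single 0 1 1) fun g => by rw [h, one_mul, mul_one]
    have := congrFun₂ hc 0 1
    simp at this
  set f : Γ → ℝ := fun g => sqChar ρ g + (ρ g).trace.re with hfdef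
  have hf1 : f 1 = 12 := by
    simp only [hfdef, sqChar_one, map_one, trace_one]
    norm_num
  have hz : ∀ z ∈ scalarSubgroup ρ, f z = f 1 := fun z h => by rw [hZ1 z h]
  have hf : ∀ y, ¬ IsRegularElt ρ y → y ∉ scalarSubgroup ρ → f y = 0 := by
    intro y hy hyz
    obtain ⟨S, T, d, hST, hTS, heq⟩ := exists_diagonal_of_pow_eq_one (M := ρ y)
      (k := Nat.card Γ) Nat.card_pos.ne' (by rw [← map_pow, pow_card_eq_one', map_one])
    have hD : IsDiagonalization (ρ y) S T d := ⟨hST, hTS, heq⟩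
    obtain ⟨σ, hσ⟩ := hD.exists_perm_of_form hX
    have hdet := hD.det
    rw [hρ.det_eq_one, Fin.prod_univ_three] at hdet
    rcases trace_eq_of_perm (fun j => hD.exists_perm_mul_eq_one (hinv y) (hσ j)) hdet.symm
      (fun hi => hy ⟨S, T, d, hD, hi⟩) with h | h
    · refine absurd ⟨1, ?_⟩ hyz
      rw [hD.eq, show d = fun _ => 1 from funext h, diagonal_one, mul_one, hST, one_smul]
    · have htr := hD.trace
      rw [Fin.sum_univ_three, h] at htr
      simp [hfdef, sqChar, htr]
  have hconj : ∀ x g, f (g * x * g⁻¹) = f x := fun x g => by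
    simp only [hfdef, sqChar_conj, trace_rep_conj]
  have hsum : ∑ y, f y = Nat.card Γ := by
    have h := hc.sum_trace_mul_trace_inv
    simp only [← hρ.ofReal_sqChar] at h
    have h' : ∑ g, sqChar ρ g = Nat.card Γ := by
      rw [Nat.card_eq_fintype_card]
      exact_mod_cast h
    simp only [hfdef]
    rw [Finset.sum_add_distrib, h', ← Complex.re_sum, hc.sum_trace_eq_zero hne]
    simp
  have key : ∀ x, IsRegularElt ρ x → ∃ w a : ℕ,
      Nat.card (Subgroup.normalizer (Subgroup.centralizer {x} : Set Γ)) = w * a ∧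
      centralizerSum (IsRegularElt ρ) f x = 4 * a - 12 ∧ 3 ≤ a ∧ (w = 1 ∨ w = 2) := by
    intro x hx
    obtain ⟨w, hw, hw', h6, hwp⟩ := hρ.exists_card_normalizer hx
    obtain ⟨t⟩ := hx.nonempty_centralizerDiagonalization
    have hS := hρ.centralizerSum_eq hz hf x
    simp only [hfdef] at hS
    rw [t.sum_sqChar_add_trace hρ hX hinv] at hS
    have hcj := fun n hn => t.conj_eq_or_of_form hρ hX hinv (n := n) hn
    have hxx : x ≠ x⁻¹ := fun h => by
      have hxC : x ∈ Subgroup.centralizer {x} := Subgroup.mem_centralizer_singleton_iff.2 rfl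
      have e : ∀ i, t.δ i ⟨x, hxC⟩ = 1 ∨ t.δ i ⟨x, hxC⟩ = -1 := fun i => by
        rw [← mul_self_eq_one_iff, ← map_mul]
        have : (⟨x, hxC⟩ : Subgroup.centralizer {x}) * ⟨x, hxC⟩ = 1 :=
          Subtype.ext (by simpa using mul_eq_one_iff_eq_inv.2 h)
        rw [this, map_one]
      have hinj := t.injective
      have h01 := hinj.ne (show (0 : Fin 3) ≠ 1 by decide)
      have h02 := hinj.ne (show (0 : Fin 3) ≠ 2 by decide)
      have h12 := hinj.ne (show (1 : Fin 3) ≠ 2 by decide)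
      have e0 := e 0
      have e1 := e 1
      have e2 := e 2
      grind
    refine ⟨w, _, hw, by rw [hS, hZ]; simp only [hfdef] at hf1; rw [hf1]; push_cast; ring, ?_, ?_⟩
    · have hx1 : x ≠ 1 := fun h => hxx (by rw [h, inv_one])
      have hxC : x ∈ Subgroup.centralizer {x} := Subgroup.mem_centralizer_singleton_iff.2 rfl
      have hsub : ({1, ⟨x, hxC⟩, ⟨x, hxC⟩⁻¹} : Finset (Subgroup.centralizer {x})).card = 3 := by
        rw [Finset.card_eq_three]
        refine ⟨_, _, _, ?_, ?_, ?_, rfl⟩ <;> rw [Ne, Subtype.ext_iff] <;> simpa [eq_comm] using by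
          first | exact hx1 | exact hxx
      rw [← hsub, Nat.card_eq_fintype_card]
      exact Finset.card_le_univ _
    · rcases hw' with rfl | rfl | rfl | rfl
      · exact Or.inl rfl
      · exact Or.inr rfl
      · exfalso
        obtain ⟨n, hn, hnC, hn3⟩ := hwp (by norm_num)
        rw [Subgroup.mem_centralizer_singleton_iff] at hnC hn3
        rcases hcj n hn with h | h
        · exact hnC (by rw [← mul_inv_eq_iff_eq_mul, h])
        · apply hxx
          have h1 : n * x⁻¹ * n⁻¹ = x := by
            rw [show n * x⁻¹ * n⁻¹ = (n * x * n⁻¹)⁻¹ by group, h, inv_inv]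
          calc x = n ^ 3 * x * (n ^ 3)⁻¹ := by rw [hn3]; group
            _ = n * (n * (n * x * n⁻¹) * n⁻¹) * n⁻¹ := by rw [pow_three]; group
            _ = x⁻¹ := by rw [h, h1, h]
      · exfalso
        obtain ⟨n₁, hn₁, n₂, hn₂, hC⟩ := h6 rfl
        apply hC
        rw [Subgroup.mem_centralizer_singleton_iff, ← mul_inv_eq_iff_eq_mul]
        have hinv' : ∀ n : Γ, n * x * n⁻¹ = x⁻¹ → n * x⁻¹ * n⁻¹ = x := fun n h => by
          rw [show n * x⁻¹ * n⁻¹ = (n * x * n⁻¹)⁻¹ by group, h, inv_inv]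
        have hinv'' : ∀ n : Γ, n * x * n⁻¹ = x → n * x⁻¹ * n⁻¹ = x⁻¹ := fun n h => by
          rw [show n * x⁻¹ * n⁻¹ = (n * x * n⁻¹)⁻¹ by group, h]
        have h3 : n₁ * (n₂ * x * n₂⁻¹) * n₁⁻¹ = n₂ * (n₁ * x * n₁⁻¹) * n₂⁻¹ := by
          rcases hcj n₁ hn₁ with h1 | h1 <;> rcases hcj n₂ hn₂ with h2 | h2 <;>
            rw [h1, h2]
          · rw [h1]
          · rw [hinv'' _ h1]
          · rw [h1, hinv'' _ h2]
          · rw [hinv' _ h1, hinv' _ h2]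
        calc (n₂ * n₁)⁻¹ * (n₁ * n₂) * x * ((n₂ * n₁)⁻¹ * (n₁ * n₂))⁻¹ =
            (n₂ * n₁)⁻¹ * (n₁ * (n₂ * x * n₂⁻¹) * n₁⁻¹) * (n₂ * n₁) := by group
          _ = x := by rw [h3]; group
  have hpos : (0 : ℝ) < Nat.card Γ := by exact_mod_cast Nat.card_pos
  have hT1 : ∀ x, IsRegularElt ρ x →
      (Nat.card Γ : ℝ) * centralizerSum (IsRegularElt ρ) f x ≤
      Nat.card (Subgroup.normalizer (Subgroup.centralizer {x} : Set Γ)) * (Nat.card Γ - 12) := by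
    intro x hx
    have h := card_mul_centralizerSum_le (R := IsRegularElt ρ) (f := f)
      (fun x g hx => isRegularElt_conj g hx) hρ.centralizer_eq hconj (fun y hy => by
        obtain ⟨w, a, -, hS, ha, -⟩ := key y hy
        have : (3 : ℝ) ≤ a := by exact_mod_cast ha
        rw [hS]; linarith) hx
    rwa [sum_isRegularElt_eq hz hf, hsum, hf1, hZ, ← Nat.card_eq_fintype_card, Nat.cast_one,
      one_mul] at h
  have key2 : ∀ x, IsRegularElt ρ x → ∃ w a : ℕ,
      Nat.card (Subgroup.normalizer (Subgroup.centralizer {x} : Set Γ)) = w * a ∧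
      centralizerSum (IsRegularElt ρ) f x = 4 * a - 12 ∧
      (a = 3 ∨ w = 2 ∧ a = 4 ∨ w = 2 ∧ a = 5) := by
    intro x hx
    obtain ⟨w, a, hN, hS, ha, hw⟩ := key x hx
    refine ⟨w, a, hN, hS, ?_⟩
    have h := hT1 x hx
    rw [hN, hS] at h
    have h2 : (4 * a - 12 : ℝ) < w * a := by
      by_contra! h3
      push_cast at h
      have h4 : (0 : ℝ) < w * a := by
        have : 0 < w * a := by rcases hw with rfl | rfl <;> omega
        exact_mod_cast this
      nlinarith
    have h3 : 4 * a < w * a + 12 := by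
      have : (4 * a : ℝ) < w * a + 12 := by linarith
      exact_mod_cast this
    rcases hw with rfl | rfl <;> omega
  have hS : ∀ x, IsRegularElt ρ x → centralizerSum (IsRegularElt ρ) f x = 0 ∨
      (Nat.card (Subgroup.normalizer (Subgroup.centralizer {x} : Set Γ)) : ℝ) ≤
        2 * centralizerSum (IsRegularElt ρ) f x := by
    intro x hx
    obtain ⟨w, a, hN, hS, ha⟩ := key2 x hx
    rw [hN, hS]
    rcases ha with rfl | ⟨rfl, rfl⟩ | ⟨rfl, rfl⟩ <;> norm_num
  rcases hρ.sum_eq_or_exists hz hf hconj hS (by rw [hsum, hf1, hZ]; norm_num) with h | h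
  · rw [hsum, hf1, hZ] at h
    left
    rw [Nat.cast_one] at h
    exact_mod_cast (by linarith : (Nat.card Γ : ℝ) = 12)
  · obtain ⟨x, hx, hpos', h⟩ := h
    obtain ⟨w, a, hN, hS, ha⟩ := key2 x hx
    rw [hS] at hpos'
    rw [hsum, hf1, hZ, hN, hS] at h
    rcases ha with rfl | ⟨rfl, rfl⟩ | ⟨rfl, rfl⟩
    · norm_num at hpos'
    · right; left
      push_cast at h
      exact_mod_cast (by linarith : (Nat.card Γ : ℝ) = 24)
    · right; right
      push_cast at h
      exact_mod_cast (by linarith : (Nat.card Γ : ℝ) = 60)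

end InvariantForm

section RatiosOfEigenvalues

/-- Exponents modulo `m` describing a diagonal matrix of projective order `m` all of whose
nonregular powers square to a scalar. -/
lemma exponents_cases (m : ℕ) (h1 : 3 ≤ m) (h2 : m ≤ 7) : ∀ i j : Fin m,
    (i : ℕ) % m ≠ 0 → (j : ℕ) % m ≠ 0 → i ≠ j →
    (∀ k : Fin m, ((k * i : ℕ) % m = 0 ∨ (k * j : ℕ) % m = 0 ∨ (k * i : ℕ) % m = (k * j : ℕ) % m) →
      (2 * k * i : ℕ) % m = 0 ∧ (2 * k * j : ℕ) % m = 0) →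
    (i + j : ℕ) % m = 0 ∨ (2 * i : ℕ) % m = (j : ℕ) % m ∨ (2 * j : ℕ) % m = (i : ℕ) % m ∨
      m = 7 ∧ ((j : ℕ) % m = (3 * i : ℕ) % m ∨ (j : ℕ) % m = (5 * i : ℕ) % m) := by
  interval_cases m <;> decide +kernel

lemma ratio_cases {m : ℕ} (h3 : 3 ≤ m) (h7 : m ≤ 7) {u v : ℂ} (hu : u ^ m = 1) (hv : v ^ m = 1)
    (hu1 : u ≠ 1) (hv1 : v ≠ 1) (huv : u ≠ v)
    (h : ∀ k : ℕ, (u ^ k = 1 ∨ v ^ k = 1 ∨ u ^ k = v ^ k) → u ^ (2 * k) = 1 ∧ v ^ (2 * k) = 1) :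
    u * v = 1 ∨ v = u ^ 2 ∨ u = v ^ 2 ∨ m = 7 ∧ (v = u ^ 3 ∨ v = u ^ 5) := by
  have hm : m ≠ 0 := by omega
  have : NeZero m := ⟨hm⟩
  have hζ := Complex.isPrimitiveRoot_exp m hm
  set ζ := Complex.exp (2 * Real.pi * Complex.I / m)
  obtain ⟨i, hi, rfl⟩ := hζ.eq_pow_of_pow_eq_one hu
  obtain ⟨j, hj, rfl⟩ := hζ.eq_pow_of_pow_eq_one hv
  have h1 : ∀ a b : ℕ, ζ ^ a = ζ ^ b ↔ a % m = b % m := fun a b => by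
    have hfin : IsOfFinOrder ζ := isOfFinOrder_iff_pow_eq_one.2 ⟨m, by omega, hζ.pow_eq_one⟩
    rw [hfin.pow_eq_pow_iff_modEq, ← hζ.eq_orderOf]; rfl
  have h0 : ∀ a : ℕ, ζ ^ a = 1 ↔ a % m = 0 := fun a => by
    rw [← pow_zero ζ, h1, Nat.zero_mod]
  simp only [← pow_mul, ← pow_add, h0, h1, ne_eq] at hu1 hv1 huv h ⊢
  have := exponents_cases m h3 h7 ⟨i, hi⟩ ⟨j, hj⟩ hu1 hv1
    (fun hij => huv (by rw [Fin.mk.injEq] at hij; rw [hij])) (fun k hk => by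
      have := h k (by simpa only [mul_comm] using hk)
      rwa [mul_comm i, mul_comm j] at this)
  rcases this with h | h | h | h
  · exact Or.inl h
  · refine Or.inr (Or.inl ?_); rw [← h, mul_comm]
  · refine Or.inr (Or.inr (Or.inl ?_)); rw [← h, mul_comm]
  · refine Or.inr (Or.inr (Or.inr ?_)); rwa [mul_comm i, mul_comm i]

end RatiosOfEigenvalues

section InvolutiveHomologies

open Matrix

variable {Γ : Type*} [Group Γ] {ρ : Γ →* Matrix (Fin 3) (Fin 3) ℂ} {G : Type*} [Group G]
  {π : Γ →* G}

/-- The difference of the fourth and second power of the modulus of the character. -/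
noncomputable def quarticChar (ρ : Γ →* Matrix (Fin 3) (Fin 3) ℂ) (g : Γ) : ℝ :=
  sqChar ρ g ^ 2 - sqChar ρ g

lemma quarticChar_conj (ρ : Γ →* Matrix (Fin 3) (Fin 3) ℂ) (x g : Γ) :
    quarticChar ρ (g * x * g⁻¹) = quarticChar ρ x := by
  rw [quarticChar, sqChar_conj, quarticChar]

/-- A special unitary representation with kernel of `π` the scalars, of order three, whose
nonregular nonscalar elements are involutions modulo scalars. -/
structure IsInvolutiveRep [Fintype Γ] (ρ : Γ →* Matrix (Fin 3) (Fin 3) ℂ) (π : Γ →* G) :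
    Prop where
  rep : IsSpecialUnitaryRep ρ
  surjective : Function.Surjective π
  ker : ∀ g, π g = 1 ↔ g ∈ scalarSubgroup ρ
  card_scalar : Nat.card (scalarSubgroup ρ) = 3
  sum_quarticChar : ∑ y, quarticChar ρ y = Nat.card Γ
  homology : ∀ y, ¬ IsRegularElt ρ y → y ∉ scalarSubgroup ρ → π y ^ 2 = 1 ∧ sqChar ρ y = 1

namespace CentralizerDiagonalization

variable {x : Γ} (t : CentralizerDiagonalization ρ x)

/-- The element `x` as an element of its own centralizer. -/
def self (x : Γ) : Subgroup.centralizer {x} := ⟨x, Subgroup.mem_centralizer_singleton_iff.2 rfl⟩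

/-- One of the eigenvalues squares to the product of the other two. -/
def IsRealAt (y : Subgroup.centralizer {x}) : Prop :=
  ∃ a b c : Fin 3, a ≠ b ∧ a ≠ c ∧ b ≠ c ∧ t.δ a y * t.δ a y = t.δ b y * t.δ c y

lemma sum_eq_of_distinct {M : Type*} [AddCommMonoid M] (f : Fin 3 → M) {a b c : Fin 3} (hab : a ≠ b)
    (hac : a ≠ c) (hbc : b ≠ c) : f 0 + f 1 + f 2 = f a + f b + f c := by
  have h : (Finset.univ : Finset (Fin 3)) = {a, b, c} := by
    revert a b c; decide
  rw [← Fin.sum_univ_three, h, Finset.sum_insert (by simp [hab, hac]), Finset.sum_pair hbc,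
      add_assoc]

variable {t} in
lemma IsRealAt.exists_sqChar_eq [Finite Γ] (hρ : IsSpecialUnitaryRep ρ)
    {y : Subgroup.centralizer {x}}
    (h : t.IsRealAt y) (hy : Function.Injective fun i => t.δ i y) :
    ∃ ω : ℂ, ω ≠ 0 ∧ ω ^ 2 ≠ 1 ∧ (sqChar ρ y : ℂ) = (1 + ω + ω⁻¹) ^ 2 ∧
      ∀ k, (y : Γ) ^ k ∈ scalarSubgroup ρ → ω ^ k = 1 := by
  obtain ⟨a, b, c, hab, hac, hbc, h⟩ := h
  have ha := t.ne_zero a y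
  have hb := t.ne_zero b y
  have hc := t.ne_zero c y
  refine ⟨t.δ b y / t.δ a y, div_ne_zero hb ha, ?_, ?_, fun k hk => ?_⟩
  · intro h1
    rw [div_pow, div_eq_one_iff_eq (pow_ne_zero 2 ha), sq, sq, h] at h1
    exact hbc (hy (mul_left_cancel₀ hb h1))
  · rw [hρ.ofReal_sqChar, ← Subgroup.coe_inv, t.trace, t.trace,
      sum_eq_of_distinct (fun i => t.δ i y) hab hac hbc,
      sum_eq_of_distinct (fun i => t.δ i y⁻¹) hab hac hbc]
    simp only [map_inv]
    have : t.δ c y = t.δ a y * t.δ a y / t.δ b y := by rw [h]; field_simp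
    rw [this]
    field_simp
    ring
  · rw [← Subgroup.coe_pow, t.mem_scalarSubgroup_iff] at hk
    have : ∀ i, t.δ i (y ^ k) = t.δ 0 (y ^ k) := by
      intro i
      fin_cases i
      exacts [rfl, hk.1.symm, hk.2.symm]
    rw [div_pow, ← map_pow, ← map_pow, this a, this b, div_self (t.ne_zero _ _)]

lemma pow_mem_scalarSubgroup_iff (y : Subgroup.centralizer {x}) (k : ℕ) :
    (y : Γ) ^ k ∈ scalarSubgroup ρ ↔
      (t.δ 1 y / t.δ 0 y) ^ k = 1 ∧ (t.δ 2 y / t.δ 0 y) ^ k = 1 := by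
  rw [← Subgroup.coe_pow, t.mem_scalarSubgroup_iff, div_pow, div_pow, ← map_pow, ← map_pow,
    ← map_pow, div_eq_one_iff_eq (t.ne_zero _ _), div_eq_one_iff_eq (t.ne_zero _ _)]
  exact and_congr eq_comm eq_comm

lemma injective_of_isRegularElt {y : Subgroup.centralizer {x}} (hy : IsRegularElt ρ y) :
    Function.Injective fun i => t.δ i y := by
  obtain ⟨S, T, d, h, hd⟩ := hy
  exact h.injective_of_injective (t.diag y) hd

end CentralizerDiagonalization

namespace IsInvolutiveRep

open CentralizerDiagonalization

variable [Fintype Γ]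

lemma pow_mem_iff (h : IsInvolutiveRep ρ π) (x : Γ) (k : ℕ) :
    x ^ k ∈ scalarSubgroup ρ ↔ π x ^ k = 1 := by
  rw [← h.ker, map_pow]

lemma pow_two_mul_eq_one (h : IsInvolutiveRep ρ π) {x : Γ} {k : ℕ} (hx : ¬ IsRegularElt ρ (x ^ k)) :
    π x ^ (2 * k) = 1 := by
  by_cases hz : x ^ k ∈ scalarSubgroup ρ
  · rw [mul_comm, pow_mul, (h.pow_mem_iff x k).1 hz, one_pow]
  · rw [mul_comm, pow_mul, ← map_pow, (h.homology _ hx hz).1]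

lemma isRealAt_or (h : IsInvolutiveRep ρ π) {x : Γ} (t : CentralizerDiagonalization ρ x)
    {y : Subgroup.centralizer {x}} (hy : IsRegularElt ρ y) (h3 : 3 ≤ orderOf (π y))
    (h7 : orderOf (π y) ≤ 7) :
    t.IsRealAt y ∨ orderOf (π y) = 7 ∧ sqChar ρ y = 2 := by
  have hinj := t.injective_of_isRegularElt hy
  have h0 := t.ne_zero 0 y
  have h1 := t.ne_zero 1 y
  have h2 := t.ne_zero 2 y
  have key := fun k => t.pow_mem_scalarSubgroup_iff y k
  have hord := (key _).1 ((h.pow_mem_iff y _).2 (pow_orderOf_eq_one (π y)))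
  have hu : t.δ 1 y / t.δ 0 y ≠ 1 := fun e => by
    rw [div_eq_one_iff_eq h0] at e
    exact absurd (hinj e) (by decide)
  have hv : t.δ 2 y / t.δ 0 y ≠ 1 := fun e => by
    rw [div_eq_one_iff_eq h0] at e
    exact absurd (hinj e) (by decide)
  have huv : t.δ 1 y / t.δ 0 y ≠ t.δ 2 y / t.δ 0 y := fun e => by
    rw [div_left_inj' h0] at e
    exact absurd (hinj e) (by decide)
  rcases ratio_cases h3 h7 hord.1 hord.2 hu hv huv (fun k hk => by
    rw [← key, h.pow_mem_iff]
    refine h.pow_two_mul_eq_one fun hreg => ?_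
    rw [← Subgroup.coe_pow] at hreg
    have hinj' := t.injective_of_isRegularElt hreg
    simp only [div_pow, ← map_pow, div_eq_one_iff_eq (t.ne_zero 0 (y ^ k)),
      div_left_inj' (t.ne_zero 0 (y ^ k))] at hk
    rcases hk with e | e | e <;> exact absurd (hinj' e) (by decide)) with e | e | e | ⟨h7, e⟩
  · refine Or.inl ⟨0, 1, 2, by decide, by decide, by decide, ?_⟩
    field_simp at e
    rw [e, sq]
  · refine Or.inl ⟨1, 0, 2, by decide, by decide, by decide, ?_⟩
    field_simp at e
    rw [mul_comm (t.δ 0 y), mul_comm (t.δ 2 y)] at *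
    linear_combination -e
  · refine Or.inl ⟨2, 0, 1, by decide, by decide, by decide, ?_⟩
    field_simp at e
    linear_combination -e
  · refine Or.inr ⟨h7, ?_⟩
    have hs := h.rep.ofReal_sqChar (y : Γ)
    rw [← Subgroup.coe_inv, t.trace, t.trace, t.map_inv, t.map_inv, t.map_inv] at hs
    rw [h7] at hord
    set u := t.δ 1 y / t.δ 0 y with hu'
    set v := t.δ 2 y / t.δ 0 y with hv'
    have hu0 : u ≠ 0 := div_ne_zero h1 h0
    have hv0 : v ≠ 0 := div_ne_zero h2 h0
    have h1' : t.δ 1 y = u * t.δ 0 y := by rw [hu']; field_simp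
    have h2' : t.δ 2 y = v * t.δ 0 y := by rw [hv']; field_simp
    have hs2 : (sqChar ρ y : ℂ) = (1 + u + v) * (1 + u⁻¹ + v⁻¹) := by
      rw [hs, h1', h2']; field_simp
    have hc : 1 + u + u ^ 2 + u ^ 3 + u ^ 4 + u ^ 5 + u ^ 6 = 0 := by
      have : (u - 1) * (1 + u + u ^ 2 + u ^ 3 + u ^ 4 + u ^ 5 + u ^ 6) = 0 := by
        linear_combination hord.1
      exact (mul_eq_zero.1 this).resolve_left (sub_ne_zero.2 hu)
    have hui : u⁻¹ = u ^ 6 := by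
      apply inv_eq_of_mul_eq_one_right
      linear_combination hord.1
    have : (sqChar ρ y : ℂ) = 2 := by
      rcases e with e | e
      · have hvi : v⁻¹ = u ^ 4 := by
          apply inv_eq_of_mul_eq_one_right
          rw [e]
          linear_combination hord.1
        rw [hs2, hvi, hui, e]
        linear_combination hc + (2 + u ^ 2) * hord.1
      · have hvi : v⁻¹ = u ^ 2 := by
          apply inv_eq_of_mul_eq_one_right
          rw [e]
          linear_combination hord.1
        rw [hs2, hvi, hui, e]
        linear_combination hc + (2 + u ^ 4) * hord.1
    exact_mod_cast this

/-- Real elements of projective order five have the squared golden ratio, or its conjugate, as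
squared character. -/
lemma quarticChar_eq_of_five (h : IsInvolutiveRep ρ π) {x : Γ} (t : CentralizerDiagonalization ρ x)
    {y : Subgroup.centralizer {x}} (hy : IsRegularElt ρ y) (h5 : orderOf (π y) = 5) :
    quarticChar ρ y = 2 * sqChar ρ y - 1 := by
  have hr := (h.isRealAt_or t hy (by omega) (by omega)).resolve_right (by omega)
  obtain ⟨ω, h0, h2, hs, hk⟩ := hr.exists_sqChar_eq h.rep (t.injective_of_isRegularElt hy)
  have hω := hk 5 ((h.pow_mem_iff _ _).2 (by rw [← h5, pow_orderOf_eq_one]))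
  have hω1 : ω ≠ 1 := fun e => h2 (by rw [e, one_pow])
  have hc : 1 + ω + ω ^ 2 + ω ^ 3 + ω ^ 4 = 0 := by
    have : (ω - 1) * (1 + ω + ω ^ 2 + ω ^ 3 + ω ^ 4) = 0 := by linear_combination hω
    exact (mul_eq_zero.1 this).resolve_left (sub_ne_zero.2 hω1)
  have hi : ω⁻¹ = ω ^ 4 := by
    apply inv_eq_of_mul_eq_one_right
    linear_combination hω
  have hs' : (sqChar ρ y : ℂ) = 2 + ω + ω ^ 4 := by
    rw [hs, hi]
    linear_combination hc + (2 + ω ^ 3) * hω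
  have : (quarticChar ρ y : ℂ) = ((2 * sqChar ρ y - 1 : ℝ) : ℂ) := by
    rw [quarticChar]
    push_cast
    rw [hs']
    linear_combination hc + (2 + ω ^ 3) * hω
  exact_mod_cast this

/-- Regular elements of small projective order do not contribute. -/
lemma five_le_orderOf (h : IsInvolutiveRep ρ π) {x : Γ} (hx : IsRegularElt ρ x)
    (hF : quarticChar ρ x ≠ 0) : 5 ≤ orderOf (π x) := by
  obtain ⟨t⟩ := hx.nonempty_centralizerDiagonalization
  have hx' : IsRegularElt ρ (self x : Γ) := hx
  have hinj := t.injective_of_isRegularElt hx'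
  by_contra! hlt
  have hpos : 0 < orderOf (π x) := by
    have h1 : IsOfFinOrder x := isOfFinOrder_of_finite x
    exact orderOf_pos_iff.2 (π.isOfFinOrder h1)
  have hne : orderOf (π x) ≠ 1 := fun e => hx.map_ne_one h.ker (orderOf_eq_one_iff.1 e)
  have hmem := (h.pow_mem_iff x _).2 (pow_orderOf_eq_one (π x))
  rcases Nat.lt_or_ge (orderOf (π x)) 3 with h3 | h3
  · have h2 : orderOf (π x) = 2 := by omega
    rw [h2] at hmem
    have h0 := (t.pow_mem_scalarSubgroup_iff (self x) 2).1 hmem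
    rw [div_pow, div_pow, div_eq_one_iff_eq (pow_ne_zero 2 (t.ne_zero _ _)),
      div_eq_one_iff_eq (pow_ne_zero 2 (t.ne_zero _ _)), sq_eq_sq_iff_eq_or_eq_neg,
      sq_eq_sq_iff_eq_or_eq_neg] at h0
    rcases h0 with ⟨e | e, e' | e'⟩
    · exact absurd (hinj e) (by decide)
    · exact absurd (hinj e) (by decide)
    · exact absurd (hinj e') (by decide)
    · exact absurd (hinj (e.trans e'.symm)) (by decide)
  · have hr := (h.isRealAt_or t hx' h3 (show orderOf (π x) ≤ 7 by omega)).resolve_right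
      (fun e => by have : orderOf (π x) = 7 := e.1; omega)
    obtain ⟨ω, h0, h2, hs, hk⟩ := hr.exists_sqChar_eq h.rep hinj
    have hω := hk _ hmem
    apply hF
    have hs' : (sqChar ρ x : ℂ) = (1 + ω + ω⁻¹) ^ 2 := hs
    rcases (show orderOf (π x) = 3 ∨ orderOf (π x) = 4 by omega) with e | e <;> rw [e] at hω
    · have hω1 : ω ≠ 1 := fun e => h2 (by rw [e, one_pow])
      have hc : 1 + ω + ω ^ 2 = 0 := by
        have : (ω - 1) * (1 + ω + ω ^ 2) = 0 := by linear_combination hω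
        exact (mul_eq_zero.1 this).resolve_left (sub_ne_zero.2 hω1)
      have hi : 1 + ω + ω⁻¹ = 0 := by
        field_simp
        linear_combination hc
      rw [hi, zero_pow (by norm_num)] at hs'
      have : sqChar ρ x = 0 := by exact_mod_cast hs'
      rw [quarticChar, this]; norm_num
    · have hc : ω ^ 2 = -1 := by
        have : (ω ^ 2 - 1) * (ω ^ 2 + 1) = 0 := by linear_combination hω
        linear_combination (mul_eq_zero.1 this).resolve_left (sub_ne_zero.2 h2)
      have hi : ω + ω⁻¹ = 0 := by
        field_simp
        linear_combination hc
      rw [add_assoc, hi, add_zero, one_pow] at hs'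
      have : sqChar ρ x = 1 := by exact_mod_cast hs'
      rw [quarticChar, this]; norm_num

end IsInvolutiveRep

end InvolutiveHomologies

section InvolutiveHomologies

open Matrix CentralizerDiagonalization

variable {Γ : Type*} [Group Γ] {ρ : Γ →* Matrix (Fin 3) (Fin 3) ℂ} {G : Type*} [Group G]
  {π : Γ →* G} [Fintype Γ]

namespace IsInvolutiveRep

lemma quarticChar_scalar (h : IsInvolutiveRep ρ π) {z : Γ} (hz : z ∈ scalarSubgroup ρ) :
    quarticChar ρ z = 72 := by
  rw [quarticChar, h.rep.sqChar_scalar hz]; norm_num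

omit [Fintype Γ] in
lemma quarticChar_one : quarticChar ρ 1 = 72 := by
  rw [quarticChar, sqChar_one]; norm_num

lemma quarticChar_of_not_isRegularElt (h : IsInvolutiveRep ρ π) {y : Γ} (hy : ¬ IsRegularElt ρ y)
    (hz : y ∉ scalarSubgroup ρ) : quarticChar ρ y = 0 := by
  rw [quarticChar, (h.homology y hy hz).2]; norm_num

open scoped Classical in
lemma centralizerSum_eq (h : IsInvolutiveRep ρ π) (x : Γ) :
    centralizerSum (IsRegularElt ρ) (quarticChar ρ) x =
      ∑ y : Subgroup.centralizer {x}, quarticChar ρ y - 216 := by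
  rw [h.rep.centralizerSum_eq (fun z hz => by rw [h.quarticChar_scalar hz, quarticChar_one])
    (fun y hy hz => h.quarticChar_of_not_isRegularElt hy hz), h.card_scalar, quarticChar_one]
  norm_num

open scoped Classical in
lemma le_centralizerSum (h : IsInvolutiveRep ρ π) {x : Γ} (hx : IsRegularElt ρ x) :
    36 * (Nat.card ((Subgroup.centralizer {x}).map π) : ℝ) - 216 ≤
      centralizerSum (IsRegularElt ρ) (quarticChar ρ) x := by
  obtain ⟨t⟩ := hx.nonempty_centralizerDiagonalization
  have h1 := t.fifteen_mul_le_sum_sqChar_sq h.rep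
  have h2 := t.sum_sqChar h.rep
  rw [h.centralizerSum_eq]
  simp only [quarticChar, Finset.sum_sub_distrib]
  rw [card_centralizer_eq h.rep h.ker, h.card_scalar] at h1 h2
  push_cast at h1 h2
  linarith

open scoped Classical in
lemma le_centralizerSum_of_isRealType (h : IsInvolutiveRep ρ π) {x : Γ}
    {t : CentralizerDiagonalization ρ x} (ht : t.IsRealType) :
    48 * (Nat.card ((Subgroup.centralizer {x}).map π) : ℝ) - 216 ≤
      centralizerSum (IsRegularElt ρ) (quarticChar ρ) x := by
  have h1 := ht.nineteen_mul_le_sum_sqChar_sq h.rep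
  have h2 := t.sum_sqChar h.rep
  rw [h.centralizerSum_eq]
  simp only [quarticChar, Finset.sum_sub_distrib]
  rw [card_centralizer_eq h.rep h.ker, h.card_scalar] at h1 h2
  push_cast at h1 h2
  linarith

open scoped Classical in
lemma centralizerSum_eq_of_linear (h : IsInvolutiveRep ρ π) {x : Γ} (hx : IsRegularElt ρ x)
    {α β : ℝ}
    (hl : ∀ y ∈ Subgroup.centralizer {x}, y ∉ scalarSubgroup ρ →
      quarticChar ρ y = α * sqChar ρ y + β) :
    centralizerSum (IsRegularElt ρ) (quarticChar ρ) x =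
      α * (9 * Nat.card ((Subgroup.centralizer {x}).map π) - 27) +
      β * (3 * Nat.card ((Subgroup.centralizer {x}).map π) - 3) := by
  obtain ⟨t⟩ := hx.nonempty_centralizerDiagonalization
  have h2 := t.sum_sqChar h.rep
  have hC := card_centralizer_eq h.rep h.ker x
  have h3 : ∑ y : Subgroup.centralizer {x}, (quarticChar ρ y - (α * sqChar ρ y + β)) =
      3 * (72 - (9 * α + β)) := by
    have h4 : ∀ y : Subgroup.centralizer {x}, quarticChar ρ y - (α * sqChar ρ y + β) =
        if y ∈ (scalarSubgroup ρ).subgroupOf (Subgroup.centralizer {x}) then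
          72 - (9 * α + β) else 0 := by
      intro y
      split_ifs with hy
      · rw [Subgroup.mem_subgroupOf] at hy
        rw [h.quarticChar_scalar hy, h.rep.sqChar_scalar hy, mul_comm]
      · rw [hl y y.2 hy, sub_self]
    simp_rw [h4]
    rw [← Finset.sum_filter, Finset.sum_const, nsmul_eq_mul, ← Fintype.card_subtype,
      ← Nat.card_eq_fintype_card]
    have h5 := Nat.card_congr
      (Subgroup.subgroupOfEquivOfLe (h.rep.scalarSubgroup_le_centralizer x)).toEquiv
    rw [h.card_scalar] at h5
    rw [h5]
    norm_num
  rw [h.centralizerSum_eq]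
  rw [Finset.sum_sub_distrib, Finset.sum_add_distrib, ← Finset.mul_sum, h2, Finset.sum_const,
    nsmul_eq_mul, Finset.card_univ, ← Nat.card_eq_fintype_card, hC, h.card_scalar] at h3
  push_cast at h3
  linarith

lemma isRealType_of_isRealAt (h : IsInvolutiveRep ρ π) {x : Γ} {t : CentralizerDiagonalization ρ x}
    {g : Subgroup.centralizer {x}}
    (ha : Nat.card ((Subgroup.centralizer {x}).map π) = orderOf (π g)) (ht : t.IsRealAt g) :
    t.IsRealType := by
  obtain ⟨a, b, c, hab, hac, hbc, e⟩ := ht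
  refine ⟨a, b, c, hab, hac, hbc, fun y => ?_⟩
  have hfin : Finite ((Subgroup.centralizer {x}).map π) :=
    Set.Finite.to_subtype ((Set.toFinite (Subgroup.centralizer {x} : Set Γ)).image π)
  have hle : Subgroup.zpowers (π g) ≤ (Subgroup.centralizer {x}).map π := by
    rw [Subgroup.zpowers_le]
    exact ⟨g, g.2, rfl⟩
  have heq := Subgroup.eq_of_le_of_card_ge hle (by rw [ha, Nat.card_zpowers])
  have hy : π y ∈ Subgroup.zpowers (π g) := by
    rw [heq]; exact ⟨y, y.2, rfl⟩
  rw [← (π.isOfFinOrder (isOfFinOrder_of_finite (g : Γ))).mem_powers_iff_mem_zpowers] at hy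
  obtain ⟨k, hk⟩ := hy
  have hz : ((y * (g ^ k)⁻¹ : Subgroup.centralizer {x}) : Γ) ∈ scalarSubgroup ρ := by
    rw [← h.ker]
    simp [ ← hk]
  set z := y * (g ^ k)⁻¹ with hzdef
  have hyz : y = z * g ^ k := by rw [hzdef]; group
  rw [t.mem_scalarSubgroup_iff] at hz
  have h0 : ∀ i, t.δ i z = t.δ 0 z := by
    intro i
    fin_cases i
    exacts [rfl, hz.1.symm, hz.2.symm]
  rw [hyz]
  simp only [map_mul, map_pow]
  rw [h0 a, h0 b, h0 c, mul_mul_mul_comm, mul_mul_mul_comm (t.δ 0 z) (t.δ b g ^ k),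
    ← mul_pow, ← mul_pow, e]

lemma orderOf_eq_of_prime (h : IsInvolutiveRep ρ π) {x y : Γ} {p : ℕ} (hp : p.Prime)
    (ha : Nat.card ((Subgroup.centralizer {x}).map π) = p) (hy : y ∈ Subgroup.centralizer {x})
    (hz : y ∉ scalarSubgroup ρ) : orderOf (π y) = p := by
  have h1 : π y ∈ (Subgroup.centralizer {x}).map π := ⟨y, hy, rfl⟩
  have h2 := orderOf_dvd_natCard (⟨_, h1⟩ : (Subgroup.centralizer {x}).map π)
  rw [Subgroup.orderOf_mk, ha] at h2
  refine ((Nat.dvd_prime hp).1 h2).resolve_left fun e => hz ?_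
  rwa [orderOf_eq_one_iff, h.ker] at e

lemma isRegularElt_of_three_le (h : IsInvolutiveRep ρ π) {y : Γ} (hy : 3 ≤ orderOf (π y)) :
    IsRegularElt ρ y := by
  by_contra hreg
  have h1 := h.pow_two_mul_eq_one (x := y) (k := 1) (by rwa [pow_one])
  have := Nat.le_of_dvd (by norm_num) (orderOf_dvd_of_pow_eq_one h1)
  omega

open scoped Classical in
lemma centralizerSum_of_five (h : IsInvolutiveRep ρ π) {x : Γ} (hx : IsRegularElt ρ x)
    (ha : Nat.card ((Subgroup.centralizer {x}).map π) = 5) :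
    centralizerSum (IsRegularElt ρ) (quarticChar ρ) x = 24 := by
  obtain ⟨t⟩ := hx.nonempty_centralizerDiagonalization
  rw [h.centralizerSum_eq_of_linear hx (α := 2) (β := -1), ha]
  · norm_num
  · intro y hy hz
    have h5 := h.orderOf_eq_of_prime (by norm_num) ha hy hz
    have := h.quarticChar_eq_of_five t (y := ⟨y, hy⟩)
      (h.isRegularElt_of_three_le (by rw [h5]; norm_num)) h5
    rw [this]; ring

lemma card_map_centralizer (h : IsInvolutiveRep ρ π) (x : Γ) :
    Nat.card (Subgroup.centralizer {x}) = 3 * Nat.card ((Subgroup.centralizer {x}).map π) := by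
  rw [card_centralizer_eq h.rep h.ker, h.card_scalar]

lemma centralizerSum_congr {x y : Γ} (f : Γ → ℝ)
    (hxy : Subgroup.centralizer {y} = Subgroup.centralizer {x}) :
    centralizerSum (IsRegularElt ρ) f y = centralizerSum (IsRegularElt ρ) f x := by
  classical
  simp only [centralizerSum, hxy]

open scoped Classical in
lemma centralizerSum_eq_zero_or (h : IsInvolutiveRep ρ π) {x : Γ} (hx : IsRegularElt ρ x) :
    centralizerSum (IsRegularElt ρ) (quarticChar ρ) x = 0 ∨
      ∃ y, IsRegularElt ρ y ∧ Subgroup.centralizer {y} = Subgroup.centralizer {x} ∧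
        5 ≤ orderOf (π y) := by
  by_cases h0 : ∀ y, IsRegularElt ρ y → y ∈ Subgroup.centralizer {x} → quarticChar ρ y = 0
  · left
    refine Finset.sum_eq_zero fun y hy => ?_
    simp only [Finset.mem_filter, Finset.mem_univ, true_and] at hy
    exact h0 y hy.1 hy.2
  · right
    push Not at h0
    obtain ⟨y, hy, hyC, hF⟩ := h0
    exact ⟨y, hy, h.rep.centralizer_eq x y hx hy hyC, h.five_le_orderOf hy hF⟩

lemma card_map_centralizer_pos (x : Γ) : 0 < Nat.card ((Subgroup.centralizer {x}).map π) := by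
  have hfin : Finite ((Subgroup.centralizer {x}).map π) :=
    Set.Finite.to_subtype ((Set.toFinite (Subgroup.centralizer {x} : Set Γ)).image π)
  exact Nat.card_pos

open scoped Classical in
lemma centralizerSum_nonneg (h : IsInvolutiveRep ρ π) {x : Γ} (hx : IsRegularElt ρ x) :
    0 ≤ centralizerSum (IsRegularElt ρ) (quarticChar ρ) x := by
  rcases h.centralizerSum_eq_zero_or hx with h0 | ⟨y, hy, hyx, hm⟩
  · rw [h0]
  · rw [← centralizerSum_congr _ hyx]
    have h1 := orderOf_dvd_card_map_centralizer (π := π) y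
    have h2 := h.le_centralizerSum hy
    have h3 := Nat.le_of_dvd (card_map_centralizer_pos y) h1
    rcases h3.eq_or_lt with h4 | h4
    · rcases hm.eq_or_lt with h5 | h5
      · rw [h.centralizerSum_of_five hy (by rw [← h4, ← h5])]; norm_num
      · have : (6 : ℝ) ≤ Nat.card ((Subgroup.centralizer {y}).map π) := by
          exact_mod_cast (show 6 ≤ _ by omega)
        linarith
    · have : (6 : ℝ) ≤ Nat.card ((Subgroup.centralizer {y}).map π) := by
        exact_mod_cast (show 6 ≤ _ by omega)
      linarith

open scoped Classical in
lemma sum_isRegularElt (h : IsInvolutiveRep ρ π) :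
    ∑ y with IsRegularElt ρ y, quarticChar ρ y = Nat.card Γ - 216 := by
  rw [sum_isRegularElt_eq (fun z hz => by rw [h.quarticChar_scalar hz, quarticChar_one])
    (fun y hy hz => h.quarticChar_of_not_isRegularElt hy hz), h.card_scalar, quarticChar_one,
    h.sum_quarticChar]
  norm_num

open scoped Classical in
lemma centralizerSum_lt (h : IsInvolutiveRep ρ π) {x : Γ} (hx : IsRegularElt ρ x) :
    centralizerSum (IsRegularElt ρ) (quarticChar ρ) x <
      Nat.card (Subgroup.normalizer (Subgroup.centralizer {x} : Set Γ)) := by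
  have h1 := card_mul_centralizerSum_le (fun x g hx => isRegularElt_conj g hx)
    h.rep.centralizer_eq (fun x g => quarticChar_conj ρ x g)
    (fun x hx => h.centralizerSum_nonneg hx) hx
  rw [h.sum_isRegularElt, ← Nat.card_eq_fintype_card] at h1
  have hN : (0 : ℝ) < Nat.card (Subgroup.normalizer (Subgroup.centralizer {x} : Set Γ)) := by
    exact_mod_cast Nat.card_pos
  have hΓ : (0 : ℝ) < Nat.card Γ := by exact_mod_cast Nat.card_pos
  nlinarith

lemma weyl_ne_six (h : IsInvolutiveRep ρ π) {x : Γ} (hx : IsRegularElt ρ x) (hm : 5 ≤ orderOf (π x))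
    (ha : Nat.card ((Subgroup.centralizer {x}).map π) < 12) {n₁ n₂ : Γ}
    (h₁ : n₁ ∈ Subgroup.normalizer (Subgroup.centralizer {x} : Set Γ))
    (h₂ : n₂ ∈ Subgroup.normalizer (Subgroup.centralizer {x} : Set Γ)) :
    (n₂ * n₁)⁻¹ * (n₁ * n₂) ∈ Subgroup.centralizer {x} := by
  by_contra hn
  obtain ⟨j, hj⟩ := orderOf_dvd_card_map_centralizer (π := π) x
  have hcop : (orderOf (π x)).Coprime j := by
    have hpos := card_map_centralizer_pos (π := π) x
    have hj0 : j ≠ 0 := by rintro rfl; omega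
    have hj2 : j < 3 := by nlinarith
    have : j = 1 ∨ j = 2 := by omega
    rcases this with rfl | rfl
    · exact Nat.coprime_one_right _
    · have : orderOf (π x) = 5 := by omega
      rw [this]; norm_num
  obtain ⟨k₁, hk₁⟩ := exists_conj_eq_pow h.rep hx hj hcop h₁
  obtain ⟨k₂, hk₂⟩ := exists_conj_eq_pow h.rep hx hj hcop h₂
  have h1 := Nat.le_of_dvd (by norm_num) (h.rep.orderOf_map_dvd_three (π := π)
    (h.rep.trace_eq_zero_of_noncommuting h.ker hk₁ hk₂ hn))
  omega

omit [Fintype Γ] in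
/-- An element conjugate to its inverse modulo scalars has an eigenvalue squaring to the product
of the others. -/
lemma _root_.CentralizerDiagonalization.isRealAt_of_conj_inv (hρ : IsSpecialUnitaryRep ρ) {x n : Γ}
    (t : CentralizerDiagonalization ρ x) (h : x * (n * x * n⁻¹) ∈ scalarSubgroup ρ) :
    t.IsRealAt (self x) := by
  obtain ⟨c, hc⟩ := h
  have hc3 := hρ.scalar_pow_three hc
  have h1 : (ρ x).trace = c * (ρ x⁻¹).trace := by
    rw [← trace_rep_conj ρ x n, show n * x * n⁻¹ = x⁻¹ * (x * (n * x * n⁻¹)) by group, map_mul, hc,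
      mul_smul_comm, mul_one, trace_smul, smul_eq_mul]
  have hp := t.prod hρ (self x)
  have ht := t.trace (self x)
  have ht' := t.trace (self x)⁻¹
  have hx : (ρ x).trace = _ := ht
  have hx' : (ρ x⁻¹).trace = _ := ht'
  rw [hx, hx', t.map_inv, t.map_inv, t.map_inv] at h1
  have h0 := t.ne_zero 0 (self x)
  have h1' := t.ne_zero 1 (self x)
  have h2 := t.ne_zero 2 (self x)
  set α := t.δ 0 (self x)
  set β := t.δ 1 (self x)
  set γ := t.δ 2 (self x)
  have hα : α⁻¹ = β * γ := inv_eq_of_mul_eq_one_right (by linear_combination hp)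
  have hβ : β⁻¹ = α * γ := inv_eq_of_mul_eq_one_right (by linear_combination hp)
  have hγ : γ⁻¹ = α * β := inv_eq_of_mul_eq_one_right (by linear_combination hp)
  rw [hα, hβ, hγ] at h1
  have hprod : (c ^ 2 - α) * ((c ^ 2 - β) * (c ^ 2 - γ)) = 0 := by
    linear_combination (c ^ 3 + 1) * hc3 - c ^ 4 * h1 - hp - c ^ 2 * (β * γ + α * γ + α * β) * hc3
  have key : ∀ p q r : ℂ, c ^ 2 - p = 0 → p ≠ 0 → p * q * r = 1 → p * p = q * r := by
    intro p q r e hp0 hpqr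
    apply mul_left_cancel₀ hp0
    rw [sub_eq_zero] at e
    rw [← mul_assoc, ← mul_assoc, hpqr, ← e]
    linear_combination (c ^ 3 + 1) * hc3
  rcases mul_eq_zero.1 hprod with e | e
  · exact ⟨0, 1, 2, by decide, by decide, by decide, key _ _ _ e h0 hp⟩
  · rcases mul_eq_zero.1 e with e | e
    · exact ⟨1, 0, 2, by decide, by decide, by decide, key _ _ _ e h1' (by linear_combination hp)⟩
    · exact ⟨2, 0, 1, by decide, by decide, by decide, key _ _ _ e h2 (by linear_combination hp)⟩

open scoped Classical in
lemma card_normalizer_and_centralizerSum (h : IsInvolutiveRep ρ π) {x : Γ} (hx : IsRegularElt ρ x)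
    (hm : 5 ≤ orderOf (π x)) :
    (orderOf (π x) = 5 ∧ Nat.card (Subgroup.normalizer (Subgroup.centralizer {x} : Set Γ)) = 30 ∧
      centralizerSum (IsRegularElt ρ) (quarticChar ρ) x = 24) ∨
    (orderOf (π x) = 7 ∧ Nat.card (Subgroup.normalizer (Subgroup.centralizer {x} : Set Γ)) = 63 ∧
      centralizerSum (IsRegularElt ρ) (quarticChar ρ) x = 36) := by
  obtain ⟨t⟩ := hx.nonempty_centralizerDiagonalization
  obtain ⟨w, hw, hw', hw6, hwp⟩ := h.rep.exists_card_normalizer hx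
  have hlt := h.centralizerSum_lt hx
  have hle := h.le_centralizerSum hx
  have hdvd := orderOf_dvd_card_map_centralizer (π := π) x
  have hpos := card_map_centralizer_pos (π := π) x
  have hwey := fun h₁₂ n₁ h₁ n₂ h₂ => h.weyl_ne_six hx hm h₁₂ (n₁ := n₁) (n₂ := n₂) h₁ h₂
  have hreal := fun g ha hr => h.le_centralizerSum_of_isRealType
    (h.isRealType_of_isRealAt (t := t) (g := g) ha hr)
  have hfive := h.centralizerSum_of_five hx
  have hft := fun ha n hn => h.rep.false_of_five_of_three h.ker hx ha (n := n) hn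
  have hpr := fun ha y hy hz => h.orderOf_eq_of_prime (x := x) (y := y) (p := 7)
      (by norm_num) ha hy hz
  have hlin := h.centralizerSum_eq_of_linear hx (α := 0) (β := 2)
  have hpow := fun ha n hn => exists_conj_eq_pow (π := π) (j := 1) (n := n) h.rep hx ha
      (Nat.coprime_one_right _) hn
  rw [hw, h.card_map_centralizer x] at hlt ⊢
  have hone := h.isRealAt_or t (y := self x) hx (show 3 ≤ orderOf (π x) by omega)
  change orderOf (π x) ≤ 7 → t.IsRealAt (self x) ∨ orderOf (π x) = 7 ∧ sqChar ρ x = 2 at hone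
  generalize hS : centralizerSum (IsRegularElt ρ) (quarticChar ρ) x = S at *
  generalize ha : Nat.card ((Subgroup.centralizer {x}).map π) = a at *
  generalize horder : orderOf (π x) = m at *
  have hS0 : (36 * a - 216 : ℝ) < (w * (3 * a) : ℕ) := lt_of_le_of_lt hle hlt
  have ha12 : a < 12 := by
    have : (w : ℝ) ≤ 6 := by
      have : w ≤ 6 := by omega
      exact_mod_cast this
    have h1 : (a : ℝ) < 12 := by
      push_cast at hS0
      have ha0 : (0 : ℝ) ≤ a := Nat.cast_nonneg _
      nlinarith
    exact_mod_cast h1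
  have hw3 : w ≠ 6 := fun e => by
    obtain ⟨n₁, h₁, n₂, h₂, hn⟩ := hw6 e
    exact hn (hwey ha12 n₁ h₁ n₂ h₂)
  have ha8 : a < 8 := by
    have : (w : ℝ) ≤ 3 := by
      have : w ≤ 3 := by omega
      exact_mod_cast this
    have h1 : (a : ℝ) < 8 := by
      push_cast at hS0
      have ha0 : (0 : ℝ) ≤ a := Nat.cast_nonneg _
      nlinarith
    exact_mod_cast h1
  have ham : m = a := by
    obtain ⟨j, rfl⟩ := hdvd
    have : j < 2 := by nlinarith
    have : j = 1 := by
      rcases (show j = 0 ∨ j = 1 by omega) with rfl | rfl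
      · simp at hpos
      · rfl
    rw [this, mul_one]
  subst ham
  rcases (show m = 5 ∨ m = 6 ∨ m = 7 by omega) with rfl | rfl | rfl
  · left
    have hS5 := hfive rfl
    refine ⟨rfl, ?_, hS5⟩
    rw [hS5] at hlt
    have hw1 : w ≠ 1 := by rintro rfl; norm_num at hlt
    have hw3' : w ≠ 3 := by
      rintro rfl
      obtain ⟨n, hn, hnC, hn3⟩ := hwp (by norm_num)
      exact hft rfl n hn hnC hn3
    omega
  · exfalso
    have h1 := hreal (self x) horder.symm ((hone (by norm_num)).resolve_right (by norm_num))
    have h2 : (w : ℝ) ≤ 3 := by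
      have : w ≤ 3 := by omega
      exact_mod_cast this
    push_cast at hlt h1
    linarith
  · right
    have hnr : ∀ y : Subgroup.centralizer {x}, orderOf (π y) = 7 → ¬ t.IsRealAt y := by
      intro y hy hr
      have h1 := hreal y hy.symm hr
      have h2 : (w : ℝ) ≤ 3 := by
        have : w ≤ 3 := by omega
        exact_mod_cast this
      push_cast at hlt h1
      linarith
    have hS36 : S = 36 := by
      rw [hlin]
      · norm_num
      · intro y hy hz
        have h7 := hpr rfl y hy hz
        have h8 := (h.isRealAt_or t (y := ⟨y, hy⟩)
            (h.isRegularElt_of_three_le (by rw [h7]; norm_num))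
          (show 3 ≤ orderOf (π y) by rw [h7]; norm_num)
          (show orderOf (π y) ≤ 7 by rw [h7])).resolve_left (hnr _ h7)
        rw [quarticChar, show sqChar ρ y = 2 from h8.2]
        norm_num
    refine ⟨rfl, ?_, hS36⟩
    rw [hS36] at hlt
    have hw1 : w ≠ 1 := by rintro rfl; norm_num at hlt
    have hw2 : w ≠ 2 := by
      rintro rfl
      obtain ⟨n, hn, hnC, hn2⟩ := hwp (by norm_num)
      obtain ⟨k, hk⟩ := hpow (by norm_num) n hn
      have h1 := pow_modEq_one_of_pow_mem_centralizer hk hn2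
      rw [horder] at h1
      have h2 : k % 7 = 1 % 7 ∨ (k + 1) % 7 = 0 % 7 := by
        have h3 : k % 7 < 7 := Nat.mod_lt _ (by norm_num)
        have h4 : (k % 7) ^ 2 ≡ 1 [MOD 7] := ((Nat.mod_modEq k 7).pow 2).trans h1
        have h5 : k % 7 = 1 ∨ k % 7 = 6 := by
          generalize k % 7 = r at h3 h4
          interval_cases r <;> revert h4 <;> decide
        omega
      rcases h2 with h2 | h2
      · have h3 : π x ^ k = π x := by
          conv_rhs => rw [← pow_one (π x)]
          rw [pow_eq_pow_iff_modEq, horder]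
          exact h2
        have h4 := h.rep.orderOf_map_dvd_three (π := π)
          (h.rep.trace_eq_zero_of_map_conj h.ker (hk.trans h3) hnC)
        rw [horder] at h4
        exact absurd h4 (by norm_num)
      · have h3 : π x ^ (k + 1) = π x ^ 0 := by
          rw [pow_eq_pow_iff_modEq, horder]
          exact h2
        refine hnr (self x) horder (t.isRealAt_of_conj_inv h.rep (n := n) ?_)
        rw [← h.ker, map_mul, map_mul, map_mul, _root_.map_inv, hk, ← pow_succ', h3, pow_zero]
    omega

/-- The order of the quotient of an involutive representation by its scalars. -/
lemma card_eq (h : IsInvolutiveRep ρ π) :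
    Nat.card G = 72 ∨ Nat.card G = 360 ∨ Nat.card G = 168 := by
  classical
  have hcard := card_eq_card_scalarSubgroup_mul h.surjective h.ker
  rw [h.card_scalar] at hcard
  have hS : ∀ x, IsRegularElt ρ x → centralizerSum (IsRegularElt ρ) (quarticChar ρ) x = 0 ∨
      (Nat.card (Subgroup.normalizer (Subgroup.centralizer {x} : Set Γ)) = 30 ∧
        centralizerSum (IsRegularElt ρ) (quarticChar ρ) x = 24) ∨
      (Nat.card (Subgroup.normalizer (Subgroup.centralizer {x} : Set Γ)) = 63 ∧
        centralizerSum (IsRegularElt ρ) (quarticChar ρ) x = 36) := fun x hx => by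
    rcases h.centralizerSum_eq_zero_or hx with h0 | ⟨y, hy, hyx, hm⟩
    · exact Or.inl h0
    · rw [← centralizerSum_congr _ hyx, ← hyx]
      rcases h.card_normalizer_and_centralizerSum hy hm with ⟨-, h1, h2⟩ | ⟨-, h1, h2⟩
      · exact Or.inr (Or.inl ⟨h1, h2⟩)
      · exact Or.inr (Or.inr ⟨h1, h2⟩)
  have hz : ∀ z ∈ scalarSubgroup ρ, quarticChar ρ z = quarticChar ρ 1 := fun z hz => by
    rw [h.quarticChar_scalar hz, quarticChar_one]
  have hf : ∀ y, ¬ IsRegularElt ρ y → y ∉ scalarSubgroup ρ → quarticChar ρ y = 0 :=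
    fun y hy hz => h.quarticChar_of_not_isRegularElt hy hz
  have key := h.rep.sum_eq_or_exists hz hf (fun x g => quarticChar_conj ρ x g) (fun x hx => by
      rcases hS x hx with h0 | ⟨h1, h2⟩ | ⟨h1, h2⟩
      · exact Or.inl h0
      · right; rw [h1, h2]; norm_num
      · right; rw [h1, h2]; norm_num)
    (by rw [h.sum_quarticChar, h.card_scalar, quarticChar_one]; norm_num)
  rw [h.sum_quarticChar, h.card_scalar, quarticChar_one, hcard] at key
  push_cast at key
  rcases key with h1 | ⟨x, hx, h0, h1⟩
  · left
    have : (Nat.card G : ℝ) = 72 := by linarith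
    exact_mod_cast this
  · right
    rcases hS x hx with h2 | ⟨h2, h3⟩ | ⟨h2, h3⟩
    · rw [h2] at h0; exact absurd h0 (lt_irrefl _)
    · left
      rw [h2, h3] at h1
      push_cast at h1
      have : (Nat.card G : ℝ) = 360 := by linarith
      exact_mod_cast this
    · right
      rw [h2, h3] at h1
      push_cast at h1
      have : (Nat.card G : ℝ) = 168 := by linarith
      exact_mod_cast this

lemma orderOf_le_seven (h : IsInvolutiveRep ρ π) (s : G) : orderOf s ≤ 7 := by
  classical
  obtain ⟨x, rfl⟩ := h.surjective s
  by_contra! hlt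
  have hreg : IsRegularElt ρ x := h.isRegularElt_of_three_le (by omega)
  rcases h.card_normalizer_and_centralizerSum hreg (by omega)
    with ⟨h1, -⟩ | ⟨h1, -⟩ <;> omega

end IsInvolutiveRep

end InvolutiveHomologies

section NormalizedTrace

open ArithmeticFunction in
lemma sum_primitiveRoots_complex {m : ℕ} (hm : 0 < m) :
    ∑ z ∈ primitiveRoots m ℂ, z = (ArithmeticFunction.moebius m : ℂ) := by
  classical
  have hsum : ∀ n > 0, ∑ i ∈ n.divisors, ∑ z ∈ primitiveRoots i ℂ, z =
      if n = 1 then (1 : ℂ) else 0 := by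
    intro n hn
    have hp := Complex.isPrimitiveRoot_exp n hn.ne'
    rw [← Finset.sum_biUnion fun i _ j _ hij => IsPrimitiveRoot.disjoint hij,
      ← IsPrimitiveRoot.nthRoots_one_eq_biUnion_primitiveRoots]
    split_ifs with h1
    · subst h1
      have : Polynomial.nthRootsFinset 1 (1 : ℂ) = {1} := by
        ext z; simp [Polynomial.mem_nthRootsFinset]
      rw [this, Finset.sum_singleton]
    · have hn2 : 1 < n := by omega
      have himg : Polynomial.nthRootsFinset n (1 : ℂ) = (Finset.range n).image
          (fun i => Complex.exp (2 * Real.pi * Complex.I / n) ^ i) := by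
        ext z
        rw [Polynomial.mem_nthRootsFinset hn, Finset.mem_image]
        constructor
        · intro hz
          have : NeZero n := ⟨hn.ne'⟩
          obtain ⟨i, hi, h⟩ := hp.eq_pow_of_pow_eq_one hz
          exact ⟨i, Finset.mem_range.2 hi, h⟩
        · rintro ⟨i, -, rfl⟩
          rw [← pow_mul, mul_comm i n, pow_mul, hp.pow_eq_one, one_pow]
      rw [himg, Finset.sum_image fun i hi j hj h =>
        hp.pow_inj (Finset.mem_range.1 hi) (Finset.mem_range.1 hj) h]
      exact hp.geom_sum_eq_zero hn2
  have h := (sum_eq_iff_sum_mul_moebius_eq (R := ℂ)).1 hsum m hm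
  rw [← h, Finset.sum_eq_single (m, 1)]
  · simp
  · rintro ⟨a, b⟩ hab hne
    rw [Nat.mem_divisorsAntidiagonal] at hab
    have : b ≠ 1 := by
      rintro rfl
      exact hne (by simp [← hab.1])
    simp [this]
  · intro h0
    exact absurd (Nat.mem_divisorsAntidiagonal.2 ⟨mul_one m, hm.ne'⟩) h0

lemma nextCoeff_cyclotomic_rat {m : ℕ} (hm : 0 < m) :
    (Polynomial.cyclotomic m ℚ).nextCoeff = -(ArithmeticFunction.moebius m : ℚ) := by
  have hinj : Function.Injective (algebraMap ℚ ℂ) := (algebraMap ℚ ℂ).injective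
  apply hinj
  have hs : (Polynomial.cyclotomic m ℂ).Splits := IsAlgClosed.splits _
  rw [← Polynomial.nextCoeff_map hinj, Polynomial.map_cyclotomic,
    hs.nextCoeff_eq_neg_sum_roots_of_monic (Polynomial.cyclotomic.monic m ℂ)]
  have hp := Complex.isPrimitiveRoot_exp m hm.ne'
  have : NeZero (m : ℂ) := ⟨by exact_mod_cast hm.ne'⟩
  rw [Polynomial.cyclotomic.roots_eq_primitiveRoots_val, map_neg, map_intCast,
    ← sum_primitiveRoots_complex hm, Finset.sum, Multiset.map_id']

/-- There is a `ℚ`-linear functional on `ℂ` with the value `μ m / φ m` at every root of unity of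
order `m`: extend the normalized trace of the algebraic numbers. -/
lemma exists_linearMap_orderOf : ∃ E : ℂ →ₗ[ℚ] ℚ, ∀ z : ℂ, IsOfFinOrder z →
    E z = (ArithmeticFunction.moebius (orderOf z) : ℚ) / (Nat.totient (orderOf z) : ℚ) := by
  let K := algebraicClosure ℚ ℂ
  have : Algebra.IsAlgebraic ℚ K := algebraicClosure.isAlgebraic ℚ ℂ
  have : Algebra.IsIntegral ℚ K := Algebra.IsAlgebraic.isIntegral
  obtain ⟨E, hE⟩ := LinearMap.exists_extend (p := K.toSubalgebra.toSubmodule)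
    (Algebra.normalizedTrace ℚ K)
  refine ⟨E, fun z hz => ?_⟩
  have hpos : 0 < orderOf z := hz.orderOf_pos
  have hprim := IsPrimitiveRoot.orderOf z
  have hmin := Polynomial.cyclotomic_eq_minpoly_rat hprim hpos
  have hzint : IsIntegral ℚ z := (hprim.isIntegral hpos).tower_top
  have hzK : z ∈ K := (mem_algebraicClosure_iff).2 hzint.isAlgebraic
  have h1 : E z = Algebra.normalizedTrace ℚ K ⟨z, hzK⟩ :=
    LinearMap.congr_fun hE (⟨z, hzK⟩ : K)
  have h2 : minpoly ℚ (⟨z, hzK⟩ : K) = minpoly ℚ z :=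
    (minpoly.algebraMap_eq (algebraMap K ℂ).injective (⟨z, hzK⟩ : K)).symm
  rw [h1, Algebra.normalizedTrace_minpoly, h2, ← hmin, nextCoeff_cyclotomic_rat hpos,
    Polynomial.natDegree_cyclotomic, neg_neg, smul_eq_mul, div_eq_mul_inv, mul_comm]

end NormalizedTrace

section RamanujanRatio

/-- The mean of the primitive `m`-th roots of unity. -/
def meanPrimitiveRoot (m : ℕ) : ℚ := (ArithmeticFunction.moebius m : ℚ) / (Nat.totient m : ℚ)

lemma card_le_totient {m : ℕ} (s : Finset ℕ) (hs : ∀ a ∈ s, a < m ∧ Nat.Coprime m a) :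
    s.card ≤ Nat.totient m := by
  rw [Nat.totient]
  refine Finset.card_le_card fun a ha => ?_
  rw [Finset.mem_filter, Finset.mem_range]
  exact hs a ha

lemma Nat.coprime_sub_of_coprime {m a : ℕ} (ha : a ≤ m) (h : Nat.Coprime m a) :
    Nat.Coprime m (m - a) := by
  rw [Nat.coprime_comm] at h
  exact ((Nat.coprime_self_sub_right ha).2 h.symm)

lemma six_le_totient_of_odd {m : ℕ} (hm : 7 ≤ m) (hodd : Odd m) : 6 ≤ Nat.totient m := by
  have h2 : Nat.Coprime m 2 := (Nat.coprime_two_right).2 hodd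
  have h4 : Nat.Coprime m 4 := h2.pow_right 2
  have hm2 := Nat.odd_iff.1 hodd
  refine le_of_eq_of_le ?_ (card_le_totient {1, 2, 4, m - 1, m - 2, m - 4} ?_)
  · rw [Finset.card_insert_of_notMem, Finset.card_insert_of_notMem, Finset.card_insert_of_notMem,
      Finset.card_insert_of_notMem, Finset.card_insert_of_notMem, Finset.card_singleton] <;>
    · simp only [Finset.mem_insert, Finset.mem_singleton]
      omega
  · intro a ha
    simp only [Finset.mem_insert, Finset.mem_singleton] at ha
    rcases ha with rfl | rfl | rfl | rfl | rfl | rfl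
    · exact ⟨by omega, Nat.coprime_one_right m⟩
    · exact ⟨by omega, h2⟩
    · exact ⟨by omega, h4⟩
    · exact ⟨by omega, Nat.coprime_sub_of_coprime (by omega) (Nat.coprime_one_right m)⟩
    · exact ⟨by omega, Nat.coprime_sub_of_coprime (by omega) h2⟩
    · exact ⟨by omega, Nat.coprime_sub_of_coprime (by omega) h4⟩

lemma four_le_totient {m : ℕ} (hm : 7 ≤ m) : 4 ≤ Nat.totient m := by
  rcases Nat.even_or_odd m with he | ho
  · obtain ⟨k, rfl⟩ := he.two_dvd
    rcases Nat.even_or_odd k with hk | hk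
    · rw [Nat.totient_two_mul_of_even hk]
      have h1 := Nat.totient_even (n := k) (by omega)
      have h2 : 0 < Nat.totient k := Nat.totient_pos.2 (by omega)
      obtain ⟨c, hc⟩ := h1
      omega
    · rw [Nat.totient_two_mul_of_odd hk]
      rcases Nat.lt_or_ge k 7 with h7 | h7
      · obtain rfl : k = 5 := by
          obtain ⟨c, rfl⟩ := hk
          omega
        decide
      · have := six_le_totient_of_odd h7 hk
        omega
  · have := six_le_totient_of_odd hm ho
    omega

lemma abs_meanPrimitiveRoot_le {m k : ℕ} (hk : 0 < k) (h : k ≤ Nat.totient m) :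
    |meanPrimitiveRoot m| ≤ 1 / k := by
  have h0 : (0 : ℚ) < k := by exact_mod_cast hk
  have h1 : (k : ℚ) ≤ Nat.totient m := by exact_mod_cast h
  have h2 : |(ArithmeticFunction.moebius m : ℚ)| ≤ 1 := by
    exact_mod_cast ArithmeticFunction.abs_moebius_le_one (n := m)
  rw [meanPrimitiveRoot, abs_div, Nat.abs_cast]
  exact div_le_div₀ zero_le_one h2 h0 h1

lemma meanPrimitiveRoot_two : meanPrimitiveRoot 2 = -1 := by
  rw [meanPrimitiveRoot, ArithmeticFunction.moebius_apply_prime Nat.prime_two]; norm_num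

lemma meanPrimitiveRoot_three : meanPrimitiveRoot 3 = -1 / 2 := by
  rw [meanPrimitiveRoot, ArithmeticFunction.moebius_apply_prime Nat.prime_three,
    Nat.totient_prime Nat.prime_three]; norm_num

lemma meanPrimitiveRoot_four : meanPrimitiveRoot 4 = 0 := by
  rw [meanPrimitiveRoot, ArithmeticFunction.moebius_eq_zero_of_not_squarefree]
  · simp
  · intro h
    have := h 2 (by norm_num)
    norm_num at this

lemma meanPrimitiveRoot_five : meanPrimitiveRoot 5 = -1 / 4 := by
  rw [meanPrimitiveRoot, ArithmeticFunction.moebius_apply_prime Nat.prime_five,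
    Nat.totient_prime Nat.prime_five]; norm_num

lemma moebius_two_mul {k : ℕ} (hk : Odd k) :
    ArithmeticFunction.moebius (2 * k) = -ArithmeticFunction.moebius k := by
  rw [ArithmeticFunction.isMultiplicative_moebius.map_mul_of_coprime
    ((Nat.coprime_two_left).2 hk), ArithmeticFunction.moebius_apply_prime Nat.prime_two]
  ring

lemma meanPrimitiveRoot_six : meanPrimitiveRoot 6 = 1 / 2 := by
  have h3 : Odd 3 := by decide
  rw [meanPrimitiveRoot, show 6 = 2 * 3 from rfl, moebius_two_mul h3,
    Nat.totient_two_mul_of_odd h3, ArithmeticFunction.moebius_apply_prime Nat.prime_three,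
    Nat.totient_prime Nat.prime_three]
  norm_num

lemma abs_meanPrimitiveRoot_le_of_seven_le {m : ℕ} (hm : 7 ≤ m) :
    |meanPrimitiveRoot m| ≤ 1 / 4 := by
  simpa using abs_meanPrimitiveRoot_le (by norm_num) (four_le_totient hm)

lemma meanPrimitiveRoot_le {m : ℕ} (hm : 2 ≤ m) (h6 : m ≠ 6) : meanPrimitiveRoot m ≤ 1 / 4 := by
  rcases Nat.lt_or_ge m 7 with h | h
  · interval_cases m
    · rw [meanPrimitiveRoot_two]; norm_num
    · rw [meanPrimitiveRoot_three]; norm_num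
    · rw [meanPrimitiveRoot_four]; norm_num
    · rw [meanPrimitiveRoot_five]; norm_num
    · exact absurd rfl h6
  · exact (abs_le.1 (abs_meanPrimitiveRoot_le_of_seven_le h)).2

lemma meanPrimitiveRoot_le_half {m : ℕ} (hm : 2 ≤ m) : meanPrimitiveRoot m ≤ 1 / 2 := by
  by_cases h6 : m = 6
  · rw [h6, meanPrimitiveRoot_six]
  · exact (meanPrimitiveRoot_le hm h6).trans (by norm_num)

lemma meanPrimitiveRoot_le_neg_quarter {n : ℕ} (hn : 4 ≤ n)
    (h : meanPrimitiveRoot n ≤ -(1 / 4)) : n = 5 := by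
  rcases Nat.lt_or_ge n 7 with h7 | h7
  · interval_cases n
    · rw [meanPrimitiveRoot_four] at h; norm_num at h
    · rfl
    · rw [meanPrimitiveRoot_six] at h; norm_num at h
  · exfalso
    have aux : ∀ k, 7 ≤ k → Odd k → |meanPrimitiveRoot k| ≤ 1 / 6 := fun k hk ho => by
      simpa using abs_meanPrimitiveRoot_le (by norm_num) (six_le_totient_of_odd hk ho)
    rcases Nat.even_or_odd n with he | ho
    · obtain ⟨k, rfl⟩ := he.two_dvd
      rcases Nat.even_or_odd k with hk | hk
      · obtain ⟨j, rfl⟩ := hk.two_dvd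
        rw [meanPrimitiveRoot, ArithmeticFunction.moebius_eq_zero_of_not_squarefree] at h
        · norm_num at h
        · intro hs
          have := hs 2 ⟨j, by ring⟩
          norm_num at this
      · have hmul : meanPrimitiveRoot (2 * k) = -meanPrimitiveRoot k := by
          rw [meanPrimitiveRoot, moebius_two_mul hk, Nat.totient_two_mul_of_odd hk,
            meanPrimitiveRoot]
          push_cast; ring
        rw [hmul] at h
        rcases Nat.lt_or_ge k 7 with hk7 | hk7
        · obtain rfl : k = 5 := by
            obtain ⟨c, rfl⟩ := hk
            omega
          rw [meanPrimitiveRoot_five] at h; norm_num at h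
        · have := (abs_le.1 (aux k hk7 hk)).2
          linarith
    · have := (abs_le.1 (aux n h7 ho)).1
      linarith

lemma eq_six_or_of_meanPrimitiveRoot_add_eq {m m' n : ℕ} (hm : 2 ≤ m) (hm' : 2 ≤ m') (hn : 4 ≤ n)
    (h : meanPrimitiveRoot m + meanPrimitiveRoot m' = 1 + meanPrimitiveRoot n) :
    (m = 6 ∧ m' = 6) ∨ (n = 5 ∧ (m = 6 ∨ m' = 6)) := by
  by_cases h6 : m = 6 <;> by_cases h6' : m' = 6
  · exact Or.inl ⟨h6, h6'⟩
  · have h1 := meanPrimitiveRoot_le hm' h6'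
    rw [h6, meanPrimitiveRoot_six] at h
    exact Or.inr ⟨meanPrimitiveRoot_le_neg_quarter hn (by linarith), Or.inl h6⟩
  · have h1 := meanPrimitiveRoot_le hm h6
    rw [h6', meanPrimitiveRoot_six] at h
    exact Or.inr ⟨meanPrimitiveRoot_le_neg_quarter hn (by linarith), Or.inr h6'⟩
  · have h1 := meanPrimitiveRoot_le hm h6
    have h2 := meanPrimitiveRoot_le hm' h6'
    have h3 := meanPrimitiveRoot_le_neg_quarter hn (by linarith)
    rw [h3, meanPrimitiveRoot_five] at h
    linarith

lemma meanPrimitiveRoot_add_ne_of_odd {m m' n : ℕ} (hm : 2 ≤ m) (hm' : 2 ≤ m') (hn : 2 ≤ n)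
    (ho : Odd m) (ho' : Odd m') (hno : Odd n) :
    meanPrimitiveRoot m + meanPrimitiveRoot m' ≠ 1 + meanPrimitiveRoot n := by
  have aux : ∀ k, 2 ≤ k → Odd k → meanPrimitiveRoot k ≤ 1 / 6 ∧ -(1 / 2) ≤ meanPrimitiveRoot k := by
    intro k hk hko
    rcases Nat.lt_or_ge k 7 with h7 | h7
    · interval_cases k
      · exact absurd hko (by decide)
      · rw [meanPrimitiveRoot_three]; norm_num
      · exact absurd hko (by decide)
      · rw [meanPrimitiveRoot_five]; norm_num
      · exact absurd hko (by decide)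
    · have h := abs_le.1 (abs_meanPrimitiveRoot_le (by norm_num) (six_le_totient_of_odd h7 hko))
      norm_num at h
      constructor <;> linarith [h.1, h.2]
  intro h
  linarith [(aux m hm ho).1, (aux m' hm' ho').1, (aux n hn hno).2]

end RamanujanRatio

section Homologies

open Matrix

variable {Γ : Type*} [Group Γ] {ρ : Γ →* Matrix (Fin 3) (Fin 3) ℂ}

/-- The element `h` acts by `β` on the line with orthogonal projection `P`, and by `α ≠ β` on its
orthogonal complement. -/
structure IsHomology (ρ : Γ →* Matrix (Fin 3) (Fin 3) ℂ) (h : Γ) (α β : ℂ)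
    (P : Matrix (Fin 3) (Fin 3) ℂ) : Prop where
  eq : ρ h = α • 1 + (β - α) • P
  idem : P * P = P
  trace_eq : P.trace = 1
  conjTranspose_eq : Pᴴ = P
  ne : α ≠ β
  alpha_pow : α ^ Nat.card Γ = 1
  beta_pow : β ^ Nat.card Γ = 1
  alpha_sq_mul : α ^ 2 * β = 1

lemma IsSpecialUnitaryRep.exists_isHomology [Finite Γ] (hρ : IsSpecialUnitaryRep ρ) {h : Γ}
    (hreg : ¬ IsRegularElt ρ h) (hs : h ∉ scalarSubgroup ρ) : ∃ α β P, IsHomology ρ h α β P := by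
  have hpow : ρ h ^ Nat.card Γ = 1 := by rw [← map_pow, pow_card_eq_one', map_one]
  obtain ⟨S, T, d, hST, hTS, heq⟩ := exists_diagonal_of_pow_eq_one Nat.card_pos.ne' hpow
  have hd : IsDiagonalization (ρ h) S T d := ⟨hST, hTS, heq⟩
  have hdpow : ∀ i, d i ^ Nat.card Γ = 1 := fun i => by
    have h1 := hd.pow (Nat.card Γ)
    rw [hpow] at h1
    exact congrFun (h1.eq_of_eq (IsDiagonalization.one hST hTS)) i
  have hdet : d 0 * d 1 * d 2 = 1 := by
    rw [← Fin.prod_univ_three, ← hd.det, hρ.det_eq_one]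
  have hnsc : ¬ ∀ i, d i = d 0 := fun hall => hs ⟨d 0, by
    rw [heq, show d = fun _ => d 0 from funext hall, ← smul_one_eq_diagonal, mul_smul_comm,
      Matrix.mul_one, smul_mul_assoc, hST]⟩
  have hninj : ¬ Function.Injective d := fun hinj => hreg ⟨S, T, d, hd, hinj⟩
  obtain ⟨α, i, hi, hα, hdi, h3⟩ : ∃ α i, d i ≠ α ∧ α ^ Nat.card Γ = 1 ∧
      (∀ j, j ≠ i → d j = α) ∧ α ^ 2 * d i = 1 := by
    by_cases h01 : d 0 = d 1
    · refine ⟨d 0, 2, fun h2 => hnsc ?_, hdpow 0, ?_, by rw [← hdet, ← h01]; ring⟩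
      · intro i; fin_cases i <;> simp [h01, h2]
      · intro j hj; fin_cases j
        · rfl
        · exact h01.symm
        · exact absurd rfl hj
    by_cases h02 : d 0 = d 2
    · refine ⟨d 0, 1, fun h2 => h01 h2.symm, hdpow 0, ?_, by rw [← hdet, ← h02]; ring⟩
      intro j hj; fin_cases j
      · rfl
      · exact absurd rfl hj
      · exact h02.symm
    by_cases h12 : d 1 = d 2
    · refine ⟨d 1, 0, h01, hdpow 1, ?_, by rw [← hdet, ← h12]; ring⟩
      intro j hj; fin_cases j
      · exact absurd rfl hj
      · rfl
      · exact h12.symm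
    · exfalso
      refine hninj fun a b hab => ?_
      fin_cases a <;> fin_cases b <;> first | rfl | (exfalso; simp at hab; tauto)
  have hsplit : d = fun j => α + (d i - α) * Pi.single (M := fun _ => ℂ) i 1 j := by
    funext j
    by_cases hj : j = i
    · subst hj; simp
    · rw [hdi j hj, Pi.single_eq_of_ne hj]; ring
  let P := S * diagonal (Pi.single i (1 : ℂ)) * T
  have hP : IsDiagonalization P S T (Pi.single i (1 : ℂ)) := ⟨hST, hTS, rfl⟩
  have heqP : ρ h = α • 1 + (d i - α) • P := by
    have h1 : diagonal d = α • (1 : Matrix (Fin 3) (Fin 3) ℂ) +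
        (d i - α) • diagonal (Pi.single i (1 : ℂ)) := by
      rw [smul_one_eq_diagonal, ← diagonal_smul, diagonal_add]
      conv_lhs => rw [hsplit]
      rfl
    rw [heq, h1, Matrix.mul_add, Matrix.add_mul, mul_smul_comm, Matrix.mul_one, smul_mul_assoc,
      hST, mul_smul_comm, smul_mul_assoc]
  have hα0 : α ≠ 0 := by rintro rfl; simp at h3
  have hβ0 : d i ≠ 0 := by intro h0; simp [h0] at h3
  have hidem : P * P = P := by
    have h1 := hP.mul hP
    rw [h1.eq]
    have : (Pi.single i (1 : ℂ) * Pi.single i (1 : ℂ) : Fin 3 → ℂ) = Pi.single i 1 := by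
      rw [← Pi.single_mul, one_mul]
    rw [this]
  refine ⟨α, d i, P, heqP, hidem, ?_, ?_, hi.symm, hα, hdpow i, h3⟩
  · rw [hP.trace, Finset.sum_pi_single']; simp
  · have hnα : starRingEnd ℂ α = α⁻¹ := by
      rw [Complex.inv_eq_conj (Complex.norm_eq_one_of_pow_eq_one hα Nat.card_pos.ne')]
    have hnβ : starRingEnd ℂ (d i) = (d i)⁻¹ := by
      rw [Complex.inv_eq_conj (Complex.norm_eq_one_of_pow_eq_one (hdpow i) Nat.card_pos.ne')]
    have hinv : ρ h⁻¹ = α⁻¹ • 1 + ((d i)⁻¹ - α⁻¹) • P := by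
      have h1 : ρ h * ρ h⁻¹ = 1 := by rw [← map_mul, mul_inv_cancel, map_one]
      have h2 : (α⁻¹ • 1 + ((d i)⁻¹ - α⁻¹) • P) * ρ h = 1 := by
        rw [heqP]
        simp only [Matrix.add_mul, Matrix.mul_add, smul_mul_smul_comm, hidem, Matrix.one_mul,
          Matrix.mul_one]
        rw [inv_mul_cancel₀ hα0, one_smul, add_assoc, ← add_smul, ← add_smul]
        have : ((d i)⁻¹ - α⁻¹) * α + (α⁻¹ * (d i - α) + ((d i)⁻¹ - α⁻¹) * (d i - α)) = 0 := by
          field_simp; ring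
        rw [this, zero_smul, add_zero]
      exact (left_inv_eq_right_inv h2 h1).symm
    have hstar := hρ.map_inv h
    rw [hinv, heqP, conjTranspose_add, conjTranspose_smul, conjTranspose_smul, conjTranspose_one,
      star_sub] at hstar
    simp only [Complex.star_def, hnα, hnβ] at hstar
    have h5 := add_left_cancel hstar
    have h6 : (d i)⁻¹ - α⁻¹ ≠ 0 := sub_ne_zero.2 fun h => hi (inv_injective h)
    exact (smul_right_injective _ h6 h5).symm

namespace IsHomology

variable {h : Γ} {α β : ℂ} {P : Matrix (Fin 3) (Fin 3) ℂ}

lemma alpha_ne_zero (H : IsHomology ρ h α β P) : α ≠ 0 := by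
  intro h0
  simpa [h0] using H.alpha_sq_mul

lemma beta_ne_zero (H : IsHomology ρ h α β P) : β ≠ 0 := by
  intro h0
  simpa [h0] using H.alpha_sq_mul

lemma inv (H : IsHomology ρ h α β P) : IsHomology ρ h⁻¹ α⁻¹ β⁻¹ P := by
  refine ⟨?_, H.idem, H.trace_eq, H.conjTranspose_eq, fun h => H.ne (inv_injective h),
    by rw [inv_pow, H.alpha_pow, inv_one], by rw [inv_pow, H.beta_pow, inv_one],
    by rw [inv_pow, ← _root_.mul_inv, H.alpha_sq_mul, inv_one]⟩
  have h1 : ρ h * ρ h⁻¹ = 1 := by rw [← map_mul, mul_inv_cancel, map_one]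
  have h2 : (α⁻¹ • 1 + (β⁻¹ - α⁻¹) • P) * ρ h = 1 := by
    rw [H.eq]
    simp only [Matrix.add_mul, Matrix.mul_add, smul_mul_smul_comm, H.idem, Matrix.one_mul,
      Matrix.mul_one]
    have hα0 := H.alpha_ne_zero
    have hβ0 := H.beta_ne_zero
    rw [inv_mul_cancel₀ hα0, one_smul, add_assoc, ← add_smul, ← add_smul]
    have : (β⁻¹ - α⁻¹) * α + (α⁻¹ * (β - α) + (β⁻¹ - α⁻¹) * (β - α)) = 0 := by
      field_simp; ring
    rw [this, zero_smul, add_zero]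
  exact (left_inv_eq_right_inv h2 h1).symm

lemma conj (hρ : IsSpecialUnitaryRep ρ) (H : IsHomology ρ h α β P) (g : Γ) :
    IsHomology ρ (g * h * g⁻¹) α β (ρ g * P * ρ g⁻¹) := by
  have h1 : ρ g * ρ g⁻¹ = 1 := by rw [← map_mul, mul_inv_cancel, map_one]
  have h2 : ρ g⁻¹ * ρ g = 1 := by rw [← map_mul, inv_mul_cancel, map_one]
  refine ⟨?_, ?_, ?_, ?_, H.ne, H.alpha_pow, H.beta_pow, H.alpha_sq_mul⟩
  · rw [map_mul, map_mul, H.eq, Matrix.mul_add, Matrix.add_mul, mul_smul_comm, Matrix.mul_one,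
      smul_mul_assoc, h1, mul_smul_comm, smul_mul_assoc]
  · calc ρ g * P * ρ g⁻¹ * (ρ g * P * ρ g⁻¹) = ρ g * P * (ρ g⁻¹ * ρ g) * P * ρ g⁻¹ := by
          simp only [Matrix.mul_assoc]
      _ = ρ g * (P * P) * ρ g⁻¹ := by rw [h2]; simp only [Matrix.mul_assoc, Matrix.one_mul]
      _ = _ := by rw [H.idem]
  · rw [trace_mul_cycle, h2, Matrix.one_mul, H.trace_eq]
  · rw [conjTranspose_mul, conjTranspose_mul, H.conjTranspose_eq, hρ.map_inv,
      conjTranspose_conjTranspose, Matrix.mul_assoc]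

lemma trace_mul {h' : Γ} {α' β' : ℂ} {P' : Matrix (Fin 3) (Fin 3) ℂ} (H : IsHomology ρ h α β P)
    (H' : IsHomology ρ h' α' β' P') : (ρ (h * h')).trace =
      3 * α * α' + α * (β' - α') + (β - α) * α' + (β - α) * (β' - α') * (P * P').trace := by
  rw [map_mul, H.eq, H'.eq]
  simp only [Matrix.add_mul, Matrix.mul_add, smul_mul_smul_comm, Matrix.one_mul,
    Matrix.mul_one, trace_add, trace_smul, H.trace_eq, H'.trace_eq, trace_one, Fintype.card_fin,
    smul_eq_mul]
  push_cast; ring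

open scoped ComplexOrder in
lemma commute_of_trace_eq_zero {h' : Γ} {α' β' : ℂ} {P' : Matrix (Fin 3) (Fin 3) ℂ}
    (H : IsHomology ρ h α β P) (H' : IsHomology ρ h' α' β' P') (h0 : (P * P').trace = 0) :
    P * P' = 0 ∧ P' * P = 0 := by
  have h1 : (P' * P)ᴴ = P * P' := by
    rw [conjTranspose_mul, H.conjTranspose_eq, H'.conjTranspose_eq]
  have h2 : P' * P = 0 := by
    rw [← trace_conjTranspose_mul_self_eq_zero_iff, h1]
    rw [show P * P' * (P' * P) = P * (P' * P') * P by simp only [Matrix.mul_assoc], H'.idem,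
      trace_mul_comm, ← Matrix.mul_assoc, H.idem, h0]
  exact ⟨by rw [← h1, h2, conjTranspose_zero], h2⟩

open scoped ComplexOrder in
lemma eq_of_trace_eq_one {h' : Γ} {α' β' : ℂ} {P' : Matrix (Fin 3) (Fin 3) ℂ}
    (H : IsHomology ρ h α β P) (H' : IsHomology ρ h' α' β' P') (h0 : (P * P').trace = 1) :
    P = P' := by
  rw [← sub_eq_zero, ← trace_conjTranspose_mul_self_eq_zero_iff, conjTranspose_sub,
    H.conjTranspose_eq, H'.conjTranspose_eq, Matrix.sub_mul, Matrix.mul_sub, Matrix.mul_sub,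
    H.idem, H'.idem, trace_sub, trace_sub, trace_sub, H.trace_eq, H'.trace_eq, h0,
    trace_mul_comm, h0]
  norm_num

lemma commute_of_mul_comm (hρ : IsSpecialUnitaryRep ρ) {h' : Γ} {α' β' : ℂ}
    {P' : Matrix (Fin 3) (Fin 3) ℂ}
    (H : IsHomology ρ h α β P) (H' : IsHomology ρ h' α' β' P') (hc : P * P' = P' * P) :
    h * h' = h' * h := by
  apply hρ.injective
  rw [map_mul, map_mul, H.eq, H'.eq]
  simp only [Matrix.add_mul, Matrix.mul_add, smul_mul_smul_comm, Matrix.one_mul,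
    Matrix.mul_one, hc]
  rw [mul_comm α, mul_comm (β - α), mul_comm α, mul_comm (β - α)]
  abel

lemma commute_of_trace (hρ : IsSpecialUnitaryRep ρ) {h' : Γ} {α' β' : ℂ}
    {P' : Matrix (Fin 3) (Fin 3) ℂ}
    (H : IsHomology ρ h α β P) (H' : IsHomology ρ h' α' β' P')
    (hc : (P * P').trace = 0 ∨ (P * P').trace = 1) : h * h' = h' * h := by
  apply H.commute_of_mul_comm hρ H'
  rcases hc with hc | hc
  · rw [(H.commute_of_trace_eq_zero H' hc).1, (H.commute_of_trace_eq_zero H' hc).2]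
  · rw [H.eq_of_trace_eq_one H' hc]

end IsHomology

lemma IsSpecialUnitaryRep.exists_add_inv_eq [Finite Γ] (hρ : IsSpecialUnitaryRep ρ) (x : Γ)
    {γ τ : ℂ} (hγ : γ ^ Nat.card Γ = 1) (h1 : γ * (ρ x).trace = γ ^ 3 + τ)
    (h2 : γ⁻¹ * (ρ x⁻¹).trace = (γ ^ 3)⁻¹ + τ) :
    ∃ z : ℂ, z ^ Nat.card Γ = 1 ∧ τ = z + z⁻¹ := by
  have hpow : ρ x ^ Nat.card Γ = 1 := by rw [← map_pow, pow_card_eq_one', map_one]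
  obtain ⟨S, T, d, hST, hTS, heq⟩ := exists_diagonal_of_pow_eq_one Nat.card_pos.ne' hpow
  have hd : IsDiagonalization (ρ x) S T d := ⟨hST, hTS, heq⟩
  have hdpow : ∀ i, d i ^ Nat.card Γ = 1 := fun i => by
    have h1 := hd.pow (Nat.card Γ)
    rw [hpow] at h1
    exact congrFun (h1.eq_of_eq (IsDiagonalization.one hST hTS)) i
  have hdet : d 0 * d 1 * d 2 = 1 := by
    rw [← Fin.prod_univ_three, ← hd.det, hρ.det_eq_one]
  have hγ0 : γ ≠ 0 := by
    rintro rfl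
    rw [zero_pow Nat.card_pos.ne'] at hγ
    exact zero_ne_one hγ
  have htr : (ρ x).trace = d 0 + d 1 + d 2 := by rw [hd.trace, Fin.sum_univ_three]
  have hdi : IsDiagonalization (ρ x⁻¹) S T (fun i => (d i)⁻¹) := by
    refine ⟨hST, hTS, ?_⟩
    have h3 : ρ x⁻¹ * ρ x = 1 := by rw [← map_mul, inv_mul_cancel, map_one]
    have h4 : ρ x * (S * diagonal (fun i => (d i)⁻¹) * T) = 1 := by
      rw [heq, show S * diagonal d * T * (S * diagonal (fun i => (d i)⁻¹) * T) =
        S * (diagonal d * (T * S) * diagonal (fun i => (d i)⁻¹)) * T by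
          simp only [Matrix.mul_assoc], hTS, Matrix.mul_one, diagonal_mul_diagonal]
      have : (fun i => d i * (d i)⁻¹) = fun _ => (1 : ℂ) := by
        funext i
        refine mul_inv_cancel₀ fun h0 => ?_
        have := hdpow i
        rw [h0, zero_pow Nat.card_pos.ne'] at this
        exact zero_ne_one this
      rw [this, diagonal_one, Matrix.mul_one, hST]
    exact left_inv_eq_right_inv h3 h4
  have htri : (ρ x⁻¹).trace = d 0 * d 1 + d 0 * d 2 + d 1 * d 2 := by
    rw [hdi.trace, Fin.sum_univ_three]
    have a0 : d 0 ≠ 0 := by intro h0; simp [h0] at hdet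
    have a1 : d 1 ≠ 0 := by intro h0; simp [h0] at hdet
    have a2 : d 2 ≠ 0 := by intro h0; simp [h0] at hdet
    field_simp
    linear_combination (-(d 0 * d 1 + d 0 * d 2 + d 1 * d 2)) * hdet
  rw [htr] at h1
  rw [htri] at h2
  have h2' : γ ^ 2 * (d 0 * d 1 + d 0 * d 2 + d 1 * d 2) = 1 + τ * γ ^ 3 := by
    field_simp at h2
    linear_combination h2
  have hroot : (γ * d 0 - γ ^ 3) * ((γ * d 1 - γ ^ 3) * (γ * d 2 - γ ^ 3)) = 0 := by
    linear_combination γ ^ 3 * hdet - γ ^ 3 * h2' + γ ^ 6 * h1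
  have key : ∀ a b c : ℂ, a * b * c = 1 → γ * (a + b + c) = γ ^ 3 + τ → γ * a - γ ^ 3 = 0 →
      b ^ Nat.card Γ = 1 → ∃ z : ℂ, z ^ Nat.card Γ = 1 ∧ τ = z + z⁻¹ := by
    intro a b c habc hs h0 hb
    refine ⟨γ * b, by rw [mul_pow, hγ, hb, one_mul], ?_⟩
    have ha : a = γ ^ 2 := by
      apply mul_left_cancel₀ hγ0
      linear_combination h0
    have : (γ * b)⁻¹ = γ * c := by
      apply inv_eq_of_mul_eq_one_right
      rw [← habc, ha]; ring
    rw [this, ← sub_eq_zero]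
    linear_combination h0 - hs
  rcases mul_eq_zero.1 hroot with h | h
  · exact key _ _ _ hdet h1 h (hdpow 1)
  rcases mul_eq_zero.1 h with h | h
  · exact key (d 1) (d 0) (d 2) (by linear_combination hdet) (by linear_combination h1) h (hdpow 0)
  · exact key (d 2) (d 0) (d 1) (by linear_combination hdet) (by linear_combination h1) h (hdpow 0)

lemma IsHomology.exists_add_inv_eq [Finite Γ] (hρ : IsSpecialUnitaryRep ρ) {h h' : Γ} {α β : ℂ}
    {P P' : Matrix (Fin 3) (Fin 3) ℂ} (H : IsHomology ρ h α β P) (H' : IsHomology ρ h' α β P') :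
    ∃ z w : ℂ, z ^ Nat.card Γ = 1 ∧ w ^ Nat.card Γ = 1 ∧
      (2 - β / α - (β / α)⁻¹) * (1 - (P * P').trace) = 2 - z - z⁻¹ ∧
      (2 - β / α - (β / α)⁻¹) * (P * P').trace = 2 - w - w⁻¹ := by
  have hα := H.alpha_ne_zero
  have hβ := H.beta_ne_zero
  have h3 := H.alpha_sq_mul
  have hβ' : β = (α ^ 2)⁻¹ := by
    rw [eq_comm]
    exact inv_eq_of_mul_eq_one_right h3
  set c := (P * P').trace with hc
  have hc' : (P' * P).trace = c := by rw [trace_mul_comm]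
  obtain ⟨z, hz, hz'⟩ := hρ.exists_add_inv_eq (h * h'⁻¹) (γ := 1)
    (τ := 2 - (2 - β / α - (β / α)⁻¹) * (1 - c)) (one_pow _)
    (by rw [H.trace_mul H'.inv, ← hc]; field_simp; ring)
    (by rw [_root_.mul_inv_rev, inv_inv, H'.trace_mul H.inv, hc']; field_simp; ring)
  obtain ⟨w, hw, hw'⟩ := hρ.exists_add_inv_eq (h * h') (γ := α)
    (τ := 2 - (2 - β / α - (β / α)⁻¹) * c) H.alpha_pow
    (by rw [H.trace_mul H', ← hc, hβ']; field_simp; ring)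
    (by rw [_root_.mul_inv_rev, H'.inv.trace_mul H.inv, hc', hβ']; field_simp; ring)
  exact ⟨z, w, hz, hw, by linear_combination -hz', by linear_combination -hw'⟩

end Homologies

section HomologyOrders

open Matrix

lemma exists_linearMap_add_inv : ∃ E : ℂ →ₗ[ℚ] ℚ, E 1 = 1 ∧ ∀ (z : ℂ) (N : ℕ), N ≠ 0 → z ^ N = 1 →
    E (z + z⁻¹) = 2 * meanPrimitiveRoot (orderOf z) := by
  obtain ⟨E, hE⟩ := exists_linearMap_orderOf
  refine ⟨E, ?_, fun z N hN hz => ?_⟩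
  · rw [hE 1 IsOfFinOrder.one]; simp
  · have h1 : IsOfFinOrder z := isOfFinOrder_iff_pow_eq_one.2 ⟨N, Nat.pos_of_ne_zero hN, hz⟩
    have h2 := (IsPrimitiveRoot.orderOf z).inv
    have h3 : orderOf z⁻¹ = orderOf z := h2.eq_orderOf.symm
    have h4 : IsOfFinOrder z⁻¹ := isOfFinOrder_iff_pow_eq_one.2
      ⟨N, Nat.pos_of_ne_zero hN, by rw [inv_pow, hz, inv_one]⟩
    rw [map_add, hE z h1, hE _ h4, h3, meanPrimitiveRoot]
    ring

lemma two_le_orderOf_of_pow_eq_one {z : ℂ} {N : ℕ} (hN : N ≠ 0) (hz : z ^ N = 1) (h1 : z ≠ 1) :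
    2 ≤ orderOf z := by
  have h2 : 0 < orderOf z := orderOf_pos_iff.2
    (isOfFinOrder_iff_pow_eq_one.2 ⟨N, Nat.pos_of_ne_zero hN, hz⟩)
  have h3 : orderOf z ≠ 1 := fun h => h1 (orderOf_eq_one_iff.1 h)
  omega

lemma exists_conj_not_commute {G : Type*} [Group G] [IsSimpleGroup G]
    (hna : ∃ a b : G, a * b ≠ b * a) {k : G} (hk : k ≠ 1) :
    ∃ g, k * (g * k * g⁻¹) ≠ g * k * g⁻¹ * k := by
  by_contra! hall
  have h1 : Subgroup.normalClosure {k} ≤ Subgroup.centralizer {k} := by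
    rw [Subgroup.normalClosure, Subgroup.closure_le]
    intro x hx
    obtain ⟨y, hy, hxy⟩ := Group.mem_conjugatesOfSet_iff.1 hx
    obtain rfl := Set.mem_singleton_iff.1 hy
    obtain ⟨g, rfl⟩ := isConj_iff.1 hxy
    exact Subgroup.mem_centralizer_singleton_iff.2 (hall g).symm
  have h2 : Subgroup.normalClosure {k} = ⊤ :=
    ((Subgroup.normalClosure_normal (s := {k})).eq_bot_or_eq_top).resolve_left fun h => hk (by
      have := Subgroup.subset_normalClosure (Set.mem_singleton k)
      rw [h] at this
      exact Subgroup.mem_bot.1 this)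
  rw [h2] at h1
  have h3 : k ∈ Subgroup.center G := Subgroup.mem_center_iff.2 fun g =>
    Subgroup.mem_centralizer_singleton_iff.1 (h1 (Subgroup.mem_top g))
  have h4 : Subgroup.center G = ⊤ :=
    ((inferInstance : (Subgroup.center G).Normal).eq_bot_or_eq_top).resolve_left fun h => hk (by
      rw [h] at h3
      exact Subgroup.mem_bot.1 h3)
  obtain ⟨a, b, hab⟩ := hna
  exact hab (Subgroup.mem_center_iff.1 (h4 ▸ Subgroup.mem_top b) a)

variable {Γ : Type*} [Group Γ] {ρ : Γ →* Matrix (Fin 3) (Fin 3) ℂ} {h h' : Γ} {α β : ℂ}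
  {P P' : Matrix (Fin 3) (Fin 3) ℂ}

namespace IsHomology

lemma ratio_pow (H : IsHomology ρ h α β P) : (β / α) ^ Nat.card Γ = 1 := by
  rw [div_pow, H.alpha_pow, H.beta_pow, div_one]

lemma ratio_ne_one (H : IsHomology ρ h α β P) : β / α ≠ 1 := by
  rw [Ne, div_eq_one_iff_eq H.alpha_ne_zero]
  exact H.ne.symm

lemma two_sub_ne_zero (H : IsHomology ρ h α β P) : 2 - β / α - (β / α)⁻¹ ≠ 0 := by
  have h0 : β / α ≠ 0 := div_ne_zero H.beta_ne_zero H.alpha_ne_zero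
  have h1 : 2 - β / α - (β / α)⁻¹ = -(β / α - 1) ^ 2 * (β / α)⁻¹ := by
    generalize β / α = z at h0 ⊢
    field_simp; ring
  rw [h1]
  exact mul_ne_zero (neg_ne_zero.2 (pow_ne_zero _ (sub_ne_zero.2 H.ratio_ne_one))) (inv_ne_zero h0)

lemma exists_add_inv_eq_of_not_commute [Finite Γ] (hρ : IsSpecialUnitaryRep ρ)
    (H : IsHomology ρ h α β P) (H' : IsHomology ρ h' α β P')
    (hc0 : (P * P').trace ≠ 0) (hc1 : (P * P').trace ≠ 1) :
    ∃ z w : ℂ, z ^ Nat.card Γ = 1 ∧ w ^ Nat.card Γ = 1 ∧ 2 ≤ orderOf z ∧ 2 ≤ orderOf w ∧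
      (2 - (β / α + (β / α)⁻¹)) * (1 - (P * P').trace) = 2 - (z + z⁻¹) ∧
      (2 - (β / α + (β / α)⁻¹)) * (P * P').trace = 2 - (w + w⁻¹) := by
  obtain ⟨z, w, hz, hw, h1, h2⟩ := H.exists_add_inv_eq hρ H'
  have hs := H.two_sub_ne_zero
  refine ⟨z, w, hz, hw, two_le_orderOf_of_pow_eq_one Nat.card_pos.ne' hz ?_,
    two_le_orderOf_of_pow_eq_one Nat.card_pos.ne' hw ?_, by rw [← sub_sub, h1]; ring,
    by rw [← sub_sub, h2]; ring⟩
  · rintro rfl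
    rw [inv_one, show (2 : ℂ) - 1 - 1 = 0 by norm_num] at h1
    rcases mul_eq_zero.1 h1 with h3 | h3
    · exact hs h3
    · exact hc1 (sub_eq_zero.1 h3).symm
  · rintro rfl
    rw [inv_one, show (2 : ℂ) - 1 - 1 = 0 by norm_num] at h2
    rcases mul_eq_zero.1 h2 with h3 | h3
    · exact hs h3
    · exact hc0 h3

lemma meanPrimitiveRoot_add_eq {ζ z w c : ℂ} {N : ℕ} (hN : N ≠ 0) (hζ : ζ ^ N = 1) (hz : z ^ N = 1)
    (hw : w ^ N = 1) (h1 : (2 - (ζ + ζ⁻¹)) * (1 - c) = 2 - (z + z⁻¹))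
    (h2 : (2 - (ζ + ζ⁻¹)) * c = 2 - (w + w⁻¹)) :
    meanPrimitiveRoot (orderOf z) + meanPrimitiveRoot (orderOf w) =
      1 + meanPrimitiveRoot (orderOf ζ) := by
  obtain ⟨E, hE1, hE⟩ := exists_linearMap_add_inv
  have h3 : (z + z⁻¹) + (w + w⁻¹) = (2 : ℚ) • (1 : ℂ) + (ζ + ζ⁻¹) := by
    rw [Rat.smul_def]; push_cast
    linear_combination h1 + h2
  have h4 := congrArg E h3
  rw [map_add, map_add E ((2 : ℚ) • (1 : ℂ)), map_smul, hE1, hE z N hN hz, hE w N hN hw,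
    hE ζ N hN hζ, smul_eq_mul] at h4
  linarith

/-- A group of odd order with a simple nonabelian quotient contains no homologies. -/
lemma false_of_odd [Finite Γ] {G : Type*} [Group G] [IsSimpleGroup G]
    (hna : ∃ a b : G, a * b ≠ b * a) {π : Γ →* G} (hsurj : Function.Surjective π)
    (hρ : IsSpecialUnitaryRep ρ) (hodd : Odd (Nat.card Γ)) (H : IsHomology ρ h α β P)
    (hh : π h ≠ 1) : False := by
  obtain ⟨g, hg⟩ := exists_conj_not_commute hna hh
  obtain ⟨g, rfl⟩ := hsurj g
  have hnc : h * (g * h * g⁻¹) ≠ g * h * g⁻¹ * h := fun h1 => hg (by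
    simpa only [_root_.map_mul, _root_.map_inv] using congrArg π h1)
  have H' := H.conj hρ g
  obtain ⟨z, w, hz, hw, h2, h2', h3, h4⟩ := H.exists_add_inv_eq_of_not_commute hρ H'
    (fun h0 => hnc (H.commute_of_trace hρ H' (Or.inl h0)))
    (fun h0 => hnc (H.commute_of_trace hρ H' (Or.inr h0)))
  have key := meanPrimitiveRoot_add_eq Nat.card_pos.ne' H.ratio_pow hz hw h3 h4
  have ho : ∀ u : ℂ, u ^ Nat.card Γ = 1 → Odd (orderOf u) := fun u hu =>
    hodd.of_dvd_nat (orderOf_dvd_of_pow_eq_one hu)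
  exact meanPrimitiveRoot_add_ne_of_odd h2 h2'
    (two_le_orderOf_of_pow_eq_one Nat.card_pos.ne' H.ratio_pow H.ratio_ne_one)
    (ho _ hz) (ho _ hw) (ho _ H.ratio_pow) key

lemma add_inv_eq_one_of_orderOf_eq_six {z : ℂ} (h : orderOf z = 6) : z + z⁻¹ = 1 := by
  have h6 : z ^ 6 = 1 := by rw [← h, pow_orderOf_eq_one]
  have h2 : z ^ 2 ≠ 1 := fun h2 => by
    have := Nat.le_of_dvd (by norm_num) (orderOf_dvd_of_pow_eq_one h2); omega
  have h3 : z ^ 3 ≠ 1 := fun h3 => by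
    have := Nat.le_of_dvd (by norm_num) (orderOf_dvd_of_pow_eq_one h3); omega
  have hz : z ≠ 0 := by rintro rfl; norm_num at h6
  have h4 : (z ^ 3 - 1) * ((z + 1) * (z ^ 2 - z + 1)) = 0 := by linear_combination h6
  have h5 := (mul_eq_zero.1 h4).resolve_left (sub_ne_zero.2 h3)
  have h7 : z ^ 2 - z + 1 = 0 := (mul_eq_zero.1 h5).resolve_left fun h8 => h2 (by
    linear_combination (z - 1) * h8)
  field_simp
  linear_combination h7

lemma add_inv_of_orderOf_eq_five {z : ℂ} (h : orderOf z = 5) :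
    (z + z⁻¹) ^ 2 + (z + z⁻¹) = 1 := by
  have h5 : z ^ 5 = 1 := by rw [← h, pow_orderOf_eq_one]
  have h1 : z ≠ 1 := by rintro rfl; simp at h
  have hz : z ≠ 0 := by rintro rfl; norm_num at h5
  have h2 : (z - 1) * (z ^ 4 + z ^ 3 + z ^ 2 + z + 1) = 0 := by linear_combination h5
  have h3 := (mul_eq_zero.1 h2).resolve_left (sub_ne_zero.2 h1)
  field_simp
  linear_combination h3

/-- The value of the normalized trace at the trace of a product of two projections. -/
lemma map_trace_eq_half {E : ℂ →ₗ[ℚ] ℚ} (hE1 : E 1 = 1)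
    (hE : ∀ (z : ℂ) (N : ℕ), N ≠ 0 → z ^ N = 1 → E (z + z⁻¹) = 2 * meanPrimitiveRoot (orderOf z))
    {ζ z w c : ℂ} {N : ℕ} (hN : N ≠ 0) (hζ : ζ ^ N = 1) (hz : z ^ N = 1)
    (hw : w ^ N = 1) (h1 : (2 - (ζ + ζ⁻¹)) * (1 - c) = 2 - (z + z⁻¹))
    (h2 : (2 - (ζ + ζ⁻¹)) * c = 2 - (w + w⁻¹)) (h4 : 4 ≤ orderOf ζ) (hz2 : 2 ≤ orderOf z)
    (hw2 : 2 ≤ orderOf w) : E c = 1 / 2 ∧ 1 / 4 ≤ E (c ^ 2) := by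
  have hEq : ∀ q : ℚ, E (q : ℂ) = q := fun q => by
    have : (q : ℂ) = q • (1 : ℂ) := by rw [Rat.smul_def, mul_one]
    rw [this, map_smul, hE1, smul_eq_mul, mul_one]
  rcases eq_six_or_of_meanPrimitiveRoot_add_eq hz2 hw2 h4
    (meanPrimitiveRoot_add_eq hN hζ hz hw h1 h2) with ⟨hz6, hw6⟩ | ⟨h5, h6⟩
  · rw [add_inv_eq_one_of_orderOf_eq_six hz6] at h1
    rw [add_inv_eq_one_of_orderOf_eq_six hw6] at h2
    have hc : c = ((1 / 2 : ℚ) : ℂ) := by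
      push_cast
      linear_combination (1 / 2 : ℂ) * h2 - (c / 2) * (h1 + h2)
    constructor
    · rw [hc, hEq]
    · rw [hc, show (((1 / 2 : ℚ) : ℂ)) ^ 2 = ((1 / 4 : ℚ) : ℂ) by push_cast; norm_num, hEq]
  · have hw5 := add_inv_of_orderOf_eq_five h5
    have hEζ : E (ζ + ζ⁻¹) = -1 / 2 := by
      rw [hE ζ N hN hζ, h5, meanPrimitiveRoot_five]; norm_num
    set t := ζ + ζ⁻¹ with ht
    have hE3 : E (((3 / 5 : ℚ) : ℂ) + (1 / 5 : ℚ) • t) = 1 / 2 := by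
      rw [map_add, hEq, map_smul, hEζ]; norm_num
    have hE2 : E (((2 / 5 : ℚ) : ℂ) - (1 / 5 : ℚ) • t) = 1 / 2 := by
      rw [map_sub, hEq, map_smul, hEζ]; norm_num
    have hcc : c = ((3 / 5 : ℚ) : ℂ) + (1 / 5 : ℚ) • t ∨
        c = ((2 / 5 : ℚ) : ℂ) - (1 / 5 : ℚ) • t := by
      rcases h6 with h6 | h6
      · rw [add_inv_eq_one_of_orderOf_eq_six h6] at h1
        right
        rw [Rat.smul_def]; push_cast
        linear_combination (-(3 + t) / 5) * h1 + ((1 - c) / 5) * (-hw5)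
      · rw [add_inv_eq_one_of_orderOf_eq_six h6] at h2
        left
        rw [Rat.smul_def]; push_cast
        linear_combination ((3 + t) / 5) * h2 + (c / 5) * hw5
    have hsq : c ^ 2 = c - ((1 / 5 : ℚ) : ℂ) := by
      rcases hcc with hc | hc
      · rw [hc, Rat.smul_def]; push_cast
        linear_combination (1 / 25 : ℂ) * hw5
      · rw [hc, Rat.smul_def]; push_cast
        linear_combination (1 / 25 : ℂ) * hw5
    have hEc : E c = 1 / 2 := by rcases hcc with hc | hc <;> rw [hc] <;> assumption
    refine ⟨hEc, ?_⟩
    rw [hsq, map_sub, hEc, hEq]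
    norm_num

lemma ratio_sq_eq_one_or [Fintype Γ] (hρ : IsSpecialUnitaryRep ρ) (hf : HasFlipCommutant ρ)
    (H : IsHomology ρ h α β P) : (β / α) ^ 2 = 1 ∨ ((β / α) ^ 3 = 1 ∧
      ∃ g, (P * (ρ g * P * ρ g⁻¹)).trace = 0) := by
  obtain ⟨E, hE1, hE⟩ := exists_linearMap_add_inv
  have hEq : ∀ q : ℚ, E (q : ℂ) = q := fun q => by
    have : (q : ℂ) = q • (1 : ℂ) := by rw [Rat.smul_def, mul_one]
    rw [this, map_smul, hE1, smul_eq_mul, mul_one]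
  have hN : Nat.card Γ ≠ 0 := Nat.card_pos.ne'
  have hs1 := congrArg E (hf.hasScalarCommutant.sum_trace_conj H.trace_eq)
  have hs2 := congrArg E (hf.sum_trace_conj_sq H.trace_eq H.idem)
  rw [show (Fintype.card Γ : ℂ) / 3 = ((Fintype.card Γ / 3 : ℚ) : ℂ) by push_cast; rfl, hEq,
    map_sum] at hs1
  rw [show (Fintype.card Γ : ℂ) / 6 = ((Fintype.card Γ / 6 : ℚ) : ℂ) by push_cast; rfl, hEq,
    map_sum] at hs2
  have hone : (P * (ρ 1 * P * ρ 1⁻¹)).trace = 1 := by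
    rw [inv_one, map_one, Matrix.one_mul, Matrix.mul_one, H.idem, H.trace_eq]
  by_cases h2 : (β / α) ^ 2 = 1
  · exact Or.inl h2
  by_cases h3 : (β / α) ^ 3 = 1
  · refine Or.inr ⟨h3, ?_⟩
    by_contra! hne
    have hord : orderOf (β / α) = 3 := by
      have := orderOf_eq_prime (p := 3) h3 H.ratio_ne_one
      exact this
    have hle : ∀ g ∈ Finset.univ, (1 / 3 : ℚ) ≤ E (P * (ρ g * P * ρ g⁻¹)).trace := by
      intro g _
      by_cases hc1 : (P * (ρ g * P * ρ g⁻¹)).trace = 1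
      · rw [hc1, hE1]; norm_num
      · obtain ⟨z, w, hz, hw, hz2, hw2, h5, h6⟩ :=
          H.exists_add_inv_eq_of_not_commute hρ (H.conj hρ g) (hne g) hc1
        have hζ3 : β / α + (β / α)⁻¹ = -1 := by
          have h0 : β / α ≠ 0 := div_ne_zero H.beta_ne_zero H.alpha_ne_zero
          have h1 := H.ratio_ne_one
          generalize β / α = u at h0 h1 h3 ⊢
          have h7 : (u - 1) * (u ^ 2 + u + 1) = 0 := by linear_combination h3
          have h8 := (mul_eq_zero.1 h7).resolve_left (sub_ne_zero.2 h1)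
          field_simp
          linear_combination h8
        rw [hζ3] at h6
        have h7 : (3 : ℚ) • (P * (ρ g * P * ρ g⁻¹)).trace = ((2 : ℚ) : ℂ) - (w + w⁻¹) := by
          rw [Rat.smul_def]; push_cast
          linear_combination h6
        have h8 := congrArg E h7
        rw [map_smul, map_sub, hEq, hE w _ hN hw, smul_eq_mul] at h8
        linarith [meanPrimitiveRoot_le_half hw2]
    have hlt := Finset.sum_lt_sum hle ⟨1, Finset.mem_univ 1, by rw [hone, hE1]; norm_num⟩
    rw [hs1, Finset.sum_const, Finset.card_univ, nsmul_eq_mul] at hlt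
    linarith
  · exfalso
    have h4 : 4 ≤ orderOf (β / α) := by
      have := two_le_orderOf_of_pow_eq_one hN H.ratio_pow H.ratio_ne_one
      have a2 : orderOf (β / α) ≠ 2 := fun h => h2 (h ▸ pow_orderOf_eq_one (β / α))
      have a3 : orderOf (β / α) ≠ 3 := fun h => h3 (h ▸ pow_orderOf_eq_one (β / α))
      omega
    have hle : ∀ g ∈ Finset.univ, E (P * (ρ g * P * ρ g⁻¹)).trace / 2 ≤
        E ((P * (ρ g * P * ρ g⁻¹)).trace ^ 2) := by
      intro g _
      by_cases hc0 : (P * (ρ g * P * ρ g⁻¹)).trace = 0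
      · rw [hc0]; simp
      by_cases hc1 : (P * (ρ g * P * ρ g⁻¹)).trace = 1
      · rw [hc1, one_pow, hE1]; norm_num
      · obtain ⟨z, w, hz, hw, hz2, hw2, h5, h6⟩ :=
          H.exists_add_inv_eq_of_not_commute hρ (H.conj hρ g) hc0 hc1
        have := map_trace_eq_half hE1 hE hN H.ratio_pow hz hw h5 h6 h4 hz2 hw2
        rw [this.1]
        linarith [this.2]
    have hlt := Finset.sum_lt_sum hle ⟨1, Finset.mem_univ 1, by
      rw [hone, one_pow, hE1]; norm_num⟩
    rw [hs2, ← Finset.sum_div, hs1] at hlt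
    linarith

end IsHomology

end HomologyOrders

section CubicHomologies

open Matrix

variable {Γ : Type*} [Group Γ] {ρ : Γ →* Matrix (Fin 3) (Fin 3) ℂ} {h h' : Γ} {α β : ℂ}
  {P P' : Matrix (Fin 3) (Fin 3) ℂ}

namespace IsHomology

lemma trace_rep (H : IsHomology ρ h α β P) : (ρ h).trace = 2 * α + β := by
  rw [H.eq, trace_add, trace_smul, trace_smul, H.trace_eq, trace_one, Fintype.card_fin]
  simp only [smul_eq_mul]
  push_cast; ring

lemma trace_ne_zero [Finite Γ] (H : IsHomology ρ h α β P) : (ρ h).trace ≠ 0 := by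
  rw [H.trace_rep]
  intro h0
  have h1 := Complex.norm_eq_one_of_pow_eq_one H.alpha_pow Nat.card_pos.ne'
  have h2 := Complex.norm_eq_one_of_pow_eq_one H.beta_pow Nat.card_pos.ne'
  rw [show β = -2 * α by linear_combination h0, norm_mul, h1] at h2
  norm_num at h2

lemma ofReal_sqChar_eq (hρ : IsSpecialUnitaryRep ρ) (H : IsHomology ρ h α β P) :
    (sqChar ρ h : ℂ) = 5 + 2 * (β / α + (β / α)⁻¹) := by
  have h1 := H.alpha_ne_zero
  have h2 := H.beta_ne_zero
  rw [hρ.ofReal_sqChar, H.trace_rep, H.inv.trace_rep]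
  field_simp
  ring

lemma add_inv_eq_neg_one (H : IsHomology ρ h α β P) (h3 : (β / α) ^ 3 = 1) :
    β / α + (β / α)⁻¹ = -1 := by
  have h1 : β / α ≠ 0 := div_ne_zero H.beta_ne_zero H.alpha_ne_zero
  have h2 : (β / α - 1) * ((β / α) ^ 2 + β / α + 1) = 0 := by linear_combination h3
  have h4 := (mul_eq_zero.1 h2).resolve_left (sub_ne_zero.2 H.ratio_ne_one)
  have h5 : (β / α) * (β / α)⁻¹ = 1 := mul_inv_cancel₀ h1
  linear_combination (β / α)⁻¹ * h4 - (β / α + 1) * h5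

lemma sqChar_of_ratio_sq (hρ : IsSpecialUnitaryRep ρ) (H : IsHomology ρ h α β P)
    (h2 : (β / α) ^ 2 = 1) : sqChar ρ h = 1 := by
  have h1 : β / α = 1 ∨ β / α = -1 := by rw [← sq_eq_sq_iff_eq_or_eq_neg, h2, one_pow]
  replace h1 := h1.resolve_left H.ratio_ne_one
  have := H.ofReal_sqChar_eq hρ
  rw [h1] at this
  norm_num at this
  exact_mod_cast this

lemma sqChar_of_ratio_cube (hρ : IsSpecialUnitaryRep ρ) (H : IsHomology ρ h α β P)
    (h3 : (β / α) ^ 3 = 1) : sqChar ρ h = 3 := by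
  have := H.ofReal_sqChar_eq hρ
  rw [H.add_inv_eq_neg_one h3] at this
  norm_num at this
  exact_mod_cast this

lemma alpha_cube_mul (H : IsHomology ρ h α β P) : α ^ 3 * (β / α) = 1 := by
  have h1 := H.alpha_ne_zero
  rw [← H.alpha_sq_mul]
  field_simp

lemma pow_nine (H : IsHomology ρ h α β P) (h3 : (β / α) ^ 3 = 1) : α ^ 9 = 1 ∧ β ^ 9 = 1 := by
  have h1 : α ^ 9 = 1 := by
    calc α ^ 9 = (α ^ 3 * (β / α)) ^ 3 := by rw [mul_pow, h3]; ring
      _ = 1 := by rw [H.alpha_cube_mul, one_pow]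
  refine ⟨h1, ?_⟩
  have h2 : β = β / α * α := by rw [div_mul_cancel₀ _ H.alpha_ne_zero]
  rw [h2, mul_pow, h1, show (9 : ℕ) = 3 * 3 by norm_num, pow_mul, h3]
  norm_num

lemma eigenvalue {x : Γ} (t : CentralizerDiagonalization ρ x) {y : Subgroup.centralizer {x}}
    (H : IsHomology ρ y α β P) (i : Fin 3) : t.δ i y = α ∨ t.δ i y = β := by
  have h0 : (ρ y - α • 1) * (ρ y - β • 1) = 0 := by
    rw [H.eq]
    have h1 : α • (1 : Matrix (Fin 3) (Fin 3) ℂ) + (β - α) • P - β • 1 =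
        (β - α) • (P - 1) := by
      rw [smul_sub, sub_smul β α 1]; abel
    rw [h1, add_sub_cancel_left, smul_mul_smul_comm, Matrix.mul_sub, H.idem, Matrix.mul_one,
      sub_self, smul_zero]
  have h := t.diag y
  have h2 : (diagonal (fun i => t.δ i y) - α • 1) * (diagonal (fun i => t.δ i y) - β • 1) = 0 := by
    rw [← h.conj_eq]
    calc (t.T * ρ y * t.S - α • 1) * (t.T * ρ y * t.S - β • 1)
        = (t.T * (ρ y - α • 1) * t.S) * (t.T * (ρ y - β • 1) * t.S) := by
          simp only [Matrix.mul_sub, Matrix.sub_mul, mul_smul_comm, smul_mul_assoc,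
            Matrix.mul_one, h.inv_mul]
      _ = t.T * ((ρ y - α • 1) * (t.S * t.T) * (ρ y - β • 1)) * t.S := by
          simp only [Matrix.mul_assoc]
      _ = 0 := by rw [h.mul_inv, Matrix.mul_one, h0, Matrix.mul_zero, Matrix.zero_mul]
  have h3 := congrFun (congrFun h2 i) i
  have h4 : ∀ c : ℂ, diagonal (fun i => t.δ i y) - c • (1 : Matrix (Fin 3) (Fin 3) ℂ) =
      diagonal (fun i => t.δ i y - c) := fun c => by
    rw [← diagonal_one, ← diagonal_smul, diagonal_sub]
    congr 1
    ext i
    simp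
  rw [h4, h4, diagonal_mul_diagonal, diagonal_apply_eq, Matrix.zero_apply] at h3
  exact (mul_eq_zero.1 h3).imp sub_eq_zero.1 sub_eq_zero.1

end IsHomology

lemma IsSpecialUnitaryRep.isRegularElt_of_trace_eq_zero [Finite Γ] (hρ : IsSpecialUnitaryRep ρ)
    {x : Γ} (hx : (ρ x).trace = 0) : IsRegularElt ρ x := by
  by_contra hreg
  by_cases hs : x ∈ scalarSubgroup ρ
  · have := hρ.sqChar_scalar hs
    rw [sqChar, hx] at this
    norm_num at this
  · obtain ⟨α, β, P, H⟩ := hρ.exists_isHomology hreg hs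
    exact H.trace_ne_zero hx

lemma CentralizerDiagonalization.exists_eq_of_not_injective {x : Γ}
    (t : CentralizerDiagonalization ρ x) {y : Subgroup.centralizer {x}}
    (hy : ¬ Function.Injective fun i => t.δ i y) : ∃ k : Fin 3, ∃ a, ∀ i ≠ k, t.δ i y = a := by
  rw [Function.Injective] at hy
  push Not at hy
  obtain ⟨i, j, hij, hne⟩ := hy
  obtain ⟨k, hk⟩ : ∃ k : Fin 3, ∀ l ≠ k, l = i ∨ l = j := by
    clear hij; revert i j; decide +kernel
  refine ⟨k, t.δ i y, fun l hl => ?_⟩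
  rcases hk l hl with rfl | rfl
  · rfl
  · exact hij.symm

open scoped Classical in
lemma CentralizerDiagonalization.card_filter_le [Fintype Γ] (hρ : IsSpecialUnitaryRep ρ) {x : Γ}
    (t : CentralizerDiagonalization ρ x) :
    (Finset.univ.filter fun y : Subgroup.centralizer {x} =>
      ∃ k : Fin 3, ∃ a, a ^ 9 = 1 ∧ ∀ i ≠ k, t.δ i y = a).card ≤ 27 := by
  have h9 : (Polynomial.nthRootsFinset 9 (1 : ℂ)).card ≤ 9 :=
    (Multiset.toFinset_card_le _).trans (Polynomial.card_nthRoots 9 1)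
  have h27 : ((Finset.univ : Finset (Fin 3)) ×ˢ Polynomial.nthRootsFinset 9 (1 : ℂ)).card ≤ 27 := by
    rw [Finset.card_product, Finset.card_univ, Fintype.card_fin]
    omega
  have hex : ∀ y : Subgroup.centralizer {x}, ∃ p : Fin 3 × ℂ,
      (∃ k : Fin 3, ∃ a, a ^ 9 = 1 ∧ ∀ i ≠ k, t.δ i y = a) →
        p.2 ^ 9 = 1 ∧ ∀ i ≠ p.1, t.δ i y = p.2 := fun y => by
    by_cases hy : ∃ k : Fin 3, ∃ a, a ^ 9 = 1 ∧ ∀ i ≠ k, t.δ i y = a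
    · obtain ⟨k, a, h1⟩ := hy
      exact ⟨(k, a), fun _ => h1⟩
    · exact ⟨(0, 0), fun h => absurd h hy⟩
  choose p hp using hex
  refine (Finset.card_le_card_of_injOn p ?_ ?_).trans h27
  · intro y hy
    rw [Finset.mem_coe, Finset.mem_product]
    refine ⟨Finset.mem_univ _, ?_⟩
    rw [Polynomial.mem_nthRootsFinset (by norm_num)]
    exact (hp y (Finset.mem_filter.1 hy).2).1
  · intro y hy z hz hyz
    have h1 := hp y (Finset.mem_filter.1 hy).2
    have h2 := hp z (Finset.mem_filter.1 hz).2
    rw [← hyz] at h2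
    have h3 : ∀ i ≠ (p y).1, t.δ i y = t.δ i z := fun i hi => by rw [h1.2 i hi, h2.2 i hi]
    have h4 := t.prod hρ y
    have h5 := t.prod hρ z
    refine t.ext hρ fun i => ?_
    by_cases hi : i = (p y).1
    · rw [← hi] at h3
      have n0 := t.ne_zero 0 z
      have n1 := t.ne_zero 1 z
      have n2 := t.ne_zero 2 z
      fin_cases i
      · rw [h3 1 (by decide), h3 2 (by decide)] at h4
        exact mul_right_cancel₀ n1 (mul_right_cancel₀ n2 (h4.trans h5.symm))
      · rw [h3 0 (by decide), h3 2 (by decide)] at h4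
        exact mul_left_cancel₀ n0 (mul_right_cancel₀ n2 (h4.trans h5.symm))
      · rw [h3 0 (by decide), h3 1 (by decide)] at h4
        exact mul_left_cancel₀ (mul_ne_zero n0 n1) (h4.trans h5.symm)
    · exact h3 i hi

open scoped Classical in
lemma HasFlipCommutant.sum_sqChar_sub_one_sq [Fintype Γ] (hρ : IsSpecialUnitaryRep ρ)
    (hf : HasFlipCommutant ρ) :
    ∑ y, ((sqChar ρ y - 1) ^ 2 : ℝ) = (Fintype.card Γ : ℝ) := by
  have h : ((∑ y, ((sqChar ρ y - 1) ^ 2 : ℝ) : ℝ) : ℂ) = (Fintype.card Γ : ℂ) := by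
    push_cast
    simp only [hρ.ofReal_sqChar, sub_sq, Finset.sum_add_distrib, Finset.sum_sub_distrib, mul_one,
      ← Finset.mul_sum, hf.sum_trace_mul_trace_inv_sq,
      hf.hasScalarCommutant.sum_trace_mul_trace_inv]
    simp
  exact_mod_cast h

lemma HasFlipCommutant.sqChar_sub_one_sq_le [Fintype Γ] (hρ : IsSpecialUnitaryRep ρ)
    (hf : HasFlipCommutant ρ) {x : Γ} (t : CentralizerDiagonalization ρ x)
    (y : Subgroup.centralizer {x}) (hy : ¬ IsRegularElt ρ y) :
    (sqChar ρ y - 1) ^ 2 = 0 ∨ ((sqChar ρ y - 1) ^ 2 ≤ 64 ∧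
      ((y : Γ) ∉ scalarSubgroup ρ → (sqChar ρ y - 1) ^ 2 = 4) ∧
      ∃ k : Fin 3, ∃ a, a ^ 9 = 1 ∧ ∀ i ≠ k, t.δ i y = a) := by
  by_cases hs : (y : Γ) ∈ scalarSubgroup ρ
  · right
    rw [hρ.sqChar_scalar hs]
    refine ⟨by norm_num, fun h => absurd hs h, 2, t.δ 0 y, ?_, ?_⟩
    · obtain ⟨c, hc⟩ := hs
      have h := t.diag y
      rw [hc] at h
      have h1 := h.eq_of_eq (IsDiagonalization.scalar h.mul_inv h.inv_mul c)
      have h2 := congrFun h1 0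
      rw [h2, show (9 : ℕ) = 3 * 3 by norm_num, pow_mul, hρ.scalar_pow_three hc, one_pow]
    · have := (t.mem_scalarSubgroup_iff).1 hs
      intro i hi
      fin_cases i
      · rfl
      · exact this.1.symm
      · exact absurd rfl hi
  · obtain ⟨α, β, P, H⟩ := hρ.exists_isHomology hy hs
    rcases H.ratio_sq_eq_one_or hρ hf with h2 | ⟨h3, -⟩
    · left
      rw [H.sqChar_of_ratio_sq hρ h2]; norm_num
    · right
      rw [H.sqChar_of_ratio_cube hρ h3]
      refine ⟨by norm_num, fun _ => by norm_num, ?_⟩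
      obtain ⟨k, a, ha⟩ := t.exists_eq_of_not_injective
        fun h => hy (t.isRegularElt_of_injective h)
      refine ⟨k, a, ?_, ha⟩
      obtain ⟨i, hi⟩ : ∃ i : Fin 3, i ≠ k := exists_ne k
      rw [← ha i hi]
      rcases H.eigenvalue t i with h | h
      · rw [h]; exact (H.pow_nine h3).1
      · rw [h]; exact (H.pow_nine h3).2

open scoped Classical in
lemma HasFlipCommutant.card_centralizer_le [Fintype Γ] (hρ : IsSpecialUnitaryRep ρ)
    (hf : HasFlipCommutant ρ) (hz : Nat.card (scalarSubgroup ρ) = 3) {x : Γ}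
    (hx : IsRegularElt ρ x) : Nat.card (Subgroup.centralizer {x}) ≤ 72 := by
  obtain ⟨t⟩ := hx.nonempty_centralizerDiagonalization
  set f : Γ → ℝ := fun y => (sqChar ρ y - 1) ^ 2 with hfdef
  have hnn : ∀ y, 0 ≤ f y := fun y => sq_nonneg _
  have h1 := card_mul_centralizerSum_le (R := IsRegularElt ρ) (f := f)
    (fun x g hx => isRegularElt_conj g hx) hρ.centralizer_eq
    (fun x g => by simp only [hfdef, sqChar_conj])
    (fun x _ => Finset.sum_nonneg fun y _ => hnn y) hx
  have h2 : ∑ y with IsRegularElt ρ y, f y ≤ Fintype.card Γ := by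
    rw [← HasFlipCommutant.sum_sqChar_sub_one_sq hρ hf]
    exact Finset.sum_le_sum_of_subset_of_nonneg (Finset.filter_subset _ _) fun y _ _ => hnn y
  have hA : (10 : ℝ) * Nat.card (Subgroup.centralizer {x}) ≤
      ∑ y : Subgroup.centralizer {x}, f y := by
    have h3 := t.fifteen_mul_le_sum_sqChar_sq hρ
    have h4 := t.sum_sqChar hρ
    simp only [hfdef, sub_sq, Finset.sum_add_distrib, Finset.sum_sub_distrib, mul_one,
      ← Finset.mul_sum, h4]
    simp only [one_pow, Finset.sum_const, Finset.card_univ, nsmul_eq_mul, mul_one]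
    rw [← Nat.card_eq_fintype_card]
    linarith
  have hsplit : ∑ y : Subgroup.centralizer {x}, f y = centralizerSum (IsRegularElt ρ) f x +
      ∑ y ∈ Finset.univ.filter (fun y : Subgroup.centralizer {x} => ¬ IsRegularElt ρ y), f y := by
    rw [← Finset.sum_filter_add_sum_filter_not Finset.univ
      (fun y : Subgroup.centralizer {x} => IsRegularElt ρ y)]
    congr 1
    rw [centralizerSum]
    refine Finset.sum_bij (fun y _ => (y : Γ)) ?_ ?_ ?_ ?_
    · intro y hy
      simp only [Finset.mem_filter, Finset.mem_univ, true_and] at hy ⊢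
      exact ⟨hy, y.2⟩
    · intro y _ z _ h
      exact Subtype.ext h
    · intro y hy
      simp only [Finset.mem_filter, Finset.mem_univ, true_and] at hy
      exact ⟨⟨y, hy.2⟩, by simpa using hy.1, rfl⟩
    · intro y _; rfl
  have hnonreg : ∑ y ∈ Finset.univ.filter (fun y : Subgroup.centralizer {x} => ¬ IsRegularElt ρ y),
      f y ≤ 288 := by
    set W := Finset.univ.filter fun y : Subgroup.centralizer {x} =>
      ∃ k : Fin 3, ∃ a, a ^ 9 = 1 ∧ ∀ i ≠ k, t.δ i y = a
    set Zs := Finset.univ.filter fun y : Subgroup.centralizer {x} => (y : Γ) ∈ scalarSubgroup ρ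
    have hW : W.card ≤ 27 := t.card_filter_le hρ
    have hZ : Zs.card ≤ 3 := by
      rw [← hz, Nat.card_eq_fintype_card, ← Finset.card_univ]
      refine Finset.card_le_card_of_injOn
        (fun y => if h : (y : Γ) ∈ scalarSubgroup ρ then ⟨y, h⟩ else 1) (fun _ _ => by simp) ?_
      intro y hy z hz hyz
      have hy := (Finset.mem_filter.1 hy).2
      have hz := (Finset.mem_filter.1 hz).2
      simp only [hy, hz, dif_pos] at hyz
      exact Subtype.ext (Subtype.mk.inj hyz)
    have hle : ∀ y : Subgroup.centralizer {x}, ¬ IsRegularElt ρ y →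
        f y ≤ (if y ∈ W then 4 else 0) + (if y ∈ Zs then 60 else 0) := by
      intro y hy
      have hp1 : (0 : ℝ) ≤ if y ∈ W then 4 else 0 := by split_ifs <;> norm_num
      have hp2 : (0 : ℝ) ≤ if y ∈ Zs then 60 else 0 := by split_ifs <;> norm_num
      rcases HasFlipCommutant.sqChar_sub_one_sq_le hρ hf t y hy with h | ⟨h, h', h''⟩
      · simp only [hfdef, h]; positivity
      · have hyW : y ∈ W := by simpa [W] using h''
        rw [if_pos hyW]
        by_cases hyZ : (y : Γ) ∈ scalarSubgroup ρ
        · have : y ∈ Zs := by simpa [Zs] using hyZ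
          rw [if_pos this]
          simp only [hfdef]; linarith
        · have := h' hyZ
          simp only [hfdef]; linarith
    calc ∑ y ∈ Finset.univ.filter (fun y : Subgroup.centralizer {x} => ¬ IsRegularElt ρ y), f y
        ≤ ∑ y ∈ Finset.univ.filter (fun y : Subgroup.centralizer {x} => ¬ IsRegularElt ρ y),
          ((if y ∈ W then (4 : ℝ) else 0) + (if y ∈ Zs then 60 else 0)) :=
          Finset.sum_le_sum fun y hy => hle y (Finset.mem_filter.1 hy).2
      _ ≤ ∑ y : Subgroup.centralizer {x},
          ((if y ∈ W then (4 : ℝ) else 0) + (if y ∈ Zs then 60 else 0)) :=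
          Finset.sum_le_sum_of_subset_of_nonneg (Finset.filter_subset _ _) fun y _ _ => by
            split_ifs <;> norm_num
      _ = W.card * 4 + Zs.card * 60 := by
          rw [Finset.sum_add_distrib, Finset.sum_ite_mem, Finset.sum_ite_mem, Finset.univ_inter,
            Finset.univ_inter, Finset.sum_const, Finset.sum_const, nsmul_eq_mul, nsmul_eq_mul]
      _ ≤ 288 := by
          have hW' : (W.card : ℝ) ≤ 27 := by exact_mod_cast hW
          have hZ' : (Zs.card : ℝ) ≤ 3 := by exact_mod_cast hZ
          linarith
  obtain ⟨w, hw, hw6, -⟩ := hρ.exists_card_normalizer hx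
  have hw6 : (w : ℝ) ≤ 6 := by
    have : w ≤ 6 := by omega
    exact_mod_cast this
  rw [hw] at h1
  have hc : (0 : ℝ) < Fintype.card Γ := by exact_mod_cast Fintype.card_pos
  have h3 : (Fintype.card Γ : ℝ) * centralizerSum (IsRegularElt ρ) f x ≤
      Fintype.card Γ * (6 * Nat.card (Subgroup.centralizer {x})) := by
    refine h1.trans ?_
    rw [mul_comm (Fintype.card Γ : ℝ)]
    push_cast
    refine mul_le_mul ?_ h2 (Finset.sum_nonneg fun y _ => hnn y) (by positivity)
    exact mul_le_mul_of_nonneg_right hw6 (Nat.cast_nonneg _)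
  have h4 := le_of_mul_le_mul_left h3 hc
  have h5 : (Nat.card (Subgroup.centralizer {x}) : ℝ) ≤ 72 := by linarith
  exact_mod_cast h5

end CubicHomologies

theorem card_mul_relIndex {G : Type*} [Group G] {H K : Subgroup G} (h : H ≤ K) :
    Nat.card H * H.relIndex K = Nat.card K := by
  rw [← Subgroup.relIndex_bot_left, ← Subgroup.relIndex_bot_left]
  exact Subgroup.relIndex_mul_relIndex _ _ _ bot_le h

section TransferToSylow

lemma MonoidHom.transfer_eq_pow_index {Γ : Type*} [Group Γ] [Finite Γ] {P : Subgroup Γ}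
    {Q : Type*} [CommGroup Q] (ϕ : P →* Q) {h : Γ} {ε : Q} (hcen : ∀ g, g * h ^ 3 = h ^ 3 * g)
    (h3 : h ^ 3 ∈ P) (hϕ : ϕ ⟨h ^ 3, h3⟩ = 1) (hε : ε ^ 3 = 1)
    (hconj : ∀ g (hg : g⁻¹ * h * g ∈ P), ϕ ⟨g⁻¹ * h * g, hg⟩ = ε) :
    ϕ.transfer h = ε ^ P.index := by
  classical
  let _ := Fintype.ofFinite (Quotient (MulAction.orbitRel (Subgroup.zpowers h) (Γ ⧸ P)))
  have hfac : ∀ (q : Γ ⧸ P) (hq : q.out⁻¹ * h ^ Function.minimalPeriod (h • ·) q * q.out ∈ P),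
      ϕ ⟨_, hq⟩ = ε ^ Function.minimalPeriod (h • ·) q := by
    intro q hq
    have hdvd : Function.minimalPeriod (h • ·) q ∣ 3 := by
      apply Function.IsPeriodicPt.minimalPeriod_dvd
      rw [Function.IsPeriodicPt, Function.IsFixedPt, smul_iterate]
      obtain ⟨g, rfl⟩ := QuotientGroup.mk_surjective q
      change h ^ 3 • (g : Γ ⧸ P) = g
      rw [MulAction.Quotient.smul_mk, QuotientGroup.eq, smul_eq_mul, ← hcen]
      simpa using P.inv_mem h3
    rcases (Nat.dvd_prime Nat.prime_three).1 hdvd with h1 | h1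
    · simp only [h1, pow_one] at hq ⊢
      exact hconj _ hq
    · simp only [h1] at hq ⊢
      rw [hε, ← hϕ]
      congr 2
      rw [mul_assoc, ← hcen, inv_mul_cancel_left]
  rw [MonoidHom.transfer_eq_prod_quotient_orbitRel_zpowers_quot,
    Finset.prod_congr rfl fun q _ => hfac _ _, Finset.prod_pow_eq_pow_sum,
    Subgroup.index_eq_sum_minimalPeriod P h]

variable {Γ : Type*} [Group Γ] {ρ : Γ →* Matrix (Fin 3) (Fin 3) ℂ}

open Matrix

lemma IsSpecialUnitaryRep.mem_centralizer_or_trace_eq_zero [Finite Γ] (hρ : IsSpecialUnitaryRep ρ)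
    {x n : Γ} (hx : IsRegularElt ρ x)
    (hn : n ∈ Subgroup.normalizer (Subgroup.centralizer {x} : Set Γ)) {k : ℕ}
    (hk : n ^ 3 ^ k = 1) : n ∈ Subgroup.centralizer {x} ∨ (ρ n).trace = 0 := by
  obtain ⟨t⟩ := hx.nonempty_centralizerDiagonalization
  obtain ⟨f, hf1, hf2⟩ := t.exists_hom_perm hρ
  set σ := f ⟨n, hn⟩ with hσ
  have h1 : σ ^ 3 ^ k = 1 := by
    rw [hσ, ← map_pow, ← map_one f]
    congr 1
    exact Subtype.ext hk
  have h2 : σ ^ 3 = 1 := by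
    have h3 : σ ^ 6 = 1 := by
      rw [show 6 = Fintype.card (Equiv.Perm (Fin 3)) by rw [Fintype.card_perm]; rfl]
      exact pow_card_eq_one
    have h4 : orderOf σ ∣ Nat.gcd 6 (3 ^ k) :=
      Nat.dvd_gcd (orderOf_dvd_of_pow_eq_one h3) (orderOf_dvd_of_pow_eq_one h1)
    have h5 : Nat.gcd 6 (3 ^ k) ∣ 3 := by
      rw [show 6 = 2 * 3 by norm_num, Nat.Coprime.gcd_mul_left_cancel _
        (Nat.Coprime.pow_right _ (by norm_num))]
      exact Nat.gcd_dvd_left _ _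
    exact orderOf_dvd_iff_pow_eq_one.1 (h4.trans h5)
  have h3 : σ = 1 ∨ ∀ i, σ i ≠ i := by
    clear_value σ; clear hσ h1 hf1 hf2
    revert σ; decide +kernel
  rcases h3 with h3 | h3
  · exact Or.inl ((hf2 _).1 h3)
  right
  set x' : Subgroup.centralizer {x} := ⟨x, Subgroup.mem_centralizer_singleton_iff.2 rfl⟩
  have hmem : n * x * n⁻¹ ∈ Subgroup.centralizer {x} :=
    (Subgroup.mem_normalizer_iff.1 hn x).1 x'.2
  set z : Subgroup.centralizer {x} := ⟨n * x * n⁻¹, hmem⟩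
  have hz : ∀ j, t.δ (σ j) z = t.δ j x' := hf1 ⟨n, hn⟩ x' z rfl
  have hmi := (t.diag x').mul_inv
  have h4 : diagonal (fun i => t.δ i z) * (t.T * ρ n * t.S) =
      (t.T * ρ n * t.S) * diagonal (fun i => t.δ i x') := by
    rw [← (t.diag z).conj_eq, ← (t.diag x').conj_eq]
    calc _ = t.T * (ρ (n * x * n⁻¹) * (t.S * t.T) * ρ n) * t.S := by
          simp only [Matrix.mul_assoc]; rfl
      _ = t.T * (ρ n * (t.S * t.T) * ρ x) * t.S := by
        rw [hmi, Matrix.mul_one, Matrix.mul_one, ← map_mul, ← map_mul]; simp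
      _ = _ := by simp only [Matrix.mul_assoc]; rfl
  have h5 : (ρ n).trace = (t.T * ρ n * t.S).trace := by
    rw [trace_mul_cycle, hmi, Matrix.one_mul]
  rw [h5, Matrix.trace]
  refine Finset.sum_eq_zero fun i _ => ?_
  have h6 := congrFun (congrFun h4 i) i
  rw [diagonal_mul, mul_diagonal] at h6
  have h7 : t.δ i z ≠ t.δ i x' := by
    rw [show t.δ i z = t.δ (σ.symm i) x' by rw [← hz, Equiv.apply_symm_apply]]
    intro h8
    have h9 := t.injective h8
    exact h3 i (by nth_rw 1 [← h9, Equiv.apply_symm_apply])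
  rw [diag_apply]
  have h8 : (t.δ i z - t.δ i x') * (t.T * ρ n * t.S) i i = 0 := by linear_combination h6
  exact (mul_eq_zero.1 h8).resolve_left (sub_ne_zero.2 h7)

/-- The elements of `3`-power order in the centralizer of a regular element. -/
def IsSpecialUnitaryRep.threePart (hρ : IsSpecialUnitaryRep ρ) {x : Γ} (hx : IsRegularElt ρ x) :
    Subgroup Γ where
  carrier := {y | y ∈ Subgroup.centralizer {x} ∧ ∃ k : ℕ, y ^ 3 ^ k = 1}
  one_mem' := ⟨one_mem _, 0, one_pow _⟩
  mul_mem' := by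
    rintro y z ⟨hy, k, hk⟩ ⟨hz, l, hl⟩
    refine ⟨mul_mem hy hz, k + l, ?_⟩
    rw [Commute.mul_pow (hρ.centralizer_comm hx hy hz), pow_add, pow_mul, hk, one_pow, one_mul,
      mul_comm, pow_mul, hl, one_pow]
  inv_mem' := by
    rintro y ⟨hy, k, hk⟩
    exact ⟨inv_mem hy, k, by rw [inv_pow, hk, inv_one]⟩

lemma IsSpecialUnitaryRep.isPGroup_threePart (hρ : IsSpecialUnitaryRep ρ) {x : Γ}
    (hx : IsRegularElt ρ x) : IsPGroup 3 (hρ.threePart hx) := fun y => by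
  obtain ⟨k, hk⟩ := y.2.2
  exact ⟨k, Subtype.ext hk⟩

lemma Sylow.exists_pow_eq_one {p : ℕ} (P : Sylow p Γ) {y : Γ} (hy : y ∈ P) :
    ∃ k : ℕ, y ^ p ^ k = 1 := by
  obtain ⟨k, hk⟩ := P.isPGroup' ⟨y, hy⟩
  exact ⟨k, congrArg Subtype.val hk⟩

lemma IsHomology.mem_centralizer [Finite Γ] (hρ : IsSpecialUnitaryRep ρ) {x h : Γ} {α β : ℂ}
    {P : Matrix (Fin 3) (Fin 3) ℂ} (hx : IsRegularElt ρ x) (H : IsHomology ρ h α β P)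
    (hn : h ∈ Subgroup.normalizer (Subgroup.centralizer {x} : Set Γ)) {k : ℕ}
    (hk : h ^ 3 ^ k = 1) : h ∈ Subgroup.centralizer {x} :=
  (hρ.mem_centralizer_or_trace_eq_zero hx hn hk).resolve_right H.trace_ne_zero

lemma IsSpecialUnitaryRep.sylow_le_normalizer [Finite Γ] (hρ : IsSpecialUnitaryRep ρ) {h h' : Γ}
    {α β α' β' : ℂ} {P P' : Matrix (Fin 3) (Fin 3) ℂ} (hx : IsRegularElt ρ (h * h'⁻¹))
    (H : IsHomology ρ h α β P) (H' : IsHomology ρ h' α' β' P')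
    (hh : h ∈ hρ.threePart hx) (hh' : h' ∈ hρ.threePart hx) (S : Sylow 3 Γ)
    (hS : hρ.threePart hx ≤ S) :
    (S : Subgroup Γ) ≤ Subgroup.normalizer (Subgroup.centralizer {h * h'⁻¹} : Set Γ) := by
  set N := Subgroup.normalizer (Subgroup.centralizer {h * h'⁻¹} : Set Γ) with hN
  have : Fact (Nat.Prime 3) := ⟨Nat.prime_three⟩
  have hnil : Group.IsNilpotent S := S.isPGroup'.isNilpotent
  have key := normalizerCondition_iff_only_full_group_self_normalizing.1
    (Group.normalizerCondition_of_isNilpotent (G := S)) (N.subgroupOf S) ?_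
  · exact Subgroup.subgroupOf_eq_top.1 key
  refine le_antisymm (fun y hy => ?_) Subgroup.le_normalizer
  rw [Subgroup.mem_subgroupOf, hN, mem_normalizer_centralizer_iff]
  have hc : ∀ {u : Γ} {a b : ℂ} {R : Matrix (Fin 3) (Fin 3) ℂ}, IsHomology ρ u a b R →
      u ∈ hρ.threePart hx → y * u * (y : Γ)⁻¹ ∈ Subgroup.centralizer {h * h'⁻¹} := by
    intro u a b R Hu hu
    have h1 : (⟨u, hS hu⟩ : S) ∈ N.subgroupOf S :=
      centralizer_le_normalizer _ hu.1
    have h2 := (Subgroup.mem_normalizer_iff.1 hy _).1 h1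
    obtain ⟨k, hk⟩ := S.exists_pow_eq_one (y * ⟨u, hS hu⟩ * y⁻¹).2
    exact (Hu.conj hρ y).mem_centralizer hρ hx h2 hk
  refine hρ.centralizer_eq _ _ hx (isRegularElt_conj _ hx) ?_
  rw [show (y : Γ) * (h * h'⁻¹) * (y : Γ)⁻¹ = y * h * (y : Γ)⁻¹ * (y * h' * (y : Γ)⁻¹)⁻¹ by group]
  exact mul_mem (hc H hh) (inv_mem (hc H' hh'))

lemma IsPGroup.mul_comm_of_card_dvd {p : ℕ} [Fact p.Prime] {Q : Type*} [Group Q] [Finite Q]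
    (h : Nat.card Q ∣ p ^ 2) (a b : Q) : a * b = b * a := by
  obtain ⟨k, hk, h1⟩ := (Nat.dvd_prime_pow Fact.out).1 h
  interval_cases k
  · have : Subsingleton Q := (Nat.card_eq_one_iff_unique.1 (by simpa using h1)).1
    exact Subsingleton.elim _ _
  · have : IsCyclic Q := isCyclic_of_prime_card (p := p) (by simpa using h1)
    exact IsCyclic.commGroup.mul_comm a b
  · exact (IsPGroup.isMulCommutative_of_card_eq_prime_sq h1).is_comm.comm a b

lemma IsHomology.pow_three_mem {h : Γ} {α β : ℂ}
    {P : Matrix (Fin 3) (Fin 3) ℂ} (H : IsHomology ρ h α β P) (h3 : (β / α) ^ 3 = 1) :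
    ρ (h ^ 3) = α ^ 3 • 1 ∧ α ^ 3 ≠ 1 := by
  constructor
  · have hβ : β ^ 3 = α ^ 3 := by
      rw [div_pow, div_eq_one_iff_eq (pow_ne_zero 3 H.alpha_ne_zero)] at h3
      exact h3
    rw [map_pow, pow_three, H.eq]
    simp only [Matrix.add_mul, Matrix.mul_add, smul_mul_smul_comm, H.idem, Matrix.one_mul,
      Matrix.mul_one]
    have : (α * (α * α)) • (1 : Matrix (Fin 3) (Fin 3) ℂ) = α ^ 3 • 1 := by congr 1; ring
    rw [this]
    simp only [add_assoc, ← add_smul]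
    rw [add_eq_left]
    convert zero_smul ℂ P using 2
    linear_combination hβ
  · intro h1
    have := H.alpha_cube_mul
    rw [h1, one_mul] at this
    exact H.ratio_ne_one this

lemma IsHomology.false_of_ratio_cube [Fintype Γ] {G : Type*} [Group G] [IsSimpleGroup G]
    (hna : ∃ a b : G, a * b ≠ b * a) {π : Γ →* G} (hsurj : Function.Surjective π)
    (hπ : ∀ g, π g = 1 ↔ g ∈ scalarSubgroup ρ) (hz : Nat.card (scalarSubgroup ρ) = 3)
    (hρ : IsSpecialUnitaryRep ρ) (hf : HasFlipCommutant ρ) {h g : Γ} {α β : ℂ}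
    {P : Matrix (Fin 3) (Fin 3) ℂ} (H : IsHomology ρ h α β P) (h3 : (β / α) ^ 3 = 1)
    (hg : (P * (ρ g * P * ρ g⁻¹)).trace = 0) : False := by
  have : Fact (Nat.Prime 3) := ⟨Nat.prime_three⟩
  have H' := H.conj hρ g
  set h' := g * h * g⁻¹ with hh'
  have hcube := H.pow_three_mem h3
  have hcomm : h * h' = h' * h := H.commute_of_trace hρ H' (Or.inl hg)
  have hZ3 : ∀ z ∈ scalarSubgroup ρ, z ^ 3 = 1 := fun z hzz => by
    have := pow_card_eq_one' (x := (⟨z, hzz⟩ : scalarSubgroup ρ))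
    rw [hz] at this
    exact congrArg Subtype.val this
  have h3Z : h ^ 3 ∈ scalarSubgroup ρ := ⟨_, hcube.1⟩
  have h9 : h ^ 9 = 1 := by rw [show 9 = 3 * 3 by norm_num, pow_mul, hZ3 _ h3Z]
  have htr : (ρ (h * h'⁻¹)).trace = 0 := by
    rw [H.trace_mul H'.inv, hg]
    have h1 := H.add_inv_eq_neg_one h3
    have h2 := H.alpha_ne_zero
    have h4 := H.beta_ne_zero
    field_simp at h1 ⊢
    linear_combination h1
  have hx : IsRegularElt ρ (h * h'⁻¹) := hρ.isRegularElt_of_trace_eq_zero htr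
  set U := hρ.threePart hx with hU
  have hhU : h ∈ U := by
    refine ⟨Subgroup.mem_centralizer_singleton_iff.2 ?_, 2, h9⟩
    exact ((Commute.refl h).mul_right (Commute.inv_right hcomm)).eq
  have hh'U : h' ∈ U := by
    refine ⟨Subgroup.mem_centralizer_singleton_iff.2 ?_, 2, ?_⟩
    · exact ((Commute.symm hcomm).mul_right (Commute.inv_right (Commute.refl h'))).eq
    · rw [hh', conj_pow, show 3 ^ 2 = 9 by norm_num, h9, mul_one, mul_inv_cancel]
  have hZU : scalarSubgroup ρ ≤ U := fun z hzz =>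
    ⟨hρ.scalarSubgroup_le_centralizer _ hzz, 1, hZ3 z hzz⟩
  obtain ⟨S, hS⟩ := (hρ.isPGroup_threePart hx).exists_le_sylow
  have hSN := hρ.sylow_le_normalizer hx H H' hhU hh'U S hS
  obtain ⟨w, hw, hw6, -⟩ := hρ.exists_card_normalizer hx
  have hA : Nat.card (Subgroup.centralizer {h * h'⁻¹}) ≤ 72 :=
    HasFlipCommutant.card_centralizer_le hρ hf hz hx
  have hUcard : Nat.card U ∣ 27 := by
    obtain ⟨k, hk⟩ := IsPGroup.iff_card.1 (hρ.isPGroup_threePart hx)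
    have h1 : Nat.card U ≤ 72 := (Subgroup.card_le_of_le fun y (hy : y ∈ U) => hy.1).trans hA
    rw [hk] at h1 ⊢
    rw [show 27 = 3 ^ 3 by norm_num]
    refine pow_dvd_pow _ ?_
    by_contra! hk4
    have := Nat.pow_le_pow_right (show 0 < 3 by norm_num) (show 4 ≤ k by omega)
    omega
  have hUS : Nat.card S ∣ 81 := by
    obtain ⟨k, hk⟩ := IsPGroup.iff_card.1 S.isPGroup'
    obtain ⟨l, hl⟩ := IsPGroup.iff_card.1 (hρ.isPGroup_threePart hx)
    have h0 : (Subgroup.centralizer {h * h'⁻¹} ⊓ (S : Subgroup Γ)) = U := by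
      refine le_antisymm (fun y hy => ⟨hy.1, S.exists_pow_eq_one hy.2⟩) fun y hy => ⟨hy.1, hS hy⟩
    set A := Subgroup.centralizer {h * h'⁻¹} with hAdef
    set N := Subgroup.normalizer (A : Set Γ) with hN
    have hAN : A.relIndex N = w := by
      have h1 := card_mul_relIndex (centralizer_le_normalizer (h * h'⁻¹))
      rw [hw, mul_comm] at h1
      exact Nat.eq_of_mul_eq_mul_right Nat.card_pos h1
    have hAS : U.relIndex S = A.relIndex S := by
      rw [← h0, Subgroup.inf_relIndex_right]
    have hdvd : U.relIndex S ∣ w := by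
      have h2 : (A.subgroupOf N).Normal := Subgroup.normal_in_normalizer
      rw [hAS, ← hAN, ← Subgroup.relIndex_subgroupOf hSN]
      exact Subgroup.relIndex_dvd_index_of_normal _ _
    have hcs := card_mul_relIndex hS
    have h3' : U.relIndex S ∣ 3 := by
      have h2 : U.relIndex S ∣ 3 ^ k := hk ▸ Subgroup.relIndex_dvd_card _ _
      obtain ⟨j, hj, h4⟩ := (Nat.dvd_prime_pow Nat.prime_three).1 h2
      rw [h4] at hdvd ⊢
      have h5 : 3 ^ j ∣ 6 := hdvd.trans (by rcases hw6 with rfl | rfl | rfl | rfl <;> norm_num)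
      have h6 := Nat.le_of_dvd (by norm_num) h5
      have : j ≤ 1 := by
        by_contra! hj2
        have := Nat.pow_le_pow_right (show 0 < 3 by norm_num) hj2
        omega
      interval_cases j <;> norm_num
    have := mul_dvd_mul hUcard h3'
    rwa [hcs] at this
  let Ω : Subgroup S :=
    { carrier := {s | (s : Γ) ∈ U ∧ (s : Γ) ^ 3 = 1}
      one_mem' := ⟨one_mem _, one_pow _⟩
      mul_mem' := by
        rintro y z ⟨hy, hk⟩ ⟨hz, hl⟩
        refine ⟨mul_mem hy hz, ?_⟩
        rw [Subgroup.coe_mul, Commute.mul_pow (hρ.centralizer_comm hx hy.1 hz.1), hk, hl, one_mul]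
      inv_mem' := by
        rintro y ⟨hy, hk⟩
        exact ⟨inv_mem hy, by rw [Subgroup.coe_inv, inv_pow, hk, inv_one]⟩ }
  have hΩmem : ∀ s : S, s ∈ Ω ↔ (s : Γ) ∈ U ∧ (s : Γ) ^ 3 = 1 := fun s => Iff.rfl
  have hΩn : Ω.Normal := by
    constructor
    rintro y ⟨hy, hk⟩ s
    refine ⟨⟨(Subgroup.mem_normalizer_iff.1 (hSN s.2) _).1 hy.1, 1, ?_⟩, ?_⟩
    · change (s * y * (s : Γ)⁻¹) ^ (3 ^ 1) = 1
      rw [pow_one, conj_pow, hk, mul_one, mul_inv_cancel]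
    · change (s * y * (s : Γ)⁻¹) ^ 3 = 1
      rw [conj_pow, hk, mul_one, mul_inv_cancel]
  have hΩcard : 9 ∣ Nat.card Ω := by
    obtain ⟨j, hj⟩ := IsPGroup.iff_card.1 (S.isPGroup'.to_subgroup Ω)
    rw [hj, show 9 = 3 ^ 2 by norm_num]
    refine pow_dvd_pow _ ?_
    by_contra! hj2
    have h1 : Nat.card Ω ≤ 3 := by
      rw [hj]
      interval_cases j <;> norm_num
    have h2 : (scalarSubgroup ρ).subgroupOf S ≤ Ω := fun y hy => ⟨hZU hy, hZ3 _ hy⟩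
    have h4 : Nat.card ((scalarSubgroup ρ).subgroupOf S) = 3 := by
      exact (Nat.card_congr (Subgroup.subgroupOfEquivOfLe (hZU.trans hS)).toEquiv).trans hz
    have h5 := Subgroup.eq_of_le_of_card_ge h2 (by rw [h4]; exact h1)
    have h6 : (⟨h * h'⁻¹, mul_mem (hS hhU) (inv_mem (hS hh'U))⟩ : S) ∈ Ω := by
      refine ⟨mul_mem hhU (inv_mem hh'U), ?_⟩
      change (h * h'⁻¹) ^ 3 = 1
      rw [Commute.mul_pow (Commute.inv_right hcomm), inv_pow, hh', conj_pow,
        hρ.commute_scalar h3Z, mul_inv_cancel_right, mul_inv_cancel]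
    rw [← h5] at h6
    exact not_isRegularElt_of_mem_scalarSubgroup h6 hx
  have hQ : Nat.card (S ⧸ Ω) ∣ 3 ^ 2 := by
    have h1 := Subgroup.card_mul_index Ω
    rw [Subgroup.index] at h1
    have h2 : 9 * Nat.card (S ⧸ Ω) ∣ 9 * 9 :=
      (mul_dvd_mul_right hΩcard _).trans (h1 ▸ hUS)
    exact Nat.dvd_of_mul_dvd_mul_left (by norm_num) h2
  let _ : CommGroup (S ⧸ Ω) := { mul_comm := IsPGroup.mul_comm_of_card_dvd hQ }
  let ϕ : S →* S ⧸ Ω := QuotientGroup.mk' Ω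
  have hϕ : ∀ s, ϕ s = 1 ↔ s ∈ Ω := fun s => QuotientGroup.eq_one_iff s
  have hϕh3 : ϕ ⟨h ^ 3, pow_mem (hS hhU) 3⟩ = 1 := (hϕ _).2 ⟨hZU h3Z, hZ3 _ h3Z⟩
  have htransfer := ϕ.transfer_eq_pow_index (h := h) (ε := ϕ ⟨h, hS hhU⟩)
    (fun u => hρ.commute_scalar h3Z u) (pow_mem (hS hhU) 3) hϕh3
    (by rw [← map_pow]; exact hϕh3) ?_
  · obtain ⟨z, hzk, hzeq⟩ := MonoidHom.exists_mem_ker_eq_of_isSimpleGroup hna π hsurj ϕ.transfer h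
    have hzZ : z ∈ scalarSubgroup ρ := (hπ z).1 hzk
    have h1 : ϕ.transfer z = 1 := by
      rw [MonoidHom.transfer_eq_pow]
      · exact (hϕ _).2 ⟨hZU (pow_mem hzZ _), hZ3 _ (pow_mem hzZ _)⟩
      · intro k u _
        rw [mul_assoc, ← hρ.commute_scalar (pow_mem hzZ k), inv_mul_cancel_left]
    rw [hzeq, h1] at htransfer
    have h2 : ϕ ⟨h, hS hhU⟩ ^ 3 = 1 := by rw [← map_pow]; exact hϕh3
    have h4 : orderOf (ϕ ⟨h, hS hhU⟩) ∣ Nat.gcd 3 (S : Subgroup Γ).index :=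
      Nat.dvd_gcd (orderOf_dvd_of_pow_eq_one h2) (orderOf_dvd_of_pow_eq_one htransfer.symm)
    rw [(Nat.Prime.coprime_iff_not_dvd Nat.prime_three).2 S.not_dvd_index, Nat.dvd_one,
      orderOf_eq_one_iff, hϕ] at h4
    have h5 := h4.2
    rw [show ((⟨h, hS hhU⟩ : S) : Γ) = h from rfl] at h5
    have h6 := hcube.1
    rw [h5, map_one] at h6
    have h7 := congrFun (congrFun h6 0) 0
    simp at h7
    exact hcube.2 h7.symm
  · intro u hu
    rw [← inv_mul_eq_one, ← map_inv, ← map_mul, hϕ]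
    have Hu : IsHomology ρ (u⁻¹ * h * u) α β (ρ u⁻¹ * P * ρ u) := by
      simpa using H.conj hρ u⁻¹
    obtain ⟨k, hk⟩ := S.exists_pow_eq_one hu
    have huU : u⁻¹ * h * u ∈ U := ⟨Hu.mem_centralizer hρ hx (hSN hu) hk, k, hk⟩
    refine ⟨mul_mem (inv_mem huU) hhU, ?_⟩
    change ((u⁻¹ * h * u)⁻¹ * h) ^ 3 = 1
    rw [Commute.mul_pow (Commute.inv_left (hρ.centralizer_comm hx huU.1 hhU.1)), inv_pow]
    have h8 : (u⁻¹ * h * u) ^ 3 = h ^ 3 := by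
      have := conj_pow (a := u⁻¹) (b := h) (i := 3)
      rw [inv_inv] at this
      rw [this, mul_assoc, ← hρ.commute_scalar h3Z, inv_mul_cancel_left]
    rw [h8, inv_mul_cancel]

end TransferToSylow

section FlipCommutant

open Matrix

variable {Γ : Type*} [Group Γ] {ρ : Γ →* Matrix (Fin 3) (Fin 3) ℂ} {G : Type*} [Group G]

/-- A special unitary representation whose scalars are the three cube roots of unity and form the
kernel of the surjection `π`. -/
structure IsProjectiveLift (ρ : Γ →* Matrix (Fin 3) (Fin 3) ℂ) (π : Γ →* G) : Prop where
  rep : IsSpecialUnitaryRep ρ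
  surjective : Function.Surjective π
  ker : ∀ g, π g = 1 ↔ g ∈ scalarSubgroup ρ
  card_scalar : Nat.card (scalarSubgroup ρ) = 3

namespace IsHomology

variable {h : Γ} {α β : ℂ} {P : Matrix (Fin 3) (Fin 3) ℂ}

lemma sq_eq (H : IsHomology ρ h α β P) (h2 : (β / α) ^ 2 = 1) : ρ (h ^ 2) = α ^ 2 • 1 := by
  have hβ : β ^ 2 = α ^ 2 := by
    rw [div_pow, div_eq_one_iff_eq (pow_ne_zero 2 H.alpha_ne_zero)] at h2
    exact h2
  rw [_root_.map_pow, sq, H.eq]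
  simp only [Matrix.add_mul, Matrix.mul_add, smul_mul_smul_comm, H.idem, Matrix.one_mul,
    Matrix.mul_one]
  have : (α * α) • (1 : Matrix (Fin 3) (Fin 3) ℂ) = α ^ 2 • 1 := by congr 1; ring
  rw [this]
  simp only [add_assoc, ← add_smul]
  rw [add_eq_left]
  convert zero_smul ℂ P using 2
  linear_combination hβ

end IsHomology

theorem IsProjectiveLift.isInvolutiveRep [Fintype Γ] [IsSimpleGroup G] {π : Γ →* G}
    (h : IsProjectiveLift ρ π) (hna : ∃ a b : G, a * b ≠ b * a) (hf : HasFlipCommutant ρ) :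
    IsInvolutiveRep ρ π where
  rep := h.rep
  surjective := h.surjective
  ker := h.ker
  card_scalar := h.card_scalar
  sum_quarticChar := by
    have h1 := HasFlipCommutant.sum_trace_mul_trace_inv_sq hf
    have h2 := (HasFlipCommutant.hasScalarCommutant hf).sum_trace_mul_trace_inv
    simp_rw [← h.rep.ofReal_sqChar] at h1 h2
    norm_cast at h1 h2
    simp only [quarticChar, Finset.sum_sub_distrib, Nat.card_eq_fintype_card]
    push_cast at h1
    linear_combination h1 - h2
  homology := by
    intro y hy hyz
    obtain ⟨α, β, P, H⟩ := h.rep.exists_isHomology hy hyz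
    have h2 : (β / α) ^ 2 = 1 := by
      rcases H.ratio_sq_eq_one_or h.rep hf with h2 | ⟨h3, g, hg⟩
      · exact h2
      · exact (H.false_of_ratio_cube hna h.surjective h.ker h.card_scalar h.rep hf h3 hg).elim
    refine ⟨?_, H.sqChar_of_ratio_sq h.rep h2⟩
    rw [← _root_.map_pow, h.ker, mem_scalarSubgroup]
    exact ⟨_, H.sq_eq h2⟩

/-- Groups of odd order do not have simple nonabelian quotients of this kind. -/
theorem IsProjectiveLift.even_card [Fintype Γ] [Finite G] [IsSimpleGroup G] {π : Γ →* G}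
    (h : IsProjectiveLift ρ π) (hna : ∃ a b : G, a * b ≠ b * a) (hc : HasScalarCommutant ρ) :
    Even (Nat.card Γ) := by
  by_contra ho
  rw [Nat.not_even_iff_odd] at ho
  refine h.rep.false_of_odd hna hc h.surjective h.ker ho fun y hy => ?_
  by_contra hyz
  obtain ⟨α, β, P, H⟩ := h.rep.exists_isHomology hy hyz
  exact H.false_of_odd hna h.surjective h.rep ho fun h1 => hyz ((h.ker y).1 h1)

end FlipCommutant

section CommonEigenvector

open Matrix

variable {Γ : Type*} [Group Γ] {ι : Type*} [Fintype ι] [DecidableEq ι]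

lemma exists_det_eq_zero_of_not_hasScalarCommutant [Nonempty ι] {ρ : Γ →* Matrix ι ι ℂ}
    (hρ : ¬ HasScalarCommutant ρ) :
    ∃ Y : Matrix ι ι ℂ, Y ≠ 0 ∧ Y.det = 0 ∧ ∀ g, ρ g * Y = Y * ρ g := by
  unfold HasScalarCommutant at hρ
  push Not at hρ
  obtain ⟨X, hX, hns⟩ := hρ
  obtain ⟨μ, hμ⟩ := Module.End.exists_eigenvalue (Matrix.toLin' X)
  obtain ⟨v, hv⟩ := hμ.exists_hasEigenvector
  refine ⟨X - μ • 1, sub_ne_zero.2 (hns μ), ?_, fun g => ?_⟩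
  · rw [← Matrix.exists_mulVec_eq_zero_iff]
    refine ⟨v, hv.2, ?_⟩
    have := hv.apply_eq_smul
    rw [Matrix.toLin'_apply] at this
    rw [Matrix.sub_mulVec, this, Matrix.smul_mulVec, Matrix.one_mulVec, sub_self]
  · rw [Matrix.mul_sub, Matrix.sub_mul, hX]
    simp

/-- An invariant line is spanned by a common eigenvector. -/
lemma exists_eigenvector_of_finrank_eq_one (ρ : Γ →* Matrix ι ι ℂ)
    (W : Submodule ℂ (ι → ℂ)) (hW : Module.finrank ℂ W = 1) (h : ∀ g, ∀ w ∈ W, ρ g *ᵥ w ∈ W) :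
    ∃ v : ι → ℂ, v ≠ 0 ∧ ∃ κ : Γ →* ℂ, ∀ g, ρ g *ᵥ v = κ g • v := by
  obtain ⟨v, hv, hs⟩ := finrank_eq_one_iff'.1 hW
  choose κ hκ using fun g => hs ⟨_, h g v v.2⟩
  have hv0 : (v : ι → ℂ) ≠ 0 := fun h0 => hv (Subtype.ext h0)
  have hκ' : ∀ g, ρ g *ᵥ (v : ι → ℂ) = κ g • (v : ι → ℂ) := fun g =>
    (congrArg Subtype.val (hκ g)).symm
  refine ⟨v, hv0, ⟨⟨κ, ?_⟩, ?_⟩, hκ'⟩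
  · refine smul_left_injective ℂ hv0 ?_
    change κ 1 • (v : ι → ℂ) = (1 : ℂ) • (v : ι → ℂ)
    rw [← hκ', _root_.map_one, one_mulVec, one_smul]
  · intro g k
    refine smul_left_injective ℂ hv0 ?_
    change κ (g * k) • (v : ι → ℂ) = (κ g * κ k) • (v : ι → ℂ)
    rw [← hκ', _root_.map_mul, ← mulVec_mulVec, hκ', mulVec_smul, hκ', smul_smul, mul_comm]

/-- In dimension at most three, a group without common eigenvectors has only scalars in its
commutant. -/
lemma exists_eigenvector_of_not_hasScalarCommutant {n : ℕ} (hn : n = 2 ∨ n = 3)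
    {ρ : Γ →* Matrix (Fin n) (Fin n) ℂ} (hρ : ¬ HasScalarCommutant ρ) :
    ∃ v : Fin n → ℂ, v ≠ 0 ∧ ∃ κ : Γ →* ℂ, ∀ g, ρ g *ᵥ v = κ g • v := by
  have : Nonempty (Fin n) := ⟨⟨0, by omega⟩⟩
  obtain ⟨Y, hY0, hdet, hY⟩ := exists_det_eq_zero_of_not_hasScalarCommutant hρ
  have h1 := LinearMap.finrank_range_add_finrank_ker (Matrix.toLin' Y)
  rw [Module.finrank_fin_fun] at h1
  have h2 : Module.finrank ℂ (LinearMap.range (Matrix.toLin' Y)) ≠ 0 := fun h => by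
    rw [Submodule.finrank_eq_zero, LinearMap.range_eq_bot] at h
    exact hY0 ((LinearEquiv.map_eq_zero_iff _).1 h)
  have h3 : Module.finrank ℂ (LinearMap.ker (Matrix.toLin' Y)) ≠ 0 := fun h => by
    rw [Submodule.finrank_eq_zero, LinearMap.ker_eq_bot'] at h
    obtain ⟨v, hv, hv0⟩ := Matrix.exists_mulVec_eq_zero_iff.2 hdet
    exact hv (h v hv0)
  have hk : ∀ g, ∀ w ∈ LinearMap.ker (Matrix.toLin' Y),
      ρ g *ᵥ w ∈ LinearMap.ker (Matrix.toLin' Y) := by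
    intro g w hw
    rw [LinearMap.mem_ker, Matrix.toLin'_apply] at hw ⊢
    rw [mulVec_mulVec, ← hY, ← mulVec_mulVec, hw, mulVec_zero]
  have hr : ∀ g, ∀ w ∈ LinearMap.range (Matrix.toLin' Y),
      ρ g *ᵥ w ∈ LinearMap.range (Matrix.toLin' Y) := by
    rintro g _ ⟨w, rfl⟩
    refine ⟨ρ g *ᵥ w, ?_⟩
    rw [Matrix.toLin'_apply, Matrix.toLin'_apply, mulVec_mulVec, mulVec_mulVec, hY]
  by_cases h4 : Module.finrank ℂ (LinearMap.ker (Matrix.toLin' Y)) = 1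
  · exact exists_eigenvector_of_finrank_eq_one ρ _ h4 hk
  · exact exists_eigenvector_of_finrank_eq_one ρ _ (by omega) hr

/-- A simple nonabelian group has no faithful representation of dimension two and determinant
one. -/
lemma false_of_two_dimensional {N : Type*} [Group N] [Fintype N] [IsSimpleGroup N]
    (hna : ∃ a b : N, a * b ≠ b * a) (R : N →* Matrix (Fin 2) (Fin 2) ℂ)
    (hR : Function.Injective R) (hdet : ∀ n, (R n).det = 1) : False := by
  have hCH : ∀ n, R n * R n = (R n).trace • R n - 1 := fun n => by
    have h := hdet n
    rw [det_fin_two] at h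
    ext i j
    fin_cases i <;> fin_cases j <;>
      simp [Matrix.mul_apply, Fin.sum_univ_two, Matrix.trace] <;>
      first | ring1 | linear_combination h | linear_combination -h
  rcases Nat.even_or_odd (Nat.card N) with he | ho
  · obtain ⟨t, ht⟩ := exists_prime_orderOf_dvd_card' (G := N) 2 he.two_dvd
    have ht2 : t ^ 2 = 1 := ht ▸ pow_orderOf_eq_one t
    have h1 := hCH t
    rw [← _root_.map_mul, ← sq, ht2, _root_.map_one, eq_sub_iff_add_eq] at h1
    have hc : ∀ n, n * t = t * n := fun n => hR (by
      rw [_root_.map_mul, _root_.map_mul]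
      have h0 : (R t).trace ≠ 0 := fun h0 => by
        rw [h0, zero_smul] at h1
        have := congrFun₂ h1 0 0
        norm_num at this
      have h3 : (R t).trace • (R n * R t) = (R t).trace • (R t * R n) := by
        rw [← Matrix.mul_smul, ← h1, ← Matrix.smul_mul, ← h1, Matrix.mul_add, Matrix.add_mul]
        simp
      exact smul_right_injective _ h0 h3)
    obtain ⟨a, b, hab⟩ := hna
    rcases Subgroup.Normal.eq_bot_or_eq_top (inferInstance : (Subgroup.center N).Normal) with h | h
    · have : t ∈ Subgroup.center N := Subgroup.mem_center_iff.2 hc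
      rw [h, Subgroup.mem_bot] at this
      rw [this, orderOf_one] at ht
      omega
    · have : a ∈ Subgroup.center N := h ▸ Subgroup.mem_top a
      exact hab (Subgroup.mem_center_iff.1 this b).symm
  · have hc : HasScalarCommutant R := by
      by_contra hc
      obtain ⟨w, hw, κ, hκ⟩ := exists_eigenvector_of_not_hasScalarCommutant (Or.inl rfl) hc
      have hκ1 : ∀ n, κ n = 1 := fun n => by
        have := MonoidHom.eq_one_of_isSimpleGroup hna κ.toHomUnits n
        simpa using congrArg Units.val this
      obtain ⟨a, b, hab⟩ := hna
      refine hab (hR ?_)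
      rw [_root_.map_mul, _root_.map_mul]
      have h0 : ∀ n, R n 0 0 * w 0 + R n 0 1 * w 1 = w 0 := fun n => by
        simpa [hκ1, mulVec, dotProduct, Fin.sum_univ_two] using congrFun (hκ n) 0
      have h1 : ∀ n, R n 1 0 * w 0 + R n 1 1 * w 1 = w 1 := fun n => by
        simpa [hκ1, mulVec, dotProduct, Fin.sum_univ_two] using congrFun (hκ n) 1
      have hd : ∀ n, R n 0 0 * R n 1 1 - R n 0 1 * R n 1 0 = 1 := fun n => by
        rw [← det_fin_two, hdet]
      have hw' : w 0 ≠ 0 ∨ w 1 ≠ 0 := by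
        by_contra! h
        exact hw (by ext i; fin_cases i; exacts [h.1, h.2])
      have ht : ∀ n, R n 0 0 + R n 1 1 = 2 := by
        intro n
        rcases hw' with h | h <;> apply mul_left_cancel₀ h <;> have := h0 n <;> have := h1 n <;>
          have := hd n <;> grind
      have key : ∀ n, ∃ c : ℂ,
          R n = 1 + c • !![w 0 * w 1, -(w 0 * w 0); w 1 * w 1, -(w 0 * w 1)] := by
        intro n
        have e0 := h0 n
        have e1 := h1 n
        have e2 := ht n
        rcases hw' with h | h
        · refine ⟨-R n 0 1 / (w 0 * w 0), ?_⟩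
          ext i j
          fin_cases i <;> fin_cases j <;> simp <;> field_simp <;> grind
        · refine ⟨R n 1 0 / (w 1 * w 1), ?_⟩
          ext i j
          fin_cases i <;> fin_cases j <;> simp <;> field_simp <;> grind
      obtain ⟨c, hc⟩ := key a
      obtain ⟨d, hd⟩ := key b
      rw [hc, hd]
      simp only [Matrix.add_mul, Matrix.mul_add, smul_mul_smul_comm, Matrix.one_mul, Matrix.mul_one,
        mul_comm c d]
      abel
    have h1 := hc.sum_trace_mul_trace_inv
    have h2 : ∑ g, (R g).trace = 0 := hc.sum_trace_eq_zero (by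
      obtain ⟨a, b, hab⟩ := hna
      refine ⟨a, fun h => hab ?_⟩
      rw [hR (h.trans (_root_.map_one R).symm), one_mul, mul_one])
    have hinv : ∀ g, (R g⁻¹).trace = (R g).trace := fun g => by
      have h3 : R g⁻¹ = (R g).trace • 1 - R g := by
        have h4 := congrArg (R g⁻¹ * ·) (hCH g)
        have h5 : R g⁻¹ * R g = 1 := by rw [← _root_.map_mul, inv_mul_cancel, _root_.map_one]
        simp only [← Matrix.mul_assoc, h5, Matrix.mul_sub, Matrix.mul_smul, Matrix.one_mul,
          Matrix.mul_one] at h4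
        rw [eq_sub_iff_add_eq] at h4 ⊢
        rwa [add_comm]
      rw [h3, trace_sub, trace_smul, trace_one]
      simp
      ring
    simp only [hinv] at h1
    have h3 : ∑ g : N, (R (g ^ 2)).trace = ∑ g, (R g).trace := by
      refine Function.Bijective.sum_comp (e := fun g : N => g ^ 2) ?_ (fun g => (R g).trace)
      exact (Nat.Coprime.pow_left_bijective (G := N) (n := 2) (Nat.coprime_two_right.2 ho))
    have h4 : ∀ g : N, (R (g ^ 2)).trace = (R g).trace * (R g).trace - 2 := fun g => by
      rw [sq, _root_.map_mul, hCH, trace_sub, trace_smul, trace_one]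
      simp
    simp only [h4, Finset.sum_sub_distrib, h1, h2] at h3
    simp at h3
    have : (Fintype.card N : ℂ) = 0 := by linear_combination -h3
    simp at this

end CommonEigenvector

section Irreducibility

open Matrix

lemma exists_mul_eq_one_and_apply_zero {v : Fin 3 → ℂ} (hv : v ≠ 0) :
    ∃ S T : Matrix (Fin 3) (Fin 3) ℂ, S * T = 1 ∧ T * S = 1 ∧ ∀ i, S i 0 = v i := by
  suffices h : ∃ S : Matrix (Fin 3) (Fin 3) ℂ, S.det ≠ 0 ∧ ∀ i, S i 0 = v i by
    obtain ⟨S, hS, h⟩ := h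
    exact ⟨S, S⁻¹, Matrix.mul_nonsing_inv _ hS.isUnit, Matrix.nonsing_inv_mul _ hS.isUnit, h⟩
  by_cases h0 : v 0 ≠ 0
  · exact ⟨!![v 0, 0, 0; v 1, 1, 0; v 2, 0, 1], by simpa [det_fin_three] using h0, by
      intro i; fin_cases i <;> rfl⟩
  by_cases h1 : v 1 ≠ 0
  · exact ⟨!![v 0, 1, 0; v 1, 0, 0; v 2, 0, 1], by simpa [det_fin_three] using h1, by
      intro i; fin_cases i <;> rfl⟩
  by_cases h2 : v 2 ≠ 0
  · exact ⟨!![v 0, 0, 1; v 1, 1, 0; v 2, 0, 0], by simpa [det_fin_three] using h2, by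
      intro i; fin_cases i <;> rfl⟩
  push Not at h0 h1 h2
  exact absurd (by ext i; fin_cases i; exacts [h0, h1, h2]) hv

/-- A simple nonabelian group with a faithful three-dimensional representation of determinant one
fixes no nonzero vector. -/
lemma false_of_mulVec_eq {N : Type*} [Group N] [Fintype N] [IsSimpleGroup N]
    (hna : ∃ a b : N, a * b ≠ b * a) (ρ : N →* Matrix (Fin 3) (Fin 3) ℂ)
    (hρ : Function.Injective ρ) (hdet : ∀ n, (ρ n).det = 1) {v : Fin 3 → ℂ} (hv : v ≠ 0)
    (hfix : ∀ n, ρ n *ᵥ v = v) : False := by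
  obtain ⟨S, T, hST, hTS, hSv⟩ := exists_mul_eq_one_and_apply_zero hv
  let M : N →* Matrix (Fin 3) (Fin 3) ℂ :=
    { toFun := fun n => T * ρ n * S
      map_one' := by rw [_root_.map_one, Matrix.mul_one, hTS]
      map_mul' := fun a b => by
        rw [_root_.map_mul, show T * ρ a * S * (T * ρ b * S) = T * ρ a * (S * T) * (ρ b * S) by
          simp only [Matrix.mul_assoc], hST]
        simp only [Matrix.mul_assoc, Matrix.one_mul] }
  have hM0 : ∀ n i, M n i 0 = (1 : Matrix (Fin 3) (Fin 3) ℂ) i 0 := by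
    intro n i
    change (T * ρ n * S) i 0 = _
    rw [Matrix.mul_assoc, ← hTS, Matrix.mul_apply, Matrix.mul_apply]
    refine Finset.sum_congr rfl fun j _ => ?_
    congr 1
    rw [hSv, Matrix.mul_apply]
    simp only [hSv]
    exact congrFun (hfix n) j
  have hMinj : Function.Injective M := fun a b hab => hρ (by
    have := congrArg (fun A => S * A * T) hab
    change S * (T * ρ a * S) * T = S * (T * ρ b * S) * T at this
    have h : ∀ A, S * (T * A * S) * T = A := fun A => by
      rw [show S * (T * A * S) * T = S * T * A * (S * T) by simp only [Matrix.mul_assoc], hST,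
        Matrix.one_mul, Matrix.mul_one]
    rwa [h, h] at this)
  have hMdet : ∀ n, (M n).det = 1 := fun n => by
    change (T * ρ n * S).det = 1
    rw [det_mul, det_mul, hdet, mul_one, ← det_mul, hTS, det_one]
  let R : N →* Matrix (Fin 2) (Fin 2) ℂ :=
    { toFun := fun n => (M n).submatrix Fin.succ Fin.succ
      map_one' := by
        rw [_root_.map_one]
        exact Matrix.submatrix_one _ (Fin.succ_injective _)
      map_mul' := fun a b => by
        ext i j
        rw [_root_.map_mul, submatrix_apply, Matrix.mul_apply, Fin.sum_univ_succ, hM0,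
            Matrix.mul_apply]
        simp }
  by_cases hR : ∃ n, R n ≠ 1
  · refine false_of_two_dimensional hna R ?_ fun n => ?_
    · obtain ⟨n, hn⟩ := hR
      have := MonoidHom.injective_of_isSimpleGroup R.toHomUnits ⟨n, fun h => hn (by
        simpa using congrArg Units.val h)⟩
      intro a b hab
      exact this (Units.ext hab)
    · rw [← hMdet n, det_fin_two, det_fin_three, hM0, hM0, hM0]
      simp [R]
  · push Not at hR
    have h1 : ∀ n, M n 1 1 = 1 := fun n => congrFun₂ (hR n) 0 0
    have h2 : ∀ n, M n 1 2 = 0 := fun n => congrFun₂ (hR n) 0 1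
    have h3 : ∀ n, M n 2 1 = 0 := fun n => congrFun₂ (hR n) 1 0
    have h4 : ∀ n, M n 2 2 = 1 := fun n => congrFun₂ (hR n) 1 1
    obtain ⟨a, b, hab⟩ := hna
    refine hab (hMinj ?_)
    rw [_root_.map_mul, _root_.map_mul]
    ext i j
    fin_cases i <;> fin_cases j <;>
      simp [Matrix.mul_apply, Fin.sum_univ_three, hM0, h1, h2, h3, h4, add_comm]

variable {Γ : Type*} [Group Γ] {ρ : Γ →* Matrix (Fin 3) (Fin 3) ℂ} {G : Type*} [Group G]
  {π : Γ →* G}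

/-- A subgroup meeting the scalars trivially and mapping onto the quotient is isomorphic to it. -/
noncomputable def IsProjectiveLift.equivOfInf (h : IsProjectiveLift ρ π) (N : Subgroup Γ)
    (h1 : ∀ n ∈ N, n ∈ scalarSubgroup ρ → n = 1) (h2 : ∀ g, ∃ n ∈ N, π n = g) : N ≃* G :=
  MulEquiv.ofBijective (π.comp N.subtype) ⟨by
    rw [injective_iff_map_eq_one]
    exact fun n hn => Subtype.ext (h1 n n.2 ((h.ker _).1 hn)), fun g => by
    obtain ⟨n, hn, rfl⟩ := h2 g
    exact ⟨⟨n, hn⟩, rfl⟩⟩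

theorem IsProjectiveLift.hasScalarCommutant [Fintype Γ] [IsSimpleGroup G]
    (h : IsProjectiveLift ρ π) (hna : ∃ a b : G, a * b ≠ b * a) : HasScalarCommutant ρ := by
  classical
  by_contra hc
  obtain ⟨v, hv, κ, hκ⟩ := exists_eigenvector_of_not_hasScalarCommutant (Or.inr rfl) hc
  let N := κ.toHomUnits.ker
  have hN : ∀ n ∈ N, κ n = 1 := fun n hn => by
    simpa using congrArg Units.val (MonoidHom.mem_ker.1 hn)
  let e : N ≃* G := h.equivOfInf N (by
    intro n hn hz
    obtain ⟨c, hc⟩ := mem_scalarSubgroup.1 hz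
    refine h.rep.injective ?_
    have h1 := hκ n
    rw [hN n hn, hc, smul_mulVec, one_mulVec] at h1
    rw [hc, smul_left_injective ℂ hv h1, one_smul, _root_.map_one]) (by
    intro g
    obtain ⟨g, rfl⟩ := h.surjective g
    obtain ⟨z, hz, hzg⟩ := MonoidHom.exists_mem_ker_eq_of_isSimpleGroup hna π h.surjective
      κ.toHomUnits g
    refine ⟨g * z⁻¹, ?_, ?_⟩
    · rw [MonoidHom.mem_ker, _root_.map_mul, _root_.map_inv, hzg, mul_inv_cancel]
    · rw [_root_.map_mul, _root_.map_inv, MonoidHom.mem_ker.1 hz, inv_one, mul_one])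
  have : IsSimpleGroup N := e.isSimpleGroup
  obtain ⟨a, b, hab⟩ := hna
  refine false_of_mulVec_eq (N := N) ⟨e.symm a, e.symm b, fun h => hab ?_⟩ (ρ.comp N.subtype)
    (h.rep.injective.comp Subtype.val_injective) (fun n => h.rep.det_eq_one _) hv fun n => ?_
  · simpa using congrArg e h
  · exact (hκ n).trans (by rw [hN n n.2, one_smul])

end Irreducibility

section SymmetricSquare

open Matrix
open scoped Kronecker

variable {Γ : Type*} [Group Γ] {ρ : Γ →* Matrix (Fin 3) (Fin 3) ℂ}

/-- The action on bilinear forms, `X ↦ ρ g * X * (ρ g)ᵀ`. -/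
def formAction (ρ : Γ →* Matrix (Fin 3) (Fin 3) ℂ) :
    Γ →* Module.End ℂ (Matrix (Fin 3) (Fin 3) ℂ) where
  toFun g := LinearMap.mulRight ℂ (ρ g)ᵀ ∘ₗ LinearMap.mulLeft ℂ (ρ g)
  map_one' := by
    ext1 X
    simp
  map_mul' g h := by
    ext1 X
    simp [Matrix.mul_assoc]

lemma formAction_apply (g : Γ) (X : Matrix (Fin 3) (Fin 3) ℂ) :
    formAction ρ g X = ρ g * X * (ρ g)ᵀ := rfl

lemma formAction_transpose (g : Γ) (X : Matrix (Fin 3) (Fin 3) ℂ) :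
    (formAction ρ g X)ᵀ = formAction ρ g Xᵀ := by
  simp [formAction_apply, Matrix.mul_assoc]

/-- The subspace of symmetric matrices. -/
def symmetricForms : Submodule ℂ (Matrix (Fin 3) (Fin 3) ℂ) where
  carrier := {X | Xᵀ = X}
  zero_mem' := transpose_zero
  add_mem' {X Y} (hX : Xᵀ = X) (hY : Yᵀ = Y) := by
    change (X + Y)ᵀ = X + Y
    rw [transpose_add, hX, hY]
  smul_mem' c {X} (hX : Xᵀ = X) := by
    change (c • X)ᵀ = c • X
    rw [transpose_smul, hX]

lemma mem_symmetricForms {X : Matrix (Fin 3) (Fin 3) ℂ} : X ∈ symmetricForms ↔ Xᵀ = X := Iff.rfl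

lemma formAction_mem_symmetricForms (g : Γ) {X : Matrix (Fin 3) (Fin 3) ℂ}
    (hX : X ∈ symmetricForms) : formAction ρ g X ∈ symmetricForms := by
  rw [mem_symmetricForms] at *
  rw [formAction_transpose, hX]

lemma three_lt_finrank_symmetricForms : 3 < Module.finrank ℂ symmetricForms := by
  let f : (Fin 4 → ℂ) →ₗ[ℂ] Matrix (Fin 3) (Fin 3) ℂ :=
    { toFun := fun x => !![x 0, x 3, 0; x 3, x 1, 0; 0, 0, x 2]
      map_add' := fun x y => by
        ext i j
        fin_cases i <;> fin_cases j <;> simp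
      map_smul' := fun c x => by
        ext i j
        fin_cases i <;> fin_cases j <;> simp }
  have hfx : ∀ x, f x = !![x 0, x 3, 0; x 3, x 1, 0; 0, 0, x 2] := fun x => rfl
  have hf : Function.Injective (f.codRestrict symmetricForms fun x => by
      rw [mem_symmetricForms, hfx]
      ext i j
      fin_cases i <;> fin_cases j <;> rfl) := by
    intro x y h
    have h' : f x = f y := congrArg Subtype.val h
    rw [hfx, hfx] at h'
    have h0 := congrFun₂ h' 0 0
    have h1 := congrFun₂ h' 1 1
    have h2 := congrFun₂ h' 2 2
    have h3 := congrFun₂ h' 0 1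
    simp at h0 h1 h2 h3
    ext i
    fin_cases i
    exacts [h0, h1, h2, h3]
  have := LinearMap.finrank_le_finrank_of_injective hf
  simp only [Module.finrank_fin_fun] at this
  omega

/-- The skew-symmetric matrix of the cross product with a vector. -/
def crossMatrix : (Fin 3 → ℂ) →ₗ[ℂ] Matrix (Fin 3) (Fin 3) ℂ where
  toFun w := !![0, -w 2, w 1; w 2, 0, -w 0; -w 1, w 0, 0]
  map_add' x y := by
    ext i j
    fin_cases i <;> fin_cases j <;> simp [add_comm]
  map_smul' c x := by
    ext i j
    fin_cases i <;> fin_cases j <;> simp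

lemma crossMatrix_apply (w : Fin 3 → ℂ) :
    crossMatrix w = !![0, -w 2, w 1; w 2, 0, -w 0; -w 1, w 0, 0] := rfl

lemma exists_crossMatrix_eq {X : Matrix (Fin 3) (Fin 3) ℂ} (hX : Xᵀ = -X) :
    crossMatrix ![X 2 1, X 0 2, X 1 0] = X := by
  have h : ∀ i j, X j i = - X i j := fun i j => congrFun₂ hX i j
  ext i j
  fin_cases i <;> fin_cases j <;> simp [crossMatrix_apply]
  all_goals have h0 := h 0 0; have h1 := h 1 1; have h2 := h 2 2; have := h 0 1; have := h 0 2
  all_goals have := h 1 2; grind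

lemma mul_crossMatrix_mul_transpose (M : Matrix (Fin 3) (Fin 3) ℂ) (w : Fin 3 → ℂ) :
    M * crossMatrix w * Mᵀ = crossMatrix (M.adjugateᵀ *ᵥ w) := by
  ext i j
  fin_cases i <;> fin_cases j <;>
    simp [crossMatrix_apply, adjugate_fin_three, Matrix.mul_apply, mulVec, dotProduct,
      Fin.sum_univ_three] <;> ring

/-- If the representation on symmetric forms is irreducible, then the commutant of the tensor
square is spanned by the identity and the flip. -/
theorem hasFlipCommutant_of_forall_submodule (hc : HasScalarCommutant ρ)
    (hdet : ∀ g, (ρ g).det = 1)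
    (hS : ∀ S ≤ symmetricForms, (∀ g, ∀ X ∈ S, formAction ρ g X ∈ S) →
      S = ⊥ ∨ S = symmetricForms) : HasFlipCommutant ρ := by
  intro T hT
  -- the linear map on matrices given by `T`
  let V : Matrix (Fin 3) (Fin 3) ℂ →ₗ[ℂ] (Fin 3 × Fin 3 → ℂ) :=
    { toFun := fun X p => X p.1 p.2
      map_add' := fun X Y => rfl
      map_smul' := fun c X => rfl }
  let V' : (Fin 3 × Fin 3 → ℂ) →ₗ[ℂ] Matrix (Fin 3) (Fin 3) ℂ :=
    { toFun := fun x => Matrix.of fun i j => x (i, j)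
      map_add' := fun X Y => rfl
      map_smul' := fun c X => rfl }
  have hVV' : ∀ x, V (V' x) = x := fun x => rfl
  have hV'V : ∀ X, V' (V X) = X := fun x => rfl
  let L : Module.End ℂ (Matrix (Fin 3) (Fin 3) ℂ) := V' ∘ₗ Matrix.toLin' T ∘ₗ V
  have hVL : ∀ X, V (L X) = T *ᵥ V X := fun X => rfl
  have hVA : ∀ g X, V (formAction ρ g X) = tensorSquare ρ g *ᵥ V X := by
    intro g X
    funext p
    change (ρ g * X * (ρ g)ᵀ) p.1 p.2 = ∑ q, (ρ g ⊗ₖ ρ g) p q * X q.1 q.2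
    simp only [Matrix.mul_apply, transpose_apply, Finset.sum_mul, Fintype.sum_prod_type]
    rw [Finset.sum_comm]
    exact Finset.sum_congr rfl fun i _ => Finset.sum_congr rfl fun j _ => by
      change _ = ρ g p.1 i * ρ g p.2 j * X i j
      ring
  have hL : ∀ g X, L (formAction ρ g X) = formAction ρ g (L X) := by
    intro g X
    have : V (L (formAction ρ g X)) = V (formAction ρ g (L X)) := by
      rw [hVL, hVA, hVA, hVL, mulVec_mulVec, mulVec_mulVec, hT]
    rw [← hV'V (L _), this, hV'V]
  let τ : Module.End ℂ (Matrix (Fin 3) (Fin 3) ℂ) := transposeLinearEquiv (Fin 3) (Fin 3) ℂ ℂ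
  have hτ : ∀ X, τ X = Xᵀ := fun X => rfl
  have hdim := three_lt_finrank_symmetricForms
  -- symmetric part on symmetric matrices
  let Lp := L + τ ∘ₗ L
  let Lm := L - τ ∘ₗ L
  have hLp : ∀ X, Lp X = L X + (L X)ᵀ := fun X => rfl
  have hLm : ∀ X, Lm X = L X - (L X)ᵀ := fun X => rfl
  have hLpA : ∀ g X, Lp (formAction ρ g X) = formAction ρ g (Lp X) := fun g X => by
    rw [hLp, hLp, hL, formAction_transpose, map_add]
  have hLmA : ∀ g X, Lm (formAction ρ g X) = formAction ρ g (Lm X) := fun g X => by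
    rw [hLm, hLm, hL, formAction_transpose, map_sub]
  have hLps : ∀ X, Lp X ∈ symmetricForms := fun X => by
    rw [mem_symmetricForms, hLp, transpose_add, transpose_transpose, add_comm]
  have hLma : ∀ X, (Lm X)ᵀ = -Lm X := fun X => by
    rw [hLm, transpose_sub, transpose_transpose, neg_sub]
  have hsub : ∀ S ≤ symmetricForms, (∀ g, ∀ X ∈ S, formAction ρ g X ∈ S) → S ≠ ⊥ →
      ∀ X ∈ symmetricForms, X ∈ S := fun S h1 h2 h3 X hX => by
    rw [(hS S h1 h2).resolve_left h3]; exact hX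
  obtain ⟨a, ha⟩ : ∃ a : ℂ, ∀ X ∈ symmetricForms, Lp X = a • X := by
    let Ls : Module.End ℂ symmetricForms := Lp.restrict fun X _ => hLps X
    have : Nontrivial symmetricForms := Module.nontrivial_of_finrank_pos (R := ℂ) (by omega)
    obtain ⟨a, ha⟩ := Module.End.exists_eigenvalue Ls
    obtain ⟨X, hX⟩ := ha.exists_hasEigenvector
    refine ⟨a, fun Y hY => ?_⟩
    have := hsub (symmetricForms ⊓ LinearMap.ker (Lp - a • LinearMap.id)) inf_le_left ?_ ?_ Y hY
    · have := LinearMap.mem_ker.1 this.2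
      simpa [sub_eq_zero] using this
    · rintro g Z ⟨hZ, hZ'⟩
      refine ⟨formAction_mem_symmetricForms g hZ, ?_⟩
      simp only [LinearMap.mem_ker, LinearMap.sub_apply, LinearMap.smul_apply, LinearMap.id_apply,
        SetLike.mem_coe, sub_eq_zero] at hZ' ⊢
      rw [hLpA, hZ', map_smul]
    · intro h
      have h1 : (X : Matrix (Fin 3) (Fin 3) ℂ) ∈
          symmetricForms ⊓ LinearMap.ker (Lp - a • LinearMap.id) := by
        refine ⟨X.2, ?_⟩
        have := congrArg Subtype.val hX.apply_eq_smul
        simp only [LinearMap.mem_ker, LinearMap.sub_apply, LinearMap.smul_apply, LinearMap.id_apply,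
          SetLike.mem_coe, sub_eq_zero]
        exact this
      rw [h, Submodule.mem_bot] at h1
      exact hX.2 (Subtype.ext h1)
  have hm : ∀ X ∈ symmetricForms, Lm X = 0 := by
    intro X hX
    refine (hsub (symmetricForms ⊓ LinearMap.ker Lm) inf_le_left ?_ ?_ X hX).2
    · rintro g Z ⟨hZ, hZ'⟩
      refine ⟨formAction_mem_symmetricForms g hZ, ?_⟩
      simp only [LinearMap.mem_ker, SetLike.mem_coe] at hZ' ⊢
      rw [hLmA, hZ', map_zero]
    · intro h
      let f : symmetricForms →ₗ[ℂ] (Fin 3 → ℂ) :=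
        { toFun := fun X => ![Lm X 2 1, Lm X 0 2, Lm X 1 0]
          map_add' := fun X Y => by
            ext i; fin_cases i <;> simp
          map_smul' := fun c X => by
            ext i; fin_cases i <;> simp }
      have hk : LinearMap.ker f ≠ ⊥ := LinearMap.ker_ne_bot_of_finrank_lt (by simpa using hdim)
      obtain ⟨Z, hZ, hZ0⟩ := Submodule.exists_mem_ne_zero_of_ne_bot hk
      have h1 := exists_crossMatrix_eq (hLma Z)
      have h2 : ![Lm Z 2 1, Lm Z 0 2, Lm Z 1 0] = 0 := hZ
      rw [h2, map_zero] at h1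
      have h3 : (Z : Matrix (Fin 3) (Fin 3) ℂ) ∈ symmetricForms ⊓ LinearMap.ker Lm :=
        ⟨Z.2, h1.symm⟩
      rw [h, Submodule.mem_bot] at h3
      exact hZ0 (Subtype.ext h3)
  have hA : ∀ g w, formAction ρ g (crossMatrix w) = crossMatrix ((ρ g⁻¹)ᵀ *ᵥ w) := by
    intro g w
    rw [formAction_apply, mul_crossMatrix_mul_transpose]
    have h1 : ρ g⁻¹ * ρ g = 1 := by rw [← _root_.map_mul, inv_mul_cancel, _root_.map_one]
    have h2 := Matrix.mul_adjugate (ρ g)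
    rw [hdet, one_smul] at h2
    rw [← left_inv_eq_right_inv h1 h2]
  have hp : ∀ w, Lp (crossMatrix w) = 0 := by
    have h := hS (LinearMap.range (Lp ∘ₗ crossMatrix)) ?_ ?_
    · rcases h with h | h
      · intro w
        have : Lp (crossMatrix w) ∈ LinearMap.range (Lp ∘ₗ crossMatrix) := ⟨w, rfl⟩
        rwa [h, Submodule.mem_bot] at this
      · have := LinearMap.finrank_range_le (Lp ∘ₗ crossMatrix)
        rw [h, Module.finrank_fin_fun] at this
        omega
    · rintro _ ⟨w, rfl⟩
      exact hLps _
    · rintro g _ ⟨w, rfl⟩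
      refine ⟨(ρ g⁻¹)ᵀ *ᵥ w, ?_⟩
      rw [LinearMap.comp_apply, LinearMap.comp_apply, ← hA, hLpA]
  obtain ⟨c, hcc⟩ : ∃ c : ℂ, ∀ w, Lm (crossMatrix w) = c • crossMatrix w := by
    let f : (Fin 3 → ℂ) →ₗ[ℂ] (Fin 3 → ℂ) :=
      { toFun := fun w => ![Lm (crossMatrix w) 2 1, Lm (crossMatrix w) 0 2, Lm (crossMatrix w) 1 0]
        map_add' := fun X Y => by
          ext i; fin_cases i <;> simp
        map_smul' := fun c X => by
          ext i; fin_cases i <;> simp }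
    have hf : ∀ w, crossMatrix (f w) = Lm (crossMatrix w) := fun w => exists_crossMatrix_eq (hLma _)
    have hinj : Function.Injective crossMatrix := fun x y h => by
      ext i
      fin_cases i
      · exact congrFun₂ h 2 1
      · exact congrFun₂ h 0 2
      · exact congrFun₂ h 1 0
    have hB : ∀ w, LinearMap.toMatrix' f *ᵥ w = f w := fun w => LinearMap.toMatrix'_mulVec f w
    obtain ⟨c, hcB⟩ := hc (LinearMap.toMatrix' f)ᵀ fun g => by
      have : LinearMap.toMatrix' f * (ρ g)ᵀ = (ρ g)ᵀ * LinearMap.toMatrix' f := by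
        refine Matrix.ext_of_mulVec_single fun i => ?_
        rw [← mulVec_mulVec, ← mulVec_mulVec, hB, hB]
        apply hinj
        have hA' := hA g⁻¹
        rw [inv_inv] at hA'
        rw [← hA', hf, hf, ← hA', hLmA]
      have := congrArg transpose this
      rwa [transpose_mul, transpose_mul, transpose_transpose] at this
    refine ⟨c, fun w => ?_⟩
    rw [← hf, ← hB, ← transpose_transpose (LinearMap.toMatrix' f), hcB, transpose_smul,
      transpose_one, smul_mulVec, one_mulVec, map_smul]
  have hmain : ∀ X, L X = ((a + c) / 4) • X + ((a - c) / 4) • Xᵀ := by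
    intro X
    have h1 : ∀ Y, L Y = (1 / 2 : ℂ) • (Lp Y + Lm Y) := fun Y => by
      rw [hLp, hLm, add_add_sub_cancel, ← two_smul ℂ, smul_smul]
      norm_num
    have h2 : X + Xᵀ ∈ symmetricForms := by
      rw [mem_symmetricForms, transpose_add, transpose_transpose, add_comm]
    have h3 : (X - Xᵀ)ᵀ = -(X - Xᵀ) := by
      rw [transpose_sub, transpose_transpose, neg_sub]
    have h4 := exists_crossMatrix_eq h3
    have h5 : X = (1 / 2 : ℂ) • (X + Xᵀ) + (1 / 2 : ℂ) • (X - Xᵀ) := by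
      rw [← smul_add, add_add_sub_cancel, ← two_smul ℂ, smul_smul]
      norm_num
    rw [show L X = (1 / 2 : ℂ) • L (X + Xᵀ) + (1 / 2 : ℂ) • L (X - Xᵀ) by
      rw [← map_smul, ← map_smul, ← map_add, ← h5], h1, h1, ha _ h2, hm _ h2, ← h4, hp, hcc, h4]
    ext i j
    simp
    ring
  refine ⟨(a + c) / 4, (a - c) / 4, ?_⟩
  refine Matrix.ext_of_mulVec_single fun p => ?_
  rw [← hVV' (Pi.single p 1), ← hVL, hmain]
  ext ⟨i, j⟩
  simp only [Matrix.add_mulVec, Matrix.smul_mulVec, one_mulVec, hVV', map_add, map_smul]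
  have h : ∀ x : Fin 3 × Fin 3 → ℂ, V (V' x)ᵀ = flipMatrix *ᵥ x := fun x => by
    funext q
    change x (q.2, q.1) = _
    simp [mulVec, dotProduct, flipMatrix, Fintype.sum_prod_type, ite_and]
  rw [h]

end SymmetricSquare

section InvariantForms

open Matrix

lemma exists_eq_vecMulVec_sub_one {M : Matrix (Fin 3) (Fin 3) ℂ} (h2 : M ^ 2 = 1) (hdet : M.det = 1)
    (h1 : M ≠ 1) : ∃ v φ : Fin 3 → ℂ, φ ⬝ᵥ v = 1 ∧ M = (2 : ℂ) • vecMulVec v φ - 1 := by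
  obtain ⟨S, T, d, hST, hTS, hM⟩ := exists_diagonal_of_pow_eq_one two_ne_zero h2
  have hd : IsDiagonalization M S T d := ⟨hST, hTS, hM⟩
  have hd2 : ∀ i, d i = 1 ∨ d i = -1 := by
    have : d ^ 2 = 1 := (hd.pow 2).eq_of_eq (h2 ▸ IsDiagonalization.one hST hTS)
    exact fun i => sq_eq_one_iff.1 (congrFun this i)
  have hd3 : d 0 * d 1 * d 2 = 1 := by
    rw [← hdet, hd.det, Fin.prod_univ_three]
  have hd1 : ¬ (d 0 = 1 ∧ d 1 = 1 ∧ d 2 = 1) := fun h => h1 (by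
    have : d = 1 := by
      ext i; fin_cases i; exacts [h.1, h.2.1, h.2.2]
    rw [hM, this, Pi.one_def, diagonal_one, Matrix.mul_one, hST])
  obtain ⟨k, hk⟩ : ∃ k, d = (2 : ℂ) • Pi.single k 1 - 1 := by
    rcases hd2 0 with e0 | e0 <;> rcases hd2 1 with e1 | e1 <;> rcases hd2 2 with e2 | e2 <;>
      first
      | exact (hd1 ⟨e0, e1, e2⟩).elim
      | (exfalso; rw [e0, e1, e2] at hd3; norm_num at hd3; done)
      | (refine ⟨0, ?_⟩; ext i; fin_cases i <;> simp [e0, e1, e2]; norm_num; done)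
      | (refine ⟨1, ?_⟩; ext i; fin_cases i <;> simp [e0, e1, e2]; norm_num; done)
      | (refine ⟨2, ?_⟩; ext i; fin_cases i <;> simp [e0, e1, e2]; norm_num)
  refine ⟨fun i => S i k, fun j => T k j, congrFun₂ hTS k k |>.trans (by simp), ?_⟩
  have h3 : S * diagonal (Pi.single k 1) * T = vecMulVec (fun i => S i k) fun j => T k j := by
    ext i j
    simp [Matrix.mul_apply, vecMulVec_apply, diagonal_apply, Pi.single_apply]
  rw [← h3, hM, hk]
  have h4 : diagonal ((2 : ℂ) • Pi.single k 1 - 1) =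
      (2 : ℂ) • diagonal (Pi.single k (1 : ℂ)) - 1 := by
    ext i j
    by_cases h : i = j
    · subst h; simp
    · simp [h]
  rw [h4, Matrix.mul_sub, Matrix.sub_mul, Matrix.mul_smul, Matrix.smul_mul, Matrix.mul_one, hST]

lemma LinearMap.eq_one_of_finrank_range_le_one {V : Type*} [AddCommGroup V] [Module ℂ V]
    [FiniteDimensional ℂ V] {A : Module.End ℂ V} (h2 : A * A = 1) (hdet : LinearMap.det A = 1)
    (hr : Module.finrank ℂ (LinearMap.range (1 - A)) ≤ 1) : A = 1 := by
  by_contra hne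
  obtain ⟨x, hx⟩ : ∃ x, (1 - A) x ≠ 0 := by
    by_contra! h
    exact hne (sub_eq_zero.1 (LinearMap.ext h : 1 - A = 0)).symm
  set u := (1 - A) x with hu
  have hspan : ∀ y, ∃ c : ℂ, c • u = (1 - A) y := by
    obtain ⟨w, hw⟩ := finrank_le_one_iff.1 hr
    intro y
    obtain ⟨a, ha⟩ := hw ⟨_, x, rfl⟩
    obtain ⟨b, hb⟩ := hw ⟨_, y, rfl⟩
    replace ha : a • (w : V) = u := congrArg Subtype.val ha
    replace hb : b • (w : V) = (1 - A) y := congrArg Subtype.val hb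
    have ha0 : a ≠ 0 := by
      rintro rfl
      rw [zero_smul] at ha
      exact hx ha.symm
    refine ⟨b / a, ?_⟩
    rw [← ha, smul_smul, div_mul_cancel₀ _ ha0, hb]
  choose f hf using hspan
  have hinj := smul_left_injective ℂ hx
  let F : Module.Dual ℂ V :=
    { toFun := fun y => -f y
      map_add' := fun y z => by
        rw [← neg_add]
        congr 1
        apply hinj
        change f (y + z) • u = (f y + f z) • u
        rw [add_smul, hf, hf, hf, map_add]
      map_smul' := fun c y => by
        rw [RingHom.id_apply, smul_neg]
        congr 1
        apply hinj
        change f (c • y) • u = (c • f y) • u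
        rw [smul_assoc, hf, hf, map_smul] }
  have hA : A = LinearMap.transvection F u := by
    ext y
    rw [LinearMap.transvection.apply]
    change A y = y + -f y • u
    rw [neg_smul, hf]
    simp
  have hu2 : (1 - A) u = (2 : ℂ) • u := by
    have h3 : A (A x) = x := congrArg (fun B : Module.End ℂ V => B x) h2
    simp only [hu, LinearMap.sub_apply, Module.End.one_apply, map_sub, h3, two_smul]
    abel
  have hfu : f u = 2 := hinj ((hf u).trans hu2)
  rw [hA, LinearMap.transvection.det] at hdet
  change 1 + -f u = 1 at hdet
  rw [hfu] at hdet
  norm_num at hdet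

variable {Γ : Type*} [Group Γ] {ρ : Γ →* Matrix (Fin 3) (Fin 3) ℂ}

/-- An involution acts trivially on an invariant space of symmetric forms, on which it has
determinant one, or on the quotient by it. -/
lemma formAction_eq_or_sub_mem (hdet : ∀ g, (ρ g).det = 1) {t : Γ} (ht : t ^ 2 = 1)
    (ht1 : ρ t ≠ 1) {S : Submodule ℂ (Matrix (Fin 3) (Fin 3) ℂ)}
    (hS : S ≤ symmetricForms) (hinv : ∀ X ∈ S, formAction ρ t X ∈ S)
    (hS1 : LinearMap.det ((formAction ρ t).restrict hinv) = 1) :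
    (∀ X ∈ S, formAction ρ t X = X) ∨ ∀ X ∈ symmetricForms, formAction ρ t X - X ∈ S := by
  have ht2 : ρ t ^ 2 = 1 := by rw [← _root_.map_pow, ht, _root_.map_one]
  obtain ⟨v, φ, hφ, hM⟩ := exists_eq_vecMulVec_sub_one ht2 (hdet t) ht1
  let ψ : (Fin 3 → ℂ) →ₗ[ℂ] ℂ :=
    { toFun := fun w => φ ⬝ᵥ w
      map_add' := fun x y => dotProduct_add _ _ _
      map_smul' := fun c x => dotProduct_smul _ _ _ }
  have hψ : ∀ w, ψ w = φ ⬝ᵥ w := fun w => rfl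
  let Ψ : (Fin 3 → ℂ) →ₗ[ℂ] Matrix (Fin 3) (Fin 3) ℂ :=
    { toFun := fun w => vecMulVec v w + vecMulVec w v
      map_add' := fun x y => by
        rw [vecMulVec_add, add_vecMulVec]
        abel
      map_smul' := fun c x => by
        rw [vecMulVec_smul, smul_vecMulVec, smul_add, RingHom.id_apply] }
  have hΨ : ∀ w, Ψ w = vecMulVec v w + vecMulVec w v := fun w => rfl
  let E := (LinearMap.ker ψ).map Ψ
  have hE : ∀ X ∈ symmetricForms, formAction ρ t X - X ∈ E := by
    intro X hX
    refine ⟨(2 : ℂ) • ((φ ⬝ᵥ (X *ᵥ φ)) • v - X *ᵥ φ), ?_, ?_⟩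
    · rw [SetLike.mem_coe, LinearMap.mem_ker, map_smul, map_sub, map_smul, hψ, hψ, hφ]
      simp
    · have hX' : φ ᵥ* X = X *ᵥ φ := by
        rw [← vecMul_transpose, mem_symmetricForms.1 hX]
      rw [hΨ, formAction_apply, hM, transpose_sub, transpose_smul, transpose_vecMulVec,
        transpose_one]
      simp only [Matrix.sub_mul, Matrix.mul_sub, Matrix.smul_mul, Matrix.mul_smul, Matrix.one_mul,
        Matrix.mul_one, vecMulVec_mul, mul_vecMulVec, hX']
      ext i j
      simp [vecMulVec_apply]
      rw [sub_mulVec, smul_mulVec, vecMulVec_mulVec, dotProduct_comm]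
      simp
      ring
  have hE2 : Module.finrank ℂ E ≤ 2 := by
    refine (Submodule.finrank_map_le _ _).trans ?_
    have h1 : LinearMap.ker ψ < ⊤ := by
      rw [lt_top_iff_ne_top]
      intro h
      have h2 : v ∈ LinearMap.ker ψ := h ▸ Submodule.mem_top
      rw [LinearMap.mem_ker, hψ, hφ] at h2
      exact one_ne_zero h2
    have h2 := Submodule.finrank_lt h1.ne
    rw [Module.finrank_fin_fun] at h2
    omega
  by_cases hcap : Module.finrank ℂ (S ⊓ E : Submodule ℂ (Matrix (Fin 3) (Fin 3) ℂ)) ≤ 1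
  · left
    set A := (formAction ρ t).restrict hinv with hA
    have hAv : ∀ X : S, (A X : Matrix (Fin 3) (Fin 3) ℂ) = formAction ρ t X := fun X => rfl
    have h1 : A = 1 := by
      apply LinearMap.eq_one_of_finrank_range_le_one _ hS1
      · refine le_trans ?_ hcap
        have h3 : LinearMap.range (1 - A) ≤ (S ⊓ E).comap S.subtype := by
          rintro _ ⟨X, rfl⟩
          refine ⟨((1 - A) X).2, ?_⟩
          have := E.neg_mem (hE X (hS X.2))
          rw [neg_sub] at this
          exact this
        rw [← Submodule.finrank_map_subtype_eq S (LinearMap.range (1 - A))]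
        exact Submodule.finrank_mono (Submodule.map_le_iff_le_comap.2 h3)
      · ext1 X
        apply Subtype.ext
        change formAction ρ t (formAction ρ t X) = X
        rw [← Module.End.mul_apply, ← _root_.map_mul, ← sq, ht, _root_.map_one]
        rfl
    intro X hX
    have := hAv ⟨X, hX⟩
    rw [h1] at this
    exact this.symm
  · right
    have h1 : S ⊓ E = E := Submodule.eq_of_le_of_finrank_le inf_le_right (by omega)
    exact fun X hX => (inf_eq_right.1 h1) (hE X hX)

end InvariantForms

section ReducibleForms

open Matrix

variable {Γ : Type*} [Group Γ] {ρ : Γ →* Matrix (Fin 3) (Fin 3) ℂ} {G : Type*} [Group G]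
  {π : Γ →* G}

open scoped ComplexOrder in
lemma IsProjectiveLift.card_map_of_form [Fintype Γ] (h : IsProjectiveLift ρ π) (N : Subgroup Γ)
    (hc : HasScalarCommutant (ρ.comp N.subtype)) {X : Matrix (Fin 3) (Fin 3) ℂ} (hX : X ≠ 0)
    (hinv : ∀ n ∈ N, ρ n * X * (ρ n)ᵀ = X) :
    Nat.card (N.map π) = 12 ∨ Nat.card (N.map π) = 24 ∨ Nat.card (N.map π) = 60 := by
  classical
  have hU : ∀ n, (ρ n)ᴴ * ρ n = 1 := fun n => by
    rw [← h.rep.map_inv, ← _root_.map_mul, inv_mul_cancel, _root_.map_one]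
  obtain ⟨c, hcX⟩ := hc (X * Xᴴ) fun n => by
    change ρ n * (X * Xᴴ) = X * Xᴴ * ρ n
    have h1 := hinv n n.2
    have h2 : (ρ n)ᵀ * (ρ n)ᵀᴴ = 1 := by
      rw [← transpose_one, ← hU n, transpose_mul]
      rfl
    have h3 : X * Xᴴ = ρ n * (X * Xᴴ) * (ρ n)ᴴ := by
      conv_lhs => rw [← h1]
      rw [conjTranspose_mul, conjTranspose_mul,
        show ρ n * X * (ρ n)ᵀ * ((ρ n)ᵀᴴ * (Xᴴ * (ρ n)ᴴ)) =
          ρ n * X * ((ρ n)ᵀ * (ρ n)ᵀᴴ) * (Xᴴ * (ρ n)ᴴ) by simp only [Matrix.mul_assoc], h2]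
      simp only [Matrix.mul_assoc, Matrix.one_mul]
    conv_rhs => rw [h3]
    rw [Matrix.mul_assoc, hU, Matrix.mul_one]
  have hc0 : c ≠ 0 := by
    rintro rfl
    rw [zero_smul] at hcX
    exact hX (Matrix.self_mul_conjTranspose_eq_zero.1 hcX)
  have hN : IsSpecialUnitaryRep (ρ.comp N.subtype) :=
    ⟨h.rep.injective.comp Subtype.val_injective, fun n => h.rep.det_eq_one _,
      fun n => h.rep.map_inv _⟩
  have hcard := hN.card_of_form hc (X' := c⁻¹ • Xᴴ) (by
    rw [Matrix.mul_smul, hcX, smul_smul, inv_mul_cancel₀ hc0, one_smul])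
    fun n => hinv n n.2
  have hker : ∀ n ∈ N, π n = 1 → n = 1 := by
    intro n hn h1
    obtain ⟨z, hz⟩ := mem_scalarSubgroup.1 ((h.ker n).1 h1)
    have h2 := hinv n hn
    have hz3 : z ^ 3 = 1 := by
      have := h.rep.det_eq_one n
      rwa [hz, det_smul, det_one, mul_one, Fintype.card_fin] at this
    rw [hz, transpose_smul, transpose_one, Matrix.smul_mul, Matrix.one_mul, Matrix.mul_smul,
      Matrix.mul_one, smul_smul] at h2
    have h4 : z * z = 1 := smul_left_injective ℂ hX (by simpa using h2)
    refine h.rep.injective ?_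
    rw [hz, _root_.map_one, show z = 1 by linear_combination hz3 - z * h4, one_smul]
  have e : N ≃ N.map π := Equiv.ofBijective (fun n => ⟨π n, n, n.2, rfl⟩) ⟨by
    intro a b hab
    have hab' : π a = π b := congrArg Subtype.val hab
    have := hker _ (N.mul_mem a.2 (N.inv_mem b.2)) (by
      rw [_root_.map_mul, _root_.map_inv, hab', mul_inv_cancel])
    exact Subtype.ext (mul_inv_eq_one.1 this), by
    rintro ⟨_, n, hn, rfl⟩
    exact ⟨⟨n, hn⟩, rfl⟩⟩
  rwa [← Nat.card_congr e]

lemma IsProjectiveLift.pow_three_eq_one (h : IsProjectiveLift ρ π) {z : Γ} (hz : π z = 1) :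
    z ^ 3 = 1 := by
  have : (⟨z, (h.ker z).1 hz⟩ : scalarSubgroup ρ) ^ Nat.card (scalarSubgroup ρ) = 1 :=
    pow_card_eq_one'
  rw [h.card_scalar] at this
  exact congrArg Subtype.val this

lemma IsProjectiveLift.eq_one_of_sq (h : IsProjectiveLift ρ π) {z : Γ} (hz : π z = 1)
    (hz2 : z ^ 2 = 1) : z = 1 := by
  have h3 := h.pow_three_eq_one hz
  rwa [pow_succ, hz2, one_mul] at h3

lemma IsProjectiveLift.map_eq_one_of_sq [IsSimpleGroup G] (h : IsProjectiveLift ρ π)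
    (hna : ∃ a b : G, a * b ≠ b * a) {H : Type*} [CommGroup H] (κ : Γ →* H) {t : Γ}
    (ht : t ^ 2 = 1) : κ t = 1 := by
  obtain ⟨z, hz, hzt⟩ := MonoidHom.exists_mem_ker_eq_of_isSimpleGroup hna π h.surjective κ t
  have h3 : κ t ^ 3 = 1 := by rw [hzt, ← _root_.map_pow, h.pow_three_eq_one hz, _root_.map_one]
  have h2 : κ t ^ 2 = 1 := by rw [← _root_.map_pow, ht, _root_.map_one]
  rw [pow_succ, h2, one_mul] at h3
  exact h3

/-- A subgroup mapping onto the quotient still acts irreducibly. -/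
lemma IsProjectiveLift.hasScalarCommutant_subgroup (h : IsProjectiveLift ρ π)
    (hc : HasScalarCommutant ρ) {N : Subgroup Γ} (hN : N.map π = ⊤) :
    HasScalarCommutant (ρ.comp N.subtype) := by
  intro X hX
  refine hc X fun g => ?_
  obtain ⟨n, hn, hng⟩ := (hN.symm ▸ Subgroup.mem_top (π g) : π g ∈ N.map π)
  have h1 : π (n⁻¹ * g) = 1 := by
    rw [_root_.map_mul, _root_.map_inv, hng, inv_mul_cancel]
  obtain ⟨z, hz⟩ := mem_scalarSubgroup.1 ((h.ker _).1 h1)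
  have h2 : ρ g = z • ρ n := by
    rw [← mul_inv_cancel_left n g, _root_.map_mul, hz, Matrix.mul_smul, Matrix.mul_one]
  rw [h2, Matrix.smul_mul, Matrix.mul_smul]
  exact congrArg (z • ·) (hX ⟨n, hn⟩)

theorem IsProjectiveLift.card_eq_of_not_hasFlipCommutant [Fintype Γ] [IsSimpleGroup G]
    (h : IsProjectiveLift ρ π) (hna : ∃ a b : G, a * b ≠ b * a) {t : Γ} (ht : t ^ 2 = 1)
    (ht1 : t ≠ 1) (hf : ¬ HasFlipCommutant ρ) :
    Nat.card G = 12 ∨ Nat.card G = 24 ∨ Nat.card G = 60 := by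
  classical
  have hc := h.hasScalarCommutant hna
  obtain ⟨S, hS, hinv, hbot, htop⟩ : ∃ S ≤ symmetricForms,
      (∀ g, ∀ X ∈ S, formAction ρ g X ∈ S) ∧ S ≠ ⊥ ∧ S ≠ symmetricForms := by
    by_contra! hcon
    refine hf (hasFlipCommutant_of_forall_submodule hc h.rep.det_eq_one fun S hS hinv => ?_)
    by_contra! h1
    exact h1.2 (hcon S hS hinv h1.1)
  obtain ⟨S₀, W, hlt, hS₀, hW, htW⟩ : ∃ S₀ W : Submodule ℂ (Matrix (Fin 3) (Fin 3) ℂ), S₀ < W ∧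
      (∀ g, ∀ X ∈ S₀, formAction ρ g X ∈ S₀) ∧ (∀ g, ∀ X ∈ W, formAction ρ g X ∈ W) ∧
      ∀ X ∈ W, formAction ρ t X - X ∈ S₀ := by
    have ht' : ρ t ≠ 1 := fun h1 => ht1 (h.rep.injective (h1.trans (_root_.map_one ρ).symm))
    let κ : Γ →* ℂ :=
      { toFun := fun g => LinearMap.det ((formAction ρ g).restrict (hinv g))
        map_one' := by
          rw [← LinearMap.det_id (M := S)]
          congr 1
          ext1 X
          apply Subtype.ext
          change formAction ρ 1 X = X
          rw [_root_.map_one]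
          rfl
        map_mul' := fun a b => by
          rw [← LinearMap.det_comp]
          congr 1
          ext1 X
          apply Subtype.ext
          change formAction ρ (a * b) X = formAction ρ a (formAction ρ b X)
          rw [_root_.map_mul]
          rfl }
    have hκ : κ t = 1 := by
      simpa using congrArg Units.val (h.map_eq_one_of_sq hna κ.toHomUnits ht)
    rcases formAction_eq_or_sub_mem h.rep.det_eq_one ht ht' hS (hinv t) hκ with h1 | h1
    · exact ⟨⊥, S, bot_lt_iff_ne_bot.2 hbot, fun g X hX => by
        rw [(Submodule.mem_bot ℂ).1 hX, map_zero]; exact Submodule.zero_mem _, hinv,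
        fun X hX => by rw [h1 X hX, sub_self]; exact Submodule.zero_mem _⟩
    · exact ⟨S, symmetricForms, lt_of_le_of_ne hS htop, hinv,
        fun g X hX => formAction_mem_symmetricForms g hX, h1⟩
  let K : Subgroup Γ :=
    { carrier := {n | ∀ X ∈ W, formAction ρ n X - X ∈ S₀}
      one_mem' := fun X hX => by
        rw [_root_.map_one, Module.End.one_apply, sub_self]
        exact S₀.zero_mem
      mul_mem' := fun {a b} ha hb X hX => by
        have h1 := S₀.add_mem (hS₀ a _ (hb X hX)) (ha X hX)
        rwa [map_sub, sub_add_sub_cancel, ← Module.End.mul_apply, ← _root_.map_mul] at h1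
      inv_mem' := fun {a} ha X hX => by
        have h1 := S₀.neg_mem (hS₀ a⁻¹ _ (ha X hX))
        rwa [map_sub, neg_sub, ← Module.End.mul_apply, ← _root_.map_mul, inv_mul_cancel,
          _root_.map_one, Module.End.one_apply] at h1 }
  have hKmem : ∀ n, n ∈ K ↔ ∀ X ∈ W, formAction ρ n X - X ∈ S₀ := fun n => Iff.rfl
  have hKn : K.Normal := ⟨fun n hn g => (hKmem _).2 fun X hX => by
    have h1 := hS₀ g _ (hn _ (hW g⁻¹ X hX))
    rwa [map_sub, ← Module.End.mul_apply, ← Module.End.mul_apply, ← Module.End.mul_apply,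
      ← _root_.map_mul, ← _root_.map_mul, ← _root_.map_mul, mul_inv_cancel, _root_.map_one,
      Module.End.one_apply] at h1⟩
  have hKtop : K.map π = ⊤ := by
    refine (hKn.map π h.surjective).eq_bot_or_eq_top.resolve_left fun hb => ht1 ?_
    refine h.eq_one_of_sq ?_ ht
    have : π t ∈ K.map π := ⟨t, (hKmem t).2 htW, rfl⟩
    rwa [hb, Subgroup.mem_bot] at this
  obtain ⟨X, hXW, hXS⟩ := SetLike.exists_of_lt hlt
  let Y := ∑ n : K, formAction ρ n X
  have hY0 : Y ≠ 0 := by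
    intro h0
    have h1 : (Fintype.card K : ℂ) • X ∈ S₀ := by
      have h2 : ∑ n : K, (formAction ρ n X - X) ∈ S₀ :=
        S₀.sum_mem fun n _ => (hKmem n).1 n.2 X hXW
      rw [Finset.sum_sub_distrib, Finset.sum_const, Finset.card_univ,
        show ∑ n : K, formAction ρ n X = 0 from h0, zero_sub] at h2
      rw [Nat.cast_smul_eq_nsmul]
      exact S₀.neg_mem_iff.1 h2
    exact hXS ((S₀.smul_mem_iff (Nat.cast_ne_zero.2 Fintype.card_ne_zero)).1 h1)
  have hYinv : ∀ n ∈ K, ρ n * Y * (ρ n)ᵀ = Y := by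
    intro n hn
    change formAction ρ n Y = Y
    rw [map_sum]
    refine Fintype.sum_equiv (Equiv.mulLeft ⟨n, hn⟩) _ _ fun m => ?_
    rw [← Module.End.mul_apply, ← _root_.map_mul]
    rfl
  have := h.card_map_of_form K (h.hasScalarCommutant_subgroup hc hKtop) hY0 hYinv
  rwa [hKtop, Nat.card_congr (Subgroup.topEquiv (G := G)).toEquiv] at this

end ReducibleForms

section HalfTurns

open Matrix

/-- The matrix `M` is the half turn about the line spanned by `v`. -/
structure IsHalfTurn (M : Matrix (Fin 3) (Fin 3) ℂ) (v : Fin 3 → ℂ) (μ : ℂ) : Prop where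
  eq : M = μ • vecMulVec v (star v) - 1
  norm : μ * (star v ⬝ᵥ v) = 2

lemma exists_isHalfTurn {M : Matrix (Fin 3) (Fin 3) ℂ} (h2 : M ^ 2 = 1) (hdet : M.det = 1)
    (h1 : M ≠ 1) (hM : Mᴴ = M) : ∃ v μ, IsHalfTurn M v μ := by
  obtain ⟨v, φ, hφ, hv⟩ := exists_eq_vecMulVec_sub_one h2 hdet h1
  have h3 : vecMulVec v φ = vecMulVec (star φ) (star v) := by
    rw [← conjTranspose_vecMulVec]
    have h4 := hM
    rw [hv, conjTranspose_sub, conjTranspose_smul, conjTranspose_one, sub_left_inj,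
      star_ofNat] at h4
    exact (smul_right_injective _ two_ne_zero h4).symm
  have h4 : star v ⬝ᵥ star φ = 1 := by
    rw [star_dotProduct_star, hφ, star_one]
  have h5 : star φ = (φ ⬝ᵥ star φ) • v := by
    have := congrArg (· *ᵥ star φ) h3
    simp only [vecMulVec_mulVec, h4] at this
    simpa using this.symm
  have h6 : φ = star (φ ⬝ᵥ star φ) • star v := by
    rw [← star_smul, ← h5, star_star]
  refine ⟨v, 2 * star (φ ⬝ᵥ star φ), ?_, ?_⟩
  · rw [hv, mul_smul, ← vecMulVec_smul (star (φ ⬝ᵥ star φ)), ← h6]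
  · rw [mul_assoc, ← smul_eq_mul (star _), ← smul_dotProduct, ← h6, hφ, mul_one]

namespace IsHalfTurn

variable {M M' : Matrix (Fin 3) (Fin 3) ℂ} {u v : Fin 3 → ℂ} {μ ν : ℂ}

lemma ne_zero (h : IsHalfTurn M v μ) : μ ≠ 0 ∧ v ≠ 0 := by
  constructor <;> rintro rfl <;> simpa using h.norm

lemma smul (h : IsHalfTurn M v μ) {c : ℂ} (hc : c ≠ 0) :
    IsHalfTurn M (c • v) (μ / (c * star c)) := by
  have hc' : star c ≠ 0 := star_ne_zero.2 hc
  constructor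
  · rw [h.eq, star_smul, smul_vecMulVec, vecMulVec_smul, smul_smul, smul_smul]
    congr 2
    field_simp
  · rw [star_smul, smul_dotProduct, dotProduct_smul, smul_eq_mul, smul_eq_mul, ← h.norm]
    field_simp

lemma mul_eq (h : IsHalfTurn M u μ) (h' : IsHalfTurn M' v ν) :
    M * M' = (μ * ν * (star u ⬝ᵥ v)) • vecMulVec u (star v) - μ • vecMulVec u (star u) -
      ν • vecMulVec v (star v) + 1 := by
  rw [h.eq, h'.eq, Matrix.sub_mul, Matrix.mul_sub, Matrix.mul_one, Matrix.one_mul,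
    Matrix.smul_mul, Matrix.mul_smul, vecMulVec_mul_vecMulVec, vecMulVec_smul, smul_smul, smul_smul]
  abel

lemma star_dotProduct_eq_zero (huv : star u ⬝ᵥ v = 0) : star v ⬝ᵥ u = 0 := by
  rw [← star_star u, star_dotProduct_star, huv, star_zero]

lemma commute (h : IsHalfTurn M u μ) (h' : IsHalfTurn M' v ν) (huv : star u ⬝ᵥ v = 0) :
    M * M' = M' * M := by
  rw [h.mul_eq h', h'.mul_eq h, huv, star_dotProduct_eq_zero huv]
  simp only [mul_zero, zero_smul, zero_sub]
  abel

lemma dotProduct_eq_zero (h : IsHalfTurn M u μ) (h' : IsHalfTurn M' v ν) (hne : M ≠ M')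
    (hc : M * M' = M' * M) : star u ⬝ᵥ v = 0 := by
  by_contra huv
  rw [h.mul_eq h', h'.mul_eq h] at hc
  have h1 : (μ * ν * (star u ⬝ᵥ v)) • vecMulVec u (star v) =
      (ν * μ * (star v ⬝ᵥ u)) • vecMulVec v (star u) := by
    have := congrArg (fun A => A + μ • vecMulVec u (star u) + ν • vecMulVec v (star v) - 1) hc
    convert this using 1 <;> module
  have h2 := congrArg (· *ᵥ v) h1
  simp only [smul_mulVec, vecMulVec_mulVec] at h2
  have hvv : star v ⬝ᵥ v ≠ 0 := fun h0 => by simpa [h0] using h'.norm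
  obtain ⟨c, hc⟩ : ∃ c : ℂ, u = c • v := by
    refine ⟨(μ * ν * (star u ⬝ᵥ v) * (star v ⬝ᵥ v))⁻¹ *
      ((ν * μ * (star v ⬝ᵥ u)) * (star u ⬝ᵥ v)), ?_⟩
    rw [mul_smul, eq_inv_smul_iff₀ (mul_ne_zero (mul_ne_zero (mul_ne_zero h.ne_zero.1 h'.ne_zero.1)
      huv) hvv), mul_smul, mul_smul]
    simpa [smul_smul, mul_assoc] using h2
  subst hc
  have hc0 : c ≠ 0 := by
    rintro rfl
    simpa using h.ne_zero.2
  apply hne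
  have h3 := h.norm
  rw [star_smul, smul_dotProduct, dotProduct_smul, smul_eq_mul, smul_eq_mul, ← h'.norm] at h3
  rw [h.eq, h'.eq, star_smul, smul_vecMulVec, vecMulVec_smul, smul_smul, smul_smul]
  congr 2
  exact mul_right_cancel₀ hvv (by linear_combination h3)

lemma exists_mulVec_eq (h : IsHalfTurn M v μ) {A : Matrix (Fin 3) (Fin 3) ℂ}
    (hA : M * A = A * M) : ∃ a : ℂ, A *ᵥ v = a • v ∧ star v ᵥ* A = a • star v := by
  have h1 : vecMulVec v (star v ᵥ* A) = vecMulVec (A *ᵥ v) (star v) := by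
    rw [h.eq, Matrix.sub_mul, Matrix.mul_sub, Matrix.one_mul, Matrix.mul_one, sub_left_inj,
      Matrix.smul_mul, Matrix.mul_smul, vecMulVec_mul, mul_vecMulVec] at hA
    exact smul_right_injective _ h.ne_zero.1 hA
  have hvv : star v ⬝ᵥ v ≠ 0 := fun h0 => by simpa [h0] using h.norm
  have h2 := congrArg (· *ᵥ v) h1
  simp only [vecMulVec_mulVec] at h2
  have h3 : A *ᵥ v = ((star v ⬝ᵥ v)⁻¹ * ((star v ᵥ* A) ⬝ᵥ v)) • v := by
    rw [mul_smul, eq_inv_smul_iff₀ hvv]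
    simpa using h2.symm
  refine ⟨_, h3, ?_⟩
  rw [h3, smul_vecMulVec, ← vecMulVec_smul] at h1
  have h4 := congrArg (star v ᵥ* ·) h1
  simp only [vecMul_vecMulVec] at h4
  exact smul_right_injective _ hvv (by simpa using h4)

lemma mul_mul_transpose (h : IsHalfTurn M v μ) {X : Matrix (Fin 3) (Fin 3) ℂ}
    (h1 : X *ᵥ star v = v) (h2 : star v ᵥ* X = v) : M * X * Mᵀ = X := by
  have h3 : star v ⬝ᵥ v = v ⬝ᵥ star v := dotProduct_comm _ _
  have h4 := h.norm
  rw [h.eq, transpose_sub, transpose_smul, transpose_vecMulVec, transpose_one, Matrix.sub_mul,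
    Matrix.one_mul, Matrix.smul_mul, vecMulVec_mul, h2, Matrix.mul_sub, Matrix.mul_one,
    Matrix.mul_smul, Matrix.sub_mul, Matrix.smul_mul, vecMulVec_mul_vecMulVec, mul_vecMulVec, h1,
    vecMulVec_smul, ← h3]
  have : (μ * μ * (star v ⬝ᵥ v)) = 2 * μ := by linear_combination μ * h4
  rw [smul_sub, smul_smul, smul_smul, this]
  module

end IsHalfTurn

lemma exists_smul_star_dotProduct (v w : Fin 3 → ℂ) :
    ∃ c : ℂ, c ≠ 0 ∧ star (star (c • v) ⬝ᵥ w) = star (c • v) ⬝ᵥ w := by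
  by_cases h : star v ⬝ᵥ w = 0
  · exact ⟨1, one_ne_zero, by rw [one_smul, h, star_zero]⟩
  · refine ⟨_, h, ?_⟩
    rw [star_smul, smul_dotProduct, smul_eq_mul, star_mul, star_star]

variable {Γ : Type*} [Group Γ] {ρ : Γ →* Matrix (Fin 3) (Fin 3) ℂ} {G : Type*} [Group G]
  {π : Γ →* G}

/-- Three half turns about independent lines, two of which are orthogonal, preserve a common
bilinear form. -/
theorem IsProjectiveLift.card_map_closure [Fintype Γ] (h : IsProjectiveLift ρ π) {x y z : Γ}
    {e f g : Fin 3 → ℂ} {κ₁ κ₂ κ₃ : ℂ} (hx : IsHalfTurn (ρ x) e κ₁) (hy : IsHalfTurn (ρ y) f κ₂)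
    (hz : IsHalfTurn (ρ z) g κ₃) (heg : star e ⬝ᵥ g = 0) (hef : star e ⬝ᵥ f ≠ 0)
    (hgf : star g ⬝ᵥ f ≠ 0) (hind : ∀ w : Fin 3 → ℂ, w ⬝ᵥ e = 0 → w ⬝ᵥ f = 0 → w ⬝ᵥ g = 0 → w = 0) :
    Nat.card ((Subgroup.closure {x, y, z}).map π) = 12 ∨
      Nat.card ((Subgroup.closure {x, y, z}).map π) = 24 ∨
      Nat.card ((Subgroup.closure {x, y, z}).map π) = 60 := by
  wlog hreal : star (star e ⬝ᵥ f) = star e ⬝ᵥ f ∧ star (star g ⬝ᵥ f) = star g ⬝ᵥ f generalizing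
    e g κ₁ κ₃
  · obtain ⟨c, hc, hce⟩ := exists_smul_star_dotProduct e f
    obtain ⟨d, hd, hde⟩ := exists_smul_star_dotProduct g f
    refine this (hx.smul hc) (hz.smul hd) ?_ ?_ ?_ ?_ ⟨hce, hde⟩
    · rw [star_smul, smul_dotProduct, dotProduct_smul, heg, smul_zero, smul_zero]
    · rw [star_smul, smul_dotProduct]
      exact mul_ne_zero (star_ne_zero.2 hc) hef
    · rw [star_smul, smul_dotProduct]
      exact mul_ne_zero (star_ne_zero.2 hd) hgf
    · intro w h1 h2 h3
      rw [dotProduct_smul] at h1 h3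
      exact hind w ((mul_eq_zero.1 h1).resolve_left hc) h2 ((mul_eq_zero.1 h3).resolve_left hd)
  let S : Matrix (Fin 3) (Fin 3) ℂ := (Matrix.of ![e, f, g])ᵀ
  have hS : IsUnit S.det := by
    rw [isUnit_iff_ne_zero]
    intro h0
    obtain ⟨w, hw0, hw⟩ := Matrix.exists_vecMul_eq_zero_iff.2 h0
    exact hw0 (hind w (congrFun hw 0) (congrFun hw 1) (congrFun hw 2))
  let S' := S⁻¹
  have hSS' : S * S' = 1 := Matrix.mul_nonsing_inv _ hS
  have hS'S : S' * S = 1 := Matrix.nonsing_inv_mul _ hS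
  have hsymm : Sᴴ * S = (Sᴴ * S)ᵀ := by
    have h1 : ∀ i j, (Sᴴ * S) i j = star (![e, f, g] i) ⬝ᵥ ![e, f, g] j := fun i j => rfl
    have h2 : ∀ u v : Fin 3 → ℂ, star (star u ⬝ᵥ v) = star v ⬝ᵥ u := fun u v => by
      rw [← star_dotProduct_star, star_star]
    ext i j
    rw [transpose_apply, h1, h1]
    have h3 := IsHalfTurn.star_dotProduct_eq_zero heg
    rw [h2, h2] at hreal
    fin_cases i <;> fin_cases j <;> simp [heg, h3, hreal.1, hreal.2]
  let X := S * S'ᴴᵀ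
  have hX1 : X * Sᴴᵀ = S := by
    rw [Matrix.mul_assoc, ← transpose_mul, ← conjTranspose_mul, hS'S, conjTranspose_one,
      transpose_one, Matrix.mul_one]
  have hX2 : Sᴴ * X = Sᵀ := by
    rw [← Matrix.mul_assoc, hsymm, transpose_mul, Matrix.mul_assoc, ← transpose_mul,
      ← conjTranspose_mul, hSS', conjTranspose_one, transpose_one, Matrix.mul_one]
  have hcol : ∀ i, X *ᵥ star (![e, f, g] i) = ![e, f, g] i ∧
      star (![e, f, g] i) ᵥ* X = ![e, f, g] i := fun i =>
    ⟨funext fun j => congrFun₂ hX1 j i, funext fun j => congrFun₂ hX2 i j⟩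
  refine h.card_map_of_form _ (fun A hA => ?_) (X := X) ?_ fun n hn => ?_
  · have hA' : ∀ n ∈ ({x, y, z} : Set Γ), ρ n * A = A * ρ n := fun n hn =>
      hA ⟨n, Subgroup.subset_closure hn⟩
    obtain ⟨a, ha, ha'⟩ := hx.exists_mulVec_eq (hA' x (by simp))
    obtain ⟨b, hb, hb'⟩ := hy.exists_mulVec_eq (hA' y (by simp))
    obtain ⟨c, hc, hc'⟩ := hz.exists_mulVec_eq (hA' z (by simp))
    have hab : a = b := by
      have h1 : (star e ᵥ* A) ⬝ᵥ f = star e ⬝ᵥ (A *ᵥ f) := (dotProduct_mulVec _ _ _).symm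
      rw [ha', hb, smul_dotProduct, dotProduct_smul] at h1
      exact mul_right_cancel₀ hef h1
    have hcb : c = b := by
      have h1 : (star g ᵥ* A) ⬝ᵥ f = star g ⬝ᵥ (A *ᵥ f) := (dotProduct_mulVec _ _ _).symm
      rw [hc', hb, smul_dotProduct, dotProduct_smul] at h1
      exact mul_right_cancel₀ hgf h1
    subst hab hcb
    refine ⟨c, ?_⟩
    have h1 : A * S = c • S := by
      ext i j
      fin_cases j
      exacts [congrFun ha i, congrFun hb i, congrFun hc i]
    rw [← Matrix.mul_one A, ← hSS', ← Matrix.mul_assoc, h1, Matrix.smul_mul]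
  · intro h0
    rw [h0, Matrix.zero_mul] at hX1
    rw [← hX1, Matrix.zero_mul] at hSS'
    exact zero_ne_one hSS'
  · induction hn using Subgroup.closure_induction with
    | mem n hn =>
      rcases hn with rfl | rfl | rfl
      · exact hx.mul_mul_transpose (hcol 0).1 (hcol 0).2
      · exact hy.mul_mul_transpose (hcol 1).1 (hcol 1).2
      · exact hz.mul_mul_transpose (hcol 2).1 (hcol 2).2
    | one => rw [_root_.map_one, transpose_one, Matrix.one_mul, Matrix.mul_one]
    | mul a b _ _ ha hb =>
      change formAction ρ (a * b) X = X
      change formAction ρ a X = X at ha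
      change formAction ρ b X = X at hb
      rw [_root_.map_mul (formAction ρ), Module.End.mul_apply, hb, ha]
    | inv a _ ha =>
      change formAction ρ a⁻¹ X = X
      change formAction ρ a X = X at ha
      conv_lhs => rw [← ha]
      rw [← Module.End.mul_apply, ← _root_.map_mul, inv_mul_cancel, _root_.map_one,
        Module.End.one_apply]

end HalfTurns

section InvolutionCentralizers

variable {G : Type*} [Group G]

/-- If `t` is the only involution commuting with `t`, a Sylow `2`-subgroup containing `t` acts
freely on the nontrivial cosets of the centralizer of `t`. -/
lemma card_dvd_index_centralizer_sub_one [Finite G] {t : G} (ht : orderOf t = 2)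
    (huniq : ∀ u : G, orderOf u = 2 → u * t = t * u → u = t) (P : Sylow 2 G) (htP : t ∈ P) :
    Nat.card P ∣ (Subgroup.centralizer {t}).index - 1 := by
  classical
  have htc : ∀ p ∈ P, p * t = t * p := by
    have : Nontrivial P := ⟨⟨t, htP⟩, 1, fun h => by
      have := congrArg Subtype.val h
      rw [Subgroup.coe_one] at this
      rw [show t = 1 from this, orderOf_one] at ht
      omega⟩
    have hc := P.isPGroup'.center_nontrivial
    obtain ⟨n, hn0, hn⟩ := (P.isPGroup'.to_subgroup (Subgroup.center P)).nontrivial_iff_card.1 hc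
    obtain ⟨z, hz⟩ := exists_prime_orderOf_dvd_card' (G := Subgroup.center P) 2
      (by rw [hn]; exact dvd_pow_self 2 hn0.ne')
    have hzc : ∀ p : P, p * z = z * p := fun p => Subgroup.mem_center_iff.1 z.2 p
    have hz2 : orderOf ((z : P) : G) = 2 := by
      rw [Subgroup.orderOf_coe, Subgroup.orderOf_coe, hz]
    have hzt := huniq _ hz2 (congrArg Subtype.val (hzc ⟨t, htP⟩)).symm
    intro p hp
    rw [← hzt]
    exact congrArg Subtype.val (hzc ⟨p, hp⟩)
  set C := Subgroup.centralizer {t} with hC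
  have hmem : ∀ g, g ∈ C ↔ g * t = t * g := fun g => by
    rw [hC, Subgroup.mem_centralizer_singleton_iff, eq_comm]
  let S : SubMulAction P (G ⧸ C) :=
    { carrier := {x | x ≠ ((1 : G) : G ⧸ C)}
      smul_mem' := fun p x hx h => hx (by
        rw [← eq_inv_smul_iff] at h
        rw [h]
        change (((p⁻¹ : P) : G) * 1 : G) = ((1 : G) : G ⧸ C)
        rw [QuotientGroup.eq, hmem, mul_one, mul_one]
        exact htc _ (inv_mem (inv_mem p.2))) }
  have hfree : ∀ x : S, MulAction.stabilizer P x = ⊥ := by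
    rintro ⟨x, hx⟩
    obtain ⟨g, rfl⟩ := QuotientGroup.mk_surjective x
    rw [eq_bot_iff]
    intro p hp
    rw [Subgroup.mem_bot]
    by_contra hp1
    have h1 : ∀ p : P, p ∈ MulAction.stabilizer P (⟨_, hx⟩ : S) →
        (g⁻¹ * p * g) * t = t * (g⁻¹ * p * g) := by
      intro p hp
      have h1 : (((p : G) * g : G) : G ⧸ C) = g := congrArg Subtype.val hp
      have h2 := QuotientGroup.eq.1 h1.symm
      rwa [hmem, ← mul_assoc] at h2
    obtain ⟨n, hn⟩ := IsPGroup.iff_orderOf.1 P.isPGroup' p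
    obtain ⟨m, rfl⟩ : ∃ m, n = m + 1 := Nat.exists_eq_succ_of_ne_zero (by
      rintro rfl
      rw [pow_zero, orderOf_eq_one_iff] at hn
      exact hp1 hn)
    have h2 : orderOf (p ^ 2 ^ m) = 2 := by
      rw [orderOf_pow_of_dvd (by positivity) (by rw [hn]; exact pow_dvd_pow 2 (Nat.le_succ m)), hn,
        pow_succ, Nat.mul_div_cancel_left _ (by positivity)]
    have h3 : ((p ^ 2 ^ m : P) : G) = t := huniq _ (by rw [Subgroup.orderOf_coe, h2])
      (htc _ (p ^ 2 ^ m).2)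
    have h4 := h1 _ (pow_mem hp (2 ^ m))
    rw [h3] at h4
    have h5 : g⁻¹ * t * g = t := huniq _ (by
      rw [← ht]
      convert orderOf_injective (MulAut.conj g⁻¹).toMonoidHom (MulAut.conj g⁻¹).injective t using 2
      simp) h4
    refine hx (QuotientGroup.eq.2 ?_)
    rw [mul_one, inv_mem_iff, hmem]
    rw [mul_assoc, inv_mul_eq_iff_eq_mul] at h5
    exact h5.symm
  have e := MulAction.selfEquivOrbitsQuotientProd hfree
  have h1 := Nat.card_congr e
  rw [Nat.card_prod] at h1
  have h2 : Nat.card S = C.index - 1 := by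
    change Nat.card {x : G ⧸ C // x ≠ ((1 : G) : G ⧸ C)} = _
    have := Fintype.ofFinite (G ⧸ C)
    rw [Nat.card_eq_fintype_card, Fintype.card_subtype_compl, Fintype.card_subtype_eq,
      Subgroup.index, Nat.card_eq_fintype_card]
  rw [← h2, h1]
  exact dvd_mul_left _ _

lemma not_commute_of_orderOf (hord : ∀ g : G, orderOf g ≤ 7) {q r : G} (hq : orderOf q = 2)
    (hr : orderOf r = 5) : q * r ≠ r * q := by
  intro h
  have := Commute.orderOf_mul_eq_mul_orderOf_of_coprime (x := q) (y := r) h (by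
    rw [hq, hr]; decide)
  rw [hq, hr] at this
  have := hord (q * r)
  omega

lemma exists_involution_commute [Finite G] (hG : Nat.card G = 360) (hord : ∀ g : G, orderOf g ≤ 7)
    {t : G} (ht : orderOf t = 2) : ∃ q : G, orderOf q = 2 ∧ q ≠ t ∧ q * t = t * q := by
  by_contra! hcon
  have huniq : ∀ u : G, orderOf u = 2 → u * t = t * u → u = t := fun u hu hut => by
    by_contra hne
    exact hcon u hu hne hut
  obtain ⟨P, hP⟩ := (IsPGroup.of_card (p := 2) (n := 1) (G := Subgroup.zpowers t) (by
    rw [Nat.card_zpowers, ht, pow_one])).exists_le_sylow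
  have hPcard : Nat.card P = 8 := card_sylow_subgroup (k := 3) (m := 45) hG (by decide) P
  have htP : t ∈ P := hP (Subgroup.mem_zpowers t)
  have h1 := card_dvd_index_centralizer_sub_one ht huniq P htP
  have h2 : ¬ 5 ∣ Nat.card (Subgroup.centralizer {t}) := by
    intro h5
    have : Fact (Nat.Prime 5) := ⟨by norm_num⟩
    obtain ⟨r, hr⟩ := exists_prime_orderOf_dvd_card' 5 h5
    rw [← Subgroup.orderOf_coe] at hr
    exact not_commute_of_orderOf hord ht hr (Subgroup.mem_centralizer_singleton_iff.1 r.2).symm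
  have h3 := (Subgroup.centralizer {t}).card_mul_index
  rw [hG] at h3
  rw [hPcard] at h1
  have key : ∀ m ∈ Nat.divisors 360, 8 ∣ m - 1 → 5 ∣ 360 / m := by decide +kernel
  refine h2 ?_
  convert key _ (Nat.mem_divisors.2 ⟨⟨_, (mul_comm _ _).trans h3 |>.symm⟩, by norm_num⟩) h1 using 1
  rw [← h3, Nat.mul_div_cancel _ (Nat.pos_of_ne_zero Subgroup.index_ne_zero_of_finite)]

lemma exists_involutions_mul [Finite G] [IsSimpleGroup G] (hna : ∃ a b : G, a * b ≠ b * a)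
    (hG : Nat.card G = 360) (hord : ∀ g : G, orderOf g ≤ 7) :
    ∃ t t' : G, orderOf t = 2 ∧ orderOf t' = 2 ∧ orderOf (t * t') = 5 := by
  have : Fact (Nat.Prime 5) := ⟨by norm_num⟩
  let P : Sylow 5 G := default
  have hP : Nat.card P = 5 := card_sylow_subgroup (k := 1) (m := 72) hG (by decide) P
  set N := Subgroup.normalizer (P : Set G) with hN
  have hN2 : 2 ∣ Nat.card N := by
    obtain ⟨h1, h2, h3, -⟩ := card_sylow_mem_divisors hna (p := 5) (k := 0) (m := 72) hG (by decide)
    have h4 := N.card_mul_index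
    rw [← P.card_eq_index_normalizer, hG] at h4
    generalize Nat.card (Sylow 5 G) = n at h1 h2 h3 h4
    rw [show Nat.divisors 72 = {1, 2, 3, 4, 6, 8, 9, 12, 18, 24, 36, 72} by decide] at h1
    simp only [Finset.mem_insert, Finset.mem_singleton] at h1
    have h5 : n = 6 ∨ n = 36 := by omega
    rcases h5 with rfl | rfl <;> omega
  obtain ⟨t, ht⟩ := exists_prime_orderOf_dvd_card' (G := N) 2 hN2
  obtain ⟨s, hs⟩ := exists_prime_orderOf_dvd_card' (G := P) 5 (by rw [hP])
  rw [← Subgroup.orderOf_coe] at ht hs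
  have h3 : (t : G)⁻¹ = t := by
    rw [inv_eq_iff_mul_eq_one, ← sq, ← ht, pow_orderOf_eq_one]
  refine ⟨t, s * t * s⁻¹, ht, ?_, ?_⟩
  · rw [← ht]
    exact orderOf_injective (MulAut.conj (s : G)).toMonoidHom (MulAut.conj (s : G)).injective t
  · have h1 : (t : G) * (s * t * s⁻¹) ∈ P := by
      have h2 : (t : G) * s * (t : G)⁻¹ ∈ P := (Subgroup.mem_normalizer_iff.1 t.2 s).1 s.2
      rw [h3] at h2
      simpa [mul_assoc] using mul_mem h2 (inv_mem s.2)
    have h5 : (t : G) * (s * t * s⁻¹) ≠ 1 := by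
      intro h5
      refine not_commute_of_orderOf hord ht hs ?_
      have h6 := eq_inv_of_mul_eq_one_right h5
      replace h6 := mul_inv_eq_iff_eq_mul.1 h6
      rw [h6, h3]
    have h6 : orderOf (⟨_, h1⟩ : P) = 5 := by
      refine orderOf_eq_prime ?_ fun h => h5 (congrArg Subtype.val h)
      have := pow_card_eq_one' (x := (⟨_, h1⟩ : P))
      rwa [show Nat.card { x // x ∈ P } = 5 from hP] at this
    rwa [← Subgroup.orderOf_coe] at h6

end InvolutionCentralizers

section AlternatingSix

open Matrix

variable {Γ : Type*} [Group Γ] {ρ : Γ →* Matrix (Fin 3) (Fin 3) ℂ} {G : Type*} [Group G]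
  {π : Γ →* G}

namespace IsProjectiveLift

lemma exists_involution (h : IsProjectiveLift ρ π) {x : G} (hx : orderOf x = 2) :
    ∃ y : Γ, π y = x ∧ y ^ 2 = 1 ∧ y ≠ 1 := by
  obtain ⟨y, rfl⟩ := h.surjective x
  have h2 : π y ^ 2 = 1 := by rw [← hx, pow_orderOf_eq_one]
  have h3 : π (y ^ 3) = π y := by rw [_root_.map_pow, pow_succ, h2, one_mul]
  refine ⟨y ^ 3, h3, ?_, fun h1 => ?_⟩
  · rw [← pow_mul, mul_comm, pow_mul]
    exact h.pow_three_eq_one (by rw [_root_.map_pow, h2])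
  · rw [h1, _root_.map_one] at h3
    rw [← h3, orderOf_one] at hx
    omega

lemma commute_of_map_commute (h : IsProjectiveLift ρ π) {x y : Γ} (hy : y ^ 2 = 1)
    (hc : π x * π y = π y * π x) : x * y = y * x := by
  have hz : π (x * y * x⁻¹ * y⁻¹) = 1 := by
    simp only [_root_.map_mul, _root_.map_inv]
    rw [hc, mul_inv_cancel_right, mul_inv_cancel]
  have h1 := h.eq_one_of_sq hz (by
    have h2 := h.rep.commute_scalar ((h.ker _).1 hz) y
    set z := x * y * x⁻¹ * y⁻¹ with hzd
    have h3 : z * y = x * y * x⁻¹ := by rw [hzd, inv_mul_cancel_right]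
    have h4 : (z * y) ^ 2 = 1 := by rw [h3, conj_pow, hy, mul_one, mul_inv_cancel]
    rwa [Commute.mul_pow (show Commute z y from h2.symm), hy, mul_one] at h4)
  rwa [mul_inv_eq_one, mul_inv_eq_iff_eq_mul] at h1

lemma exists_isHalfTurn (h : IsProjectiveLift ρ π) {y : Γ} (hy : y ^ 2 = 1) (hy1 : y ≠ 1) :
    ∃ v μ, IsHalfTurn (ρ y) v μ := by
  refine _root_.exists_isHalfTurn (by rw [← _root_.map_pow, hy, _root_.map_one])
    (h.rep.det_eq_one y) (fun h1 => hy1 (h.rep.injective (by rw [h1, _root_.map_one]))) ?_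
  rw [← h.rep.map_inv, inv_eq_of_mul_eq_one_right (by rw [← sq, hy])]

theorem nonempty_mulEquiv_alternatingGroup_six [Fintype Γ] [Finite G] [IsSimpleGroup G]
    (h : IsProjectiveLift ρ π) (hna : ∃ a b : G, a * b ≠ b * a) (hG : Nat.card G = 360)
    (hord : ∀ g : G, orderOf g ≤ 7) : Nonempty (G ≃* alternatingGroup (Fin 6)) := by
  obtain ⟨t, t', ht, ht', hs⟩ := exists_involutions_mul hna hG hord
  obtain ⟨q, hq, hqt, hqc⟩ := exists_involution_commute hG hord ht
  have hsq : ∀ {x : G}, orderOf x = 2 → x * x = 1 := fun {x} hx => by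
    rw [← sq, ← hx, pow_orderOf_eq_one]
  have htt' : t * t' ≠ t' * t := by
    intro hc
    have h1 : (t * t') ^ 2 = 1 := by
      rw [Commute.mul_pow hc, sq, sq, hsq ht, hsq ht', mul_one]
    have h2 := orderOf_dvd_of_pow_eq_one h1
    rw [hs] at h2
    omega
  have hqt' : q * t' ≠ t' * q := fun hc =>
    not_commute_of_orderOf hord hq hs (Commute.mul_right hqc hc)
  obtain ⟨x, rfl, hx2, hx1⟩ := h.exists_involution ht
  obtain ⟨y, rfl, hy2, hy1⟩ := h.exists_involution ht'
  obtain ⟨z, rfl, hz2, hz1⟩ := h.exists_involution hq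
  obtain ⟨e, κ₁, he⟩ := h.exists_isHalfTurn hx2 hx1
  obtain ⟨f, κ₂, hf⟩ := h.exists_isHalfTurn hy2 hy1
  obtain ⟨g, κ₃, hg⟩ := h.exists_isHalfTurn hz2 hz1
  have hcomm : ∀ {a b : Γ}, ρ a * ρ b = ρ b * ρ a → π a * π b = π b * π a := fun {a b} hab => by
    rw [← _root_.map_mul, ← _root_.map_mul] at hab ⊢
    rw [h.rep.injective hab]
  have hxz := h.commute_of_map_commute (x := x) hz2 hqc.symm
  have heg : star e ⬝ᵥ g = 0 := by
    refine he.dotProduct_eq_zero hg (fun h1 => hqt ?_) ?_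
    · rw [h.rep.injective h1]
    · rw [← _root_.map_mul, ← _root_.map_mul, hxz]
  have hcard := h.card_map_closure he hf hg heg (fun h0 => htt' (hcomm (he.commute hf h0)))
    (fun h0 => hqt' (hcomm (hg.commute hf h0))) ?_
  · set N := (Subgroup.closure {x, y, z}).map π with hN
    have hmem : π x * π y ∈ N := by
      rw [← _root_.map_mul]
      exact ⟨_, mul_mem (Subgroup.subset_closure (by simp)) (Subgroup.subset_closure (by simp)),
          rfl⟩
    have h5 : 5 ∣ Nat.card N := by
      rw [← hs, ← Subgroup.orderOf_mk _ hmem]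
      exact orderOf_dvd_natCard _
    have h60 : Nat.card N = 60 := by omega
    have hi := N.card_mul_index
    rw [h60, hG] at hi
    exact nonempty_mulEquiv_alternatingGroup_of_index hna (by norm_num) N
      (show N.index = 6 by omega) (by rw [hG]; rfl)
  · intro w hwe hwf hwg
    by_contra hw
    have hxz1 : x * z ≠ 1 := fun h1 => hqt (by
      rw [eq_inv_of_mul_eq_one_right h1, inv_eq_of_mul_eq_one_right (by rw [← sq, hx2])])
    have hxz2 : (x * z) ^ 2 = 1 := by
      rw [Commute.mul_pow (show Commute x z from hxz), hx2, hz2, mul_one]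
    obtain ⟨u, κ, hu⟩ := h.exists_isHalfTurn hxz2 hxz1
    have h1 := he.mul_eq hg
    rw [heg, ← _root_.map_mul, hu.eq] at h1
    have h2 := congrArg (w ᵥ* ·) h1
    simp only [mul_zero, zero_smul, zero_sub, vecMul_add, vecMul_sub, vecMul_smul, vecMul_vecMulVec,
      vecMul_neg, vecMul_one, hwe, hwg, smul_zero, neg_zero, sub_zero, zero_add] at h2
    have h3 : (κ * (w ⬝ᵥ u)) • star u = (2 : ℂ) • w := by
      rw [mul_smul, two_smul]
      exact sub_eq_iff_eq_add.1 h2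
    have h4 : star u ⬝ᵥ f = 0 := by
      have h5 := congrArg (· ⬝ᵥ f) h3
      simp only [smul_dotProduct, hwf, smul_zero] at h5
      refine (smul_eq_zero.1 h5).resolve_left fun h0 => hw ?_
      rw [h0, zero_smul] at h3
      exact (smul_eq_zero.1 h3.symm).resolve_left two_ne_zero
    have h5 := hcomm (hu.commute hf h4)
    rw [_root_.map_mul] at h5
    refine not_commute_of_orderOf hord (q := π x * π z) (r := π x * π y) ?_ hs ?_
    · refine orderOf_eq_prime ?_ ?_
      · rw [← _root_.map_mul, ← _root_.map_pow, hxz2, _root_.map_one]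
      · intro h0
        exact hxz1 (h.eq_one_of_sq (by rw [_root_.map_mul, h0]) hxz2)
    · refine Commute.mul_right ?_ h5
      exact Commute.mul_left (Commute.refl _) hqc

end IsProjectiveLift

end AlternatingSix

section Unitarization

open Matrix
open scoped MatrixOrder ComplexOrder

variable {Γ : Type*} [Group Γ]

/-- Averaging a Hermitian form over a finite group makes a representation unitary. -/
theorem exists_isSpecialUnitaryRep [Finite Γ] (ρ : Γ →* Matrix (Fin 3) (Fin 3) ℂ)
    (hinj : Function.Injective ρ) (hdet : ∀ g, (ρ g).det = 1) :
    ∃ σ : Γ →* Matrix (Fin 3) (Fin 3) ℂ, IsSpecialUnitaryRep σ ∧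
      scalarSubgroup σ = scalarSubgroup ρ := by
  cases nonempty_fintype Γ
  classical
  obtain ⟨Q, hQ⟩ : ∃ Q, Q = ∑ g, (ρ g)ᴴ * ρ g := ⟨_, rfl⟩
  have hpos : Q.PosDef := by
    rw [hQ, ← Finset.add_sum_erase _ _ (Finset.mem_univ 1)]
    refine PosDef.add_posSemidef ?_ (posSemidef_sum _ fun g _ =>
      posSemidef_conjTranspose_mul_self _)
    rw [_root_.map_one, conjTranspose_one, Matrix.one_mul]
    exact PosDef.one
  have hinv (h : Γ) : (ρ h)ᴴ * Q * ρ h = Q := by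
    rw [hQ, Matrix.mul_sum, Matrix.sum_mul]
    refine Fintype.sum_equiv (Equiv.mulRight h) _ _ fun g => ?_
    simp [_root_.map_mul, conjTranspose_mul, Matrix.mul_assoc]
  obtain ⟨B, hB⟩ := CStarAlgebra.nonneg_iff_eq_star_mul_self.mp hpos.posSemidef.nonneg
  have hBu : IsUnit B.det := by
    have := hpos.det_pos.ne'
    rw [hB, Matrix.det_mul] at this
    exact (right_ne_zero_of_mul this).isUnit
  have hBB : B * B⁻¹ = 1 := Matrix.mul_nonsing_inv _ hBu
  have hBB' : B⁻¹ * B = 1 := Matrix.nonsing_inv_mul _ hBu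
  let σ : Γ →* Matrix (Fin 3) (Fin 3) ℂ :=
    { toFun g := B * ρ g * B⁻¹
      map_one' := by rw [_root_.map_one, Matrix.mul_one, hBB]
      map_mul' g h := by
        rw [_root_.map_mul]
        calc B * (ρ g * ρ h) * B⁻¹ = B * ρ g * 1 * ρ h * B⁻¹ := by
              simp only [Matrix.mul_one, Matrix.mul_assoc]
          _ = _ := by rw [← hBB']; simp only [Matrix.mul_assoc] }
  have hσ (g : Γ) : σ g = B * ρ g * B⁻¹ := rfl
  have hρ (g : Γ) : ρ g = B⁻¹ * σ g * B := by
    rw [hσ]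
    calc ρ g = 1 * ρ g * 1 := by rw [Matrix.one_mul, Matrix.mul_one]
      _ = _ := by rw [← hBB']; simp only [Matrix.mul_assoc]
  have hunit (g : Γ) : (σ g)ᴴ * σ g = 1 := by
    have h1 := hinv g
    rw [hB, star_eq_conjTranspose] at h1
    have h2 : (B⁻¹)ᴴ * Bᴴ = 1 := by rw [← conjTranspose_mul, hBB, conjTranspose_one]
    calc (σ g)ᴴ * σ g = (B⁻¹)ᴴ * ((ρ g)ᴴ * (Bᴴ * B) * ρ g) * B⁻¹ := by
          simp only [hσ, conjTranspose_mul, Matrix.mul_assoc]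
      _ = ((B⁻¹)ᴴ * Bᴴ) * (B * B⁻¹) := by rw [h1]; simp only [Matrix.mul_assoc]
      _ = 1 := by rw [h2, hBB, Matrix.mul_one]
  refine ⟨σ, ⟨fun a b hab => hinj ?_, fun g => ?_, fun g => ?_⟩, ?_⟩
  · rw [hρ, hρ, hab]
  · rw [hσ, Matrix.det_mul, Matrix.det_mul, hdet, _root_.mul_one, ← Matrix.det_mul, hBB,
      Matrix.det_one]
  · have h1 : σ g * σ g⁻¹ = 1 := by rw [← _root_.map_mul, mul_inv_cancel, _root_.map_one]
    calc σ g⁻¹ = (σ g)ᴴ * σ g * σ g⁻¹ := by rw [hunit, Matrix.one_mul]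
      _ = (σ g)ᴴ := by rw [Matrix.mul_assoc, h1, Matrix.mul_one]
  · ext g
    simp only [mem_scalarSubgroup]
    constructor
    · rintro ⟨c, hc⟩
      exact ⟨c, by rw [hρ, hc, Matrix.mul_smul, Matrix.mul_one, Matrix.smul_mul, hBB']⟩
    · rintro ⟨c, hc⟩
      exact ⟨c, by rw [hσ, hc, Matrix.mul_smul, Matrix.mul_one, Matrix.smul_mul, hBB]⟩

end Unitarization

section Main

open Matrix

lemma mk_comp_toGL_surjective :
    Function.Surjective ((QuotientGroup.mk' (Subgroup.center (GL (Fin 3) ℂ))).comp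
      (SpecialLinearGroup.toGL (n := Fin 3) (R := ℂ))) := by
  intro x
  obtain ⟨A, rfl⟩ := QuotientGroup.mk_surjective x
  obtain ⟨d, hd⟩ := IsAlgClosed.exists_pow_nat_eq (A.val.det) (n := 3) (by norm_num)
  have hdet : A.val.det ≠ 0 := A.det.ne_zero
  have hd0 : d ≠ 0 := by rintro rfl; apply hdet; rw [← hd]; norm_num
  refine ⟨⟨d⁻¹ • A.val, ?_⟩, ?_⟩
  · rw [Matrix.det_smul, Fintype.card_fin, ← hd, ← mul_pow, inv_mul_cancel₀ hd0, one_pow]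
  · refine QuotientGroup.eq.mpr ?_
    rw [GeneralLinearGroup.mem_center_iff_val_mem_range_scalar]
    refine ⟨d, ?_⟩
    symm
    rw [Units.val_mul, Units.inv_mul_eq_iff_eq_mul]
    change A.val = (d⁻¹ • A.val) * _
    rw [scalar_apply, ← smul_one_eq_diagonal, Matrix.mul_smul, Matrix.mul_one, smul_smul,
      mul_inv_cancel₀ hd0, one_smul]

/-- A finite subgroup of `PGL(3, ℂ)` lifts to a finite special unitary group. -/
theorem exists_isProjectiveLift {G : Type*} [Group G] [Finite G] (ψ : G →* PGL 3 ℂ)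
    (hψ : Function.Injective ψ) :
    ∃ (Γ : Subgroup (SpecialLinearGroup (Fin 3) ℂ)) (_ : Finite Γ)
      (ρ : Γ →* Matrix (Fin 3) (Fin 3) ℂ) (π : Γ →* G), IsProjectiveLift ρ π := by
  let q : SpecialLinearGroup (Fin 3) ℂ →* PGL 3 ℂ :=
    (QuotientGroup.mk' (Subgroup.center (GL (Fin 3) ℂ))).comp SpecialLinearGroup.toGL
  have hq : Function.Surjective q := mk_comp_toGL_surjective
  have hqker (A) : q A = 1 ↔ A ∈ Subgroup.center (SpecialLinearGroup (Fin 3) ℂ) := by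
    rw [← SpecialLinearGroup.toGL_mem_center_iff]
    exact QuotientGroup.eq_one_iff _
  let Γ := ψ.range.comap q
  let π : Γ →* G := (MonoidHom.ofInjective hψ).symm.toMonoidHom.comp (q.subgroupComap ψ.range)
  have hψπ (g : Γ) : ψ (π g) = q g :=
    congrArg Subtype.val ((MonoidHom.ofInjective hψ).apply_symm_apply (q.subgroupComap ψ.range g))
  have hsurj : Function.Surjective π := by
    intro x
    obtain ⟨A, hA⟩ := hq (ψ x)
    exact ⟨⟨A, x, hA.symm⟩, hψ (by rw [hψπ, hA])⟩
  let ρ : Γ →* Matrix (Fin 3) (Fin 3) ℂ :=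
    { toFun g := (g.val).val
      map_one' := rfl
      map_mul' _ _ := rfl }
  have hρ (g : Γ) : ρ g = g.val.val := rfl
  have hker (g : Γ) : π g = 1 ↔ g.val ∈ Subgroup.center (SpecialLinearGroup (Fin 3) ℂ) := by
    rw [← hqker, ← hψπ, map_eq_one_iff ψ hψ]
  have hscalar (g : Γ) : g ∈ scalarSubgroup ρ ↔
      g.val ∈ Subgroup.center (SpecialLinearGroup (Fin 3) ℂ) := by
    rw [mem_scalarSubgroup, Matrix.SpecialLinearGroup.mem_center_iff]
    constructor
    · rintro ⟨c, hc⟩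
      refine ⟨c, ?_, by rw [← hρ, hc, scalar_apply, smul_one_eq_diagonal]⟩
      have := g.val.2
      rwa [← hρ, hc, Matrix.det_smul, Matrix.det_one, _root_.mul_one] at this
    · rintro ⟨c, -, hc⟩
      exact ⟨c, by rw [hρ, ← hc, scalar_apply, smul_one_eq_diagonal]⟩
  have hcard : Nat.card (scalarSubgroup ρ) = 3 := by
    have e1 : scalarSubgroup ρ ≃ Subgroup.center (SpecialLinearGroup (Fin 3) ℂ) :=
      { toFun g := ⟨g.val.val, (hscalar _).mp g.2⟩
        invFun A := ⟨⟨A.val, 1, by rw [_root_.map_one, (hqker _).mpr A.2]⟩, (hscalar _).mpr A.2⟩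
        left_inv _ := rfl
        right_inv _ := rfl }
    rw [Nat.card_congr e1,
      Nat.card_congr (SpecialLinearGroup.center_equiv_rootsOfUnity (n := Fin 3) (R := ℂ)).toEquiv]
    change Nat.card (rootsOfUnity 3 ℂ) = 3
    exact Complex.card_rootsOfUnity 3
  have hkeq : π.ker = scalarSubgroup ρ := by
    ext g
    rw [MonoidHom.mem_ker, hker, hscalar]
  have hfin : Finite Γ := by
    have h1 : Finite π.ker := by
      rw [hkeq]
      exact Nat.finite_of_card_ne_zero (by rw [hcard]; norm_num)
    have h2 : Finite (Γ ⧸ π.ker) :=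
      Finite.of_equiv G (QuotientGroup.quotientKerEquivOfSurjective π hsurj).symm.toEquiv
    exact Finite.of_subgroup_quotient π.ker
  obtain ⟨σ, hσ, hs⟩ := exists_isSpecialUnitaryRep ρ
    (fun a b hab => Subtype.ext (Subtype.ext hab)) fun g => g.val.2
  exact ⟨Γ, hfin, σ, π, hσ, hsurj, fun g => by rw [hs, ← hkeq, MonoidHom.mem_ker],
    by rw [hs, hcard]⟩

end Main

/-- A finite nonabelian simple group isomorphic to a subgroup of `PGL(3, ℂ)` is isomorphic to
`A_5`, `A_6` or `PSL(2, 𝔽_7)`. -/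
theorem finite_simple_subgroup_pgl_three_complex (G : Type*) [Group G] [Finite G]
    [IsSimpleGroup G] (hna : ∃ a b : G, a * b ≠ b * a)
    (hemb : ∃ ψ : G →* PGL 3 ℂ, Function.Injective ψ) :
    Nonempty (G ≃* alternatingGroup (Fin 5)) ∨
      Nonempty (G ≃* alternatingGroup (Fin 6)) ∨
      Nonempty (G ≃* PSL 2 (ZMod 7)) := by
  obtain ⟨ψ, hψ⟩ := hemb
  obtain ⟨Γ, _, ρ, π, h⟩ := exists_isProjectiveLift ψ hψ
  cases nonempty_fintype Γ
  obtain ⟨h12, h24, h72⟩ := card_ne_of_isSimpleGroup hna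
  by_cases hf : HasFlipCommutant ρ
  · have hI := h.isInvolutiveRep hna hf
    rcases hI.card_eq with hG | hG | hG
    · exact absurd hG h72
    · exact Or.inr (Or.inl (h.nonempty_mulEquiv_alternatingGroup_six hna hG hI.orderOf_le_seven))
    · exact Or.inr (Or.inr (nonempty_mulEquiv_PSL_seven hna hG))
  · have : Fact (Nat.Prime 2) := ⟨Nat.prime_two⟩
    obtain ⟨t, ht⟩ := exists_prime_orderOf_dvd_card' 2
      (h.even_card hna (h.hasScalarCommutant hna)).two_dvd
    have ht1 : t ≠ 1 := by
      rintro rfl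
      norm_num at ht
    have ht2 : t ^ 2 = 1 := by rw [← ht, pow_orderOf_eq_one]
    rcases h.card_eq_of_not_hasFlipCommutant hna ht2 ht1 hf with hG | hG | hG
    · exact absurd hG h12
    · exact absurd hG h24
    · exact Or.inl (nonempty_mulEquiv_alternatingGroup_five hna hG)
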